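/- Let A be a basic indecomposable artin algebra and let Γ be a cycle-finite finite connected component of the cyclic quiver _cΓ_A. Then: (i) the support algebra supp(Γ) is a generalized double tilted algebra; (ii) Γ is the core c(C^{B(Γ)}) of a unique almost acyclic connecting component C^{B(Γ)} of the Auslander–Reiten quiver Γ_{B(Γ)} of the faithful algebra B(Γ); (iii) supp(Γ) = B(Γ). -/

import Mathlib

/-!
Common framework: finite length modules over a ring, the radical of the module
category, cycles of indecomposable modules, Auslander-Reiten quivers,
translation quivers notions, and classes of artin algebras.
Right `A`-modules are formalized as left `Aᵐᵒᵖ`-modules.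
-/

universe u

/-- A bundled object of `mod R`: a finite length `R`-module. -/
structure ModA (R : Type u) [Ring R] : Type (u + 1) where
  M : Type u
  [acg : AddCommGroup M]
  [mod : Module R M]
  finLen : IsFiniteLength R M

attribute [instance] ModA.acg ModA.mod

/-- A bundled (not necessarily finite length) `R`-module. -/
structure RawMod (R : Type u) [Ring R] : Type (u + 1) where
  M : Type u
  [acg : AddCommGroup M]
  [mod : Module R M]

attribute [instance] RawMod.acg RawMod.mod

/-- A module is indecomposable iff it is nonzero and its endomorphism ring has no
nontrivial idempotents. -/
def IsIndecMod (R : Type u) [Ring R] (M : Type u) [AddCommGroup M] [Module R M] : Prop :=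
  Nontrivial M ∧ ∀ f : Module.End R M, f * f = f → f = 0 ∨ f = 1

namespace ModA

variable {R : Type u} [Ring R]

/-- Indecomposability of an object of `mod R`. -/
def IsIndec (X : ModA R) : Prop := IsIndecMod R X.M

/-- Isomorphism of objects of `mod R`. -/
def Iso (X Y : ModA R) : Prop := Nonempty (X.M ≃ₗ[R] Y.M)

end ModA

/-- Membership in the radical `rad(X, Y)` of the category `mod R`: a map `f : X → Y`
belongs to the radical iff for every indecomposable `Z` and all `g : Z → X`, `h : Y → Z`
the composite `h ∘ f ∘ g` is not an isomorphism. -/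
def InRad {R : Type u} [Ring R] {X Y : ModA R} (f : X.M →ₗ[R] Y.M) : Prop :=
  ∀ Z : ModA R, Z.IsIndec → ∀ (g : Z.M →ₗ[R] X.M) (h : Y.M →ₗ[R] Z.M),
    ¬Function.Bijective (h.comp (f.comp g))

/-- The powers `rad^n` of the radical of `mod R`. -/
def radPow (R : Type u) [Ring R] : ℕ → ∀ X Y : ModA R, AddSubgroup (X.M →ₗ[R] Y.M)
  | 0, _, _ => ⊤
  | n + 1, X, Y => AddSubgroup.closure
      {f | ∃ (Z : ModA R) (g : X.M →ₗ[R] Z.M) (h : Z.M →ₗ[R] Y.M),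
        InRad g ∧ h ∈ radPow R n Z Y ∧ f = h.comp g}

/-- Membership in the infinite radical `rad^∞ = ⋂ₙ radⁿ` of `mod R`. -/
def InRadInf {R : Type u} [Ring R] {X Y : ModA R} (f : X.M →ₗ[R] Y.M) : Prop :=
  ∀ n : ℕ, f ∈ radPow R n X Y

/-- A cycle in `ind R`: a sequence of nonzero nonisomorphisms
`M₀ → M₁ → ⋯ → M_{r-1} → M_r = M₀` between indecomposable modules. -/
structure ModCycle (R : Type u) [Ring R] : Type (u + 1) where
  len : ℕ
  len_pos : 0 < len
  obj : Fin (len + 1) → ModA R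
  obj_indec : ∀ i, (obj i).IsIndec
  closed : obj (Fin.last len) = obj 0
  hom : ∀ i : Fin len, (obj i.castSucc).M →ₗ[R] (obj i.succ).M
  hom_ne_zero : ∀ i, hom i ≠ 0
  hom_not_iso : ∀ i, ¬Function.Bijective (hom i)

/-- A cycle is finite if none of its homomorphisms lies in the infinite radical. -/
def ModCycle.IsFiniteCycle {R : Type u} [Ring R] (c : ModCycle R) : Prop :=
  ∀ i, ¬InRadInf (c.hom i)

/-- The cycle passes through the module `M`. -/
def ModCycle.Passes {R : Type u} [Ring R] (c : ModCycle R) (M : ModA R) : Prop :=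
  ∃ i, (c.obj i).Iso M

/-- A module is cycle-finite if it lies on a cycle and every cycle through it is finite. -/
def IsCycleFiniteModule {R : Type u} [Ring R] (M : ModA R) : Prop :=
  (∃ c : ModCycle R, c.Passes M) ∧ ∀ c : ModCycle R, c.Passes M → c.IsFiniteCycle

/-- A module is directing if it lies on no cycle. -/
def IsDirectingModule {R : Type u} [Ring R] (M : ModA R) : Prop :=
  ¬∃ c : ModCycle R, c.Passes M

section Irreducible

variable {R : Type u} [Ring R]

/-- `f` is a split monomorphism (a section). -/
def SplitMonoMap {X Y : ModA R} (f : X.M →ₗ[R] Y.M) : Prop :=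
  ∃ r : Y.M →ₗ[R] X.M, r.comp f = LinearMap.id

/-- `f` is a split epimorphism (a retraction). -/
def SplitEpiMap {X Y : ModA R} (f : X.M →ₗ[R] Y.M) : Prop :=
  ∃ s : Y.M →ₗ[R] X.M, f.comp s = LinearMap.id

/-- `f` is an irreducible homomorphism. -/
def IsIrred {X Y : ModA R} (f : X.M →ₗ[R] Y.M) : Prop :=
  ¬SplitMonoMap f ∧ ¬SplitEpiMap f ∧
    ∀ (Z : ModA R) (g : X.M →ₗ[R] Z.M) (h : Z.M →ₗ[R] Y.M), h.comp g = f →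
      SplitMonoMap g ∨ SplitEpiMap h

end Irreducible

/-- An almost split (Auslander-Reiten) sequence `0 → l → m → r → 0` in `mod R`. -/
structure AlmostSplitSeq (R : Type u) [Ring R] : Type (u + 1) where
  l : ModA R
  m : ModA R
  r : ModA R
  f : l.M →ₗ[R] m.M
  g : m.M →ₗ[R] r.M
  inj : Function.Injective f
  surj : Function.Surjective g
  exact : LinearMap.range f = LinearMap.ker g
  not_split : ¬SplitEpiMap g
  l_indec : l.IsIndec
  r_indec : r.IsIndec
  right_almost : ∀ (Z : ModA R) (h : Z.M →ₗ[R] r.M), ¬SplitEpiMap h →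
      ∃ h' : Z.M →ₗ[R] m.M, g.comp h' = h
  left_almost : ∀ (Z : ModA R) (h : l.M →ₗ[R] Z.M), ¬SplitMonoMap h →
      ∃ h' : m.M →ₗ[R] Z.M, h'.comp f = h

/-- `N ≅ τ M` for the Auslander-Reiten translation `τ = DTr`. -/
def IsTauOf {R : Type u} [Ring R] (N M : ModA R) : Prop :=
  ∃ s : AlmostSplitSeq R, s.l.Iso N ∧ s.r.Iso M

/-- The indecomposable objects of `mod R`. -/
def IndecModA (R : Type u) [Ring R] := {X : ModA R // X.IsIndec}

/-- Isomorphism is an equivalence relation on indecomposable modules. -/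
def isoSetoid (R : Type u) [Ring R] : Setoid (IndecModA R) where
  r X Y := X.1.Iso Y.1
  iseqv :=
    { refl := fun X => ⟨LinearEquiv.refl R X.1.M⟩
      symm := fun h => h.elim fun e => ⟨e.symm⟩
      trans := fun h h' => h.elim fun e => h'.elim fun e' => ⟨e.trans e'⟩ }

/-- The vertices of the Auslander-Reiten quiver `Γ_R`: isomorphism classes of
indecomposable modules in `mod R`. -/
def ARVertex (R : Type u) [Ring R] := Quotient (isoSetoid R)

/-- The vertex of `Γ_R` given by an indecomposable module. -/
def ARVertex.mk {R : Type u} [Ring R] (X : IndecModA R) : ARVertex R :=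
  Quotient.mk (isoSetoid R) X

section ARQuiver

variable {R : Type u} [Ring R]

/-- The arrows of the Auslander-Reiten quiver: `x → y` iff there is an irreducible
homomorphism between representatives. -/
def ARArrow (x y : ARVertex R) : Prop :=
  ∃ (X Y : IndecModA R) (f : X.1.M →ₗ[R] Y.1.M),
    IsIrred f ∧ ARVertex.mk X = x ∧ ARVertex.mk Y = y

/-- `TauRel x y` iff `x = τ y` in the Auslander-Reiten quiver. -/
def TauRel (x y : ARVertex R) : Prop :=
  ∃ X Y : IndecModA R, ARVertex.mk X = x ∧ ARVertex.mk Y = y ∧ IsTauOf X.1 Y.1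

/-- A vertex given by an (indecomposable) projective module. -/
def IsProjVertex (x : ARVertex R) : Prop :=
  ∃ X : IndecModA R, ARVertex.mk X = x ∧ Module.Projective R X.1.M

/-- A vertex given by an (indecomposable) injective module. -/
def IsInjVertex (x : ARVertex R) : Prop :=
  ∃ X : IndecModA R, ARVertex.mk X = x ∧ Module.Injective R X.1.M

/-- The vertex lies on an oriented cycle of `Γ_R`. -/
def OnARCycle (x : ARVertex R) : Prop := Relation.TransGen ARArrow x x

/-- An edge (arrow in either direction) of the underlying graph of `Γ_R`. -/
def ARStep (x y : ARVertex R) : Prop := ARArrow x y ∨ ARArrow y x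

/-- `D` is a connected component of the full subquiver of `Γ_R` on the vertex set `S`. -/
def IsComponentOf (S D : Set (ARVertex R)) : Prop :=
  D ⊆ S ∧ D.Nonempty ∧
    (∀ x ∈ D, ∀ y ∈ S, ARStep x y → y ∈ D) ∧
    ∀ x ∈ D, ∀ y ∈ D, Relation.ReflTransGen (fun a b => a ∈ S ∧ b ∈ S ∧ ARStep a b) x y

/-- `C` is a connected component of `Γ_R`. -/
def IsARComponent (C : Set (ARVertex R)) : Prop := IsComponentOf Set.univ C

/-- The vertex lies on an oriented cycle all of whose vertices belong to `S`. -/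
def OnCycleIn (S : Set (ARVertex R)) (x : ARVertex R) : Prop :=
  Relation.TransGen (fun a b => a ∈ S ∧ b ∈ S ∧ ARArrow a b) x x

/-- `Γ` is a connected component of the cyclic quiver `_cΓ_R` (a cyclic component). -/
def IsCyclicComponent (Γ : Set (ARVertex R)) : Prop :=
  IsComponentOf {x | OnARCycle x} Γ

/-- A vertex represented by a cycle-finite module. -/
def IsCycleFiniteVertex (x : ARVertex R) : Prop :=
  ∃ X : IndecModA R, ARVertex.mk X = x ∧ IsCycleFiniteModule X.1

/-- A vertex represented by a directing module. -/
def IsDirectingVertex (x : ARVertex R) : Prop :=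
  ∃ X : IndecModA R, ARVertex.mk X = x ∧ IsDirectingModule X.1

/-- A cycle-finite cyclic component: a cyclic component containing a cycle-finite module. -/
def IsCycleFiniteCyclicComponent (Γ : Set (ARVertex R)) : Prop :=
  IsCyclicComponent Γ ∧ ∃ x ∈ Γ, IsCycleFiniteVertex x

/-- A full translation subquiver is cyclic if each of its vertices lies on an oriented
cycle inside it. -/
def IsCyclicSub (S : Set (ARVertex R)) : Prop := ∀ x ∈ S, OnCycleIn S x

/-- A full translation subquiver is coherent: every projective vertex is the start of an
infinite sectional path inside it, and every injective vertex is the end of an infinite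
sectional path inside it. -/
def IsCoherentSub (S : Set (ARVertex R)) : Prop :=
  (∀ x ∈ S, IsProjVertex x → ∃ c : ℕ → ARVertex R, c 0 = x ∧ (∀ n, c n ∈ S) ∧
      (∀ n, ARArrow (c n) (c (n + 1))) ∧ ∀ n, ¬TauRel (c n) (c (n + 2))) ∧
  (∀ x ∈ S, IsInjVertex x → ∃ c : ℕ → ARVertex R, c 0 = x ∧ (∀ n, c n ∈ S) ∧
      (∀ n, ARArrow (c (n + 1)) (c n)) ∧ ∀ n, ¬TauRel (c (n + 2)) (c n))

/-- `S` is a convex subquiver of (the full subquiver on) `C`: every path in `C` with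
source and target in `S` has all its vertices in `S`. -/
def ConvexIn (C S : Set (ARVertex R)) : Prop :=
  ∀ (n : ℕ) (c : ℕ → ARVertex R), (∀ k ≤ n, c k ∈ C) →
    (∀ k < n, ARArrow (c k) (c (k + 1))) → c 0 ∈ S → c n ∈ S → ∀ k ≤ n, c k ∈ S

/-- `S` is the core of the almost acyclic component `C`: the finite convex subquiver of
`C` containing all vertices lying on oriented cycles in `C`. -/
def IsCoreOf (C S : Set (ARVertex R)) : Prop :=
  S ⊆ C ∧ S.Finite ∧ ConvexIn C S ∧ ∀ x ∈ C, OnCycleIn C x → x ∈ S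

/-- A component is almost acyclic if all but finitely many of its vertices do not lie on
oriented cycles. -/
def IsAlmostAcyclicComp (C : Set (ARVertex R)) : Prop := {x ∈ C | OnCycleIn C x}.Finite

/-- A component is almost cyclic if its cyclic part is cofinite. -/
def IsAlmostCyclicComp (C : Set (ARVertex R)) : Prop := {x ∈ C | ¬OnCycleIn C x}.Finite

/-- Two vertices lie in the same `τ`-orbit. -/
def TauConn (x y : ARVertex R) : Prop :=
  Relation.ReflTransGen (fun a b => TauRel a b ∨ TauRel b a) x y

/-- The left stable part of `C`: remove the `τ`-orbits of projective vertices. -/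
def leftStable (C : Set (ARVertex R)) : Set (ARVertex R) :=
  {x | x ∈ C ∧ ¬∃ y, TauConn x y ∧ IsProjVertex y}

/-- The right stable part of `C`: remove the `τ`-orbits of injective vertices. -/
def rightStable (C : Set (ARVertex R)) : Set (ARVertex R) :=
  {x | x ∈ C ∧ ¬∃ y, TauConn x y ∧ IsInjVertex y}

/-- The stable part of `C`. -/
def stablePart (C : Set (ARVertex R)) : Set (ARVertex R) := leftStable C ∩ rightStable C

end ARQuiver

/-- The arrows of the translation quiver `ℤA∞/(τ^r)`, with vertices indexed by the
`τ`-orbit coordinate in `ZMod r` and the quasi-length (minus one) in `ℕ`. -/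
def TubeArrow {r : ℕ} : ZMod r × ℕ → ZMod r × ℕ → Prop := fun u v =>
  (v.1 = u.1 ∧ v.2 = u.2 + 1) ∨ (v.1 = u.1 + 1 ∧ u.2 = v.2 + 1)

section Tube

variable {R : Type u} [Ring R]

/-- `T` is a stable tube of rank `r`, parametrized by `φ : ℤA∞/(τ^r) → Γ_R`. -/
def IsStableTubeVia (T : Set (ARVertex R)) (r : ℕ) (φ : ZMod r × ℕ → ARVertex R) : Prop :=
  0 < r ∧ Function.Injective φ ∧ Set.range φ = T ∧
    (∀ u v, TubeArrow u v → ARArrow (φ u) (φ v)) ∧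
    (∀ u v, ARArrow (φ u) (φ v) → TubeArrow u v) ∧
    ∀ (i : ZMod r) (n : ℕ), TauRel (φ (i - 1, n)) (φ (i, n))

/-- `T` is a stable tube. -/
def IsStableTube (T : Set (ARVertex R)) : Prop := ∃ r φ, IsStableTubeVia T r φ

end Tube

section Separating

variable {R : Type u} [Ring R]

/-- A family of vertices is generalized standard if `rad^∞` vanishes between its modules. -/
def GeneralizedStandardSet (U : Set (ARVertex R)) : Prop :=
  ∀ X Y : IndecModA R, ARVertex.mk X ∈ U → ARVertex.mk Y ∈ U →
    ∀ f : X.1.M →ₗ[R] Y.1.M, InRadInf f → f = 0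

/-- `S` is (isomorphic to) a composition factor (a subquotient) of `M`. -/
def IsCompFactorMod (R : Type u) [Ring R] (S : Type u) [AddCommGroup S] [Module R S]
    (M : Type u) [AddCommGroup M] [Module R M] : Prop :=
  ∃ N' N : Submodule R M, N' ≤ N ∧
    Nonempty ((↥N ⧸ N'.comap N.subtype) ≃ₗ[R] S)

/-- A family of vertices is sincere if every simple module is a composition factor of one
of its modules. -/
def SincereSet (U : Set (ARVertex R)) : Prop :=
  ∀ (S : Type u) [AddCommGroup S] [Module R S], IsSimpleModule R S →
    ∃ x ∈ U, ∃ X : IndecModA R, ARVertex.mk X = x ∧ IsCompFactorMod R S X.1.M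

/-- All homomorphisms from modules with vertex in `U` to modules with vertex in `V` vanish. -/
def HomVanish (U V : Set (ARVertex R)) : Prop :=
  ∀ X Y : IndecModA R, ARVertex.mk X ∈ U → ARVertex.mk Y ∈ V →
    ∀ f : X.1.M →ₗ[R] Y.1.M, f = 0

/-- Every homomorphism from a module in `U` to a module in `V` factors through the
additive closure of the modules in `W`. -/
def FactorsThrough (U W V : Set (ARVertex R)) : Prop :=
  ∀ X Y : IndecModA R, ARVertex.mk X ∈ U → ARVertex.mk Y ∈ V →
    ∀ f : X.1.M →ₗ[R] Y.1.M, ∃ (k : ℕ) (Z : Fin k → IndecModA R)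
      (g : ∀ i, X.1.M →ₗ[R] (Z i).1.M) (h : ∀ i, (Z i).1.M →ₗ[R] Y.1.M),
      (∀ i, ARVertex.mk (Z i) ∈ W) ∧ f = ∑ i, (h i).comp (g i)

/-- `cs` is a separating family of components of `Γ_R`. -/
def IsSeparatingFamily (cs : Set (Set (ARVertex R))) : Prop :=
  ∃ ps qs : Set (Set (ARVertex R)),
    (∀ C ∈ ps, IsARComponent C) ∧ (∀ C ∈ cs, IsARComponent C) ∧ (∀ C ∈ qs, IsARComponent C) ∧
    (∀ C, IsARComponent C → C ∈ ps ∨ C ∈ cs ∨ C ∈ qs) ∧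
    (∀ C ∈ ps, C ∉ cs ∧ C ∉ qs) ∧ (∀ C ∈ cs, C ∉ qs) ∧
    SincereSet (⋃₀ cs) ∧ GeneralizedStandardSet (⋃₀ cs) ∧
    HomVanish (⋃₀ qs) (⋃₀ ps) ∧ HomVanish (⋃₀ qs) (⋃₀ cs) ∧ HomVanish (⋃₀ cs) (⋃₀ ps) ∧
    FactorsThrough (⋃₀ ps) (⋃₀ cs) (⋃₀ qs)

end Separating

/-! ### Classes of algebras via their Auslander-Reiten quivers.
For a ring `B`, the category `mod B` of finitely generated right `B`-modules is
realized as the category of finite length left `Bᵐᵒᵖ`-modules. -/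

/-- An algebra is of finite representation type if it has only finitely many isomorphism
classes of indecomposable finitely generated (right) modules. -/
def IsFiniteRepTypeAlg (B : Type u) [Ring B] : Prop :=
  (Set.univ : Set (ARVertex Bᵐᵒᵖ)).Finite

/-- An algebra is cycle-finite if all cycles in `ind B` are finite. -/
def IsCycleFiniteAlg (B : Type u) [Ring B] : Prop :=
  ∀ c : ModCycle Bᵐᵒᵖ, c.IsFiniteCycle

/-- A generalized multicoil algebra: an algebra whose Auslander-Reiten quiver admits a
separating family of almost cyclic coherent components. -/
def IsGeneralizedMulticoilAlgebra (B : Type u) [Ring B] : Prop :=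
  ∃ cs : Set (Set (ARVertex Bᵐᵒᵖ)),
    (∀ C ∈ cs, IsARComponent C ∧ IsAlmostCyclicComp C ∧ IsCoherentSub C) ∧
    IsSeparatingFamily cs

/-- A generalized double tilted algebra: an algebra whose Auslander-Reiten quiver admits
a separating almost acyclic component (a connecting component). -/
def IsGeneralizedDoubleTiltedAlgebra (B : Type u) [Ring B] : Prop :=
  ∃ C : Set (ARVertex Bᵐᵒᵖ),
    IsARComponent C ∧ IsAlmostAcyclicComp C ∧ IsSeparatingFamily {C}

/-- A concealed canonical algebra: an algebra whose Auslander-Reiten quiver admits a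
separating family of stable tubes. -/
def IsConcealedCanonicalAlgebra (B : Type u) [Ring B] : Prop :=
  ∃ ts : Set (Set (ARVertex Bᵐᵒᵖ)), (∀ T ∈ ts, IsStableTube T) ∧ IsSeparatingFamily ts

/-- A generic module: an indecomposable module of infinite length with finite endolength. -/
def IsGenericModule (R : Type u) [Ring R] (N : RawMod R) : Prop :=
  IsIndecMod R N.M ∧ ¬IsFiniteLength R N.M ∧ IsFiniteLength (Module.End R N.M) N.M

/-- The endolength of a module: its length over its endomorphism ring. -/
noncomputable def endolength (R : Type u) [Ring R] (N : RawMod R) : WithBot ℕ∞ :=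
  Order.krullDim (Submodule (Module.End R N.M) N.M)

/-- Generic tameness in the sense of Crawley-Boevey: for each `d` there are only finitely
many isomorphism classes of generic (right) modules of endolength `d`. -/
def IsGenericallyTameAlg (B : Type u) [Ring B] : Prop :=
  ∀ d : ℕ, ∃ (k : ℕ) (T : Fin k → RawMod Bᵐᵒᵖ),
    ∀ N : RawMod Bᵐᵒᵖ, IsGenericModule Bᵐᵒᵖ N → endolength Bᵐᵒᵖ N = (d : ℕ∞) →
      ∃ i, Nonempty (N.M ≃ₗ[Bᵐᵒᵖ] (T i).M)

/-- A tame generalized multicoil algebra. -/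
def IsTameGeneralizedMulticoilAlgebra (B : Type u) [Ring B] : Prop :=
  IsGeneralizedMulticoilAlgebra B ∧ IsGenericallyTameAlg B

/-- A tame generalized double tilted algebra. -/
def IsTameGeneralizedDoubleTiltedAlgebra (B : Type u) [Ring B] : Prop :=
  IsGeneralizedDoubleTiltedAlgebra B ∧ IsGenericallyTameAlg B

/-! ### The quiver of an algebra, convex idempotents, basic and connected algebras -/

section AlgebraSide

variable (A : Type u) [Ring A]

/-- The Jacobson radical of `A` (as a left ideal; it is in fact two-sided). -/
def jacobsonRad : Ideal A := (⊥ : Ideal A).jacobson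

/-- The square of the Jacobson radical of `A`. -/
def jacobsonRadSq : Ideal A :=
  Ideal.span {x | ∃ a ∈ jacobsonRad A, ∃ b ∈ jacobsonRad A, x = a * b}

/-- A primitive idempotent of `A`. -/
def IsPrimitiveIdempotent (e : A) : Prop :=
  IsIdempotentElem e ∧ e ≠ 0 ∧
    ∀ f g : A, IsIdempotentElem f → IsIdempotentElem g → f * g = 0 → g * f = 0 →
      e = f + g → f = 0 ∨ g = 0

/-- A complete family of pairwise orthogonal primitive idempotents of `A`; its indices
are the vertices of the quiver `Q_A` of `A`. -/
structure CompleteIdemFamily (A : Type u) [Ring A] where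
  n : ℕ
  e : Fin n → A
  prim : ∀ i, IsPrimitiveIdempotent A (e i)
  orth : ∀ i j, i ≠ j → e i * e j = 0
  total : ∑ i, e i = 1

/-- There is an arrow `i → j` in the quiver `Q_A` iff `e_i (rad A) e_j ⊄ (rad A)²`. -/
def QAarrow (E : CompleteIdemFamily A) (i j : Fin E.n) : Prop :=
  ∃ y ∈ jacobsonRad A, E.e i * y * E.e j ∉ jacobsonRadSq A

/-- A set of vertices of `Q_A` is convex if every path of `Q_A` with source and target in
it has all its vertices in it. -/
def ConvexVertexSet (E : CompleteIdemFamily A) (S : Set (Fin E.n)) : Prop :=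
  ∀ (n : ℕ) (c : ℕ → Fin E.n), (∀ k < n, QAarrow A E (c k) (c (k + 1))) →
    c 0 ∈ S → c n ∈ S → ∀ k ≤ n, c k ∈ S

/-- A convex idempotent of `A`: a sum of pairwise orthogonal primitive idempotents
corresponding to the vertices of a convex subquiver of `Q_A`. -/
def IsConvexIdempotent (e : A) : Prop :=
  ∃ (E : CompleteIdemFamily A) (S : Finset (Fin E.n)),
    ConvexVertexSet A E ↑S ∧ e = ∑ i ∈ S, E.e i

/-- The corner `eAe` of `A` at an idempotent `e`, as a nonunital subring (it is a unital
ring with unit `e`). -/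
def cornerRing (e : A) : NonUnitalSubring A where
  carrier := {x | e * x = x ∧ x * e = x}
  zero_mem' := by simp
  add_mem' := by
    rintro a b ⟨ha1, ha2⟩ ⟨hb1, hb2⟩
    constructor
    · rw [mul_add, ha1, hb1]
    · rw [add_mul, ha2, hb2]
  neg_mem' := by
    rintro a ⟨ha1, ha2⟩
    constructor
    · rw [mul_neg, ha1]
    · rw [neg_mul, ha2]
  mul_mem' := by
    rintro a b ⟨ha1, ha2⟩ ⟨hb1, hb2⟩
    constructor
    · rw [← mul_assoc, ha1]
    · rw [mul_assoc, hb2]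

/-- An (indecomposable =) connected algebra: no nontrivial central idempotents. -/
def IsConnectedAlgebra : Prop :=
  Nontrivial A ∧ ∀ e : A, IsIdempotentElem e → e ∈ Set.center A → e = 0 ∨ e = 1

/-- A basic algebra: distinct orthogonal primitive idempotents have nonisomorphic
associated indecomposable projective right modules. -/
def IsBasicAlgebra : Prop :=
  ¬∃ e f : A, IsPrimitiveIdempotent A e ∧ IsPrimitiveIdempotent A f ∧
    e * f = 0 ∧ f * e = 0 ∧
    Nonempty ((Submodule.span Aᵐᵒᵖ {e} : Submodule Aᵐᵒᵖ A) ≃ₗ[Aᵐᵒᵖ]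
      (Submodule.span Aᵐᵒᵖ {f} : Submodule Aᵐᵒᵖ A))

end AlgebraSide

/-! ### Support algebras and faithful algebras of families of vertices -/

section Support

variable (A : Type u) [Ring A]

/-- The radical of a module: the intersection of its maximal submodules. -/
def modRadical (R : Type u) [Ring R] (M : Type u) [AddCommGroup M] [Module R M] :
    Submodule R M :=
  sInf {N | IsCoatom N}

/-- The intersection `ann_A(Γ)` of the annihilators of all right `A`-modules whose
vertices belong to `Γ`, as a two-sided ideal of `A`. -/
def annTwoSidedIdeal (Γ : Set (ARVertex Aᵐᵒᵖ)) : TwoSidedIdeal A :=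
  TwoSidedIdeal.mk'
    {a | ∀ x ∈ Γ, ∀ X : IndecModA Aᵐᵒᵖ, ARVertex.mk X = x →
      ∀ m : X.1.M, MulOpposite.op a • m = 0}
    (by intro x _ X _ m; simp)
    (by
      intro a b ha hb x hx X hX m
      have : MulOpposite.op (a + b) • m = MulOpposite.op a • m + MulOpposite.op b • m := by
        rw [← add_smul]; rfl
      rw [this, ha x hx X hX m, hb x hx X hX m, add_zero])
    (by
      intro a ha x hx X hX m
      have : MulOpposite.op (-a) • m = -(MulOpposite.op a • m) := by
        rw [← neg_smul]; rfl
      rw [this, ha x hx X hX m, neg_zero])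
    (by
      intro a b hb x hx X hX m
      have : MulOpposite.op (a * b) • m = MulOpposite.op b • (MulOpposite.op a • m) := by
        rw [← mul_smul]; rfl
      rw [this, hb x hx X hX _])
    (by
      intro a b ha x hx X hX m
      have : MulOpposite.op (a * b) • m = MulOpposite.op b • (MulOpposite.op a • m) := by
        rw [← mul_smul]; rfl
      rw [this, ha x hx X hX m, smul_zero])

/-- The faithful algebra `B(Γ) = A / ann_A(Γ)` of a family `Γ` of vertices of `Γ_A`. -/
abbrev faithfulAlg (Γ : Set (ARVertex Aᵐᵒᵖ)) : Type u :=
  (annTwoSidedIdeal A Γ).ringCon.Quotient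

/-- The canonical projection `A → B(Γ)`. -/
def faithfulProj (Γ : Set (ARVertex Aᵐᵒᵖ)) : A →+* faithfulAlg A Γ :=
  RingCon.mk' (annTwoSidedIdeal A Γ).ringCon

/-- The trace ideal `t_A(Γ)`: the two-sided ideal of `A` generated by the images of all
homomorphisms of right `A`-modules from `Q` to `A`. -/
def traceIdeal (Q : Submodule Aᵐᵒᵖ A) : TwoSidedIdeal A :=
  TwoSidedIdeal.span (⋃ f : ↥Q →ₗ[Aᵐᵒᵖ] A, Set.range f)

/-- A decomposition `A = P_Γ ⊕ Q_Γ` of `A` in `mod A` such that the simple summands of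
`P_Γ / rad P_Γ` are exactly the simple composition factors of the modules in `Γ`. -/
structure GammaDecomp (A : Type u) [Ring A] (Γ : Set (ARVertex Aᵐᵒᵖ)) where
  P : Submodule Aᵐᵒᵖ A
  Q : Submodule Aᵐᵒᵖ A
  compl : IsCompl P Q
  top_factors : ∀ (S : Type u) [AddCommGroup S] [Module Aᵐᵒᵖ S], IsSimpleModule Aᵐᵒᵖ S →
    (IsCompFactorMod Aᵐᵒᵖ S (↥P ⧸ modRadical Aᵐᵒᵖ ↥P) ↔
      ∃ x ∈ Γ, ∃ X : IndecModA Aᵐᵒᵖ, ARVertex.mk X = x ∧ IsCompFactorMod Aᵐᵒᵖ S X.1.M)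

end Support

/-- Restriction of scalars along a surjective ring homomorphism `π : A → B` identifies a
vertex `y` of `Γ_B` with a vertex `x` of `Γ_A`: representatives have the same underlying
group, with the `A`-action obtained from the `B`-action through `π`. -/
def VertexRestrictsTo {A B : Type u} [Ring A] [Ring B] (π : A →+* B)
    (y : ARVertex Bᵐᵒᵖ) (x : ARVertex Aᵐᵒᵖ) : Prop :=
  ∃ (N : IndecModA Bᵐᵒᵖ) (X : IndecModA Aᵐᵒᵖ), ARVertex.mk N = y ∧ ARVertex.mk X = x ∧
    ∃ e : X.1.M ≃+ N.1.M, ∀ (a : A) (m : X.1.M),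
      e (MulOpposite.op a • m) = MulOpposite.op (π a) • e m

/-! ### `K`-module structures on Hom-groups, lengths, and Ext -/

section KLength

variable (K B : Type u) [CommRing K] [Ring B] [Algebra K B]
variable (X N : Type u) [AddCommGroup X] [Module B X] [AddCommGroup N] [Module B N]

/-- The action of `K` on `B`-linear maps, through `algebraMap K B`. -/
def homKSMul (k : K) (f : X →ₗ[B] N) : X →ₗ[B] N where
  toFun x := algebraMap K B k • f x
  map_add' x y := by show algebraMap K B k • f (x + y) = _; rw [map_add, smul_add]
  map_smul' b x := by
    simp only [map_smul, RingHom.id_apply, smul_smul]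
    rw [Algebra.commutes]

/-- The `K`-module structure on the group of `B`-linear maps. -/
def homKModule : Module K (X →ₗ[B] N) where
  smul := homKSMul K B X N
  one_smul f := LinearMap.ext fun x => by
    show algebraMap K B 1 • f x = f x
    rw [map_one, one_smul]
  mul_smul k l f := LinearMap.ext fun x => by
    show algebraMap K B (k * l) • f x = algebraMap K B k • algebraMap K B l • f x
    rw [map_mul, mul_smul]
  smul_zero k := LinearMap.ext fun x => by
    show algebraMap K B k • (0 : X →ₗ[B] N) x = 0
    simp
  smul_add k f g := LinearMap.ext fun x => by
    show algebraMap K B k • (f + g) x = algebraMap K B k • f x + algebraMap K B k • g x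
    simp [smul_add]
  add_smul k l f := LinearMap.ext fun x => by
    show algebraMap K B (k + l) • f x = algebraMap K B k • f x + algebraMap K B l • f x
    rw [map_add, add_smul]
  zero_smul f := LinearMap.ext fun x => by
    show algebraMap K B 0 • f x = 0
    rw [map_zero, zero_smul]

/-- The length `|Hom_B(X, N)|` of the group of `B`-linear maps `X → N` as a `K`-module. -/
noncomputable def homKLength : WithBot ℕ∞ :=
  letI : Module K (X →ₗ[B] N) := homKModule K B X N
  Order.krullDim (Submodule K (X →ₗ[B] N))

/-- The canonical surjection from the free module on (the underlying set of) `X` to `X`. -/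
noncomputable def freeCover : (X →₀ B) →ₗ[B] X :=
  Finsupp.linearCombination B id

/-- The length `|Ext¹_B(X, N)|` of `Ext¹` as a `K`-module, computed as the cokernel of
`Hom_B(F, N) → Hom_B(Ω X, N)` for the canonical free cover `F → X` with kernel `Ω X`. -/
noncomputable def ext1KLength : WithBot ℕ∞ :=
  letI : Module K (↥(LinearMap.ker (freeCover B X)) →ₗ[B] N) :=
    homKModule K B (↥(LinearMap.ker (freeCover B X))) N
  let D : Submodule K (↥(LinearMap.ker (freeCover B X)) →ₗ[B] N) :=
    { carrier := {f | ∃ g : (X →₀ B) →ₗ[B] N,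
        f = g.comp (LinearMap.ker (freeCover B X)).subtype}
      add_mem' := by
        rintro f₁ f₂ ⟨g₁, rfl⟩ ⟨g₂, rfl⟩
        exact ⟨g₁ + g₂, rfl⟩
      zero_mem' := ⟨0, rfl⟩
      smul_mem' := by
        rintro k f ⟨g, rfl⟩
        exact ⟨homKSMul K B _ N k g, rfl⟩ }
  Order.krullDim (Submodule K ((↥(LinearMap.ker (freeCover B X)) →ₗ[B] N) ⧸ D))

end KLength

/-- Vanishing of `Ext¹_B(X, N)`: every short exact sequence `0 → N → E → X → 0` splits. -/
def Ext1IsZero (B : Type u) [Ring B] (X : Type u) [AddCommGroup X] [Module B X]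
    (N : Type u) [AddCommGroup N] [Module B N] : Prop :=
  ∀ (E : Type u) [AddCommGroup E] [Module B E], ∀ (f : N →ₗ[B] E) (g : E →ₗ[B] X),
    Function.Injective f → Function.Surjective g → LinearMap.range f = LinearMap.ker g →
    ∃ s : X →ₗ[B] E, g.comp s = LinearMap.id

/-- The syzygy `Ω X`: the kernel of the canonical free cover of `X`. -/
noncomputable def syzygyRaw (B : Type u) [Ring B] (X : RawMod B) : RawMod B :=
  ⟨↥(LinearMap.ker (freeCover B X.M))⟩

/-- Iterated syzygies. -/
noncomputable def syzygyIter (B : Type u) [Ring B] : ℕ → RawMod B → RawMod B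
  | 0, X => X
  | n + 1, X => syzygyRaw B (syzygyIter B n X)

/-- Vanishing of `Ext^r_B(X, N)` for `r ≥ 1`, via `Ext^r(X, N) ≅ Ext¹(Ω^{r-1} X, N)`. -/
noncomputable def ExtIsZero (B : Type u) [Ring B] (X N : RawMod B) (r : ℕ) : Prop :=
  Ext1IsZero B (syzygyIter B (r - 1) X).M N.M

/-- `[X] = [M]` in the Grothendieck group `K₀`: the modules `X` and `M` have the same
composition factors including multiplicities. -/
def SameCompFactors {B : Type u} [Ring B] (X M : ModA B) : Prop :=
  ∃ (n : ℕ) (s : Fin (n + 1) → Submodule B X.M) (t : Fin (n + 1) → Submodule B M.M)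
    (σ : Equiv.Perm (Fin n)),
    s 0 = ⊥ ∧ s (Fin.last n) = ⊤ ∧ t 0 = ⊥ ∧ t (Fin.last n) = ⊤ ∧
    (∀ i : Fin n, s i.castSucc ≤ s i.succ) ∧ (∀ i : Fin n, t i.castSucc ≤ t i.succ) ∧
    ∀ i : Fin n,
      IsSimpleModule B (↥(s i.succ) ⧸ (s i.castSucc).comap (s i.succ).subtype) ∧
      Nonempty ((↥(s i.succ) ⧸ (s i.castSucc).comap (s i.succ).subtype) ≃ₗ[B]
        (↥(t (σ i).succ) ⧸ (t (σ i).castSucc).comap (t (σ i).succ).subtype))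

/-- A torsion class in `mod B`: a class of modules closed under factor modules and
extensions. -/
def IsTorsionClass (B : Type u) [Ring B] (T : Set (ModA B)) : Prop :=
  (∀ M ∈ T, ∀ (N : ModA B) (g : M.M →ₗ[B] N.M), Function.Surjective g → N ∈ T) ∧
  ∀ (X E M : ModA B) (f : X.M →ₗ[B] E.M) (g : E.M →ₗ[B] M.M),
    Function.Injective f → Function.Surjective g → LinearMap.range f = LinearMap.ker g →
    X ∈ T → M ∈ T → E ∈ T

/-- A torsion class is functorially finite iff it is of the form `Fac(M)`. -/
def IsFunctoriallyFinite (B : Type u) [Ring B] (T : Set (ModA B)) : Prop :=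
  ∃ M : ModA B,
    T = {N | ∃ (k : ℕ) (g : (Fin k → M.M) →ₗ[B] N.M), Function.Surjective g}

/-- A module `M` is `τ`-rigid if `Hom(M, τM) = 0`. -/
def IsTauRigid {B : Type u} [Ring B] (M : ModA B) : Prop :=
  ∀ N : ModA B, IsTauOf N M → ∀ f : M.M →ₗ[B] N.M, f = 0

/-- A module `M` is rigid if `Ext¹(M, M) = 0`. -/
def IsRigid {B : Type u} [Ring B] (M : ModA B) : Prop := Ext1IsZero B M.M M.M

/-- `α(M) ≤ 2`: the middle term of any almost split sequence ending at `M` has at most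
two indecomposable direct summands. -/
def AlphaLe2 {B : Type u} [Ring B] (M : ModA B) : Prop :=
  ∀ s : AlmostSplitSeq B, s.r.Iso M →
    ∀ (k : ℕ) (N : Fin k → Submodule B s.m.M),
      (∀ i, IsIndecMod B ↥(N i)) → iSupIndep N → (⨆ i, N i) = ⊤ → k ≤ 2

namespace CF

universe v w

/-- Abstract (skeletal) category of indecomposables with almost split sequences. -/
structure ARCat (V : Type v) where
  Hom : V → V → Type w
  [ag : ∀ a b, AddCommGroup (Hom a b)]
  comp : ∀ {a b c}, Hom a b →+ Hom b c →+ Hom a c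
  one : ∀ a, Hom a a
  one_comp : ∀ {a b} (f : Hom a b), comp (one a) f = f
  comp_one : ∀ {a b} (f : Hom a b), comp f (one b) = f
  assoc : ∀ {a b c d} (f : Hom a b) (g : Hom b c) (h : Hom c d),
    comp (comp f g) h = comp f (comp g h)
  Rad : ∀ a b, AddSubgroup (Hom a b)
  rad_l : ∀ {a b c} (f : Hom a b) (g : Hom b c), f ∈ Rad a b → comp f g ∈ Rad a c
  rad_r : ∀ {a b c} (f : Hom a b) (g : Hom b c), g ∈ Rad b c → comp f g ∈ Rad a c
  rad_ne : ∀ {a b}, a ≠ b → ∀ f : Hom a b, f ∈ Rad a b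
  one_rad : ∀ a, one a ∉ Rad a a
  Arrow : V → V → Prop
  Tau : V → V → Prop
  Proj : V → Prop
  Inj : V → Prop
  len : V → V → ℤ
  len_zero : ∀ a b, (∀ f : Hom a b, f = 0) → len a b = 0
  arrow_ne : ∀ {a b}, Arrow a b → ∃ f : Hom a b, f ≠ 0
  tau_l : ∀ {a a' b}, Tau a b → Tau a' b → a = a'
  tau_r : ∀ {a b b'}, Tau a b → Tau a b' → b = b'
  proj_or : ∀ b, ¬ Proj b → ∃ a, Tau a b
  inj_or : ∀ a, ¬ Inj a → ∃ b, Tau a b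
  proj_seq : ∀ b, Proj b → ∃ (n : ℕ) (Z : Fin n → V) (p : ∀ k, Hom (Z k) b),
    (∀ x, Arrow x b ↔ ∃ k, Z k = x) ∧ (∀ k, p k ∈ Rad _ _) ∧
    (∀ u (f : Hom u b), f ∈ Rad u b → ∃ c : ∀ k, Hom u (Z k), f = ∑ k, comp (c k) (p k)) ∧
    (∀ u, u ≠ b → len u b - ∑ k, len u (Z k) = 0) ∧ 0 < len b b - ∑ k, len b (Z k)
  inj_seq : ∀ a, Inj a → ∃ (n : ℕ) (Z : Fin n → V) (i : ∀ k, Hom a (Z k)),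
    (∀ x, Arrow a x ↔ ∃ k, Z k = x) ∧ (∀ k, i k ∈ Rad _ _) ∧
    (∀ u (f : Hom a u), f ∈ Rad a u → ∃ c : ∀ k, Hom (Z k) u, f = ∑ k, comp (i k) (c k)) ∧
    (∀ u, u ≠ a → len a u - ∑ k, len (Z k) u = 0) ∧ 0 < len a a - ∑ k, len (Z k) a
  tau_seq : ∀ a b, Tau a b → ∃ (n : ℕ) (Z : Fin n → V) (i : ∀ k, Hom a (Z k))
    (p : ∀ k, Hom (Z k) b),
    (∀ x, Arrow x b ↔ ∃ k, Z k = x) ∧ (∀ x, Arrow a x ↔ ∃ k, Z k = x) ∧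
    (∀ k, p k ∈ Rad _ _) ∧ (∀ k, i k ∈ Rad _ _) ∧
    (∀ u (f : Hom u b), f ∈ Rad u b → ∃ c : ∀ k, Hom u (Z k), f = ∑ k, comp (c k) (p k)) ∧
    (∀ u (f : Hom a u), f ∈ Rad a u → ∃ c : ∀ k, Hom (Z k) u, f = ∑ k, comp (i k) (c k)) ∧
    (∀ u (c : ∀ k, Hom u (Z k)), ∑ k, comp (c k) (p k) = 0 →
      ∃ d : Hom u a, ∀ k, c k = comp d (i k)) ∧
    (∀ u (c : ∀ k, Hom (Z k) u), ∑ k, comp (i k) (c k) = 0 →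
      ∃ d : Hom b u, ∀ k, c k = comp (p k) d) ∧
    (∀ u, u ≠ b → len u a + len u b - ∑ k, len u (Z k) = 0) ∧
      0 < len b a + len b b - ∑ k, len b (Z k) ∧
    (∀ u, u ≠ a → len a u + len b u - ∑ k, len (Z k) u = 0) ∧
      0 < len a a + len b a - ∑ k, len (Z k) a ∧ 0 < n
  arrow_me : ∀ {a b}, Arrow a b →
    (∀ i, Inj i → (∃ f : Hom a i, f ≠ 0) → ∃ f : Hom b i, f ≠ 0) ∨
    (∀ p, Proj p → (∃ f : Hom p b, f ≠ 0) → ∃ f : Hom p a, f ≠ 0)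
  ex_proj : ∀ b, ∃ p, Proj p ∧ ∃ f : Hom p b, f ≠ 0
  ex_inj : ∀ a, ∃ i, Inj i ∧ ∃ f : Hom a i, f ≠ 0
  nv : ℕ
  dv : Fin nv → V → ℤ
  gv_proj : ∀ b, Proj b → ∃ g : Fin nv → ℤ, ∀ y, len b y = ∑ i, g i * dv i y
  gv : ∀ a b, Tau a b → (∀ i, Inj i → ∀ f : Hom i a, f = 0) →
    ∃ g : Fin nv → ℤ, ∀ y, (∀ f : Hom y a, f = 0) → len b y = ∑ i, g i * dv i y
  nv' : ℕ
  dv' : Fin nv' → V → ℤ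
  gv_inj : ∀ a, Inj a → ∃ g : Fin nv' → ℤ, ∀ y, len y a = ∑ i, g i * dv' i y
  gv' : ∀ a b, Tau a b → (∀ p, Proj p → ∀ f : Hom b p, f = 0) →
    ∃ g : Fin nv' → ℤ, ∀ y, (∀ f : Hom b y, f = 0) → len y a = ∑ i, g i * dv' i y
  /-- Harada–Sai for finite sets of indecomposables. -/
  hs : ∀ U : Set V, U.Finite → ∃ (N : ℕ) (J : ℕ → ∀ a b, AddSubgroup (Hom a b)),
    (∀ a b (f : Hom a b), f ∈ J 0 a b) ∧
    (∀ n a b c (f : Hom a b) (g : Hom b c), a ∈ U → b ∈ U → c ∈ U → f ∈ J n a b →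
      g ∈ Rad b c → comp f g ∈ J (n + 1) a c) ∧
    (∀ n a b c (f : Hom a b) (g : Hom b c), a ∈ U → b ∈ U → c ∈ U → f ∈ Rad a b →
      g ∈ J n b c → comp f g ∈ J (n + 1) a c) ∧
    (∀ a b (f : Hom a b), a ∈ U → b ∈ U → f ∈ J N a b → f = 0)

attribute [instance] ARCat.ag

namespace ARCat

variable {V : Type v}

/-- The opposite structure. -/
def op (C : ARCat.{v, w} V) : ARCat.{v, w} V where
  Hom a b := C.Hom b a
  ag a b := C.ag b a
  comp := C.comp.flip
  one := C.one
  one_comp f := C.comp_one f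
  comp_one f := C.one_comp f
  assoc f g h := (C.assoc h g f).symm
  Rad a b := C.Rad b a
  rad_l f g h := C.rad_r g f h
  rad_r f g h := C.rad_l g f h
  rad_ne h f := C.rad_ne (Ne.symm h) f
  one_rad := C.one_rad
  Arrow a b := C.Arrow b a
  Tau a b := C.Tau b a
  Proj := C.Inj
  Inj := C.Proj
  len a b := C.len b a
  len_zero a b := C.len_zero b a
  arrow_ne h := C.arrow_ne h
  tau_l h h' := C.tau_r h h'
  tau_r h h' := C.tau_l h h'
  proj_or := C.inj_or
  inj_or := C.proj_or
  proj_seq := C.inj_seq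
  inj_seq := C.proj_seq
  tau_seq a b h := by
    obtain ⟨n, Z, i, p, h1, h2, h3, h4, h5, h6, h7, h8, h9, h10, h11, h12, hn⟩ := C.tau_seq b a h
    refine ⟨n, Z, p, i, h2, h1, h4, h3, h6, h5, h8, h7, ?_, ?_, ?_, ?_, hn⟩
    · intro u hu; have := h11 u hu; linarith
    · linarith
    · intro u hu; have := h9 u hu; linarith
    · linarith
  arrow_me h := (C.arrow_me h).symm
  ex_proj := C.ex_inj
  ex_inj := C.ex_proj
  nv := C.nv'
  dv := C.dv'
  gv_proj := C.gv_inj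
  gv a b h := C.gv' b a h
  nv' := C.nv
  dv' := C.dv
  gv_inj := C.gv_proj
  gv' a b h := C.gv b a h
  hs U hU := by
    obtain ⟨N, J, h0, h1, h2, h3⟩ := C.hs U hU
    exact ⟨N, fun n a b => J n b a, fun a b => h0 b a,
      fun n a b c f g ha hb hc hf hg => h2 n c b a g f hc hb ha hg hf,
      fun n a b c f g ha hb hc hf hg => h1 n c b a g f hc hb ha hg hf,
      fun a b f ha hb => h3 b a f hb ha⟩

variable (C : ARCat.{v, w} V)

theorem op_op : C.op.op = C := rfl

/-- There is a nonzero morphism. -/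
def H (a b : V) : Prop := ∃ f : C.Hom a b, f ≠ 0

theorem op_H (a b : V) : C.op.H a b ↔ C.H b a := Iff.rfl

/-- Path of nonzero morphisms. -/
def Le : V → V → Prop := Relation.ReflTransGen C.H

theorem op_Le (a b : V) : C.op.Le a b ↔ C.Le b a := by
  exact Relation.reflTransGen_swap (r := C.H)

variable {C}

theorem not_H {a b : V} : ¬ C.H a b ↔ ∀ f : C.Hom a b, f = 0 := by
  simp [H]

theorem one_ne (a : V) : C.one a ≠ 0 := fun h => C.one_rad a (h ▸ (C.Rad a a).zero_mem)

theorem H_refl (a : V) : C.H a a := ⟨_, one_ne a⟩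

theorem zero_comp {a b c : V} (g : C.Hom b c) : C.comp (0 : C.Hom a b) g = 0 := by simp

theorem comp_zero {a b c : V} (f : C.Hom a b) : C.comp f (0 : C.Hom b c) = 0 := by simp

theorem sum_comp {a b c : V} {n : ℕ} (f : Fin n → C.Hom a b) (g : C.Hom b c) :
    C.comp (∑ k, f k) g = ∑ k, C.comp (f k) g := by simp

theorem comp_sum {a b c : V} {n : ℕ} (f : C.Hom a b) (g : Fin n → C.Hom b c) :
    C.comp f (∑ k, g k) = ∑ k, C.comp f (g k) := by simp

theorem sink (C : ARCat.{v, w} V) (b : V) :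
    ∃ (n : ℕ) (Z : Fin n → V) (p : ∀ k, C.Hom (Z k) b),
    (∀ x, C.Arrow x b ↔ ∃ k, Z k = x) ∧ (∀ k, p k ∈ C.Rad _ _) ∧
    (∀ u (f : C.Hom u b), f ∈ C.Rad u b →
      ∃ c : ∀ k, C.Hom u (Z k), f = ∑ k, C.comp (c k) (p k)) := by
  by_cases h : C.Proj b
  · obtain ⟨n, Z, p, h1, h2, h3, -⟩ := C.proj_seq b h
    exact ⟨n, Z, p, h1, h2, h3⟩
  · obtain ⟨a, ha⟩ := C.proj_or b h
    obtain ⟨n, Z, i, p, h1, h2, h3, h4, h5, -⟩ := C.tau_seq a b ha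
    exact ⟨n, Z, p, h1, h3, h5⟩

theorem source (C : ARCat.{v, w} V) (a : V) :
    ∃ (n : ℕ) (Z : Fin n → V) (i : ∀ k, C.Hom a (Z k)),
    (∀ x, C.Arrow a x ↔ ∃ k, Z k = x) ∧ (∀ k, i k ∈ C.Rad _ _) ∧
    (∀ u (f : C.Hom a u), f ∈ C.Rad a u →
      ∃ c : ∀ k, C.Hom (Z k) u, f = ∑ k, C.comp (i k) (c k)) := C.op.sink a

theorem tau_arrow {a b x : V} (h : C.Tau a b) : C.Arrow a x ↔ C.Arrow x b := by
  obtain ⟨n, Z, i, p, h1, h2, -⟩ := C.tau_seq a b h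
  rw [h1, h2]

variable (C)

/-- Powers of the radical. -/
def radN : ℕ → ∀ a b, AddSubgroup (C.Hom a b)
  | 0, _, _ => ⊤
  | n + 1, a, b => AddSubgroup.closure
      {f | ∃ (z : V) (g : C.Hom a z) (h : C.Hom z b), g ∈ C.Rad a z ∧ h ∈ radN n z b ∧
        f = C.comp g h}

variable {C}

theorem radN_l {n : ℕ} {a z b : V} (g : C.Hom a z) (h : C.Hom z b) (hg : g ∈ C.Rad a z)
    (hh : h ∈ C.radN n z b) : C.comp g h ∈ C.radN (n + 1) a b :=
  AddSubgroup.subset_closure ⟨z, g, h, hg, hh, rfl⟩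

theorem radN_comp_l {n : ℕ} {a z b : V} (g : C.Hom a z) (h : C.Hom z b)
    (hh : h ∈ C.radN n z b) : C.comp g h ∈ C.radN n a b := by
  cases n with
  | zero => trivial
  | succ n =>
    induction hh using AddSubgroup.closure_induction with
    | mem x hx =>
      obtain ⟨y, k, l, hk, hl, rfl⟩ := hx
      rw [← C.assoc]
      exact radN_l _ _ (C.rad_r _ _ hk) hl
    | zero => rw [comp_zero]; exact zero_mem _
    | add x y _ _ hx hy => rw [map_add]; exact add_mem hx hy
    | neg x _ hx => rw [map_neg]; exact neg_mem hx

theorem radN_comp_r {n : ℕ} {a z b : V} (g : C.Hom a z) (h : C.Hom z b)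
    (hg : g ∈ C.radN n a z) : C.comp g h ∈ C.radN n a b := by
  induction n generalizing a with
  | zero => trivial
  | succ n ih =>
    induction hg using AddSubgroup.closure_induction with
    | mem x hx =>
      obtain ⟨y, k, l, hk, hl, rfl⟩ := hx
      rw [C.assoc]
      exact radN_l _ _ hk (ih _ hl)
    | zero => rw [zero_comp]; exact zero_mem _
    | add x y _ _ hx hy => rw [map_add]; exact add_mem hx hy
    | neg x _ hx => rw [map_neg]; exact neg_mem hx

theorem radN_r {n : ℕ} {a z b : V} (g : C.Hom a z) (h : C.Hom z b) (hg : g ∈ C.radN n a z)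
    (hh : h ∈ C.Rad z b) : C.comp g h ∈ C.radN (n + 1) a b := by
  induction n generalizing a with
  | zero =>
    rw [← C.comp_one (C.comp g h)]
    exact radN_l _ _ (C.rad_r _ _ hh) trivial
  | succ n ih =>
    induction hg using AddSubgroup.closure_induction with
    | mem x hx =>
      obtain ⟨y, k, l, hk, hl, rfl⟩ := hx
      rw [C.assoc]
      exact radN_l _ _ hk (ih _ hl)
    | zero => rw [zero_comp]; exact zero_mem _
    | add x y _ _ hx hy => rw [map_add]; exact add_mem hx hy
    | neg x _ hx => rw [map_neg]; exact neg_mem hx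

theorem op_radN_le (C : ARCat.{v, w} V) (n : ℕ) (a b : V) (f : C.Hom a b)
    (hf : f ∈ C.op.radN n b a) : f ∈ C.radN n a b := by
  induction n generalizing b with
  | zero => trivial
  | succ n ih =>
    induction hf using AddSubgroup.closure_induction with
    | mem x hx =>
      obtain ⟨y, k, l, hk, hl, rfl⟩ := hx
      exact radN_r (C := C) l k (ih _ _ hl) hk
    | zero => exact zero_mem _
    | add x y _ _ hx hy => exact add_mem hx hy
    | neg x _ hx => exact neg_mem hx

theorem op_radN (C : ARCat.{v, w} V) (n : ℕ) (a b : V) (f : C.Hom a b) :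
    f ∈ C.op.radN n b a ↔ f ∈ C.radN n a b :=
  ⟨op_radN_le C n a b f, fun h => op_radN_le C.op n b a f h⟩

theorem radN_succ_le (n : ℕ) (a b : V) : C.radN (n + 1) a b ≤ C.radN n a b := by
  rw [radN, AddSubgroup.closure_le]
  rintro _ ⟨z, g, h, _, hh, rfl⟩
  exact radN_comp_l _ _ hh

theorem radN_anti {m n : ℕ} (h : m ≤ n) (a b : V) : C.radN n a b ≤ C.radN m a b := by
  induction h with
  | refl => exact le_rfl
  | step _ ih => exact (radN_succ_le _ _ _).trans ih

/-- Elements of `radN (n+1)` come from the source family. -/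
theorem radN_source {n : ℕ} {a b : V} {m : ℕ} {Z : Fin m → V} {i : ∀ k, C.Hom a (Z k)}
    (hi : ∀ u (f : C.Hom a u), f ∈ C.Rad a u →
      ∃ c : ∀ k, C.Hom (Z k) u, f = ∑ k, C.comp (i k) (c k))
    (f : C.Hom a b) (hf : f ∈ C.radN (n + 1) a b) :
    ∃ c : ∀ k, C.Hom (Z k) b, (∀ k, c k ∈ C.radN n (Z k) b) ∧ f = ∑ k, C.comp (i k) (c k) := by
  induction hf using AddSubgroup.closure_induction with
  | mem x hx =>
    obtain ⟨y, g, h, hg, hh, rfl⟩ := hx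
    obtain ⟨c, hc⟩ := hi _ g hg
    refine ⟨fun k => C.comp (c k) h, fun k => radN_comp_l _ _ hh, ?_⟩
    rw [hc, sum_comp]
    simp only [C.assoc]
  | zero => exact ⟨0, fun k => zero_mem _, by simp⟩
  | add x y _ _ hx hy =>
    obtain ⟨c, hc, rfl⟩ := hx
    obtain ⟨d, hd, rfl⟩ := hy
    exact ⟨c + d, fun k => add_mem (hc k) (hd k), by simp [Finset.sum_add_distrib]⟩
  | neg x _ hx =>
    obtain ⟨c, hc, rfl⟩ := hx
    exact ⟨-c, fun k => neg_mem (hc k), by simp⟩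

/-- Exit lemma. -/
theorem exit (C : ARCat.{v, w} V) (U E : Set V) (hU : U.Finite) (y : V)
    (hUE : ∀ a ∈ U, ∀ z, C.Arrow a z → z ∈ U ∨ z ∈ E ∨ ¬ C.H z y) :
    ∃ N, ∀ m, ∀ a ∈ U, ∀ f ∈ C.radN (N + m) a y,
      f ∈ AddSubgroup.closure {f | ∃ (z : V) (g : C.Hom a z) (h : C.Hom z y), z ∈ E ∧
        h ∈ C.radN m z y ∧ f = C.comp g h} := by
  obtain ⟨N, J, h0, h1, h2, h3⟩ := C.hs U hU
  refine ⟨N, fun m => ?_⟩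
  set S : ∀ a, AddSubgroup (C.Hom a y) := fun a => AddSubgroup.closure
    {f | ∃ (z : V) (g : C.Hom a z) (h : C.Hom z y), z ∈ E ∧
        h ∈ C.radN m z y ∧ f = C.comp g h} with hS
  have hSl : ∀ a b (i : C.Hom a b) (f : C.Hom b y), f ∈ S b → C.comp i f ∈ S a := by
    intro a b i f hf
    induction hf using AddSubgroup.closure_induction with
    | mem x hx =>
      obtain ⟨z, g, h, hz, hh, rfl⟩ := hx
      exact AddSubgroup.subset_closure ⟨z, C.comp i g, h, hz, hh, by rw [C.assoc]⟩
    | zero => rw [comp_zero]; exact zero_mem _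
    | add x y _ _ hx hy => rw [map_add]; exact add_mem hx hy
    | neg x _ hx => rw [map_neg]; exact neg_mem hx
  set Q : ℕ → ∀ a, AddSubgroup (C.Hom a y) := fun n a => AddSubgroup.closure
    {f | ∃ (z : V) (g : C.Hom a z) (h : C.Hom z y), z ∈ U ∧ g ∈ J n a z ∧ f = C.comp g h} with hQ
  have key : ∀ n, ∀ a ∈ U, ∀ f ∈ C.radN (n + m) a y, f ∈ S a ⊔ Q n a := by
    intro n
    induction n with
    | zero =>
      intro a ha f hf
      refine AddSubgroup.mem_sup_right (AddSubgroup.subset_closure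
        ⟨a, C.one a, f, ha, h0 _ _ _, (C.one_comp f).symm⟩)
    | succ n ih =>
      intro a ha f hf
      obtain ⟨k, Z, i, hZ, hi, hf'⟩ := C.source a
      obtain ⟨c, hc, rfl⟩ := radN_source (n := n + m) hf' f (by
        convert hf using 2; omega)
      refine AddSubgroup.sum_mem _ fun j _ => ?_
      rcases hUE a ha (Z j) ((hZ _).2 ⟨j, rfl⟩) with h | h | h
      · have := ih (Z j) h (c j) (hc j)
        obtain ⟨s, hs, q, hq, hsq⟩ := AddSubgroup.mem_sup.1 this
        rw [← hsq, map_add]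
        refine add_mem (AddSubgroup.mem_sup_left (hSl _ _ _ _ hs)) (AddSubgroup.mem_sup_right ?_)
        clear hsq
        induction hq using AddSubgroup.closure_induction with
        | mem x hx =>
          obtain ⟨z, g, h', hz, hh, rfl⟩ := hx
          exact AddSubgroup.subset_closure ⟨z, C.comp (i j) g, h', hz,
            h2 _ _ _ _ _ _ ha h hz (hi j) hh, by rw [C.assoc]⟩
        | zero => rw [comp_zero]; exact zero_mem _
        | add x y _ _ hx hy => rw [map_add]; exact add_mem hx hy
        | neg x _ hx => rw [map_neg]; exact neg_mem hx
      · exact AddSubgroup.mem_sup_left (AddSubgroup.subset_closure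
          ⟨Z j, i j, c j, h, radN_anti (by omega) _ _ (hc j), rfl⟩)
      · rw [not_H.1 h (c j), comp_zero]; exact zero_mem _
  intro a ha f hf
  obtain ⟨s, hs, q, hq, rfl⟩ := AddSubgroup.mem_sup.1 (key N a ha f hf)
  have hq0 : q = 0 := by
    clear hf
    induction hq using AddSubgroup.closure_induction with
    | mem x hx =>
      obtain ⟨z, g, h', hz, hh, rfl⟩ := hx
      rw [h3 _ _ g ha hz hh, zero_comp]
    | zero => rfl
    | add x y _ _ hx hy => rw [hx, hy, add_zero]
    | neg x _ hx => rw [hx, neg_zero]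
  rw [hq0, add_zero]; exact hs

/-- `GL'`. -/
theorem gl_rad (C : ARCat.{v, w} V) (U : Set V) (hU : U.Finite) (y : V)
    (hUE : ∀ a ∈ U, ∀ z, C.Arrow a z → z ∈ U ∨ ¬ C.H z y) :
    ∃ N, ∀ a ∈ U, ∀ f ∈ C.radN N a y, f = 0 := by
  obtain ⟨N, hN⟩ := C.exit U ∅ hU y (fun a ha z hz => (hUE a ha z hz).imp_right Or.inr)
  refine ⟨N, fun a ha f hf => ?_⟩
  have := hN 0 a ha f hf
  simpa using this

theorem gl (C : ARCat.{v, w} V) (U : Set V) (hU : U.Finite) (y : V)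
    (hUE : ∀ a ∈ U, ∀ z, C.Arrow a z → z ∈ U ∨ ¬ C.H z y) (hy : y ∉ U) :
    ∀ a ∈ U, ¬ C.H a y := by
  obtain ⟨N, hN⟩ := C.gl_rad U hU y hUE
  have key : ∀ n, ∀ a ∈ U, ∀ f : C.Hom a y, f ∈ C.radN n a y := by
    intro n
    induction n with
    | zero => intro a ha f; trivial
    | succ n ih =>
      intro a ha f
      obtain ⟨k, Z, i, hZ, hi, hf'⟩ := C.source a
      obtain ⟨c, rfl⟩ := hf' y f (C.rad_ne (by rintro rfl; exact hy ha) f)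
      refine AddSubgroup.sum_mem _ fun j _ => ?_
      rcases hUE a ha (Z j) ((hZ _).2 ⟨j, rfl⟩) with h | h
      · exact radN_l _ _ (hi j) (ih _ h _)
      · rw [not_H.1 h (c j), comp_zero]; exact zero_mem _
  intro a ha
  rw [not_H]
  intro f
  exact hN a ha f (key N a ha f)

/-- Nonzero composites along walks. -/
theorem walk (C : ARCat.{v, w} V) (U : Set V) (J : ℕ → ∀ a b, AddSubgroup (C.Hom a b))
    (h0 : ∀ a b (f : C.Hom a b), f ∈ J 0 a b)
    (h2 : ∀ n a b c (f : C.Hom a b) (g : C.Hom b c), a ∈ U → b ∈ U → c ∈ U → f ∈ C.Rad a b →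
      g ∈ J n b c → C.comp f g ∈ J (n + 1) a c)
    (n : ℕ) (X : ℕ → V) (hX : ∀ k, X k ∈ U) (hA : ∀ k, C.Arrow (X k) (X (k + 1)))
    (hI : ∀ k < n, ¬ C.Inj (X k))
    (hT : ∀ k < n, ∀ y, C.Tau (X k) y → ¬ C.H y (X n)) :
    ∃ f ∈ J n (X 0) (X n), f ≠ 0 := by
  induction n generalizing X with
  | zero => exact ⟨C.one _, h0 _ _ _, one_ne _⟩
  | succ n ih =>
    obtain ⟨g, hg, hg0⟩ := ih (fun k => X (k + 1)) (fun k => hX _) (fun k => hA _)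
      (fun k hk => hI (k + 1) (by omega)) (fun k hk => hT (k + 1) (by omega))
    obtain ⟨y, hy⟩ := C.inj_or _ (hI 0 (by omega))
    obtain ⟨m, Z, i, p, a1, a2, a3, a4, a5, a6, a7, a8, -⟩ := C.tau_seq _ _ hy
    obtain ⟨k, hk⟩ := (a2 _).1 (hA 0)
    have main : ∀ z (hz : z = X (0 + 1)) (r : C.Hom (X 0) z), r ∈ C.Rad _ _ →
        (∀ g : C.Hom z (X (n + 1)), C.comp r g = 0 → g = 0) →
        ∃ f ∈ J (n + 1) (X 0) (X (n + 1)), f ≠ 0 := by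
      rintro z rfl r hr hr0
      exact ⟨C.comp r g, h2 _ _ _ _ _ _ (hX _) (hX _) (hX _) hr hg, fun h => hg0 (hr0 _ h)⟩
    refine main _ hk (i k) (a4 k) fun g hg => ?_
    classical
    obtain ⟨d, hd⟩ := a8 (X (n + 1)) (fun l => if h : l = k then h ▸ g else 0) (by
      rw [Finset.sum_eq_single k]
      · simpa using hg
      · intro b _ hb; simp [hb]
      · simp)
    have := hd k
    rw [not_H.1 (hT 0 (by omega) y hy) d, comp_zero] at this
    simpa using this

end ARCat

end CF

namespace CF
universe v w
namespace ARCat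
variable {V : Type v}

/-- Undirected connectedness. -/
def Conn (C : ARCat.{v, w} V) : V → V → Prop :=
  Relation.ReflTransGen (fun a b => C.Arrow a b ∨ C.Arrow b a)

theorem op_Conn (C : ARCat.{v, w} V) (a b : V) : C.op.Conn a b ↔ C.Conn a b := by
  have : (fun a b => C.op.Arrow a b ∨ C.op.Arrow b a) = (fun a b => C.Arrow a b ∨ C.Arrow b a) := by
    funext a b
    exact propext or_comm
  rw [Conn, this, Conn]

theorem Conn.symm {C : ARCat.{v, w} V} {a b : V} (h : C.Conn a b) : C.Conn b a := by
  induction h with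
  | refl => exact .refl
  | tail _ h ih => exact Relation.ReflTransGen.head h.symm ih

theorem Conn.trans {C : ARCat.{v, w} V} {a b c : V} (h : C.Conn a b) (h' : C.Conn b c) :
    C.Conn a c := Relation.ReflTransGen.trans h h'

theorem Conn.arrow {C : ARCat.{v, w} V} {a b : V} (h : C.Arrow a b) : C.Conn a b :=
  Relation.ReflTransGen.single (Or.inl h)

theorem Conn.tau {C : ARCat.{v, w} V} {a b : V} (h : C.Tau a b) : C.Conn a b := by
  obtain ⟨n, Z, i, p, h1, h2, h3, h4, h5, h6, h7, h8, h9, h10, h11, h12, hn⟩ := C.tau_seq a b h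
  exact (Conn.arrow ((h2 (Z ⟨0, hn⟩)).2 ⟨_, rfl⟩)).trans
    (Conn.arrow ((h1 (Z ⟨0, hn⟩)).2 ⟨_, rfl⟩))

/-- The standing hypotheses on the finite set `Γ`. -/
structure Cfg (C : ARCat.{v, w} V) (Γ : Set V) : Prop where
  fin : Γ.Finite
  ne : Γ.Nonempty
  conv : ∀ a ∈ Γ, ∀ b ∈ Γ, ∀ z, C.Le a z → C.Le z b → z ∈ Γ
  inj : ∀ i, C.Inj i → ∃ a ∈ Γ, C.H a i
  proj : ∀ p, C.Proj p → ∃ a ∈ Γ, C.H p a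
  cyc : ∀ a ∈ Γ, Relation.TransGen C.Arrow a a
  conn : ∀ a ∈ Γ, ∀ b ∈ Γ, C.Conn a b

theorem Cfg.op {C : ARCat.{v, w} V} {Γ : Set V} (h : Cfg C Γ) : Cfg C.op Γ where
  fin := h.fin
  ne := h.ne
  conv a ha b hb z h1 h2 := h.conv b hb a ha z ((op_Le C _ _).1 h2) ((op_Le C _ _).1 h1)
  inj := h.proj
  proj := h.inj
  cyc a ha := (Relation.transGen_swap (r := C.Arrow)).2 (h.cyc a ha)
  conn a ha b hb := (op_Conn C _ _).2 (h.conn a ha b hb)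

variable (C : ARCat.{v, w} V) (Γ : Set V)

/-- Successors of `Γ`. -/
def T (z : V) : Prop := ∃ a ∈ Γ, C.Le a z

/-- Component of `Γ`. -/
def CC : Set V := {z | ∃ a ∈ Γ, C.Conn a z}

theorem op_CC : C.op.CC Γ = C.CC Γ := by
  ext z; simp only [CC, Set.mem_ofPred_eq, op_Conn]

/-- The slice. -/
def Sl : Set V := {b | C.T Γ b ∧ (C.Proj b ∨ ∃ a, ¬ C.T Γ a ∧ C.Tau a b)}

/-- The layers below the slice. -/
def Dk : ℕ → Set V
  | 0 => C.Sl Γ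
  | k + 1 => {x | ¬ C.T Γ x ∧ ∃ y ∈ Dk k, C.Tau x y}

variable {C Γ}

theorem T_of_mem {a : V} (h : a ∈ Γ) : C.T Γ a := ⟨a, h, .refl⟩

theorem T_H {a b : V} (h : C.T Γ a) (h' : C.H a b) : C.T Γ b := by
  obtain ⟨x, hx, hl⟩ := h
  exact ⟨x, hx, hl.tail h'⟩

theorem T_arrow {a b : V} (h : C.T Γ a) (h' : C.Arrow a b) : C.T Γ b := T_H h (C.arrow_ne h')

theorem T_not {a b : V} (h : C.T Γ a) (h' : ¬ C.T Γ b) : ¬ C.H a b := fun h'' => h' (T_H h h'')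

theorem CC_conn {a b : V} (h : a ∈ C.CC Γ) (h' : C.Conn a b) : b ∈ C.CC Γ := by
  obtain ⟨x, hx, hl⟩ := h
  exact ⟨x, hx, hl.trans h'⟩

theorem CC_of_mem {a : V} (h : a ∈ Γ) : a ∈ C.CC Γ := ⟨a, h, .refl⟩

namespace Cfg



theorem T_inj (h : Cfg C Γ) {i : V} (hi : C.Inj i) : C.T Γ i := by
  obtain ⟨a, ha, hh⟩ := h.inj i hi
  exact T_H (T_of_mem ha) hh

theorem mem_of_T (h : Cfg C Γ) {z a : V} (hz : C.T Γ z) (ha : a ∈ Γ) (hl : C.Le z a) : z ∈ Γ := by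
  obtain ⟨x, hx, hxl⟩ := hz
  exact h.conv x hx a ha z hxl hl

theorem CC_conn_iff (h : Cfg C Γ) {a b : V} (ha : a ∈ C.CC Γ) (hb : b ∈ C.CC Γ) : C.Conn a b := by
  obtain ⟨x, hx, hxl⟩ := ha
  obtain ⟨y, hy, hyl⟩ := hb
  exact hxl.symm.trans ((h.conn x hx y hy).trans hyl)

/-- L5. -/
theorem L5 (h : Cfg C Γ) {x b : V} (hx : ¬ C.T Γ x) (hb : C.T Γ b) (hxb : C.Arrow x b) :
    b ∈ C.Sl Γ ∧ ∃ y ∈ C.Sl Γ, C.Tau x y := by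
  constructor
  · refine ⟨hb, ?_⟩
    by_cases hp : C.Proj b
    · exact Or.inl hp
    · obtain ⟨y, hy⟩ := C.proj_or b hp
      exact Or.inr ⟨y, fun hT => hx (T_arrow hT ((tau_arrow hy).2 hxb)), hy⟩
  · obtain ⟨y, hy⟩ := C.inj_or x (fun hi => hx (h.T_inj hi))
    exact ⟨y, ⟨T_arrow hb ((tau_arrow hy).1 hxb), Or.inr ⟨x, hx, hy⟩⟩, hy⟩

theorem Sl_finite (h : Cfg C Γ) : (C.Sl Γ).Finite := by
  by_contra hinf
  have hgv : ∀ b ∈ C.Sl Γ, ∃ g : Fin C.nv → ℤ, ∀ y, C.T Γ y →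
      C.len b y = ∑ i, g i * C.dv i y := by
    rintro b ⟨hb, hp | ⟨a, ha, hab⟩⟩
    · obtain ⟨g, hg⟩ := C.gv_proj b hp
      exact ⟨g, fun y _ => hg y⟩
    · obtain ⟨g, hg⟩ := C.gv a b hab (fun i hi => not_H.1 (T_not (h.T_inj hi) ha))
      exact ⟨g, fun y hy => hg y (not_H.1 (T_not hy ha))⟩
  choose! g hg using hgv
  obtain ⟨t, hts, htc⟩ := Set.Infinite.exists_subset_card_eq hinf (C.nv + 1)
  have hdep : ¬ LinearIndependent ℚ (fun b : t => (fun i => (g b.1 i : ℚ))) := by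
    intro hli
    have := hli.fintype_card_le_finrank
    simp [htc] at this
  rw [Fintype.not_linearIndependent_iff] at hdep
  obtain ⟨c, hc, j, hj⟩ := hdep
  have hphi : ∀ y, ∑ b : t, c b * (C.len b.1 y : ℚ) = 0 := by
    intro y
    by_cases hy : C.T Γ y
    · have : ∀ b : t, c b * (C.len b.1 y : ℚ) = ∑ i, (c b * g b.1 i) * (C.dv i y) := by
        intro b
        rw [hg b.1 (hts b.2) y hy]
        push_cast
        rw [Finset.mul_sum]
        exact Finset.sum_congr rfl fun i _ => by ring
      rw [Finset.sum_congr rfl fun b _ => this b, Finset.sum_comm]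
      refine Finset.sum_eq_zero fun i _ => ?_
      rw [← Finset.sum_mul]
      have := congrFun hc i
      simp only [Finset.sum_apply, Pi.smul_apply, smul_eq_mul, Pi.zero_apply] at this
      rw [this, zero_mul]
    · refine Finset.sum_eq_zero fun b _ => ?_
      rw [C.len_zero _ _ (not_H.1 (T_not (hts b.2).1 hy))]
      simp
  have fin : ∀ (F : V → ℤ), (∀ u, u ≠ j.1 → F u = 0) → 0 < F j.1 →
      ∑ b : t, c b * (F b.1 : ℚ) ≠ 0 := by
    intro F h1 h2
    rw [Finset.sum_eq_single j]
    · exact mul_ne_zero hj (by exact_mod_cast h2.ne')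
    · intro b _ hb
      rw [h1 b.1 (fun h => hb (Subtype.ext h))]; simp
    · simp
  by_cases hp : C.Proj j.1
  · obtain ⟨n, Z, p, -, -, -, h1, h2⟩ := C.proj_seq _ hp
    refine fin (fun u => C.len u j.1 - ∑ k, C.len u (Z k)) h1 h2 ?_
    push_cast
    simp only [mul_sub, Finset.sum_sub_distrib, hphi, Finset.mul_sum]
    rw [Finset.sum_comm, Finset.sum_eq_zero fun y _ => hphi _]
    simp
  · obtain ⟨a, ha⟩ := C.proj_or _ hp
    obtain ⟨n, Z, i, p, -, -, -, -, -, -, -, -, h1, h2, -⟩ := C.tau_seq _ _ ha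
    refine fin (fun u => C.len u a + C.len u j.1 - ∑ k, C.len u (Z k)) h1 h2 ?_
    push_cast
    simp only [mul_sub, mul_add, Finset.sum_sub_distrib, Finset.sum_add_distrib, hphi,
      Finset.mul_sum]
    rw [Finset.sum_comm, Finset.sum_eq_zero fun y _ => hphi _]
    simp

theorem U_closed (h : Cfg C Γ) {z b : V} (hb : b ∈ C.Sl Γ ∪ Γ) (hz : C.T Γ z) (hzb : C.Arrow z b) :
    z ∈ C.Sl Γ ∪ Γ := by
  by_cases hbΓ : b ∈ Γ
  · exact Or.inr (h.mem_of_T hz hbΓ (.single (C.arrow_ne hzb)))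
  have hb := hb.resolve_right hbΓ
  left
  refine ⟨hz, ?_⟩
  by_contra hcon
  push Not at hcon
  obtain ⟨hzp, hzt⟩ := hcon
  obtain ⟨y, hy⟩ := C.proj_or z hzp
  have hyT : C.T Γ y := by
    by_contra hyT; exact hzt y hyT hy
  obtain ⟨hbT, hp | ⟨x, hx, hxb⟩⟩ := hb
  · obtain ⟨a, ha, hpa⟩ := h.proj b hp
    exact hbΓ (h.mem_of_T hbT ha (.single hpa))
  · exact hx (T_arrow hyT ((tau_arrow hy).2 ((tau_arrow hxb).2 hzb)))

/-- L1. -/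
theorem L1 (h : Cfg C Γ) {z b : V} (hb : b ∈ C.Sl Γ ∪ Γ) (hz : C.T Γ z) (hzb : C.H z b) :
    z ∈ C.Sl Γ ∪ Γ ∧ C.Conn z b := by
  by_contra hcon
  refine C.op.gl {u | u ∈ C.Sl Γ ∪ Γ ∧ C.Conn u b}
    ((h.Sl_finite.union h.fin).subset fun u hu => hu.1) z ?_ hcon b ⟨hb, .refl⟩ hzb
  rintro a ⟨ha, hab⟩ x (hxa : C.Arrow x a)
  by_cases hx : C.T Γ x
  · exact Or.inl ⟨h.U_closed ha hx hxa, (Conn.arrow hxa).trans hab⟩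
  · exact Or.inr (fun hh => T_not (C := C) hz hx hh)

/-- L4. -/
theorem L4 (h : Cfg C Γ) {b : V} (hb : b ∈ C.Sl Γ ∪ Γ) : b ∈ C.CC Γ := by
  have hT : C.T Γ b := hb.elim (fun h => h.1) T_of_mem
  obtain ⟨a, ha, hl⟩ := hT
  suffices H : ∀ x, C.Le x b → C.T Γ x → x ∈ C.Sl Γ ∪ Γ ∧ C.Conn x b from
    ⟨a, ha, (H a hl (T_of_mem ha)).2⟩
  intro x hx
  induction hx using Relation.ReflTransGen.head_induction_on with
  | refl => exact fun _ => ⟨hb, .refl⟩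
  | head hxy _ ih =>
    intro hxT
    obtain ⟨h1, h2⟩ := ih (T_H hxT hxy)
    obtain ⟨h3, h4⟩ := h.L1 h1 hxT hxy
    exact ⟨h3, h4.trans h2⟩

theorem Dk_notT (h : Cfg C Γ) {k : ℕ} {x : V} (hx : x ∈ C.Dk Γ (k + 1)) : ¬ C.T Γ x := hx.1

theorem Dk_CC (h : Cfg C Γ) {k : ℕ} {x : V} (hx : x ∈ C.Dk Γ k) : x ∈ C.CC Γ := by
  induction k generalizing x with
  | zero => exact h.L4 (Or.inl hx)
  | succ k ih =>
    obtain ⟨_, y, hy, hxy⟩ := hx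
    exact CC_conn (ih hy) (Conn.tau hxy).symm

theorem Dk_finite (h : Cfg C Γ) (k : ℕ) : (C.Dk Γ k).Finite := by
  induction k with
  | zero => exact h.Sl_finite
  | succ k ih =>
    classical
    refine Set.Finite.subset (ih.image (fun y => if hy : ∃ x, C.Tau x y then hy.choose else y)) ?_
    rintro x ⟨_, y, hy, hxy⟩
    refine ⟨y, hy, ?_⟩
    have hex : ∃ x, C.Tau x y := ⟨x, hxy⟩
    simp only [hex, dif_pos]
    exact C.tau_l hex.choose_spec hxy

/-- The union of the first layers. -/
def Fk (C : ARCat.{v, w} V) (Γ : Set V) (k : ℕ) : Set V := {x | ∃ j < k, x ∈ C.Dk Γ (j + 1)}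

theorem Fk_finite (h : Cfg C Γ) (k : ℕ) : (Fk C Γ k).Finite := by
  have : Fk C Γ k = ⋃ j ∈ Finset.range k, C.Dk Γ (j + 1) := by
    ext x; simp [Fk]
  rw [this]
  exact Set.Finite.biUnion (Finset.finite_toSet _) (fun j _ => h.Dk_finite _)

theorem ex_tau (h : Cfg C Γ) {x : V} (hx : ¬ C.T Γ x) : ∃ y, C.Tau x y := C.inj_or x (fun hi => hx (h.T_inj hi))

theorem D1_of (h : Cfg C Γ) {x y : V} (hx : ¬ C.T Γ x) (hxy : C.Tau x y) (hy : C.T Γ y) : x ∈ C.Dk Γ (0 + 1) :=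
  ⟨hx, y, ⟨hy, Or.inr ⟨x, hx, hxy⟩⟩, hxy⟩

/-- L7. -/
theorem L7 (h : Cfg C Γ) {k : ℕ} {x z : V} (hx : x ∈ C.Dk Γ (k + 1)) (hxz : C.Arrow x z) (hz : ¬ C.T Γ z) :
    z ∈ Fk C Γ (k + 1) := by
  induction k generalizing x z with
  | zero =>
    obtain ⟨hxT, y, hy, hxy⟩ := hx
    obtain ⟨_, w, hw, hzw⟩ := h.L5 hz hy.1 ((tau_arrow hxy).1 hxz)
    exact ⟨0, by omega, hz, w, hw, hzw⟩
  | succ k ih =>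
    obtain ⟨hxT, y, hy, hxy⟩ := hx
    have hzy := (tau_arrow hxy).1 hxz
    obtain ⟨z', hz'⟩ := h.ex_tau hz
    have hyz' := (tau_arrow hz').1 hzy
    by_cases hz'T : C.T Γ z'
    · exact ⟨0, by omega, h.D1_of hz hz' hz'T⟩
    · obtain ⟨j, hj, hj'⟩ := ih hy hyz' hz'T
      exact ⟨j + 1, by omega, hz, z', hj', hz'⟩

/-- L8. -/
theorem L8 (h : Cfg C Γ) {x : V} (hx : x ∈ C.CC Γ) (hxT : ¬ C.T Γ x) : ∃ k, x ∈ C.Dk Γ (k + 1) := by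
  suffices H : C.T Γ x ∨ ∃ k, x ∈ C.Dk Γ (k + 1) from H.resolve_left hxT
  clear hxT
  obtain ⟨a, ha, hl⟩ := hx
  induction hl with
  | refl => exact Or.inl (T_of_mem ha)
  | @tail b c _ hbc ih =>
    by_cases hc : C.T Γ c
    · exact Or.inl hc
    right
    rcases ih with hb | ⟨k, hb⟩
    · rcases hbc with hbc | hbc
      · exact absurd (T_arrow hb hbc) hc
      · obtain ⟨_, y, hy, hcy⟩ := h.L5 hc hb hbc
        exact ⟨0, hc, y, hy, hcy⟩
    · rcases hbc with hbc | hbc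
      · obtain ⟨j, _, hj⟩ := h.L7 hb hbc hc
        exact ⟨j, hj⟩
      · obtain ⟨z, hz⟩ := h.ex_tau hc
        have := (tau_arrow hz).1 hbc
        by_cases hzT : C.T Γ z
        · exact ⟨0, h.D1_of hc hz hzT⟩
        · obtain ⟨j, _, hj⟩ := h.L7 hb this hzT
          exact ⟨j + 1, hc, z, hj, hz⟩

theorem Fk_succ (h : Cfg C Γ) {k : ℕ} {a z y : V} (ha : a ∈ Fk C Γ k) (haz : C.Arrow a z) (hy : ¬ C.T Γ y) :
    z ∈ Fk C Γ k ∨ ¬ C.H z y := by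
  by_cases hz : C.T Γ z
  · exact Or.inr (T_not hz hy)
  · obtain ⟨j, hj, hj'⟩ := ha
    obtain ⟨l, hl, hl'⟩ := h.L7 hj' haz hz
    exact Or.inl ⟨l, by omega, hl'⟩

theorem F1' (h : Cfg C Γ) {k : ℕ} {x y : V} (hx : x ∈ Fk C Γ k) (hy : ¬ C.T Γ y) (hy' : y ∉ Fk C Γ k) :
    ¬ C.H x y :=
  C.gl (Fk C Γ k) (h.Fk_finite k) y (fun _ ha _ haz => h.Fk_succ ha haz hy) hy' x hx

theorem F1 (h : Cfg C Γ) {x y : V} (hx : x ∈ C.CC Γ) (hxT : ¬ C.T Γ x) (hy : ¬ C.T Γ y) (hy' : y ∉ C.CC Γ) :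
    ¬ C.H x y := by
  obtain ⟨k, hk⟩ := h.L8 hx hxT
  refine h.F1' (k := k + 1) ⟨k, by omega, hk⟩ hy ?_
  rintro ⟨j, _, hj⟩
  exact hy' (h.Dk_CC hj)

theorem F2 (h : Cfg C Γ) {x y : V} (hx : x ∈ C.CC Γ) (hxT : ¬ C.T Γ x) (hy : ¬ C.T Γ y) :
    ∃ N, ∀ f ∈ C.radN N x y, f = 0 := by
  obtain ⟨k, hk⟩ := h.L8 hx hxT
  obtain ⟨N, hN⟩ := C.gl_rad (Fk C Γ (k + 1)) (h.Fk_finite _) y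
    (fun _ ha _ haz => h.Fk_succ ha haz hy)
  exact ⟨N, hN x ⟨k, by omega, hk⟩⟩

theorem F3 (h : Cfg C Γ) {x : V} (hx : x ∈ C.CC Γ) (hxT : ¬ C.T Γ x) (y : V)
    (hs : ∀ s ∈ C.Sl Γ, ∃ N, ∀ f ∈ C.radN N s y, f = 0) : ∃ N, ∀ f ∈ C.radN N x y, f = 0 := by
  obtain ⟨k, hk⟩ := h.L8 hx hxT
  obtain ⟨N, hN⟩ := C.exit (Fk C Γ (k + 1)) (C.Sl Γ) (h.Fk_finite _) y (by
    rintro a ⟨j, hj, hj'⟩ z haz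
    by_cases hz : C.T Γ z
    · exact Or.inr (Or.inl (h.L5 (Dk_notT h hj') hz haz).1)
    · obtain ⟨l, hl, hl'⟩ := h.L7 hj' haz hz
      exact Or.inl ⟨l, by omega, hl'⟩)
  choose! M hM using hs
  obtain ⟨B, hB⟩ := (h.Sl_finite.image M).bddAbove
  refine ⟨N + B, fun f hf => ?_⟩
  have := hN B x ⟨k, by omega, hk⟩ f hf
  rw [← AddSubgroup.mem_bot]
  refine (AddSubgroup.closure_le (K := ⊥)).2 ?_ this
  rintro _ ⟨z, g, l, hz, hl, rfl⟩
  have hz0 : l = 0 := hM z hz l (radN_anti (hB ⟨z, hz, rfl⟩) _ _ hl)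
  rw [hz0, comp_zero]
  exact zero_mem _

/-- A closed path gives a periodic infinite walk. -/
theorem cycle_walk {r : V → V → Prop} {x : V} (hx : Relation.TransGen r x x) :
    ∃ X : ℕ → V, X 0 = x ∧ (∀ k, r (X k) (X (k + 1))) ∧ ∀ k, Relation.TransGen r (X k) x := by
  have step : ∀ a : {a // Relation.TransGen r a x}, ∃ b : {a // Relation.TransGen r a x},
      r a.1 b.1 := by
    rintro ⟨a, ha⟩
    obtain ⟨b, hb, hbx⟩ := Relation.TransGen.head'_iff.1 ha
    rcases Relation.reflTransGen_iff_eq_or_transGen.1 hbx with h | h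
    · subst h; exact ⟨⟨_, hx⟩, hb⟩
    · exact ⟨⟨b, h⟩, hb⟩
  choose f hf using step
  refine ⟨fun k => (f^[k] ⟨x, hx⟩).1, rfl, fun k => ?_, fun k => (f^[k] ⟨x, hx⟩).2⟩
  show r (f^[k] ⟨x, hx⟩).1 (f^[k + 1] ⟨x, hx⟩).1
  rw [Function.iterate_succ_apply']
  exact hf _

/-- F4. -/
theorem F4 (h : Cfg C Γ) {x : V} (hx : x ∈ C.CC Γ) (hxc : Relation.TransGen C.Arrow x x) : C.T Γ x := by
  by_contra hxT
  obtain ⟨X, hX0, hX, hXx⟩ := cycle_walk hxc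
  have hnT : ∀ k, ¬ C.T Γ (X k) := by
    intro k hk
    have : ∀ a b, Relation.TransGen C.Arrow a b → C.T Γ a → C.T Γ b := by
      intro a b ha haT
      induction ha with
      | single h => exact T_arrow haT h
      | tail _ h ih => exact T_arrow ih h
    exact hxT (this _ _ (hXx k) hk)
  classical
  -- least depth
  have hex : ∀ k, ∃ d, X k ∈ C.Dk Γ (d + 1) := by
    intro k
    refine h.L8 ?_ (hnT k)
    induction k with
    | zero => rwa [hX0]
    | succ k ih => exact CC_conn ih (Conn.arrow (hX k))
  set d : ℕ → ℕ := fun k => Nat.find (hex k) with hd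
  have hdm : ∀ k, X k ∈ C.Dk Γ (d k + 1) := fun k => Nat.find_spec (hex k)
  have hmono : ∀ a b, Relation.TransGen C.Arrow a b → ¬ C.T Γ b → ∀ m, a ∈ Fk C Γ m →
      b ∈ Fk C Γ m := by
    intro a b hab
    induction hab with
    | single hab =>
      intro hb m ha
      exact (h.Fk_succ ha hab hb).resolve_right (fun h => h (H_refl _))
    | tail _ hbc ih =>
      intro hc m ha
      have := ih (fun hT => hc (T_arrow hT hbc)) m ha
      exact (h.Fk_succ this hbc hc).resolve_right (fun h => h (H_refl _))
  have hle : ∀ k m, X k ∈ Fk C Γ m ↔ x ∈ Fk C Γ m := by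
    intro k m
    constructor
    · exact hmono _ _ (hXx k) hxT m
    · intro hxm
      have : Relation.ReflTransGen C.Arrow x (X k) := by
        induction k with
        | zero => rw [hX0]
        | succ k ih => exact ih.tail (hX k)
      rcases Relation.reflTransGen_iff_eq_or_transGen.1 this with e | e
      · rw [e]; exact hxm
      · exact hmono _ _ e (hnT k) m hxm
  set j := d 0 with hj
  have hin : ∀ k, X k ∈ Fk C Γ (j + 1) := fun k => (hle k _).2 ((hle 0 _).1 ⟨j, by omega, hdm 0⟩)
  have hnot : ∀ k, X k ∉ Fk C Γ j := by
    intro k hk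
    obtain ⟨l, hl, hl'⟩ := (hle 0 _).2 ((hle k _).1 hk)
    exact Nat.find_min (hex 0) hl hl'
  have hDj : ∀ k, X k ∈ C.Dk Γ (j + 1) := by
    intro k
    obtain ⟨l, hl, hl'⟩ := hin k
    rcases Nat.lt_or_ge l j with h' | h'
    · exact absurd ⟨l, h', hl'⟩ (hnot k)
    · obtain rfl : l = j := by omega
      exact hl'
  obtain ⟨N, J, h0, h1, h2, h3⟩ := C.hs (Fk C Γ (j + 1)) (h.Fk_finite _)
  obtain ⟨f, hf, hf0⟩ := C.walk _ J h0 h2 N X hin hX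
    (fun k _ hi => hnT k (h.T_inj hi)) (by
      intro k _ y hy
      obtain ⟨_, y', hy', hxy'⟩ := hDj k
      obtain rfl := C.tau_r hy hxy'
      cases hjj : j with
      | zero =>
        rw [hjj] at hy'
        exact T_not hy'.1 (hnT N)
      | succ i =>
        rw [hjj] at hy'
        refine h.F1' (k := j) ⟨i, by omega, hy'⟩ (hnT N) (hnot N))
  exact hf0 (h3 _ _ f (hin 0) (hin N) hf)

theorem cyclic_mem (h : Cfg C Γ) {x : V} (hx : x ∈ C.CC Γ) (hxc : Relation.TransGen C.Arrow x x) : x ∈ Γ := by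
  have h1 := h.F4 hx hxc
  obtain ⟨a, ha, hl⟩ := h.op.F4 (by rwa [op_CC])
    ((Relation.transGen_swap (r := C.Arrow)).2 hxc)
  exact h.mem_of_T h1 ha ((op_Le C _ _).1 hl)

/-- L10. -/
theorem L10 (h : Cfg C Γ) {z b : V} (hz : ¬ C.T Γ z) (hb : b ∈ C.Sl Γ ∪ Γ) (hzb : C.H z b) :
    ∃ x y, ¬ C.T Γ x ∧ y ∈ C.Sl Γ ∧ C.Tau x y ∧ C.H z x := by
  by_contra hcon
  push Not at hcon
  refine C.op.gl (C.Sl Γ ∪ Γ) (h.Sl_finite.union h.fin) z ?_ ?_ b hb hzb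
  · intro a ha x (hxa : C.Arrow x a)
    by_cases hx : C.T Γ x
    · exact Or.inl (h.U_closed ha hx hxa)
    · obtain ⟨_, y, hy, hxy⟩ := h.L5 hx (ha.elim (fun h => h.1) T_of_mem) hxa
      exact Or.inr (hcon x y hx hy hxy)
  · rintro (h' | h')
    · exact hz h'.1
    · exact hz (T_of_mem h')

theorem mem_of_both (h : Cfg C Γ) {z : V} (hz : C.T Γ z) (hz' : C.op.T Γ z) : z ∈ Γ := by
  obtain ⟨a, ha, hl⟩ := hz'
  exact h.mem_of_T hz ha ((op_Le C _ _).1 hl)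

theorem van_right (h : Cfg C Γ) {x y : V} (hx : x ∈ C.CC Γ) (hy : y ∉ C.CC Γ) (hyT : ¬ C.T Γ y) :
    ¬ C.H x y := by
  by_cases hxT : C.T Γ x
  · exact T_not hxT hyT
  · exact h.F1 hx hxT hyT hy

theorem van_left (h : Cfg C Γ) {x y : V} (hx : x ∈ C.CC Γ) (hy : y ∉ C.CC Γ) (hyT : C.T Γ y) :
    ¬ C.H y x :=
  h.op.van_right (by rwa [op_CC]) (by rwa [op_CC])
    (fun hP => hy (CC_of_mem (h.mem_of_both hyT hP)))

theorem gs_aux (h : Cfg C Γ) {x : V} (hx : x ∈ Γ) {y : V} (hy : y ∈ Γ) : ∃ N, ∀ f ∈ C.radN N x y, f = 0 := by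
  obtain ⟨N, hN⟩ := C.gl_rad Γ h.fin y (by
    intro a ha z haz
    by_cases hzy : C.H z y
    · exact Or.inl (h.conv a ha y hy z (.single (C.arrow_ne haz)) (.single hzy))
    · exact Or.inr hzy)
  exact ⟨N, hN x hx⟩

theorem gen_standard (h : Cfg C Γ) {x y : V} (hx : x ∈ C.CC Γ) (hy : y ∈ C.CC Γ) :
    ∃ N, ∀ f ∈ C.radN N x y, f = 0 := by
  have triv : ∀ {a b : V}, ¬ C.H a b → ∃ N, ∀ f ∈ C.radN N a b, f = 0 :=
    fun h => ⟨0, fun f _ => not_H.1 h f⟩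
  by_cases hyT : C.T Γ y
  swap
  · by_cases hxT : C.T Γ x
    · exact triv (T_not hxT hyT)
    · exact h.F2 hx hxT hyT
  have main : ∀ x, x ∈ C.CC Γ → C.T Γ x → ∃ N, ∀ f ∈ C.radN N x y, f = 0 := by
    intro x hx hxT
    by_cases hxΓ : x ∈ Γ
    · by_cases hyΓ : y ∈ Γ
      · exact h.gs_aux hxΓ hyΓ
      · have hyP : ¬ C.op.T Γ y := fun hP => hyΓ (h.mem_of_both hyT hP)
        have := h.op.F3 (x := y) (by rwa [op_CC]) hyP x (by
          intro s hs
          by_cases hsT : C.T Γ s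
          · obtain ⟨N, hN⟩ := h.gs_aux hxΓ (h.mem_of_both hsT hs.1)
            exact ⟨N, fun f hf => hN f ((op_radN C _ _ _ _).1 hf)⟩
          · exact ⟨0, fun f _ => not_H.1 (T_not (T_of_mem hxΓ) hsT) f⟩)
        obtain ⟨N, hN⟩ := this
        exact ⟨N, fun f hf => hN f ((op_radN C _ _ _ _).2 hf)⟩
    · by_cases hyΓ : y ∈ Γ
      · exact triv (fun hh => hxΓ (h.mem_of_T hxT hyΓ (.single hh)))
      · obtain ⟨N, hN⟩ := h.op.F2 (x := y) (y := x) (by rwa [op_CC])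
          (fun hP => hyΓ (h.mem_of_both hyT hP)) (fun hP => hxΓ (h.mem_of_both hxT hP))
        exact ⟨N, fun f hf => hN f ((op_radN C _ _ _ _).2 hf)⟩
  by_cases hxT : C.T Γ x
  · exact main x hx hxT
  · exact h.F3 hx hxT y (fun s hs => main s (h.L4 (Or.inl hs)) hs.1)

/-- Other components lie inside `T` or outside `T`. -/
theorem T_conn (h : Cfg C Γ) {a b : V} (ha : a ∉ C.CC Γ) (hab : C.Conn a b) : C.T Γ a ↔ C.T Γ b := by
  have key : ∀ x y, x ∉ C.CC Γ → C.Arrow x y → (C.T Γ x ↔ C.T Γ y) := by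
    intro x y hx hxy
    refine ⟨fun hT => T_arrow hT hxy, fun hT => ?_⟩
    by_contra hxT
    exact hx (CC_conn (h.L4 (Or.inl (h.L5 hxT hT hxy).1)) (Conn.arrow hxy).symm)
  induction hab with
  | refl => rfl
  | @tail b c hab hbc ih =>
    have hb : b ∉ C.CC Γ := fun hb => ha (CC_conn hb (Conn.symm hab))
    refine ih.trans ?_
    rcases hbc with hbc | hbc
    · exact key _ _ hb hbc
    · exact (key _ _ (fun hc => hb (CC_conn hc (Conn.arrow hbc))) hbc).symm

/-- If the component of `Γ` contains no injective, contradiction. -/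
theorem exists_inj (h : Cfg C Γ) : ∃ i ∈ C.CC Γ, C.Inj i := by
  by_contra hcon
  push Not at hcon
  have hclosed : ∀ a ∈ Γ, ∀ z, C.Arrow a z → z ∈ Γ := by
    intro a ha z haz
    obtain ⟨y, hy⟩ := C.inj_or a (hcon a (CC_of_mem ha))
    have hpath : ∀ b, Relation.TransGen C.Arrow a b → ∀ y', C.Tau b y' →
        Relation.TransGen C.Arrow y y' := by
      intro b hab
      induction hab with
      | single hab =>
        intro y' hy'
        exact .single ((tau_arrow hy').1 ((tau_arrow hy).1 hab))
      | @tail b c hab hbc ih =>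
        intro y' hy'
        have hb : b ∈ C.CC Γ := CC_conn (CC_of_mem ha)
          (Relation.ReflTransGen.mono (fun _ _ h => Or.inl h) _ _ hab.to_reflTransGen)
        obtain ⟨yb, hyb⟩ := C.inj_or b (hcon b hb)
        exact (ih _ hyb).tail ((tau_arrow hy').1 ((tau_arrow hyb).1 hbc))
    have hyΓ : y ∈ Γ := h.cyclic_mem (CC_conn (CC_of_mem ha) (Conn.tau hy))
      (hpath a (h.cyc a ha) y hy)
    exact h.conv a ha y hyΓ z (.single (C.arrow_ne haz))
      (.single (C.arrow_ne ((tau_arrow hy).1 haz)))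
  obtain ⟨a, ha⟩ := h.ne
  obtain ⟨i, hi, hai⟩ := C.ex_inj a
  by_cases hiΓ : i ∈ Γ
  · exact hcon i (CC_of_mem hiΓ) hi
  · exact C.gl Γ h.fin i (fun b hb z hbz => Or.inl (hclosed b hb z hbz)) hiΓ a ha hai

theorem exists_proj (h : Cfg C Γ) : ∃ p ∈ C.CC Γ, C.Proj p := by
  have := h.op.exists_inj
  rwa [op_CC] at this

end Cfg
end ARCat
end CF

namespace CF
universe v w
namespace ARCat
variable {V : Type v}

theorem path_fun {r : V → V → Prop} {a b : V} (h : Relation.TransGen r a b) :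
    ∃ (n : ℕ) (X : ℕ → V), 0 < n ∧ X 0 = a ∧ X n = b ∧ ∀ k < n, r (X k) (X (k + 1)) := by
  classical
  induction h with
  | @single b h =>
    refine ⟨1, fun k => if k = 0 then a else b, by omega, by simp, by simp, ?_⟩
    intro k hk
    have : k = 0 := by omega
    subst this
    simpa using h
  | @tail b c _ hbc ih =>
    obtain ⟨n, X, hn, h0, h1, h2⟩ := ih
    refine ⟨n + 1, fun k => if k ≤ n then X k else c, by omega, by simp [h0], by simp, ?_⟩
    intro k hk
    by_cases hk' : k + 1 ≤ n
    · simp only [hk', if_true, show k ≤ n by omega]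
      exact h2 k (by omega)
    · have : k = n := by omega
      subst this
      simpa [h1] using hbc

theorem periodic_walk {r : V → V → Prop} {x : V} (hx : Relation.TransGen r x x) :
    ∃ X : ℕ → V, X 0 = x ∧ (∀ k, r (X k) (X (k + 1))) ∧ (∀ k, Relation.TransGen r x (X k)) ∧
      (∀ k, Relation.TransGen r (X k) x) ∧ (Set.range X).Finite := by
  obtain ⟨n, X, hn, h0, h1, h2⟩ := path_fun hx
  have hstep : ∀ k, r (X (k % n)) (X ((k + 1) % n)) := by
    intro k
    have hk := Nat.mod_lt k hn
    by_cases h : k % n + 1 = n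
    · have : (k + 1) % n = 0 := by
        rw [← Nat.mod_add_mod, h, Nat.mod_self]
      rw [this, h0, ← h1]
      have := h2 (k % n) hk
      rwa [h] at this
    · have : (k + 1) % n = k % n + 1 := by
        rw [← Nat.mod_add_mod, Nat.mod_eq_of_lt (by omega)]
      rw [this]
      exact h2 _ hk
  have hto : ∀ k, Relation.TransGen r x (X (k % n)) := by
    intro k
    induction k with
    | zero => simpa [h0] using hx
    | succ k ih => exact ih.tail (hstep k)
  have hfrom : ∀ m k, k + m = n → Relation.TransGen r (X (k % n)) x := by
    intro m
    induction m with
    | zero => intro k hk; simpa [show k = n by omega, h0] using hx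
    | succ m ih => intro k hk; exact (ih (k + 1) (by omega)).head (hstep k)
  refine ⟨fun k => X (k % n), by simp [h0], hstep, hto, ?_, ?_⟩
  · intro k
    have hk := Nat.mod_lt k hn
    have := hfrom (n - k % n) (k % n) (by omega)
    rwa [Nat.mod_mod] at this
  · refine ((Set.finite_Iio n).image X).subset ?_
    rintro _ ⟨k, rfl⟩
    exact ⟨k % n, Nat.mod_lt k hn, rfl⟩

theorem Le_of_path {C : ARCat.{v, w} V} {a b : V} (h : Relation.ReflTransGen C.Arrow a b) :
    C.Le a b := by
  induction h with
  | refl => exact .refl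
  | tail _ h ih => exact ih.tail (C.arrow_ne h)

theorem S1a (C : ARCat.{v, w} V) {x y : V} (hxy : C.Arrow x y)
    (hx : Relation.TransGen C.Arrow x x) (hn : ¬ C.Le y x) :
    ∃ i, C.Inj i ∧ C.H x i ∧ C.Le i x := by
  classical
  obtain ⟨X, hX0, hX, -, hXx, hXf⟩ := periodic_walk hx
  have hXT : ∀ k, ¬ C.Le y (X k) := fun k hk =>
    hn (hk.trans (Le_of_path (hXx k).to_reflTransGen))
  have htau : ∀ k, (∀ j ≤ k, ¬ C.Inj (X j)) → ∀ z, C.Tau (X k) z → C.Le y z := by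
    intro k
    induction k with
    | zero =>
      intro _ z hz
      rw [hX0] at hz
      exact .single (C.arrow_ne ((tau_arrow hz).1 hxy))
    | succ k ih =>
      intro hk z hz
      obtain ⟨z', hz'⟩ := C.inj_or (X k) (hk k (by omega))
      exact (ih (fun j hj => hk j (by omega)) z' hz').tail
        (C.arrow_ne ((tau_arrow hz).1 ((tau_arrow hz').1 (hX k))))
  have walk : ∀ n, (∀ k < n, ¬ C.Inj (X k)) → ∀ (J : ℕ → ∀ a b, AddSubgroup (C.Hom a b)),
      (∀ a b (f : C.Hom a b), f ∈ J 0 a b) →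
      (∀ n a b c (f : C.Hom a b) (g : C.Hom b c), a ∈ Set.range X → b ∈ Set.range X →
        c ∈ Set.range X → f ∈ C.Rad a b → g ∈ J n b c → C.comp f g ∈ J (n + 1) a c) →
      ∃ f ∈ J n (X 0) (X n), f ≠ 0 := by
    intro n hI J h0 h2
    refine C.walk (Set.range X) J h0 h2 n X (fun k => ⟨k, rfl⟩) hX hI ?_
    intro k hk z hz hH
    exact hXT n ((htau k (fun j hj => hI j (by omega)) z hz).tail hH)
  have hex : ∃ n, C.Inj (X n) := by
    by_contra hcon
    push Not at hcon
    obtain ⟨N, J, h0, h1, h2, h3⟩ := C.hs _ hXf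
    obtain ⟨f, hf, hf0⟩ := walk N (fun k _ => hcon k) J h0 h2
    exact hf0 (h3 _ _ f ⟨0, rfl⟩ ⟨N, rfl⟩ hf)
  obtain ⟨f, -, hf0⟩ := walk (Nat.find hex) (fun k hk => Nat.find_min hex hk)
    (fun _ _ _ => ⊤) (fun _ _ _ => trivial) (fun _ _ _ _ _ _ _ _ _ _ _ => trivial)
  refine ⟨_, Nat.find_spec hex, ?_, Le_of_path (hXx _).to_reflTransGen⟩
  rw [← hX0]
  exact ⟨f, hf0⟩

theorem S1 (C : ARCat.{v, w} V) {x y : V} (hxy : C.Arrow x y)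
    (hx : Relation.TransGen C.Arrow x x) (hy : Relation.TransGen C.Arrow y y) : C.Le y x := by
  by_contra hn
  obtain ⟨i, hi, hxi, hix⟩ := C.S1a hxy hx hn
  obtain ⟨p, hp, hpy, hyp⟩ := C.op.S1a (x := y) (y := x) hxy
    ((Relation.transGen_swap (r := C.Arrow)).2 hy) (fun h => hn ((op_Le C _ _).1 h))
  rcases C.arrow_me hxy with h | h
  · exact hn (.head (h i hi hxi) hix)
  · exact hn (((op_Le C _ _).1 hyp).tail (h p hp hpy))

/-- Without a path, all morphisms are in the infinite radical. -/
theorem S2 (C : ARCat.{v, w} V) {v : V} (n : ℕ) {u : V}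
    (huv : ¬ Relation.ReflTransGen C.Arrow u v) (f : C.Hom u v) : f ∈ C.radN n u v := by
  induction n generalizing u with
  | zero => trivial
  | succ n ih =>
    obtain ⟨m, Z, i, h1, h2, h3⟩ := C.source u
    have hne : u ≠ v := by rintro rfl; exact huv .refl
    obtain ⟨c, rfl⟩ := h3 v f (C.rad_ne hne f)
    refine sum_mem fun k _ => radN_l _ _ (h2 k) (ih ?_ _)
    intro hp
    exact huv (.head ((h1 _).2 ⟨k, rfl⟩) hp)

/-- Convexity of a cycle-finite cyclic component. -/
theorem S3 (C : ARCat.{v, w} V) (Γ : Set V) (hcyc : ∀ a ∈ Γ, Relation.TransGen C.Arrow a a)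
    (hcl : ∀ a ∈ Γ, ∀ b, Relation.TransGen C.Arrow b b → (C.Arrow a b ∨ C.Arrow b a) → b ∈ Γ)
    (hconn : ∀ a ∈ Γ, ∀ b ∈ Γ, Relation.ReflTransGen (fun x y =>
      Relation.TransGen C.Arrow x x ∧ Relation.TransGen C.Arrow y y ∧
        (C.Arrow x y ∨ C.Arrow y x)) a b)
    (M : V) (hM : M ∈ Γ)
    (hcf : ∀ u v, u ≠ v → C.Le M u → C.Le v M → ∀ f : C.Hom u v, f ≠ 0 → ∃ n, f ∉ C.radN n u v) :
    ∀ a ∈ Γ, ∀ b ∈ Γ, ∀ z, C.Le a z → C.Le z b → z ∈ Γ := by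
  have hmut : ∀ a ∈ Γ, ∀ b ∈ Γ, C.Le a b := by
    intro a ha b hb
    have := hconn a ha b hb
    clear hb
    induction this with
    | refl => exact .refl
    | tail _ h ih =>
      obtain ⟨h1, h2, h3 | h3⟩ := h
      · exact ih.tail (C.arrow_ne h3)
      · exact ih.trans (C.S1 h3 h2 h1)
  have hpath : ∀ u v, C.Le u v → C.Le M u → C.Le v M → Relation.ReflTransGen C.Arrow u v := by
    intro u v huv
    induction huv with
    | refl => intro _ _; exact .refl
    | @tail b c hb hbc ih =>
      intro h1 h2
      have hbM : C.Le b M := .head hbc h2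
      refine (ih h1 hbM).trans ?_
      by_contra hcon
      have hne : b ≠ c := by rintro rfl; exact hcon .refl
      obtain ⟨f, hf⟩ := hbc
      obtain ⟨n, hn⟩ := hcf b c hne (h1.trans hb) h2 f hf
      exact hn (C.S2 n hcon f)
  intro a ha b hb z haz hzb
  have hMz := hpath M z ((hmut M hM a ha).trans haz) .refl (hzb.trans (hmut b hb M hM))
  have hzM := hpath z M (hzb.trans (hmut b hb M hM)) ((hmut M hM a ha).trans haz) .refl
  clear haz hzb ha hb
  induction hMz with
  | refl => exact hM
  | @tail x z hx hxz ih =>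
    have hxΓ := ih (.head hxz hzM)
    refine hcl _ hxΓ _ ?_ (Or.inl hxz)
    exact Relation.TransGen.tail' (hzM.trans hx) hxz

end ARCat
end CF

namespace CF
section

variable {R : Type u} [Ring R]

instance instNoethModA (X : ModA R) : IsNoetherian R X.M :=
  (isFiniteLength_iff_isNoetherian_isArtinian.1 X.finLen).1

instance instArtModA (X : ModA R) : IsArtinian R X.M :=
  (isFiniteLength_iff_isNoetherian_isArtinian.1 X.finLen).2

/-- Bundling. -/
abbrev mkA (R : Type u) [Ring R] (M : Type u) [AddCommGroup M] [Module R M] [IsNoetherian R M]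
    [IsArtinian R M] : ModA R :=
  ⟨M, isFiniteLength_iff_isNoetherian_isArtinian.2 ⟨inferInstance, inferInstance⟩⟩

theorem indec_iso {X Y : ModA R} (e : X.M ≃ₗ[R] Y.M) (h : X.IsIndec) : Y.IsIndec := by
  obtain ⟨h1, h2⟩ := h
  refine ⟨e.symm.toEquiv.nontrivial, fun f hf => ?_⟩
  have := h2 (e.symm.toLinearMap ∘ₗ f ∘ₗ e.toLinearMap) (by
    ext x
    have := LinearMap.congr_fun hf (e x)
    simp only [Module.End.mul_apply] at this
    simp [this])
  rcases this with h | h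
  · left
    ext y
    have := LinearMap.congr_fun h (e.symm y)
    simpa using this
  · right
    ext y
    have := LinearMap.congr_fun h (e.symm y)
    simp at this
    exact this

theorem fit {X : ModA R} (h : X.IsIndec) (f : X.M →ₗ[R] X.M) :
    Function.Bijective f ∨ IsNilpotent (f : Module.End R X.M) := by
  obtain ⟨n, hn⟩ := Filter.eventually_atTop.1
    (LinearMap.eventually_isCompl_ker_pow_range_pow (f : Module.End R X.M))
  have hc := hn (n + 1) (by omega)
  have hpi := h.2 (Submodule.projection _ _ hc) (Submodule.isIdempotentElem_projection hc)
  rcases hpi with h0 | h1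
  · left
    have hk : LinearMap.ker (f ^ (n + 1)) = ⊥ := by
      rw [← Submodule.range_projection hc, h0, LinearMap.range_zero]
    have hinj : Function.Injective f := by
      rw [injective_iff_map_eq_zero]
      intro x hx
      have : x ∈ LinearMap.ker (f ^ (n + 1)) := by
        rw [LinearMap.mem_ker, pow_succ, Module.End.mul_apply, hx, map_zero]
      rw [hk] at this
      simpa using this
    exact IsArtinian.bijective_of_injective_endomorphism f hinj
  · right
    refine ⟨n + 1, ?_⟩
    rw [← LinearMap.ker_eq_top, ← Submodule.range_projection hc, h1]
    exact LinearMap.range_id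

theorem bij_iff_unit {X : ModA R} (f : X.M →ₗ[R] X.M) :
    Function.Bijective f ↔ IsUnit (f : Module.End R X.M) :=
  (Module.End.isUnit_iff f).symm

theorem id_not_nilp {X : ModA R} (h : X.IsIndec) : ¬ IsNilpotent (1 : Module.End R X.M) := by
  have := h.1
  exact not_isNilpotent_one

/-- The sum of two non-isomorphisms of an indecomposable module is not an isomorphism. -/
theorem nonbij_add {X : ModA R} (h : X.IsIndec) {f g : X.M →ₗ[R] X.M}
    (hfg : Function.Bijective (f + g)) : Function.Bijective f ∨ Function.Bijective g := by
  rw [bij_iff_unit] at hfg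
  obtain ⟨u, hu⟩ := hfg
  rcases fit h ((↑u⁻¹ : Module.End R X.M) * f) with h1 | h1
  · left
    rw [bij_iff_unit] at h1 ⊢
    exact (Units.isUnit_units_mul _ _).1 h1
  · right
    have h2 : IsUnit ((↑u⁻¹ : Module.End R X.M) * g) := by
      have : ((↑u⁻¹ : Module.End R X.M) * g) = 1 - (↑u⁻¹ : Module.End R X.M) * f := by
        rw [eq_sub_iff_add_eq, ← mul_add, add_comm g f, ← hu, Units.inv_mul]
      rw [this]
      exact h1.isUnit_one_sub
    rw [bij_iff_unit]
    exact (Units.isUnit_units_mul _ _).1 h2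

theorem not_bij_zero {X Y : ModA R} (h : X.IsIndec) :
    ¬ Function.Bijective (0 : X.M →ₗ[R] Y.M) := by
  intro hb
  obtain ⟨x, y, hxy⟩ := h.1
  exact hxy (hb.1 (by simp))

theorem nonbij_sum {X : ModA R} (h : X.IsIndec) {ι : Type*} (s : Finset ι) (f : ι → X.M →ₗ[R] X.M)
    (hb : Function.Bijective ((∑ k ∈ s, f k : X.M →ₗ[R] X.M) : X.M → X.M)) : ∃ k ∈ s, Function.Bijective (f k) := by
  classical
  induction s using Finset.induction_on with
  | empty => exact absurd hb (by rw [Finset.sum_empty]; exact not_bij_zero h)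
  | insert a s ha ih =>
    rw [Finset.sum_insert ha] at hb
    rcases nonbij_add h hb with h1 | h1
    · exact ⟨a, by simp, h1⟩
    · obtain ⟨k, hk, hk'⟩ := ih h1
      exact ⟨k, by simp [hk], hk'⟩

/-- A split mono into an indecomposable is an isomorphism. -/
theorem bij_of_split {X Y : ModA R} (hX : X.IsIndec) (hY : Y.IsIndec) (f : X.M →ₗ[R] Y.M)
    (r : Y.M →ₗ[R] X.M) (hb : Function.Bijective (r ∘ₗ f)) :
    Function.Bijective f ∧ Function.Bijective r := by
  set e := LinearEquiv.ofBijective (r ∘ₗ f) hb with he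
  have he' : ∀ x, e.symm (r (f x)) = x := fun x => e.symm_apply_apply x
  have he'' : ∀ x, r (f (e.symm x)) = x := fun x => e.apply_symm_apply x
  have := hY.2 (f ∘ₗ e.symm.toLinearMap ∘ₗ r) (by ext y; simp [he''])
  have hf : Function.Bijective f := by
    rcases this with h | h
    · exfalso
      have : (LinearMap.id : X.M →ₗ[R] X.M) = 0 := by
        ext x
        have h3 := LinearMap.congr_fun h (f x)
        simp only [LinearMap.comp_apply, LinearEquiv.coe_coe, he', LinearMap.zero_apply] at h3
        have := he' x
        rw [h3] at this
        simpa using this.symm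
      obtain ⟨x, y, hxy⟩ := hX.1
      exact hxy ((LinearMap.congr_fun this x).trans (LinearMap.congr_fun this y).symm)
    · refine ⟨fun x y hxy => ?_, fun y => ⟨e.symm (r y), LinearMap.congr_fun h y⟩⟩
      rw [← he' x, hxy, he']
  refine ⟨hf, ?_⟩
  have : (r : Y.M → X.M) = (r ∘ₗ f) ∘ (LinearEquiv.ofBijective f hf).symm := by
    funext y
    simp only [Function.comp_apply, LinearMap.comp_apply]
    congr 1
    exact ((LinearEquiv.ofBijective f hf).apply_symm_apply y).symm
  rw [this]
  exact hb.comp (LinearEquiv.ofBijective f hf).symm.bijective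

theorem splitMono_bij {X Y : ModA R} (hX : X.IsIndec) (hY : Y.IsIndec) {f : X.M →ₗ[R] Y.M}
    (h : SplitMonoMap f) : Function.Bijective f := by
  obtain ⟨r, hr⟩ := h
  exact (bij_of_split hX hY f r (by rw [hr]; exact Function.bijective_id)).1

theorem splitEpi_bij {X Y : ModA R} (hX : X.IsIndec) (hY : Y.IsIndec) {f : X.M →ₗ[R] Y.M}
    (h : SplitEpiMap f) : Function.Bijective f := by
  obtain ⟨r, hr⟩ := h
  exact (bij_of_split hY hX r f (by rw [hr]; exact Function.bijective_id)).2

theorem splitMono_of_bij_comp {X Y : ModA R} (f : X.M →ₗ[R] Y.M) (r : Y.M →ₗ[R] X.M)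
    (hb : Function.Bijective (r ∘ₗ f)) : SplitMonoMap f :=
  ⟨(LinearEquiv.ofBijective _ hb).symm.toLinearMap ∘ₗ r, by
    ext x; exact (LinearEquiv.ofBijective _ hb).symm_apply_apply x⟩

theorem splitEpi_of_bij_comp {X Y : ModA R} (f : X.M →ₗ[R] Y.M) (r : Y.M →ₗ[R] X.M)
    (hb : Function.Bijective (f ∘ₗ r)) : SplitEpiMap f :=
  ⟨r ∘ₗ (LinearEquiv.ofBijective _ hb).symm.toLinearMap, by
    ext x; exact (LinearEquiv.ofBijective _ hb).apply_symm_apply x⟩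

theorem splitMono_of_bij {X Y : ModA R} {f : X.M →ₗ[R] Y.M} (h : Function.Bijective f) :
    SplitMonoMap f :=
  ⟨(LinearEquiv.ofBijective f h).symm.toLinearMap, by
    ext x; exact (LinearEquiv.ofBijective f h).symm_apply_apply x⟩

theorem splitEpi_of_bij {X Y : ModA R} {f : X.M →ₗ[R] Y.M} (h : Function.Bijective f) :
    SplitEpiMap f :=
  ⟨(LinearEquiv.ofBijective f h).symm.toLinearMap, by
    ext x; exact (LinearEquiv.ofBijective f h).apply_symm_apply x⟩

/-- The radical between indecomposables. -/
theorem inRad_iff {X Y : ModA R} (hX : X.IsIndec) (hY : Y.IsIndec) (f : X.M →ₗ[R] Y.M) :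
    InRad f ↔ ¬ Function.Bijective f := by
  constructor
  · intro h hf
    refine h X hX LinearMap.id (LinearEquiv.ofBijective f hf).symm.toLinearMap ?_
    have : (LinearEquiv.ofBijective f hf).symm.toLinearMap.comp (f.comp LinearMap.id)
        = LinearMap.id := by
      ext x; exact (LinearEquiv.ofBijective f hf).symm_apply_apply x
    rw [this]
    exact Function.bijective_id
  · intro hf Z hZ g h hb
    have h1 := bij_of_split hZ hX g (h ∘ₗ f) hb
    -- `h ∘ f` is bijective
    exact hf (bij_of_split hX hY f ((LinearEquiv.ofBijective g h1.1).toLinearMap ∘ₗ h) (by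
      have := (LinearEquiv.ofBijective g h1.1).bijective.comp h1.2
      exact this)).1

/-- Krull–Schmidt decomposition. -/
theorem ks (X : ModA R) : ∃ (ι : Type) (_ : Fintype ι) (Z : ι → IndecModA R),
    Nonempty (X.M ≃ₗ[R] ∀ k, (Z k).1.M) := by
  have main : ∀ (n : ℕ) (X : ModA R), Module.length R X.M = n →
      ∃ (ι : Type) (_ : Fintype ι) (Z : ι → IndecModA R),
        Nonempty (X.M ≃ₗ[R] ∀ k, (Z k).1.M) := by
    intro n
    induction n using Nat.strong_induction_on with
    | _ n ih =>
    intro X hX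
    by_cases hs : Subsingleton X.M
    · refine ⟨Empty, inferInstance, fun k => k.elim, ⟨?_⟩⟩
      exact
        { toFun := fun _ k => k.elim
          invFun := fun _ => 0
          map_add' := fun _ _ => funext fun k => k.elim
          map_smul' := fun _ _ => funext fun k => k.elim
          left_inv := fun _ => Subsingleton.elim _ _
          right_inv := fun _ => funext fun k => k.elim }
    rw [not_subsingleton_iff_nontrivial] at hs
    by_cases hi : X.IsIndec
    · refine ⟨Unit, inferInstance, fun _ => ⟨X, hi⟩, ⟨?_⟩⟩
      exact (LinearEquiv.funUnique Unit R X.M).symm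
    · have : ∃ f : Module.End R X.M, f * f = f ∧ f ≠ 0 ∧ f ≠ 1 := by
        by_contra hcon
        push Not at hcon
        exact hi ⟨hs, fun f hf => or_iff_not_imp_left.2 (hcon f hf)⟩
      obtain ⟨f, hff, hf0, hf1⟩ := this
      have hid : IsIdempotentElem f := hff
      have hc : IsCompl (LinearMap.range f) (LinearMap.ker f) :=
        LinearMap.IsIdempotentElem.isCompl hid
      have hlt : ∀ N : Submodule R X.M, N ≠ ⊤ → ∃ m < n, Module.length R N = m := by
        intro N hN
        have hl : Module.length R N < Module.length R X.M := by
          refine Submodule.length_lt hN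
        obtain ⟨m, hm⟩ := ENat.ne_top_iff_exists.1 (ne_top_of_lt hl)
        refine ⟨m, ?_, hm.symm⟩
        rw [hX, ← hm] at hl
        exact_mod_cast hl
      have hr : LinearMap.range f ≠ ⊤ := by
        intro h
        apply hf1
        ext x
        obtain ⟨y, rfl⟩ := LinearMap.range_eq_top.1 h x
        exact LinearMap.congr_fun hff y
      have hk : LinearMap.ker f ≠ ⊤ := by
        intro h
        exact hf0 (LinearMap.ker_eq_top.1 h)
      obtain ⟨m1, hm1, hl1⟩ := hlt _ hr
      obtain ⟨m2, hm2, hl2⟩ := hlt _ hk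
      obtain ⟨ι1, _, Z1, ⟨e1⟩⟩ := ih m1 hm1 (mkA R (LinearMap.range f)) hl1
      obtain ⟨ι2, _, Z2, ⟨e2⟩⟩ := ih m2 hm2 (mkA R (LinearMap.ker f)) hl2
      refine ⟨ι1 ⊕ ι2, inferInstance, Sum.elim Z1 Z2, ⟨?_⟩⟩
      refine (Submodule.prodEquivOfIsCompl _ _ hc).symm ≪≫ₗ (e1.prodCongr e2) ≪≫ₗ ?_
      exact (LinearEquiv.sumPiEquivProdPi R ι1 ι2 (fun k => (Sum.elim Z1 Z2 k).1.M)).symm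
  have hfin : Module.length R X.M ≠ ⊤ := Module.length_ne_top_iff.2 X.finLen
  obtain ⟨n, hn⟩ := ENat.ne_top_iff_exists.1 hfin
  exact main n X hn.symm

/-- Chosen representative. -/
noncomputable def rep (x : ARVertex R) : ModA R := (Quotient.out x).1

theorem rep_indec (x : ARVertex R) : (rep x).IsIndec := (Quotient.out x).2

theorem mk_rep (x : ARVertex R) : ARVertex.mk ⟨rep x, rep_indec x⟩ = x := Quotient.out_eq x

theorem mk_eq {X Y : IndecModA R} : ARVertex.mk X = ARVertex.mk Y ↔ X.1.Iso Y.1 :=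
  Quotient.eq (r := isoSetoid R)

theorem rep_mk (X : IndecModA R) : Nonempty ((rep (ARVertex.mk X)).M ≃ₗ[R] X.1.M) :=
  mk_eq.1 (mk_rep (ARVertex.mk X))

theorem eq_of_iso {x y : ARVertex R} (e : (rep x).M ≃ₗ[R] (rep y).M) : x = y := by
  rw [← mk_rep x, ← mk_rep y]
  exact mk_eq.2 ⟨e⟩

theorem eq_of_bij {x y : ARVertex R} (f : (rep x).M →ₗ[R] (rep y).M) (hf : Function.Bijective f) :
    x = y := eq_of_iso (LinearEquiv.ofBijective f hf)

theorem exists_rep {X : ModA R} (hX : X.IsIndec) : ∃ x : ARVertex R, Nonempty ((rep x).M ≃ₗ[R] X.M) :=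
  ⟨_, rep_mk ⟨X, hX⟩⟩

theorem decomp (X : ModA R) : ∃ (n : ℕ) (Z : Fin n → ARVertex R),
    Nonempty (X.M ≃ₗ[R] ∀ k, (rep (Z k)).M) := by
  obtain ⟨ι, _, Z, ⟨e⟩⟩ := ks X
  refine ⟨Fintype.card ι, fun k => ARVertex.mk (Z ((Fintype.equivFin ι).symm k)), ⟨?_⟩⟩
  have e2 := fun k => (rep_mk (R := R) (Z ((Fintype.equivFin ι).symm k))).some.symm
  exact e ≪≫ₗ (LinearEquiv.piCongrLeft R (fun k => (Z k).1.M) (Fintype.equivFin ι).symm).symm ≪≫ₗ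
    LinearEquiv.piCongrRight e2

/-- Biproduct data. -/
structure BiP (X : ModA R) (n : ℕ) (Z : Fin n → ARVertex R) where
  i : ∀ k, (rep (Z k)).M →ₗ[R] X.M
  p : ∀ k, X.M →ₗ[R] (rep (Z k)).M
  pi : ∀ k, p k ∘ₗ i k = LinearMap.id
  orth : ∀ k l, k ≠ l → p k ∘ₗ i l = 0
  tot : ∑ k, i k ∘ₗ p k = LinearMap.id

theorem exists_biP (X : ModA R) : ∃ (n : ℕ) (Z : Fin n → ARVertex R), Nonempty (BiP X n Z) := by
  classical
  obtain ⟨n, Z, ⟨e⟩⟩ := decomp X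
  refine ⟨n, Z, ⟨⟨fun k => e.symm.toLinearMap ∘ₗ LinearMap.single R (fun k => (rep (Z k)).M) k,
    fun k => LinearMap.proj k ∘ₗ e.toLinearMap, ?_, ?_, ?_⟩⟩⟩
  · intro k; ext x; simp
  · intro k l hkl; ext x; simp [hkl]
  · ext x
    apply e.injective
    simp only [LinearMap.sum_apply, LinearMap.comp_apply, LinearEquiv.coe_coe, map_sum,
      LinearEquiv.apply_symm_apply, LinearMap.proj_apply, LinearMap.id_apply]
    exact LinearMap.sum_single_apply _ (e x)

end
end CF

namespace CF
section

open CategoryTheory in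
theorem enough_inj (K : Type u) [Ring K] (S : Type u) [AddCommGroup S] [Module K S] :
    ∃ (E : Type u) (_ : AddCommGroup E) (_ : Module K E) (i : S →ₗ[K] E),
      Module.Injective K E ∧ Function.Injective i := by
  let J := Injective.under (ModuleCat.of K S)
  let i : ModuleCat.of K S ⟶ J := Injective.ι _
  have hJ : Injective J := inferInstance
  refine ⟨J, inferInstance, inferInstance, i.hom, ?_, ?_⟩
  · exact (Module.injective_iff_injective_object K J).2 hJ
  · exact (ModuleCat.mono_iff_injective i).1 inferInstance

/-- `S` is essential in `N`. -/
def Ess {K : Type u} [Ring K] {E : Type u} [AddCommGroup E] [Module K E]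
    (S N : Submodule K E) : Prop := S ≤ N ∧ ∀ x ∈ N, x ≠ 0 → ∃ k : K, k • x ∈ S ∧ k • x ≠ 0

theorem ess_hull {K : Type u} [Ring K] {E : Type u} [AddCommGroup E] [Module K E]
    (hE : Module.Injective K E) (S : Submodule K E) :
    ∃ F : Submodule K E, Ess S F ∧ Module.Injective K F := by
  obtain ⟨F, hSF, hF⟩ := zorn_le_nonempty₀ {N | Ess S N} (by
    intro c hc hch y hy
    have hd : DirectedOn (· ≤ ·) c := hch.directedOn
    refine ⟨sSup c, ⟨(hc hy).1.trans (le_sSup hy), ?_⟩, fun z hz => le_sSup hz⟩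
    intro x hx hx0
    obtain ⟨N, hN, hxN⟩ := (Submodule.mem_sSup_of_directed ⟨y, hy⟩ hd).1 hx
    exact (hc hN).2 x hxN hx0) S ⟨le_rfl, fun x hx hx0 => ⟨1, by simpa using hx, by simpa using hx0⟩⟩
  obtain ⟨C, -, hC⟩ := zorn_le_nonempty₀ {N : Submodule K E | ∀ x ∈ F, x ∈ N → x = 0} (by
    intro c hc hch y hy
    have hd : DirectedOn (· ≤ ·) c := hch.directedOn
    refine ⟨sSup c, ?_, fun z hz => le_sSup hz⟩
    intro x hx hxc
    obtain ⟨N, hN, hxN⟩ := (Submodule.mem_sSup_of_directed ⟨y, hy⟩ hd).1 hxc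
    exact hc hN x hx hxN) ⊥ (by intro x _ hx; simpa using hx)
  -- the quotient map is injective on `F`
  have hinj : Function.Injective (C.mkQ ∘ₗ F.subtype) := by
    rw [injective_iff_map_eq_zero]
    intro x hx
    have : (x : E) ∈ C := by simpa using hx
    exact Subtype.ext (hC.1 x x.2 this)
  obtain ⟨ψ, hψ⟩ := hE.out (C.mkQ ∘ₗ F.subtype) hinj F.subtype
  -- essentiality in the quotient
  have hess : ∀ y : E ⧸ C, y ≠ 0 → ∃ (k : K) (x : F), x ≠ 0 ∧ k • y = C.mkQ x := by
    intro y hy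
    obtain ⟨e, rfl⟩ := C.mkQ_surjective y
    have he : e ∉ C := by
      intro h; apply hy; simpa using h
    have hlt : ¬ (∀ x ∈ F, x ∈ C ⊔ Submodule.span K {e} → x = 0) := by
      intro h
      have := hC.2 (show C ⊔ Submodule.span K {e} ∈ {N : Submodule K E | ∀ x ∈ F, x ∈ N → x = 0}
        from h) le_sup_left
      exact he (this (Submodule.mem_sup_right (Submodule.mem_span_singleton_self e)))
    push Not at hlt
    obtain ⟨x, hxF, hx, hx0⟩ := hlt
    obtain ⟨c, hc, d, hd, rfl⟩ := Submodule.mem_sup.1 hx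
    obtain ⟨k, rfl⟩ := Submodule.mem_span_singleton.1 hd
    refine ⟨k, ⟨_, hxF⟩, fun h => hx0 (congrArg Subtype.val h), ?_⟩
    simp [(Submodule.Quotient.mk_eq_zero C).2 hc]
  have hψF : ∀ x : F, ψ (C.mkQ x) = x := hψ
  have hψi : Function.Injective ψ := by
    rw [injective_iff_map_eq_zero]
    intro y hy
    by_contra hy0
    obtain ⟨k, x, hx0, hkx⟩ := hess y hy0
    have := hψF x
    rw [← hkx, map_smul, hy, smul_zero] at this
    exact hx0 (Subtype.ext this.symm)
  have hrange : LinearMap.range ψ ≤ F := by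
    refine hF.2 (show Ess S (LinearMap.range ψ) from ⟨?_, ?_⟩) ?_
    · intro s hs
      exact ⟨_, hψF ⟨s, hSF hs⟩⟩
    · rintro _ ⟨y, rfl⟩ hy
      have hy0 : y ≠ 0 := by rintro rfl; simp at hy
      obtain ⟨k, x, hx0, hkx⟩ := hess y hy0
      obtain ⟨l, hl1, hl2⟩ := hF.1.2 x x.2 (fun h => hx0 (Subtype.ext h))
      have : (l * k) • ψ y = l • (x : E) := by
        rw [mul_smul, ← map_smul, hkx, hψF]
      exact ⟨l * k, by rw [this]; exact hl1, by rw [this]; exact hl2⟩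
    · intro x hx
      exact ⟨_, hψF ⟨x, hx⟩⟩
  let ρ : E →ₗ[K] F := (ψ ∘ₗ C.mkQ).codRestrict F (fun x => hrange ⟨_, rfl⟩)
  refine ⟨F, hF.1, ⟨?_⟩⟩
  intro X Y _ _ _ _ f hf g
  obtain ⟨h, hh⟩ := hE.out f hf (F.subtype ∘ₗ g)
  refine ⟨ρ ∘ₗ h, fun x => ?_⟩
  apply Subtype.ext
  have : (ρ (h (f x)) : E) = ψ (C.mkQ (h (f x))) := rfl
  rw [LinearMap.comp_apply, this, hh]
  exact hψF (g x)

/-- A minimal injective cogenerator exists. -/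
theorem exists_E (K : Type u) [CommRing K] :
    ∃ (E : Type u) (_ : AddCommGroup E) (_ : Module K E), Module.Injective K E ∧
      ∀ m : Ideal K, m.IsMaximal → (∃ x : E, x ≠ 0 ∧ ∀ k ∈ m, k • x = 0) ∧
        ∀ x y : E, x ≠ 0 → (∀ k ∈ m, k • x = 0) → (∀ k ∈ m, k • y = 0) → ∃ k : K, y = k • x := by
  classical
  let S := ∀ m : MaximalSpectrum K, K ⧸ m.asIdeal
  obtain ⟨E0, _, _, i, hE0, hi⟩ := enough_inj K S
  obtain ⟨F, hF, hFi⟩ := ess_hull hE0 (LinearMap.range i)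
  refine ⟨F, inferInstance, inferInstance, hFi, ?_⟩
  intro m hm
  have hpull : ∀ x : F, x ≠ 0 → (∀ k ∈ m, k • x = 0) → ∃ a : K, (x : E0) =
      i (Pi.single (⟨m, hm⟩ : MaximalSpectrum K) (Ideal.Quotient.mk m a)) ∧ a ∉ m := by
    intro x hx hkx
    obtain ⟨k, ⟨s, hs⟩, hk0⟩ := hF.2 x x.2 (fun h => hx (Subtype.ext h))
    have hkm : k ∉ m := by
      intro h
      apply hk0
      exact congrArg Subtype.val (hkx k h)
    obtain ⟨l, hl⟩ := hm.exists_inv hkm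
    obtain ⟨n, hn, hln⟩ := hl
    have hxs : (x : E0) = i (l • s) := by
      rw [map_smul, hs, ← mul_smul]
      have : l * k = 1 - n := by rw [← hln]; ring
      rw [this, sub_smul, one_smul]
      have := congrArg Subtype.val (hkx n hn)
      simp only [Submodule.coe_smul, ZeroMemClass.coe_zero] at this
      rw [this, sub_zero]
    set t := l • s with ht
    have ht1 : ∀ k ∈ m, k • t = 0 := by
      intro k hk
      apply hi
      rw [map_smul, ← hxs, map_zero]
      exact congrArg Subtype.val (hkx k hk)
    have ht2 : ∀ m' : MaximalSpectrum K, m' ≠ ⟨m, hm⟩ → t m' = 0 := by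
      intro m' hm'
      have hne : ¬ m ≤ m'.asIdeal := by
        intro h
        apply hm'
        have := hm.eq_of_le m'.isMaximal.ne_top h
        cases m'
        simp only at this
        subst this
        rfl
      obtain ⟨k, hk, hk'⟩ := SetLike.not_le_iff_exists.1 hne
      have h1 := congrFun (ht1 k hk) m'
      obtain ⟨b, hb⟩ := Ideal.Quotient.mk_surjective (t m')
      have h2 : Ideal.Quotient.mk m'.asIdeal (k * b) = 0 := by
        rw [map_mul, hb]
        exact h1
      rw [Ideal.Quotient.eq_zero_iff_mem] at h2
      have := (m'.isMaximal.isPrime.mem_or_mem h2).resolve_left hk'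
      rw [← hb]
      exact Ideal.Quotient.eq_zero_iff_mem.2 this
    obtain ⟨a, ha⟩ := Ideal.Quotient.mk_surjective (t ⟨m, hm⟩)
    have hts : t = Pi.single (⟨m, hm⟩ : MaximalSpectrum K) (Ideal.Quotient.mk m a) := by
      funext m'
      by_cases h : m' = ⟨m, hm⟩
      · subst h
        simp [ha]
      · rw [ht2 m' h, Pi.single_eq_of_ne h]
    refine ⟨a, by rw [hxs, hts], ?_⟩
    intro ha'
    apply hx
    apply Subtype.ext
    rw [hxs, hts, Ideal.Quotient.eq_zero_iff_mem.2 ha']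
    simp
  have hsm : ∀ (k : K) (q : K ⧸ m), k • (Pi.single (⟨m, hm⟩ : MaximalSpectrum K) q : S) =
      Pi.single (⟨m, hm⟩ : MaximalSpectrum K) (k • q) := by
    intro k q
    funext m'
    by_cases h : m' = ⟨m, hm⟩
    · subst h
      simp
    · simp [Pi.single_eq_of_ne h]
  constructor
  · refine ⟨⟨i (Pi.single (⟨m, hm⟩ : MaximalSpectrum K) 1), hF.1 ⟨_, rfl⟩⟩, ?_, ?_⟩
    · intro h
      have h1 := congrArg Subtype.val h
      simp only [ZeroMemClass.coe_zero] at h1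
      have h2 : (Pi.single (⟨m, hm⟩ : MaximalSpectrum K) 1 : S) = 0 := hi (by rw [h1, map_zero])
      have h3 := congrFun h2 ⟨m, hm⟩
      rw [Pi.single_eq_same] at h3
      have : (1 : K) ∈ m := Ideal.Quotient.eq_zero_iff_mem.1 (by rw [map_one]; exact h3)
      exact hm.ne_top ((Ideal.eq_top_iff_one m).2 this)
    · intro k hk
      apply Subtype.ext
      change k • i _ = 0
      rw [← map_smul]
      have : k • (Pi.single (⟨m, hm⟩ : MaximalSpectrum K) 1 : S) = 0 := by
        rw [hsm]
        have : k • (1 : K ⧸ m) = 0 := by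
          have : k • (1 : K ⧸ m) = Ideal.Quotient.mk m (k * 1) := rfl
          rw [this, mul_one]
          exact Ideal.Quotient.eq_zero_iff_mem.2 hk
        rw [this, Pi.single_zero]
      rw [this, map_zero]
  · intro x y hx hkx hky
    by_cases hy : y = 0
    · exact ⟨0, by rw [hy, zero_smul]⟩
    obtain ⟨a, hxa, ha⟩ := hpull x hx hkx
    obtain ⟨b, hyb, hb⟩ := hpull y hy hky
    obtain ⟨l, n, hn, hl⟩ := hm.exists_inv ha
    refine ⟨b * l, ?_⟩
    apply Subtype.ext
    rw [Submodule.coe_smul, hxa, hyb, ← map_smul, hsm]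
    congr 2
    have h1 : (b * l) • (Ideal.Quotient.mk m a) = Ideal.Quotient.mk m ((b * l) * a) := rfl
    rw [h1]
    symm
    rw [Ideal.Quotient.mk_eq_mk_iff_sub_mem]
    have : b * l * a - b = - (b * n) := by
      have : l * a = 1 - n := by rw [← hl]; ring
      rw [mul_assoc, this]; ring
    rw [this]
    exact m.neg_mem (m.mul_mem_left b hn)

end
end CF

namespace CF
section
set_option linter.unusedSectionVars false

/-- Module structure over the base ring. -/
instance (priority := 50) kmod {K R : Type u} [CommRing K] [Ring R] [Algebra K R] (X : ModA R) :
    Module K X.M := Module.compHom X.M (algebraMap K R)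

theorem kmod_def {K R : Type u} [CommRing K] [Ring R] [Algebra K R] (X : ModA R) (k : K) (x : X.M) :
    k • x = algebraMap K R k • x := rfl

instance kmod_tower {K R : Type u} [CommRing K] [Ring R] [Algebra K R] (X : ModA R) :
    IsScalarTower K R X.M := ⟨fun k r x => by
  rw [kmod_def, Algebra.smul_def, mul_smul]⟩

/-- Injective cogenerator. -/
def EK (K : Type u) [CommRing K] : Type u := (exists_E K).choose

noncomputable instance (K : Type u) [CommRing K] : AddCommGroup (EK K) :=
  (exists_E K).choose_spec.choose

noncomputable instance (K : Type u) [CommRing K] : Module K (EK K) :=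
  (exists_E K).choose_spec.choose_spec.choose

theorem EK_spec (K : Type u) [CommRing K] : Module.Injective K (EK K) ∧
      ∀ m : Ideal K, m.IsMaximal → (∃ x : EK K, x ≠ 0 ∧ ∀ k ∈ m, k • x = 0) ∧
        ∀ x y : EK K, x ≠ 0 → (∀ k ∈ m, k • x = 0) → (∀ k ∈ m, k • y = 0) → ∃ k : K, y = k • x :=
  (exists_E K).choose_spec.choose_spec.choose_spec

theorem EK_inj {K : Type u} [CommRing K] {V W : Type u} [AddCommGroup V] [AddCommGroup W]
    [Module K V] [Module K W] (f : V →ₗ[K] W) (hf : Function.Injective f) (g : V →ₗ[K] EK K) :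
    ∃ h : W →ₗ[K] EK K, ∀ x, h (f x) = g x := (EK_spec K).1.out f hf g

theorem dual_simple {K : Type u} [CommRing K] {V : Type u} [AddCommGroup V] [Module K V]
    [hV : IsSimpleModule K V] : IsSimpleModule K (V →ₗ[K] EK K) := by
  obtain ⟨m, hm, ⟨e⟩⟩ := isSimpleModule_iff_quot_maximal.1 hV
  obtain ⟨⟨x, hx0, hx⟩, huniq⟩ := (EK_spec K).2 m hm
  have hgen : ∀ v : V, ∃ k : K, v = k • e.symm (Ideal.Quotient.mk m 1) := by
    intro v
    obtain ⟨k, hk⟩ := Ideal.Quotient.mk_surjective (e v)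
    refine ⟨k, ?_⟩
    apply e.injective
    rw [map_smul, e.apply_symm_apply, ← hk]
    change _ = Ideal.Quotient.mk m (k * 1)
    rw [mul_one]
  have hann : ∀ (u : V →ₗ[K] EK K), ∀ k ∈ m, k • u (e.symm (Ideal.Quotient.mk m 1)) = 0 := by
    intro u k hk
    rw [← map_smul, ← map_smul]
    have : k • (Ideal.Quotient.mk m 1) = 0 := by
      change Ideal.Quotient.mk m (k * 1) = 0
      rw [mul_one]
      exact Ideal.Quotient.eq_zero_iff_mem.2 hk
    rw [this, map_zero, map_zero]
  rw [isSimpleModule_iff_toSpanSingleton_surjective]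
  constructor
  · let φ : (K ⧸ m) →ₗ[K] EK K := Submodule.liftQ m (LinearMap.toSpanSingleton K _ x) (by
      intro k hk; simpa using hx k hk)
    refine ⟨φ ∘ₗ e.toLinearMap, 0, ?_⟩
    intro h
    have h1 := LinearMap.congr_fun h (e.symm (Ideal.Quotient.mk m 1))
    simp only [LinearMap.comp_apply, LinearEquiv.coe_coe, LinearEquiv.apply_symm_apply,
      LinearMap.zero_apply] at h1
    apply hx0
    have h2 : φ (Ideal.Quotient.mk m 1) = (1 : K) • x := rfl
    rw [← one_smul K x, ← h2, h1]
  · intro u hu v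
    have hu1 : u (e.symm (Ideal.Quotient.mk m 1)) ≠ 0 := by
      intro h
      apply hu
      ext w
      obtain ⟨k, rfl⟩ := hgen w
      rw [map_smul, h, smul_zero, LinearMap.zero_apply]
    obtain ⟨k, hk⟩ := huniq _ _ hu1 (hann u) (hann v)
    refine ⟨k, ?_⟩
    ext w
    obtain ⟨l, rfl⟩ := hgen w
    simp only [LinearMap.toSpanSingleton_apply, LinearMap.smul_apply, map_smul, hk]

theorem dual_length {K : Type u} [CommRing K] {V : Type u} [AddCommGroup V] [Module K V]
    (h : IsFiniteLength K V) : Module.length K (V →ₗ[K] EK K) = Module.length K V := by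
  induction h with
  | @of_subsingleton M _ _ hs =>
    have h1 : Module.length K M = 0 := Module.length_eq_zero_iff.2 hs
    rw [h1, Module.length_eq_zero_iff]
    infer_instance
  | @of_simple_quotient M _ _ N hS hN ih =>
    rw [Module.length_eq_add_of_exact N.subtype N.mkQ N.injective_subtype N.mkQ_surjective
      (LinearMap.exact_subtype_mkQ N)]
    rw [Module.length_eq_add_of_exact (LinearMap.lcomp K (EK K) N.mkQ)
      (LinearMap.lcomp K (EK K) N.subtype)
      (LinearMap.lcomp_injective_of_surjective _ N.mkQ_surjective) ?_ ?_, ih]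
    · have := dual_simple (K := K) (V := M ⧸ N)
      rw [Module.length_eq_one K (M ⧸ N), Module.length_eq_one K ((M ⧸ N) →ₗ[K] EK K), add_comm]
    · intro g
      obtain ⟨h, hh⟩ := EK_inj N.subtype N.injective_subtype g
      exact ⟨h, LinearMap.ext hh⟩
    · intro g
      constructor
      · intro hg
        refine ⟨N.liftQ g ?_, ?_⟩
        · intro x hx
          exact LinearMap.congr_fun hg ⟨x, hx⟩
        · ext x; rfl
      · rintro ⟨g, rfl⟩
        ext x
        have : (Submodule.Quotient.mk (x : M) : M ⧸ N) = 0 :=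
          (Submodule.Quotient.mk_eq_zero N).2 x.2
        simp [this]

theorem dual_cogen {K : Type u} [CommRing K] {V : Type u} [AddCommGroup V] [Module K V]
    [IsNoetherian K V] [IsArtinian K V] (x : V) (hx : x ≠ 0) : ∃ u : V →ₗ[K] EK K, u x ≠ 0 := by
  let W := Submodule.span K {x}
  have hW : Nontrivial W := ⟨⟨x, Submodule.mem_span_singleton_self x⟩, 0, fun h =>
    hx (congrArg Subtype.val h)⟩
  have hl := dual_length (K := K) (V := W)
    (isFiniteLength_iff_isNoetherian_isArtinian.2 ⟨inferInstance, inferInstance⟩)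
  have : Nontrivial (W →ₗ[K] EK K) := by
    rw [← not_subsingleton_iff_nontrivial, ← Module.length_eq_zero_iff (R := K), hl,
      Module.length_eq_zero_iff, not_subsingleton_iff_nontrivial]
    exact hW
  obtain ⟨u, hu⟩ := exists_ne (0 : W →ₗ[K] EK K)
  obtain ⟨v, hv⟩ := EK_inj W.subtype W.injective_subtype u
  refine ⟨v, fun h => hu ?_⟩
  ext ⟨w, hw⟩
  obtain ⟨k, rfl⟩ := Submodule.mem_span_singleton.1 hw
  rw [← hv, LinearMap.zero_apply]
  simp [h]

theorem bij_of_length {K : Type u} [Ring K] {V W : Type u} [AddCommGroup V] [Module K V]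
    [AddCommGroup W] [Module K W] (f : V →ₗ[K] W) (hf : Function.Injective f)
    (hl : Module.length K V = Module.length K W) [IsNoetherian K W] [IsArtinian K W] :
    Function.Bijective f := by
  refine ⟨hf, ?_⟩
  rw [← LinearMap.range_eq_top]
  by_contra h
  have h1 := Submodule.length_lt h
  rw [← (LinearEquiv.ofInjective f hf).length_eq, hl] at h1
  exact lt_irrefl _ h1

/-- Length as an integer. -/
noncomputable def ln (K V : Type u) [CommRing K] [AddCommGroup V] [Module K V] : ℤ :=
  ((Module.length K V).toNat : ℤ)

section
variable {K : Type u} [CommRing K] {V W U : Type u} [AddCommGroup V] [Module K V]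
    [AddCommGroup W] [Module K W] [AddCommGroup U] [Module K U]

theorem ln_equiv (e : V ≃ₗ[K] W) : ln K V = ln K W := by
  unfold ln; rw [e.length_eq]

theorem length_ne_top [IsNoetherian K V] [IsArtinian K V] : Module.length K V ≠ ⊤ :=
  Module.length_ne_top_iff.2
    (isFiniteLength_iff_isNoetherian_isArtinian.2 ⟨inferInstance, inferInstance⟩)

theorem ln_exact [IsNoetherian K V] [IsArtinian K V] [IsNoetherian K U] [IsArtinian K U]
    (f : V →ₗ[K] W) (g : W →ₗ[K] U) (hf : Function.Injective f)
    (hg : Function.Surjective g) (h : Function.Exact f g) : ln K W = ln K V + ln K U := by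
  unfold ln
  rw [Module.length_eq_add_of_exact f g hf hg h, ENat.toNat_add length_ne_top length_ne_top]
  push_cast; rfl

theorem ln_zero (h : ∀ v : V, v = 0) : ln K V = 0 := by
  unfold ln
  have : Subsingleton V := ⟨fun a b => (h a).trans (h b).symm⟩
  rw [Module.length_eq_zero_iff.2 this]; rfl

theorem ln_pos [IsNoetherian K V] [IsArtinian K V] (v : V) (hv : v ≠ 0) : 0 < ln K V := by
  unfold ln
  have h1 : Module.length K V ≠ 0 := by
    rw [Ne, Module.length_eq_zero_iff]
    intro h
    exact hv (Subsingleton.elim _ _)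
  have h2 : (Module.length K V).toNat ≠ 0 := by
    rw [Ne, ENat.toNat_eq_zero]
    rintro (h | h)
    · exact h1 h
    · exact length_ne_top h
  omega

theorem ln_nonneg : 0 ≤ ln K V := by unfold ln; positivity

theorem ln_pi {n : ℕ} (F : Fin n → Type u) [∀ k, AddCommGroup (F k)] [∀ k, Module K (F k)]
    [∀ k, IsNoetherian K (F k)] [∀ k, IsArtinian K (F k)] : ln K (∀ k, F k) = ∑ k, ln K (F k) := by
  unfold ln
  rw [Module.length_pi_of_fintype, ENat.toNat_sum (fun k _ => length_ne_top)]
  push_cast; rfl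

end

section hom
variable {K R : Type u} [CommRing K] [IsArtinianRing K] [Ring R] [Algebra K R] [Module.Finite K R]

instance kfin (X : ModA R) : Module.Finite K X.M := Module.Finite.trans R X.M

theorem hom_emb (X : ModA R) (Y : Type u) [AddCommGroup Y] [Module R Y] [Module K Y]
    [IsScalarTower K R Y] : ∃ (n : ℕ) (j : (X.M →ₗ[R] Y) →ₗ[K] (Fin n → Y)),
      Function.Injective j := by
  obtain ⟨n, s, hs⟩ := Module.Finite.exists_fin (R := R) (M := X.M)
  refine ⟨n, ⟨⟨fun f k => f (s k), fun f g => rfl⟩, fun k f => rfl⟩, ?_⟩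
  intro f g hfg
  exact LinearMap.ext_on_range hs (fun k => congrFun hfg k)

instance homNoeth (X Y : ModA R) : IsNoetherian K (X.M →ₗ[R] Y.M) := by
  obtain ⟨n, j, hj⟩ := hom_emb (K := K) X Y.M
  exact isNoetherian_of_injective j hj

instance homArt (X Y : ModA R) : IsArtinian K (X.M →ₗ[R] Y.M) := by
  obtain ⟨n, j, hj⟩ := hom_emb (K := K) X Y.M
  exact isArtinian_of_injective j hj

theorem modA_of_K (K : Type u) {R : Type u} [CommRing K] [IsArtinianRing K] [Ring R] [Algebra K R]
    [Module.Finite K R] (M : Type u) [AddCommGroup M] [Module R M] [Module.Finite R M] :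
    IsFiniteLength R M := by
  have : IsArtinianRing R := IsArtinianRing.of_finite K R
  exact isFiniteLength_iff_isNoetherian_isArtinian.2 ⟨inferInstance, inferInstance⟩

end hom
end
end CF

namespace CF
section
set_option linter.unusedSectionVars false

/-- Mutually inverse anti-isomorphisms of algebras. -/
structure Anti (K R S : Type u) [CommRing K] [Ring R] [Ring S] [Algebra K R] [Algebra K S] where
  f : R → S
  g : S → R
  fg : ∀ s, f (g s) = s
  gf : ∀ r, g (f r) = r
  f_add : ∀ a b, f (a + b) = f a + f b
  g_add : ∀ a b, g (a + b) = g a + g b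
  f_mul : ∀ a b, f (a * b) = f b * f a
  g_mul : ∀ a b, g (a * b) = g b * g a
  f_alg : ∀ k, f (algebraMap K R k) = algebraMap K S k
  g_alg : ∀ k, g (algebraMap K S k) = algebraMap K R k

/-- Inverse. -/
def Anti.symm {K R S : Type u} [CommRing K] [Ring R] [Ring S] [Algebra K R] [Algebra K S]
    (σ : Anti K R S) : Anti K S R :=
  ⟨σ.g, σ.f, σ.gf, σ.fg, σ.g_add, σ.f_add, σ.g_mul, σ.f_mul, σ.g_alg, σ.f_alg⟩

/-- The opposite algebra. -/
def antiOp (K R : Type u) [CommRing K] [Ring R] [Algebra K R] : Anti K R Rᵐᵒᵖ :=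
  ⟨MulOpposite.op, MulOpposite.unop, fun _ => rfl, fun _ => rfl, fun _ _ => rfl, fun _ _ => rfl,
    fun _ _ => rfl, fun _ _ => rfl, fun _ => rfl, fun _ => rfl⟩

variable {K R S : Type u} [CommRing K] [IsArtinianRing K] [Ring R] [Algebra K R] [Module.Finite K R]
  [Ring S] [Algebra K S] [Module.Finite K S]

theorem Anti.g_one (σ : Anti K R S) : σ.g 1 = 1 := by
  have := σ.g_alg 1; simpa using this

theorem Anti.g_zero (σ : Anti K R S) : σ.g 0 = 0 := by
  have := σ.g_alg 0; simpa using this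

/-- The module structure on the dual. -/
@[reducible] noncomputable def dualModule (σ : Anti K R S) (X : ModA R) : Module S (X.M →ₗ[K] EK K) where
  smul s u :=
    { toFun := fun x => u (σ.g s • x)
      map_add' := fun x y => by rw [smul_add, map_add]
      map_smul' := fun k x => by rw [smul_comm, map_smul, RingHom.id_apply] }
  one_smul u := by ext x; change u (σ.g 1 • x) = _; rw [σ.g_one, one_smul]
  mul_smul s t u := by
    ext x; change u (σ.g (s * t) • x) = u (σ.g t • σ.g s • x); rw [σ.g_mul, mul_smul]
  smul_zero s := by ext x; rfl
  smul_add s u v := by ext x; rfl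
  add_smul s t u := by
    ext x; change u (σ.g (s + t) • x) = u (σ.g s • x) + u (σ.g t • x)
    rw [σ.g_add, add_smul, map_add]
  zero_smul u := by ext x; change u (σ.g 0 • x) = 0; rw [σ.g_zero, zero_smul, map_zero]

theorem dual_noeth_art (V : Type u) [AddCommGroup V] [Module K V] [Module.Finite K V] :
    IsNoetherian K (V →ₗ[K] EK K) ∧ IsArtinian K (V →ₗ[K] EK K) := by
  have h : IsFiniteLength K V :=
    isFiniteLength_iff_isNoetherian_isArtinian.2 ⟨inferInstance, inferInstance⟩
  rw [← isFiniteLength_iff_isNoetherian_isArtinian, ← Module.length_ne_top_iff, dual_length h]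
  exact Module.length_ne_top_iff.2 h

/-- The duality. -/
noncomputable def D (σ : Anti K R S) (X : ModA R) : ModA S :=
  letI := dualModule σ X
  ⟨X.M →ₗ[K] EK K, by
    have : IsScalarTower K S (X.M →ₗ[K] EK K) := ⟨fun k s u => by
      ext x
      change u (σ.g (k • s) • x) = k • u (σ.g s • x)
      rw [Algebra.smul_def, σ.g_mul, σ.g_alg, mul_smul, ← map_smul, kmod_def, ← mul_smul,
        ← mul_smul, Algebra.commutes]⟩
    have h := dual_noeth_art (K := K) X.M
    have h1 := h.1
    have h2 := h.2
    exact isFiniteLength_iff_isNoetherian_isArtinian.2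
      ⟨isNoetherian_of_tower K h1, isArtinian_of_tower K h2⟩⟩

/-- Evaluation. -/
noncomputable def Dap (σ : Anti K R S) {X : ModA R} (u : (D σ X).M) : X.M →ₗ[K] EK K := u

theorem Dap_ext (σ : Anti K R S) {X : ModA R} {u v : (D σ X).M}
    (h : ∀ x, Dap σ u x = Dap σ v x) : u = v := LinearMap.ext (f := Dap σ u) (g := Dap σ v) h

theorem Dap_smul (σ : Anti K R S) {X : ModA R} (s : S) (u : (D σ X).M) (x : X.M) :
    Dap σ (s • u) x = Dap σ u (σ.g s • x) := rfl

theorem Dap_add (σ : Anti K R S) {X : ModA R} (u v : (D σ X).M) (x : X.M) :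
    Dap σ (u + v) x = Dap σ u x + Dap σ v x := rfl

theorem Dap_zero (σ : Anti K R S) {X : ModA R} (x : X.M) :
    Dap σ (0 : (D σ X).M) x = 0 := rfl

theorem Dap_ksmul (σ : Anti K R S) {X : ModA R} (k : K) (u : (D σ X).M) (x : X.M) :
    Dap σ (k • u) x = k • Dap σ u x := by
  rw [kmod_def, Dap_smul, σ.g_alg, ← kmod_def, map_smul]

/-- Identification with the `K`-dual. -/
noncomputable def DeqK (σ : Anti K R S) (X : ModA R) : (D σ X).M ≃ₗ[K] (X.M →ₗ[K] EK K) where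
  toFun u := Dap σ u
  invFun u := u
  map_add' _ _ := rfl
  map_smul' k u := by ext x; exact Dap_ksmul σ k u x
  left_inv _ := rfl
  right_inv _ := rfl

theorem Dsurj (σ : Anti K R S) (X : ModA R) (w : X.M →ₗ[K] EK K) : ∃ u : (D σ X).M, Dap σ u = w :=
  ⟨w, rfl⟩

/-- Duality on maps. -/
noncomputable def Dm (σ : Anti K R S) {X Y : ModA R} (f : X.M →ₗ[R] Y.M) :
    (D σ Y).M →ₗ[S] (D σ X).M where
  toFun u := (Dap σ u ∘ₗ (f.restrictScalars K) : X.M →ₗ[K] EK K)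
  map_add' u v := rfl
  map_smul' s u := by
    apply Dap_ext
    intro x
    change Dap σ u (σ.g s • f x) = Dap σ u (f (σ.g s • x))
    rw [map_smul f]

theorem Dm_ap (σ : Anti K R S) {X Y : ModA R} (f : X.M →ₗ[R] Y.M) (u : (D σ Y).M) (x : X.M) :
    Dap σ (Dm σ f u) x = Dap σ u (f x) := rfl

theorem Dm_comp (σ : Anti K R S) {X Y Z : ModA R} (f : X.M →ₗ[R] Y.M) (g : Y.M →ₗ[R] Z.M) :
    Dm σ (g ∘ₗ f) = Dm σ f ∘ₗ Dm σ g := rfl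

theorem Dm_id (σ : Anti K R S) (X : ModA R) :
    Dm σ (LinearMap.id : X.M →ₗ[R] X.M) = LinearMap.id := rfl

/-- Evaluation map. -/
noncomputable def eta0 (σ : Anti K R S) (X : ModA R) : X.M →ₗ[R] (D σ.symm (D σ X)).M where
  toFun x :=
    ({ toFun := fun u => Dap σ u x
       map_add' := fun u v => rfl
       map_smul' := fun k u => Dap_ksmul σ k u x } : (D σ X).M →ₗ[K] EK K)
  map_add' x y := by
    apply Dap_ext
    intro u
    exact map_add (Dap σ u) x y
  map_smul' r x := by
    apply Dap_ext
    intro u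
    change Dap σ u (r • x) = Dap σ (σ.f r • u) x
    rw [Dap_smul, σ.gf]

theorem eta0_ap (σ : Anti K R S) (X : ModA R) (x : X.M) (u : (D σ X).M) :
    Dap σ.symm (eta0 σ X x) u = Dap σ u x := rfl

theorem klen (X : ModA R) : IsFiniteLength K X.M :=
  isFiniteLength_iff_isNoetherian_isArtinian.2 ⟨inferInstance, inferInstance⟩

theorem D_length (σ : Anti K R S) (X : ModA R) :
    Module.length K (D σ X).M = Module.length K X.M := by
  rw [(DeqK σ X).length_eq, dual_length (klen X)]

theorem eta0_bij (σ : Anti K R S) (X : ModA R) : Function.Bijective (eta0 σ X) := by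
  have := bij_of_length (K := K) ((eta0 σ X).restrictScalars K) ?_ ?_
  · exact this
  · rw [injective_iff_map_eq_zero]
    intro x hx
    by_contra hx0
    obtain ⟨u, hu⟩ := dual_cogen (K := K) x hx0
    have h := congrArg (fun t => Dap σ.symm t ((DeqK σ X).symm u)) hx
    exact hu h
  · rw [D_length, D_length]

/-- Evaluation isomorphism. -/
noncomputable def eta (σ : Anti K R S) (X : ModA R) : X.M ≃ₗ[R] (D σ.symm (D σ X)).M :=
  LinearEquiv.ofBijective (eta0 σ X) (eta0_bij σ X)

theorem eta_ap (σ : Anti K R S) (X : ModA R) (x : X.M) (u : (D σ X).M) :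
    Dap σ.symm (eta σ X x) u = Dap σ u x := rfl

theorem eta_nat (σ : Anti K R S) {X Y : ModA R} (f : X.M →ₗ[R] Y.M) (x : X.M) :
    Dm σ.symm (Dm σ f) (eta σ X x) = eta σ Y (f x) := rfl

theorem Dm_inj (σ : Anti K R S) {X Y : ModA R} {f g : X.M →ₗ[R] Y.M} (h : Dm σ f = Dm σ g) :
    f = g := by
  ext x
  apply (eta σ Y).injective
  rw [← eta_nat, ← eta_nat, h]

theorem Dm_surj (σ : Anti K R S) {X Y : ModA R} (g : (D σ Y).M →ₗ[S] (D σ X).M) :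
    ∃ f : X.M →ₗ[R] Y.M, Dm σ f = g := by
  refine ⟨(eta σ Y).symm.toLinearMap ∘ₗ Dm σ.symm g ∘ₗ (eta σ X).toLinearMap, ?_⟩
  ext u
  apply Dap_ext
  intro x
  rw [Dm_ap, ← eta_ap]
  simp only [LinearMap.comp_apply, LinearEquiv.coe_coe, LinearEquiv.apply_symm_apply]
  rfl

theorem Dm_add (σ : Anti K R S) {X Y : ModA R} (f g : X.M →ₗ[R] Y.M) :
    Dm σ (f + g) = Dm σ f + Dm σ g := by
  ext u
  apply Dap_ext
  intro x
  exact map_add (Dap σ u) (f x) (g x)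

theorem Dm_zero (σ : Anti K R S) {X Y : ModA R} : Dm σ (0 : X.M →ₗ[R] Y.M) = 0 := by
  ext u
  apply Dap_ext
  intro x
  exact map_zero (Dap σ u)

theorem Dm_ksmul (σ : Anti K R S) {X Y : ModA R} (k : K) (f : X.M →ₗ[R] Y.M) :
    Dm σ (k • f) = k • Dm σ f := by
  ext u
  apply Dap_ext
  intro x
  rw [LinearMap.smul_apply, Dap_ksmul]
  exact map_smul (Dap σ u) k (f x)

/-- Duality on Hom spaces. -/
noncomputable def DmEquiv (σ : Anti K R S) (X Y : ModA R) :
    (X.M →ₗ[R] Y.M) ≃ₗ[K] ((D σ Y).M →ₗ[S] (D σ X).M) :=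
  LinearEquiv.ofBijective
    { toFun := fun f => Dm σ f
      map_add' := Dm_add σ
      map_smul' := Dm_ksmul σ } ⟨fun _ _ h => Dm_inj σ h, fun g => Dm_surj σ g⟩

theorem DmEquiv_apply (σ : Anti K R S) {X Y : ModA R} (f : X.M →ₗ[R] Y.M) :
    DmEquiv σ X Y f = Dm σ f := rfl

theorem Dm_sum (σ : Anti K R S) {X Y : ModA R} {ι : Type*} (s : Finset ι) (f : ι → X.M →ₗ[R] Y.M) :
    Dm σ (∑ k ∈ s, f k) = ∑ k ∈ s, Dm σ (f k) := map_sum (DmEquiv σ X Y) f s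

theorem Dm_surjective (σ : Anti K R S) {X Y : ModA R} {f : X.M →ₗ[R] Y.M}
    (hf : Function.Injective f) : Function.Surjective (Dm σ f) := by
  intro u
  obtain ⟨h, hh⟩ := EK_inj (f.restrictScalars K) hf (Dap σ u)
  exact ⟨h, Dap_ext σ hh⟩

theorem Dm_injective (σ : Anti K R S) {X Y : ModA R} {f : X.M →ₗ[R] Y.M}
    (hf : Function.Surjective f) : Function.Injective (Dm σ f) := by
  intro u v huv
  apply Dap_ext
  intro y
  obtain ⟨x, rfl⟩ := hf y
  rw [← Dm_ap, huv, Dm_ap]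

theorem Dm_bijective (σ : Anti K R S) {X Y : ModA R} {f : X.M →ₗ[R] Y.M} :
    Function.Bijective (Dm σ f) ↔ Function.Bijective f := by
  constructor
  · intro h
    have h1 := Dm_surjective σ.symm h.1
    have h2 := Dm_injective σ.symm h.2
    have h3 : (f : X.M → Y.M) = (eta σ Y).symm ∘ Dm σ.symm (Dm σ f) ∘ eta σ X := by
      funext x
      rw [Function.comp_apply, Function.comp_apply, eta_nat, LinearEquiv.symm_apply_apply]
    rw [h3]
    exact (eta σ Y).symm.bijective.comp (Function.Bijective.comp ⟨h2, h1⟩ (eta σ X).bijective)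
  · intro h
    exact ⟨Dm_injective σ h.2, Dm_surjective σ h.1⟩

theorem Dm_exact (σ : Anti K R S) {X Y Z : ModA R} {f : X.M →ₗ[R] Y.M} {g : Y.M →ₗ[R] Z.M}
    (hg : Function.Surjective g) (h : LinearMap.range f = LinearMap.ker g) :
    LinearMap.range (Dm σ g) = LinearMap.ker (Dm σ f) := by
  ext u
  constructor
  · rintro ⟨w, rfl⟩
    rw [LinearMap.mem_ker]
    apply Dap_ext
    intro x
    have : g (f x) = 0 := by
      have : f x ∈ LinearMap.ker g := by rw [← h]; exact ⟨x, rfl⟩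
      exact this
    rw [Dm_ap, Dm_ap, this, map_zero, Dap_zero]
  · intro hu
    let e := (g.restrictScalars K).quotKerEquivOfSurjective hg
    have hk : LinearMap.ker (g.restrictScalars K) ≤ LinearMap.ker (Dap σ u) := by
      intro y hy
      have : y ∈ LinearMap.range f := by rw [h]; exact hy
      obtain ⟨x, rfl⟩ := this
      exact congrArg (fun t => Dap σ t x) hu
    let w : Z.M →ₗ[K] EK K :=
      (LinearMap.ker (g.restrictScalars K)).liftQ (Dap σ u) hk ∘ₗ e.symm.toLinearMap
    refine ⟨w, Dap_ext σ fun y => ?_⟩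
    change (LinearMap.ker (g.restrictScalars K)).liftQ (Dap σ u) hk (e.symm (g y)) = _
    have : e.symm (g y) = (LinearMap.ker (g.restrictScalars K)).mkQ y := by
      rw [LinearEquiv.symm_apply_eq]; rfl
    rw [this]
    rfl

theorem D_splitMono (σ : Anti K R S) {X Y : ModA R} {f : X.M →ₗ[R] Y.M} :
    SplitMonoMap (Dm σ f) ↔ SplitEpiMap f := by
  constructor
  · rintro ⟨r, hr⟩
    obtain ⟨s, rfl⟩ := Dm_surj σ r
    refine ⟨s, Dm_inj σ ?_⟩
    rw [Dm_comp]; exact hr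
  · rintro ⟨s, hs⟩
    exact ⟨Dm σ s, by rw [← Dm_comp, hs]; rfl⟩

theorem D_splitEpi (σ : Anti K R S) {X Y : ModA R} {f : X.M →ₗ[R] Y.M} :
    SplitEpiMap (Dm σ f) ↔ SplitMonoMap f := by
  constructor
  · rintro ⟨r, hr⟩
    obtain ⟨s, rfl⟩ := Dm_surj σ r
    refine ⟨s, Dm_inj σ ?_⟩
    rw [Dm_comp]; exact hr
  · rintro ⟨s, hs⟩
    exact ⟨Dm σ s, by rw [← Dm_comp, hs]; rfl⟩

theorem D_nontrivial (σ : Anti K R S) {X : ModA R} (h : Nontrivial X.M) :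
    Nontrivial (D σ X).M := by
  rw [← not_subsingleton_iff_nontrivial, ← Module.length_eq_zero_iff (R := K), D_length,
    Module.length_eq_zero_iff, not_subsingleton_iff_nontrivial]
  exact h

theorem D_indec (σ : Anti K R S) {X : ModA R} (h : X.IsIndec) : (D σ X).IsIndec := by
  refine ⟨D_nontrivial σ h.1, fun f hf => ?_⟩
  obtain ⟨g, rfl⟩ := Dm_surj σ f
  have := h.2 g (Dm_inj σ (by
    change Dm σ (g ∘ₗ g) = _
    rw [Dm_comp]; exact hf))
  rcases this with rfl | rfl
  · left; exact Dm_zero σ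
  · right; rfl

/-- Dual of an isomorphism. -/
noncomputable def Diso (σ : Anti K R S) {X Y : ModA R} (e : X.M ≃ₗ[R] Y.M) :
    (D σ X).M ≃ₗ[S] (D σ Y).M :=
  LinearEquiv.ofBijective (Dm σ e.symm.toLinearMap) ((Dm_bijective σ).2 e.symm.bijective)

theorem D_inj_of_proj (σ : Anti K R S) {X : ModA R} (h : Module.Projective R X.M) :
    Module.Injective S (D σ X).M := by
  obtain ⟨n, F, s, hF, -, hs⟩ := Module.Finite.exists_comp_eq_id_of_projective R X.M
  refine ⟨fun M N _ _ _ _ i hi g => ?_⟩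
  let _ : Module K M := Module.compHom M (algebraMap K S)
  let _ : Module K N := Module.compHom N (algebraMap K S)
  have hkM : ∀ (k : K) (m : M), k • m = algebraMap K S k • m := fun _ _ => rfl
  have hkN : ∀ (k : K) (m : N), k • m = algebraMap K S k • m := fun _ _ => rfl
  let iK : M →ₗ[K] N := { toFun := i, map_add' := map_add i, map_smul' := fun k m => map_smul i _ m }
  have hγ : ∀ j : Fin n, ∃ γ : N →ₗ[K] EK K, ∀ m, γ (i m) = Dap σ (g m) (F (Pi.single j 1)) := by
    intro j
    obtain ⟨γ, hγ⟩ := EK_inj iK hi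
      { toFun := fun m => Dap σ (g m) (F (Pi.single j 1))
        map_add' := fun a b => by rw [map_add]; rfl
        map_smul' := fun k m => by
          rw [hkM, map_smul, ← kmod_def, Dap_ksmul]; rfl }
    exact ⟨γ, hγ⟩
  choose γ hγ using hγ
  have hkk : ∀ (k : K) (a : R), σ.f (k • a) = algebraMap K S k * σ.f a := by
    intro k a
    rw [Algebra.smul_def, σ.f_mul, σ.f_alg, Algebra.commutes]
  have ex : ∀ x : X.M, x = ∑ j, s x j • F (Pi.single j 1) := by
    intro x
    have h1 : x = F (s x) := (LinearMap.congr_fun hs x).symm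
    conv_lhs => rw [h1, pi_eq_sum_univ' (s x), map_sum]
    refine Finset.sum_congr rfl fun j _ => ?_
    rw [map_smul]
  refine ⟨{ toFun := fun y => ({ toFun := fun x => ∑ j, γ j (σ.f (s x j) • y)
                                 map_add' := ?_
                                 map_smul' := ?_ } : X.M →ₗ[K] EK K)
            map_add' := ?_
            map_smul' := ?_ }, ?_⟩
  · intro a b
    rw [← Finset.sum_add_distrib]
    refine Finset.sum_congr rfl fun j _ => ?_
    rw [map_add, Pi.add_apply, σ.f_add, add_smul, map_add]
  · intro k x
    rw [RingHom.id_apply, Finset.smul_sum]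
    refine Finset.sum_congr rfl fun j _ => ?_
    have h1 : s (k • x) = k • s x := LinearMap.map_smul_of_tower s k x
    rw [← map_smul (γ j), hkN, ← mul_smul, ← hkk, h1, Pi.smul_apply]
  · intro a b
    apply Dap_ext
    intro x
    change ∑ j, γ j (σ.f (s x j) • (a + b)) = ∑ j, γ j (σ.f (s x j) • a) + ∑ j, γ j (σ.f (s x j) • b)
    rw [← Finset.sum_add_distrib]
    refine Finset.sum_congr rfl fun j _ => ?_
    rw [smul_add, map_add]
  · intro t y
    apply Dap_ext
    intro x
    change ∑ j, γ j (σ.f (s x j) • (t • y)) = ∑ j, γ j (σ.f (s (σ.g t • x) j) • y)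
    refine Finset.sum_congr rfl fun j _ => ?_
    rw [map_smul s, Pi.smul_apply, smul_eq_mul, σ.f_mul, σ.fg, mul_smul]
  · intro m
    apply Dap_ext
    intro x
    change ∑ j, γ j (σ.f (s x j) • (i m)) = _
    conv_rhs => rw [ex x, map_sum]
    refine Finset.sum_congr rfl fun j _ => ?_
    rw [← map_smul i, hγ, map_smul g, Dap_smul, σ.gf]

theorem exists_free_cover (K : Type u) {R : Type u} [CommRing K] [IsArtinianRing K] [Ring R]
    [Algebra K R] [Module.Finite K R] (X : ModA R) : ∃ (P : ModA R) (g : P.M →ₗ[R] X.M),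
    Module.Projective R P.M ∧ Function.Surjective g := by
  obtain ⟨n, g, hg⟩ := Module.Finite.exists_fin' R X.M
  exact ⟨⟨Fin n → R, modA_of_K K (Fin n → R)⟩, g, inferInstanceAs (Module.Projective R (Fin n → R)), hg⟩

theorem injective_equiv {X Y : ModA R} (e : X.M ≃ₗ[R] Y.M) (h : Module.Injective R X.M) :
    Module.Injective R Y.M := by
  refine ⟨fun M N _ _ _ _ i hi g => ?_⟩
  obtain ⟨t, ht⟩ := h.out i hi (e.symm.toLinearMap ∘ₗ g)
  exact ⟨e.toLinearMap ∘ₗ t, fun x => by simp [ht]⟩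

theorem injective_split {X Y : ModA R} (h : Module.Injective R X.M) {f : X.M →ₗ[R] Y.M}
    (hf : Function.Injective f) : SplitMonoMap f := by
  obtain ⟨t, ht⟩ := h.out f hf LinearMap.id
  exact ⟨t, LinearMap.ext ht⟩

theorem projective_split {X Y : ModA R} (h : Module.Projective R Y.M) {f : X.M →ₗ[R] Y.M}
    (hf : Function.Surjective f) : SplitEpiMap f :=
  Module.projective_lifting_property f LinearMap.id hf

theorem proj_of_D_inj (σ : Anti K R S) {X : ModA R} (h : Module.Injective S (D σ X).M) :
    Module.Projective R X.M := by
  obtain ⟨P, g, hP, hg⟩ := exists_free_cover K X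
  obtain ⟨s, hs⟩ := (D_splitMono σ).1 (injective_split h (Dm_injective σ hg))
  exact Module.Projective.of_split s g hs

theorem inj_of_D_proj (σ : Anti K R S) {X : ModA R} (h : Module.Projective S (D σ X).M) :
    Module.Injective R X.M :=
  injective_equiv (eta σ X).symm (D_inj_of_proj σ.symm h)

theorem D_proj_of_inj (σ : Anti K R S) {X : ModA R} (h : Module.Injective R X.M) :
    Module.Projective S (D σ X).M :=
  proj_of_D_inj σ.symm (injective_equiv (eta σ X) h)

theorem exists_inj_emb (K : Type u) {R : Type u} [CommRing K] [IsArtinianRing K] [Ring R]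
    [Algebra K R] [Module.Finite K R] (X : ModA R) : ∃ (I : ModA R) (g : X.M →ₗ[R] I.M),
    Module.Injective R I.M ∧ Function.Injective g := by
  have : Module.Finite K Rᵐᵒᵖ := Module.Finite.equiv (MulOpposite.opLinearEquiv K)
  obtain ⟨P, g, hP, hg⟩ := exists_free_cover K (D (antiOp K R) X)
  refine ⟨D (antiOp K R).symm P, Dm (antiOp K R).symm g ∘ₗ (eta (antiOp K R) X).toLinearMap,
    D_inj_of_proj _ hP, ?_⟩
  exact (Dm_injective (antiOp K R).symm hg).comp (eta (antiOp K R) X).injective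

end
end CF

namespace CF
section
set_option linter.unusedSectionVars false

variable {K R : Type u} [CommRing K] [IsArtinianRing K] [Ring R] [Algebra K R] [Module.Finite K R]

/-- Short exact sequence. -/
structure Sh {R : Type u} [Ring R] {X Y Z : ModA R} (f : X.M →ₗ[R] Y.M) (g : Y.M →ₗ[R] Z.M) : Prop where
  inj : Function.Injective f
  surj : Function.Surjective g
  ex : LinearMap.range f = LinearMap.ker g

theorem Sh.zero {R : Type u} [Ring R] {X Y Z : ModA R} {f : X.M →ₗ[R] Y.M} {g : Y.M →ₗ[R] Z.M}
    (h : Sh f g) : g ∘ₗ f = 0 := by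
  ext x
  have : f x ∈ LinearMap.ker g := by rw [← h.ex]; exact ⟨x, rfl⟩
  exact this

theorem Sh.split_iff {R : Type u} [Ring R] {X Y Z : ModA R} {f : X.M →ₗ[R] Y.M} {g : Y.M →ₗ[R] Z.M}
    (h : Sh f g) : SplitMonoMap f ↔ SplitEpiMap g := by
  have he : Function.Exact f g := LinearMap.exact_iff.2 h.ex.symm
  exact (he.split_tfae h.inj h.surj).out 1 0

theorem factor_surj {R : Type u} [Ring R] {Y Z W : Type u} [AddCommGroup Y] [AddCommGroup Z]
    [AddCommGroup W] [Module R Y] [Module R Z] [Module R W] {g : Y →ₗ[R] Z}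
    (hg : Function.Surjective g) (t : Y →ₗ[R] W) (h : LinearMap.ker g ≤ LinearMap.ker t) :
    ∃ t' : Z →ₗ[R] W, t' ∘ₗ g = t := by
  let e := g.quotKerEquivOfSurjective hg
  refine ⟨(LinearMap.ker g).liftQ t h ∘ₗ e.symm.toLinearMap, ?_⟩
  ext y
  have : e.symm (g y) = (LinearMap.ker g).mkQ y := by
    rw [LinearEquiv.symm_apply_eq]; rfl
  simp only [LinearMap.comp_apply, LinearEquiv.coe_coe, this]
  rfl

theorem factor_inj {R : Type u} [Ring R] {Y Z W : Type u} [AddCommGroup Y] [AddCommGroup Z]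
    [AddCommGroup W] [Module R Y] [Module R Z] [Module R W] {f : Y →ₗ[R] Z}
    (hf : Function.Injective f) (t : W →ₗ[R] Z) (h : LinearMap.range t ≤ LinearMap.range f) :
    ∃ t' : W →ₗ[R] Y, f ∘ₗ t' = t := by
  let e := LinearEquiv.ofInjective f hf
  refine ⟨e.symm.toLinearMap ∘ₗ t.codRestrict (LinearMap.range f) (fun w => h ⟨w, rfl⟩), ?_⟩
  ext w
  have := e.apply_symm_apply (t.codRestrict (LinearMap.range f) (fun w => h ⟨w, rfl⟩) w)
  exact congrArg Subtype.val this

theorem Sh.factor_right {R : Type u} [Ring R] {X Y Z W : ModA R} {f : X.M →ₗ[R] Y.M}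
    {g : Y.M →ₗ[R] Z.M} (h : Sh f g) (t : Y.M →ₗ[R] W.M) (ht : t ∘ₗ f = 0) :
    ∃ t' : Z.M →ₗ[R] W.M, t' ∘ₗ g = t := by
  refine factor_surj h.surj t ?_
  rw [← h.ex]
  rintro _ ⟨x, rfl⟩
  exact LinearMap.congr_fun ht x

theorem Sh.factor_left {R : Type u} [Ring R] {X Y Z W : ModA R} {f : X.M →ₗ[R] Y.M}
    {g : Y.M →ₗ[R] Z.M} (h : Sh f g) (t : W.M →ₗ[R] Y.M) (ht : g ∘ₗ t = 0) :
    ∃ t' : W.M →ₗ[R] X.M, f ∘ₗ t' = t := by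
  refine factor_inj h.inj t ?_
  rw [h.ex]
  rintro _ ⟨x, rfl⟩
  exact LinearMap.congr_fun ht x

/-- submodule as an object -/
abbrev sub {R : Type u} [Ring R] (X : ModA R) (N : Submodule R X.M) : ModA R :=
  ⟨N, isFiniteLength_iff_isNoetherian_isArtinian.2 ⟨inferInstance, inferInstance⟩⟩

/-- quotient as an object -/
abbrev quo {R : Type u} [Ring R] (X : ModA R) (N : Submodule R X.M) : ModA R :=
  ⟨X.M ⧸ N, isFiniteLength_iff_isNoetherian_isArtinian.2 ⟨inferInstance, inferInstance⟩⟩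

/-- inclusion -/
def sub.ι {R : Type u} [Ring R] (X : ModA R) (N : Submodule R X.M) : (sub X N).M →ₗ[R] X.M := N.subtype

/-- projection -/
def quo.π {R : Type u} [Ring R] (X : ModA R) (N : Submodule R X.M) : X.M →ₗ[R] (quo X N).M := N.mkQ

theorem sub_inj {R : Type u} [Ring R] (X : ModA R) (N : Submodule R X.M) :
    Function.Injective (sub.ι X N) := N.subtype_injective

theorem quo_surj {R : Type u} [Ring R] (X : ModA R) (N : Submodule R X.M) :
    Function.Surjective (quo.π X N) := N.mkQ_surjective

theorem sub_quo {R : Type u} [Ring R] (X : ModA R) (N : Submodule R X.M) :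
    Sh (sub.ι X N) (quo.π X N) :=
  ⟨sub_inj X N, quo_surj X N, by
    change LinearMap.range N.subtype = LinearMap.ker N.mkQ
    rw [Submodule.range_subtype, Submodule.ker_mkQ]⟩

theorem sub_ker {R : Type u} [Ring R] {X Y : ModA R} (g : X.M →ₗ[R] Y.M) (hg : Function.Surjective g) :
    Sh (sub.ι X (LinearMap.ker g)) g :=
  ⟨sub_inj X _, hg, by
    change LinearMap.range (LinearMap.ker g).subtype = _
    rw [Submodule.range_subtype]⟩

theorem quo_range {R : Type u} [Ring R] {X Y : ModA R} (f : X.M →ₗ[R] Y.M) (hf : Function.Injective f) :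
    Sh f (quo.π Y (LinearMap.range f)) :=
  ⟨hf, quo_surj Y _, by
    change _ = LinearMap.ker (LinearMap.range f).mkQ
    rw [Submodule.ker_mkQ]⟩

/-- product -/
abbrev prd {R : Type u} [Ring R] (X Y : ModA R) : ModA R :=
  ⟨X.M × Y.M, isFiniteLength_iff_isNoetherian_isArtinian.2 ⟨inferInstance, inferInstance⟩⟩

/-- Pushout along `t` of a short exact sequence. -/
theorem pushout {R : Type u} [Ring R] {X Y Z W : ModA R} {f : X.M →ₗ[R] Y.M}
    {g : Y.M →ₗ[R] Z.M} (h : Sh f g) (t : X.M →ₗ[R] W.M) :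
    ∃ (E : ModA R) (i : W.M →ₗ[R] E.M) (j : Y.M →ₗ[R] E.M) (q : E.M →ₗ[R] Z.M),
      Sh i q ∧ i ∘ₗ t = j ∘ₗ f ∧ q ∘ₗ j = g ∧
      ∀ (V : ModA R) (a : W.M →ₗ[R] V.M) (b : Y.M →ₗ[R] V.M), a ∘ₗ t = b ∘ₗ f →
        ∃ c : E.M →ₗ[R] V.M, c ∘ₗ i = a ∧ c ∘ₗ j = b := by
  let d : X.M →ₗ[R] (prd W Y).M := LinearMap.prod t (-f)
  have hfg : ∀ x, g (f x) = 0 := fun x => LinearMap.congr_fun h.zero x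
  have hdr : LinearMap.range d ≤ LinearMap.ker (g ∘ₗ LinearMap.snd R W.M Y.M) := by
    rintro _ ⟨x, rfl⟩
    change g (-f x) = 0
    rw [map_neg, hfg, neg_zero]
  let q : (quo (prd W Y) (LinearMap.range d)).M →ₗ[R] Z.M := (LinearMap.range d).liftQ
    (g ∘ₗ LinearMap.snd R W.M Y.M) hdr
  let mq := (LinearMap.range d).mkQ
  refine ⟨quo (prd W Y) (LinearMap.range d), mq ∘ₗ LinearMap.inl R W.M Y.M,
    mq ∘ₗ LinearMap.inr R W.M Y.M, q, ⟨?_, ?_, ?_⟩, ?_, ?_, ?_⟩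
  · rw [← LinearMap.ker_eq_bot, LinearMap.ker_eq_bot']
    intro w hw
    have : ((w, 0) : W.M × Y.M) ∈ LinearMap.range d := by
      rw [← Submodule.ker_mkQ (LinearMap.range d)]; exact hw
    obtain ⟨x, hx⟩ := this
    have h2 : -f x = 0 := congrArg Prod.snd hx
    have h3 : x = 0 := h.inj (by rw [map_zero]; exact neg_eq_zero.1 h2)
    have h1 : t x = w := congrArg Prod.fst hx
    rw [← h1, h3, map_zero]
  · intro z
    obtain ⟨y, hy⟩ := h.surj z
    exact ⟨mq (0, y), hy⟩
  · ext e
    obtain ⟨⟨w, y⟩, rfl⟩ := (LinearMap.range d).mkQ_surjective e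
    constructor
    · rintro ⟨w', hw'⟩
      rw [← hw']
      change g 0 = 0
      exact map_zero g
    · intro hq
      have hgy : g y = 0 := hq
      have : y ∈ LinearMap.range f := by rw [h.ex]; exact hgy
      obtain ⟨x, rfl⟩ := this
      refine ⟨w + t x, ?_⟩
      change mq (w + t x, 0) = mq (w, f x)
      refine (Submodule.Quotient.eq (LinearMap.range d)).2 ?_
      exact ⟨x, Prod.ext (by change t x = w + t x - w; abel) (by change -f x = 0 - f x; abel)⟩
  · ext x
    change mq (t x, 0) = mq (0, f x)
    refine (Submodule.Quotient.eq (LinearMap.range d)).2 ?_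
    exact ⟨x, Prod.ext (by change t x = t x - 0; abel) (by change -f x = 0 - f x; abel)⟩
  · rfl
  · intro V a b hab
    have hk : LinearMap.range d ≤ LinearMap.ker (LinearMap.coprod a b) := by
      rintro _ ⟨x, rfl⟩
      change a (t x) + b (-f x) = 0
      have : a (t x) = b (f x) := LinearMap.congr_fun hab x
      rw [this, map_neg, add_neg_cancel]
    refine ⟨(LinearMap.range d).liftQ (LinearMap.coprod a b) hk, ?_, ?_⟩
    · ext w
      change a w + b 0 = a w
      rw [map_zero, add_zero]
    · ext y
      change a 0 + b y = b y
      rw [map_zero, zero_add]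

/-- Pullback along `t` of a short exact sequence. -/
theorem pullback {R : Type u} [Ring R] {X Y Z W : ModA R} {f : X.M →ₗ[R] Y.M}
    {g : Y.M →ₗ[R] Z.M} (h : Sh f g) (t : W.M →ₗ[R] Z.M) :
    ∃ (E : ModA R) (i : X.M →ₗ[R] E.M) (j : E.M →ₗ[R] Y.M) (q : E.M →ₗ[R] W.M),
      Sh i q ∧ g ∘ₗ j = t ∘ₗ q ∧ j ∘ₗ i = f ∧ (∀ e, j e = 0 → q e = 0 → e = 0) ∧
      (∀ y w, g y = t w → ∃ e, j e = y ∧ q e = w) := by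
  let N : Submodule R (prd Y W).M :=
    LinearMap.ker (g ∘ₗ LinearMap.fst R Y.M W.M - t ∘ₗ LinearMap.snd R Y.M W.M)
  have hN : ∀ y w, ((y, w) : Y.M × W.M) ∈ N ↔ g y = t w := by
    intro y w
    rw [← sub_eq_zero]; rfl
  have hfg : ∀ x, g (f x) = 0 := fun x => LinearMap.congr_fun h.zero x
  let i : X.M →ₗ[R] (sub (prd Y W) N).M := LinearMap.codRestrict N (LinearMap.inl R Y.M W.M ∘ₗ f)
    (fun x => (hN _ _).2 ((hfg x).trans (map_zero t).symm))
  refine ⟨sub (prd Y W) N, i, LinearMap.fst R Y.M W.M ∘ₗ N.subtype,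
    LinearMap.snd R Y.M W.M ∘ₗ N.subtype, ⟨?_, ?_, ?_⟩, ?_, ?_, ?_, ?_⟩
  · intro x y hxy
    apply h.inj
    exact congrArg (fun e : N => (e.1 : Y.M × W.M).1) hxy
  · intro w
    obtain ⟨y, hy⟩ := h.surj (t w)
    exact ⟨⟨(y, w), (hN _ _).2 hy⟩, rfl⟩
  · ext ⟨⟨y, w⟩, e⟩
    constructor
    · rintro ⟨x, hx⟩
      rw [← hx]; rfl
    · intro hw
      have hw : w = 0 := hw
      subst hw
      have : y ∈ LinearMap.range f := by
        rw [h.ex, LinearMap.mem_ker, (hN _ _).1 e, map_zero]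
      obtain ⟨x, rfl⟩ := this
      exact ⟨x, rfl⟩
  · ext ⟨⟨y, w⟩, e⟩
    exact (hN _ _).1 e
  · rfl
  · rintro ⟨⟨y, w⟩, e⟩ h1 h2
    exact Subtype.ext (Prod.ext h1 h2)
  · intro y w e
    exact ⟨⟨(y, w), (hN _ _).2 e⟩, rfl, rfl⟩

/-- A nonsplit left almost split sequence is almost split. -/
theorem right_of_left {R : Type u} [Ring R] {X Y Z : ModA R} {f : X.M →ₗ[R] Y.M}
    {g : Y.M →ₗ[R] Z.M} (h : Sh f g) (hZ : Z.IsIndec) (hns : ¬ SplitEpiMap g)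
    (hl : ∀ (W : ModA R) (a : X.M →ₗ[R] W.M), ¬SplitMonoMap a →
      ∃ b : Y.M →ₗ[R] W.M, b.comp f = a) (W : ModA R) (t : W.M →ₗ[R] Z.M) (ht : ¬ SplitEpiMap t) :
    ∃ t' : W.M →ₗ[R] Y.M, g.comp t' = t := by
  obtain ⟨E, i, j, q, hE, hgj, hji, -, -⟩ := pullback h t
  by_cases hi : SplitMonoMap i
  · obtain ⟨s, hs⟩ := hE.split_iff.1 hi
    refine ⟨j ∘ₗ s, ?_⟩
    rw [← LinearMap.comp_assoc, hgj, LinearMap.comp_assoc, hs, LinearMap.comp_id]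
  · exfalso
    obtain ⟨b, hb⟩ := hl E i hi
    have hb' : b ∘ₗ f = i := hb
    obtain ⟨k, hk⟩ := h.factor_right (q ∘ₗ b) (by
      rw [LinearMap.comp_assoc, hb', hE.zero])
    rcases fit hZ (t ∘ₗ k) with h1 | ⟨n, hn⟩
    · exact ht (splitEpi_of_bij_comp t k h1)
    · let θ : Module.End R Y.M := j ∘ₗ b
      have hθf : ∀ x, θ (f x) = f x := by
        intro x
        have := LinearMap.congr_fun hb' x
        change j (b (f x)) = f x
        change b (f x) = i x at this
        rw [this]
        exact LinearMap.congr_fun hji x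
      have hθg : ∀ y, g (θ y) = (t ∘ₗ k) (g y) := by
        intro y
        change g (j (b y)) = t (k (g y))
        have h1 := LinearMap.congr_fun hgj (b y)
        have h2 := LinearMap.congr_fun hk y
        change k (g y) = q (b y) at h2
        rw [h2]
        exact h1
      have hθf' : ∀ (m : ℕ) x, (θ ^ m) (f x) = f x := by
        intro m
        induction m with
        | zero => intro x; rfl
        | succ m ih => intro x; rw [pow_succ, Module.End.mul_apply, hθf, ih]
      have hθg' : ∀ (m : ℕ) y, g ((θ ^ m) y) = (((t ∘ₗ k : Module.End R Z.M)) ^ m) (g y) := by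
        intro m
        induction m with
        | zero => intro x; rfl
        | succ m ih =>
          intro y
          rw [pow_succ, Module.End.mul_apply, ih, hθg, pow_succ, Module.End.mul_apply]
      obtain ⟨r, hr⟩ := h.factor_left (W := Y) (θ ^ n) (by
        ext y
        change g ((θ ^ n) y) = 0
        rw [hθg', hn]; rfl)
      apply hns
      rw [← h.split_iff]
      refine ⟨r, ?_⟩
      ext x
      apply h.inj
      have := LinearMap.congr_fun hr (f x)
      change f (r (f x)) = _ at this
      change f (r (f x)) = f x
      rw [this, hθf']

end
end CF

namespace CF
section
set_option linter.unusedSectionVars false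
open MulOpposite

variable {K R : Type u} [CommRing K] [IsArtinianRing K] [Ring R] [Algebra K R] [Module.Finite K R]

instance opFinite {K R : Type u} [CommRing K] [Ring R] [Algebra K R] [Module.Finite K R] :
    Module.Finite K Rᵐᵒᵖ := Module.Finite.equiv (MulOpposite.opLinearEquiv K)

/-- free module -/
def fr (K : Type u) (R : Type u) [CommRing K] [IsArtinianRing K] [Ring R] [Algebra K R]
    [Module.Finite K R] (n : ℕ) : ModA R := ⟨Fin n → R, modA_of_K K (Fin n → R)⟩

theorem functional_ext {Ω Y : ModA R} {m : ℕ} (w : Fin m → Ω.M)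
    (hw : Submodule.span R (Set.range w) = ⊤) (ψ : (Ω.M →ₗ[R] Y.M) →ₗ[K] EK K) :
    ∃ φ : (Fin m → Y.M) →ₗ[K] EK K, ∀ t : Ω.M →ₗ[R] Y.M, φ (fun i => t (w i)) = ψ t := by
  let ev : (Ω.M →ₗ[R] Y.M) →ₗ[K] (Fin m → Y.M) :=
    { toFun := fun t i => t (w i)
      map_add' := fun _ _ => rfl
      map_smul' := fun _ _ => rfl }
  have hev : Function.Injective ev := by
    intro s t hst
    refine LinearMap.ext_on_range (v := w) hw fun i => ?_
    exact congrFun hst i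
  obtain ⟨φ, hφ⟩ := EK_inj ev hev ψ
  exact ⟨φ, hφ⟩

theorem tauForm (n : ℕ) (Ω : ModA R) (ι : Ω.M →ₗ[R] (Fin n → R)) :
    ∃ (τ : ModA R) (ω : (Ω.M →ₗ[R] τ.M) →ₗ[K] EK K),
      (∀ g : (Fin n → R) →ₗ[R] τ.M, ω (g ∘ₗ ι) = 0) ∧
      ∀ (Y : ModA R) (ψ : (Ω.M →ₗ[R] Y.M) →ₗ[K] EK K),
        (∀ g : (Fin n → R) →ₗ[R] Y.M, ψ (g ∘ₗ ι) = 0) →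
        ∃ h : Y.M →ₗ[R] τ.M, ∀ t, ψ t = ω (h ∘ₗ t) := by
  classical
  obtain ⟨m, w, hw⟩ := Module.Finite.exists_fin (R := R) (M := Ω.M)
  let σ : Anti K Rᵐᵒᵖ R := (antiOp K R).symm
  let FF : ModA Rᵐᵒᵖ := fr K Rᵐᵒᵖ m
  let GG : ModA Rᵐᵒᵖ := fr K Rᵐᵒᵖ n
  let c : GG.M →ₗ[Rᵐᵒᵖ] FF.M :=
    { toFun := fun b i => ∑ j, (b j : Rᵐᵒᵖ) * op (ι (w i) j)
      map_add' := fun a b => by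
        funext i
        change ∑ j, (a j + b j : Rᵐᵒᵖ) * op (ι (w i) j) =
          ∑ j, (a j : Rᵐᵒᵖ) * op (ι (w i) j) + ∑ j, (b j : Rᵐᵒᵖ) * op (ι (w i) j)
        rw [← Finset.sum_add_distrib]
        exact Finset.sum_congr rfl fun j _ => add_mul _ _ _
      map_smul' := fun r a => by
        funext i
        change ∑ j, (r * a j : Rᵐᵒᵖ) * op (ι (w i) j) =
          r * ∑ j, (a j : Rᵐᵒᵖ) * op (ι (w i) j)
        rw [Finset.mul_sum]
        exact Finset.sum_congr rfl fun j _ => mul_assoc _ _ _ }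
  let N : Submodule R (D σ FF).M := LinearMap.ker (Dm σ c)
  let τ : ModA R := sub (D σ FF) N
  let e : Fin m → FF.M := fun i => (Pi.single i (1 : Rᵐᵒᵖ) : Fin m → Rᵐᵒᵖ)
  have hN : ∀ (u : N) (b : GG.M), Dap σ u.1 (c b) = 0 := by
    intro u b
    have : Dm σ c u.1 = 0 := u.2
    rw [← Dm_ap, this]; rfl
  let ω : (Ω.M →ₗ[R] τ.M) →ₗ[K] EK K :=
    { toFun := fun t => ∑ i, Dap σ (t (w i) : N).1 (e i)
      map_add' := fun s t => by
        rw [← Finset.sum_add_distrib]; rfl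
      map_smul' := fun k t => by
        rw [RingHom.id_apply, Finset.smul_sum]
        refine Finset.sum_congr rfl fun i _ => ?_
        rw [← Dap_ksmul]
        rfl }
  refine ⟨τ, ω, ?_, ?_⟩
  · intro g
    change ∑ i, Dap σ (g (ι (w i)) : N).1 (e i) = 0
    have h1 : ∀ i, Dap σ (g (ι (w i)) : N).1 (e i) =
        ∑ j, Dap σ (g (Pi.single j 1) : N).1 (op (ι (w i) j) • e i) := by
      intro i
      have h2 : ι (w i) = ∑ j, (ι (w i) j) • (Pi.single j 1 : Fin n → R) := by
        conv_lhs => rw [pi_eq_sum_univ' (ι (w i))]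
      have h3 : (g (ι (w i)) : N).1 = ∑ j, (ι (w i) j) • (g (Pi.single j 1) : N).1 := by
        conv_lhs => rw [h2, map_sum]
        rw [Submodule.coe_sum]
        refine Finset.sum_congr rfl fun j _ => ?_
        rw [map_smul g]; rfl
      rw [h3]
      have h4 : ∀ (s : Finset (Fin n)) (v : Fin n → (D σ FF).M) (x : FF.M),
          Dap σ (∑ j ∈ s, v j) x = ∑ j ∈ s, Dap σ (v j) x := by
        intro s v x
        induction s using Finset.induction_on with
        | empty => rfl
        | insert a s ha ih => rw [Finset.sum_insert ha, Finset.sum_insert ha, Dap_add, ih]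
      rw [h4]
      rfl
    simp_rw [h1]
    rw [Finset.sum_comm]
    refine Finset.sum_eq_zero fun j _ => ?_
    rw [← map_sum, ← hN (g (Pi.single j 1)) (Pi.single j (1 : Rᵐᵒᵖ) : Fin n → Rᵐᵒᵖ)]
    congr 1
    funext l
    change (∑ i, (op (ι (w i) j) • (Pi.single i 1 : Fin m → Rᵐᵒᵖ))) l =
      ∑ j', (Pi.single j (1 : Rᵐᵒᵖ) : Fin n → Rᵐᵒᵖ) j' * op (ι (w l) j')
    rw [Finset.sum_apply]
    simp [Pi.single_apply]
  · intro Y ψ hψ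
    obtain ⟨φ, hφ⟩ := functional_ext w hw ψ
    have hφ0 : ∀ (j : Fin n) (y : Y.M), φ (fun i => ι (w i) j • y) = 0 := by
      intro j y
      have := hψ ((LinearMap.toSpanSingleton R Y.M y) ∘ₗ LinearMap.proj j)
      rw [← hφ] at this
      exact this
    let hy : Y.M → (D σ FF).M := fun y =>
      ({ toFun := fun v => φ (fun i => (v i : Rᵐᵒᵖ).unop • y)
         map_add' := fun a b => by
          rw [← map_add]; congr 1; funext i
          exact add_smul _ _ _
         map_smul' := fun k a => by
          rw [RingHom.id_apply, ← map_smul]; congr 1; funext i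
          change ((unop (a i : Rᵐᵒᵖ)) * algebraMap K R k) • y = k • ((unop (a i : Rᵐᵒᵖ)) • y)
          rw [kmod_def, ← mul_smul, Algebra.commutes] } : FF.M →ₗ[K] EK K)
    have hyap : ∀ y (v : FF.M), Dap σ (hy y) v = φ (fun i => (v i : Rᵐᵒᵖ).unop • y) := fun _ _ => rfl
    have hyN : ∀ y, hy y ∈ N := by
      intro y
      rw [LinearMap.mem_ker]
      apply Dap_ext
      intro b
      rw [Dm_ap, hyap]
      have : (fun i => (c b i : Rᵐᵒᵖ).unop • y) = ∑ j, fun i => ι (w i) j • ((b j : Rᵐᵒᵖ).unop • y) := by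
        funext i
        rw [Finset.sum_apply]
        change (unop (∑ j, (b j : Rᵐᵒᵖ) * op (ι (w i) j))) • y = _
        rw [Finset.unop_sum, Finset.sum_smul]
        refine Finset.sum_congr rfl fun j _ => ?_
        rw [unop_mul, unop_op, mul_smul]
      rw [this, map_sum]
      exact Finset.sum_eq_zero fun j _ => hφ0 j _
    refine ⟨{ toFun := fun y => ⟨hy y, hyN y⟩, map_add' := ?_, map_smul' := ?_ }, ?_⟩
    · intro a b
      apply Subtype.ext
      apply Dap_ext
      intro v
      change φ _ = φ _ + φ _
      rw [← map_add]; congr 1; funext i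
      exact smul_add _ _ _
    · intro s a
      apply Subtype.ext
      apply Dap_ext
      intro v
      change φ _ = φ (fun i => (op s * (v i : Rᵐᵒᵖ)).unop • a)
      congr 1; funext i
      exact (mul_smul _ _ _).symm
    · intro t
      change ψ t = ∑ i, Dap σ (hy (t (w i))) (e i)
      rw [← hφ]
      simp_rw [hyap]
      rw [← map_sum]
      congr 1
      funext l
      rw [Finset.sum_apply]
      change t (w l) = ∑ i, (unop ((Pi.single i (1 : Rᵐᵒᵖ) : Fin m → Rᵐᵒᵖ) l)) • t (w i)
      rw [Finset.sum_eq_single l]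
      · simp
      · intro b _ hb
        rw [Pi.single_eq_of_ne hb.symm]; simp
      · simp

theorem quot_functional {V : Type u} [AddCommGroup V] [Module K V] [IsNoetherian K V] [IsArtinian K V]
    (N : Submodule K V) {v : V}
    (hv : v ∉ N) : ∃ ψ : V →ₗ[K] EK K, (∀ n ∈ N, ψ n = 0) ∧ ψ v ≠ 0 := by
  obtain ⟨u, hu⟩ := dual_cogen (K := K) (N.mkQ v) (by
    intro h; exact hv ((Submodule.Quotient.mk_eq_zero N).1 h))
  exact ⟨u ∘ₗ N.mkQ, fun n hn => by
    have : N.mkQ n = 0 := (Submodule.Quotient.mk_eq_zero N).2 hn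
    rw [LinearMap.comp_apply, this, map_zero], hu⟩

/-- extendable maps -/
def Zx (K : Type u) {R : Type u} [CommRing K] [Ring R] [Algebra K R] {Ω F : ModA R}
    (ι : Ω.M →ₗ[R] F.M) (Y : ModA R) : Submodule K (Ω.M →ₗ[R] Y.M) where
  carrier := {t | ∃ g : F.M →ₗ[R] Y.M, g ∘ₗ ι = t}
  add_mem' := by
    rintro _ _ ⟨a, rfl⟩ ⟨b, rfl⟩
    exact ⟨a + b, LinearMap.add_comp _ _ _⟩
  zero_mem' := ⟨0, LinearMap.zero_comp _⟩
  smul_mem' := by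
    rintro k _ ⟨a, rfl⟩
    exact ⟨k • a, rfl⟩

theorem Zx_comp {Ω F : ModA R} {ι : Ω.M →ₗ[R] F.M} {Y W : ModA R} {t : Ω.M →ₗ[R] Y.M}
    (h : t ∈ Zx K ι Y) (a : Y.M →ₗ[R] W.M) : a ∘ₗ t ∈ Zx K ι W := by
  obtain ⟨g, rfl⟩ := h
  exact ⟨a ∘ₗ g, rfl⟩

theorem ar_exists (K : Type u) {R : Type u} [CommRing K] [IsArtinianRing K] [Ring R] [Algebra K R]
    [Module.Finite K R] {X : ModA R} (hX : X.IsIndec) (hnp : ¬ Module.Projective R X.M) :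
    ∃ s : AlmostSplitSeq R, s.r = X := by
  obtain ⟨n, p, hp⟩ := Module.Finite.exists_fin' R X.M
  let F : ModA R := fr K R n
  let p' : F.M →ₗ[R] X.M := p
  have hF : Module.Projective R F.M := inferInstanceAs (Module.Projective R (Fin n → R))
  let Ω := sub F (LinearMap.ker p')
  let ι : Ω.M →ₗ[R] F.M := sub.ι F (LinearMap.ker p')
  have hsh : Sh ι p' := sub_ker p' hp
  obtain ⟨τ, ω, hω, hrep⟩ := tauForm (K := K) n Ω ι
  -- nonextendable maps are detected
  have det : ∀ (Y : ModA R) (t : Ω.M →ₗ[R] Y.M), t ∉ Zx K ι Y → ∃ h : Y.M →ₗ[R] τ.M,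
      h ∘ₗ t ∉ Zx K ι τ := by
    intro Y t ht
    have hart := homArt (K := K) Ω Y
    have hnoe := homNoeth (K := K) Ω Y
    obtain ⟨ψ, h1, h2⟩ := quot_functional (Zx K ι Y) ht
    obtain ⟨h, hh⟩ := hrep Y ψ (fun g => h1 _ ⟨g, rfl⟩)
    refine ⟨h, ?_⟩
    rintro ⟨g, hg⟩
    apply h2
    rw [hh, ← hg]
    exact hω g
  have hid : (LinearMap.id : Ω.M →ₗ[R] Ω.M) ∉ Zx K ι Ω := by
    rintro ⟨g, hg⟩
    apply hnp
    obtain ⟨s, hs⟩ := hsh.split_iff.1 ⟨g, hg⟩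
    exact Module.Projective.of_split s p' hs
  obtain ⟨ξ0, hξ0⟩ := det Ω _ hid
  let L : (Ω.M →ₗ[R] τ.M) → Submodule K (Ω.M →ₗ[R] τ.M) := fun ξ =>
    LinearMap.range ({ toFun := fun a => a ∘ₗ ξ, map_add' := fun _ _ => rfl,
                       map_smul' := fun _ _ => rfl } : (τ.M →ₗ[R] τ.M) →ₗ[K] (Ω.M →ₗ[R] τ.M)) ⊔ Zx K ι τ
  have hLmem : ∀ ξ η, η ∈ L ξ ↔ ∃ a : τ.M →ₗ[R] τ.M, a ∘ₗ ξ - η ∈ Zx K ι τ := by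
    intro ξ η
    rw [Submodule.mem_sup]
    constructor
    · rintro ⟨_, ⟨a, rfl⟩, z, hz, rfl⟩
      refine ⟨a, ?_⟩
      change a ∘ₗ ξ - (a ∘ₗ ξ + z) ∈ _
      rw [sub_add_cancel_left]
      exact neg_mem hz
    · rintro ⟨a, ha⟩
      refine ⟨a ∘ₗ ξ, ⟨a, rfl⟩, _, neg_mem ha, ?_⟩
      abel
  obtain ⟨ξ, hξ, hmin⟩ : ∃ ξ, ξ ∉ Zx K ι τ ∧ ∀ η, η ∉ Zx K ι τ → L η ≤ L ξ → L η = L ξ := by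
    have hart : IsArtinian K (Ω.M →ₗ[R] τ.M) := homArt (K := K) Ω τ
    obtain ⟨M, ⟨ξ, hξ, rfl⟩, hM⟩ := IsArtinian.set_has_minimal
      {M | ∃ ξ, ξ ∉ Zx K ι τ ∧ L ξ = M} ⟨_, ξ0, hξ0, rfl⟩
    refine ⟨ξ, hξ, fun η hη hle => ?_⟩
    by_contra hne
    exact hM _ ⟨η, hη, rfl⟩ (lt_of_le_of_ne hle hne)
  have hstar : ∀ a : τ.M →ₗ[R] τ.M, a ∘ₗ ξ ∉ Zx K ι τ → ∃ b : τ.M →ₗ[R] τ.M,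
      (b ∘ₗ a ∘ₗ ξ) - ξ ∈ Zx K ι τ := by
    intro a ha
    have hle : L (a ∘ₗ ξ) ≤ L ξ := by
      intro η hη
      rw [hLmem] at hη ⊢
      obtain ⟨b, hb⟩ := hη
      exact ⟨b ∘ₗ a, hb⟩
    have := hmin _ ha hle
    have h2 : ξ ∈ L (a ∘ₗ ξ) := by
      rw [this, hLmem]
      exact ⟨LinearMap.id, by rw [LinearMap.id_comp, sub_self]; exact zero_mem _⟩
    exact (hLmem _ _).1 h2
  obtain ⟨N, Zv, ⟨B⟩⟩ := exists_biP τ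
  obtain ⟨j, hj⟩ : ∃ j, B.p j ∘ₗ ξ ∉ Zx K ι (rep (Zv j)) := by
    by_contra hcon
    push Not at hcon
    apply hξ
    have : ξ = ∑ k, B.i k ∘ₗ (B.p k ∘ₗ ξ) := by
      conv_lhs => rw [← LinearMap.id_comp ξ, ← B.tot]
      ext x
      simp [LinearMap.sum_apply]
    rw [this]
    exact sum_mem fun k _ => Zx_comp (hcon k) _
  have key : ∀ (Y : ModA R) (f : (rep (Zv j)).M →ₗ[R] Y.M), ¬ SplitMonoMap f →
      f ∘ₗ (B.p j ∘ₗ ξ) ∈ Zx K ι Y := by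
    intro Y f hf
    by_contra hcon
    obtain ⟨h, hh⟩ := det Y _ hcon
    obtain ⟨b, hb⟩ := hstar (h ∘ₗ f ∘ₗ B.p j) hh
    have hb2 := Zx_comp hb (B.p j)
    let a : Module.End R (rep (Zv j)).M := (B.p j ∘ₗ b ∘ₗ h) ∘ₗ f
    have ha : ∀ m : ℕ, (a ^ m : Module.End R _) ∘ₗ (B.p j ∘ₗ ξ) - B.p j ∘ₗ ξ ∈ Zx K ι (rep (Zv j)) := by
      intro m
      induction m with
      | zero =>
        have : (a ^ 0 : Module.End R _) ∘ₗ (B.p j ∘ₗ ξ) - B.p j ∘ₗ ξ = 0 := by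
          rw [pow_zero]; exact sub_self _
        rw [this]; exact zero_mem _
      | succ m ih =>
        have h1 := Zx_comp hb2 (a ^ m : Module.End R _)
        have h2 := add_mem h1 ih
        convert h2 using 1
        ext x
        simp only [LinearMap.sub_apply, LinearMap.add_apply, LinearMap.comp_apply, map_sub, pow_succ,
          Module.End.mul_apply]
        change (a ^ m) (B.p j (b (h (f (B.p j (ξ x)))))) - _ = _
        abel
    rcases fit (rep_indec _) a with h1 | ⟨m, hm⟩
    · exact hf (splitMono_of_bij_comp f _ h1)
    · have h3 := ha m
      rw [hm] at h3
      apply hj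
      have h4 := neg_mem h3
      convert h4 using 1
      ext x
      simp
  obtain ⟨E, i, jj, q, hE, hit, hqj, hpush⟩ := pushout hsh (B.p j ∘ₗ ξ)
  have hns : ¬ SplitEpiMap q := by
    rw [← hE.split_iff]
    rintro ⟨r, hr⟩
    apply hj
    refine ⟨r ∘ₗ jj, ?_⟩
    rw [LinearMap.comp_assoc, ← hit, ← LinearMap.comp_assoc, hr, LinearMap.id_comp]
  have hleft : ∀ (W : ModA R) (a : (rep (Zv j)).M →ₗ[R] W.M), ¬SplitMonoMap a →
      ∃ b : E.M →ₗ[R] W.M, b.comp i = a := by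
    intro W a ha
    obtain ⟨g, hg⟩ := key W a ha
    obtain ⟨c, hc, -⟩ := hpush W a g hg.symm
    exact ⟨c, hc⟩
  exact ⟨⟨rep (Zv j), E, X, i, q, hE.inj, hE.surj, hE.ex, hns, rep_indec _, hX,
    right_of_left hE hX hns hleft, hleft⟩, rfl⟩

end
end CF

namespace CF
section
set_option linter.unusedSectionVars false

variable {K R S : Type u} [CommRing K] [IsArtinianRing K] [Ring R] [Algebra K R] [Module.Finite K R]
  [Ring S] [Algebra K S] [Module.Finite K S]

theorem nonbij_add' {R : Type u} [Ring R] {X : ModA R} (h : X.IsIndec) {f g : X.M →ₗ[R] X.M}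
    (hf : ¬ Function.Bijective f) (hg : ¬ Function.Bijective g) : ¬ Function.Bijective (f + g) :=
  fun hb => (nonbij_add h hb).elim hf hg

theorem nonbij_sum' {R : Type u} [Ring R] {X : ModA R} (h : X.IsIndec) {ι : Type*} (s : Finset ι)
    (f : ι → X.M →ₗ[R] X.M) (hf : ∀ k ∈ s, ¬ Function.Bijective (f k)) :
    ¬ Function.Bijective ((∑ k ∈ s, f k : X.M →ₗ[R] X.M) : X.M → X.M) := fun hb => by
  obtain ⟨k, hk, hk'⟩ := nonbij_sum h s f hb
  exact hf k hk hk'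

theorem seq_sh {R : Type u} [Ring R] (s : AlmostSplitSeq R) : Sh s.f s.g := ⟨s.inj, s.surj, s.exact⟩

theorem seq_nm {R : Type u} [Ring R] (s : AlmostSplitSeq R) : ¬ SplitMonoMap s.f := fun h =>
  s.not_split ((seq_sh s).split_iff.1 h)

theorem splitMono_iso_comp {R : Type u} [Ring R] {X Y Z : ModA R} (f : X.M →ₗ[R] Y.M)
    (e : Y.M ≃ₗ[R] Z.M) : SplitMonoMap (e.toLinearMap ∘ₗ f) ↔ SplitMonoMap f := by
  constructor
  · rintro ⟨r, hr⟩; exact ⟨r ∘ₗ e.toLinearMap, hr⟩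
  · rintro ⟨r, hr⟩
    refine ⟨r ∘ₗ e.symm.toLinearMap, ?_⟩
    ext x
    have := LinearMap.congr_fun hr x
    simpa using this

theorem splitEpi_comp_iso {R : Type u} [Ring R] {X Y Z : ModA R} (f : Y.M →ₗ[R] Z.M)
    (e : X.M ≃ₗ[R] Y.M) : SplitEpiMap (f ∘ₗ e.toLinearMap) ↔ SplitEpiMap f := by
  constructor
  · rintro ⟨r, hr⟩; exact ⟨e.toLinearMap ∘ₗ r, hr⟩
  · rintro ⟨r, hr⟩
    refine ⟨e.symm.toLinearMap ∘ₗ r, ?_⟩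
    ext x
    have := LinearMap.congr_fun hr x
    simpa using this

/-- left almost split for the dual of a right almost split map -/
theorem D_left_almost (σ : Anti K R S) {Y Z : ModA R} (g : Y.M →ₗ[R] Z.M)
    (hg : ∀ (W : ModA R) (h : W.M →ₗ[R] Z.M), ¬SplitEpiMap h → ∃ h' : W.M →ₗ[R] Y.M, g.comp h' = h)
    (W : ModA S) (h : (D σ Z).M →ₗ[S] W.M) (hh : ¬ SplitMonoMap h) :
    ∃ h' : (D σ Y).M →ₗ[S] W.M, h'.comp (Dm σ g) = h := by
  let e : W.M ≃ₗ[S] (D σ (D σ.symm W)).M := eta σ.symm W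
  obtain ⟨t, ht⟩ := Dm_surj σ (e.toLinearMap ∘ₗ h)
  have : ¬ SplitEpiMap t := by
    rw [← D_splitMono σ, ht, splitMono_iso_comp]; exact hh
  obtain ⟨t', ht'⟩ := hg _ t this
  refine ⟨e.symm.toLinearMap ∘ₗ Dm σ t', ?_⟩
  have h2 : Dm σ t' ∘ₗ Dm σ g = e.toLinearMap ∘ₗ h := by
    rw [← Dm_comp, ← ht]; exact congrArg _ ht'
  rw [LinearMap.comp_assoc, h2]
  ext x; simp

theorem D_right_almost (σ : Anti K R S) {X Y : ModA R} (f : X.M →ₗ[R] Y.M)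
    (hf : ∀ (W : ModA R) (h : X.M →ₗ[R] W.M), ¬SplitMonoMap h → ∃ h' : Y.M →ₗ[R] W.M, h'.comp f = h)
    (W : ModA S) (h : W.M →ₗ[S] (D σ X).M) (hh : ¬ SplitEpiMap h) :
    ∃ h' : W.M →ₗ[S] (D σ Y).M, (Dm σ f).comp h' = h := by
  let e : W.M ≃ₗ[S] (D σ (D σ.symm W)).M := eta σ.symm W
  obtain ⟨t, ht⟩ := Dm_surj σ (h ∘ₗ e.symm.toLinearMap)
  have : ¬ SplitMonoMap t := by
    rw [← D_splitEpi σ, ht, splitEpi_comp_iso]; exact hh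
  obtain ⟨t', ht'⟩ := hf _ t this
  refine ⟨Dm σ t' ∘ₗ e.toLinearMap, ?_⟩
  have h2 : Dm σ f ∘ₗ Dm σ t' = h ∘ₗ e.symm.toLinearMap := by
    rw [← Dm_comp, ← ht]; exact congrArg _ ht'
  rw [← LinearMap.comp_assoc, h2]
  ext x; simp

/-- Dual almost split sequence. -/
noncomputable def dualSeq (σ : Anti K R S) (s : AlmostSplitSeq R) : AlmostSplitSeq S where
  l := D σ s.r
  m := D σ s.m
  r := D σ s.l
  f := Dm σ s.g
  g := Dm σ s.f
  inj := Dm_injective σ s.surj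
  surj := Dm_surjective σ s.inj
  exact := Dm_exact σ s.surj s.exact
  not_split := by rw [D_splitEpi]; exact seq_nm s
  l_indec := D_indec σ s.r_indec
  r_indec := D_indec σ s.l_indec
  right_almost := D_right_almost σ s.f s.left_almost
  left_almost := D_left_almost σ s.g s.right_almost

theorem D_iso (σ : Anti K R S) {X Y : ModA R} (e : (D σ X).M ≃ₗ[S] (D σ Y).M) :
    Nonempty (X.M ≃ₗ[R] Y.M) := by
  obtain ⟨f, hf⟩ := Dm_surj σ e.symm.toLinearMap
  have : Function.Bijective (Dm σ f) := by rw [hf]; exact e.symm.bijective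
  exact ⟨LinearEquiv.ofBijective f ((Dm_bijective σ).1 this)⟩

theorem ar_exists_left (K : Type u) {R : Type u} [CommRing K] [IsArtinianRing K] [Ring R] [Algebra K R]
    [Module.Finite K R] {X : ModA R} (hX : X.IsIndec) (hnp : ¬ Module.Injective R X.M) :
    ∃ s : AlmostSplitSeq R, s.l.Iso X := by
  let σ := antiOp K R
  obtain ⟨s, hs⟩ := ar_exists K (D_indec σ hX) (fun h => hnp (inj_of_D_proj σ h))
  refine ⟨dualSeq σ.symm s, ?_⟩
  change Nonempty ((D σ.symm s.r).M ≃ₗ[R] X.M)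
  rw [hs]
  exact ⟨(eta σ X).symm⟩

theorem proj_sink {R : Type u} [Ring R] {X : ModA R} (hX : X.IsIndec) (hp : Module.Projective R X.M) :
    ∃ (Y : ModA R) (g : Y.M →ₗ[R] X.M), Function.Injective g ∧ ¬ SplitEpiMap g ∧
      ∀ (W : ModA R) (h : W.M →ₗ[R] X.M), ¬SplitEpiMap h → ∃ h' : W.M →ₗ[R] Y.M, g.comp h' = h := by
  have := hX.1
  obtain ⟨N, hN, -⟩ := (eq_top_or_exists_le_coatom (⊥ : Submodule R X.M)).resolve_left bot_ne_top
  refine ⟨sub X N, sub.ι X N, sub_inj X N, ?_, ?_⟩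
  · rintro ⟨s, hs⟩
    apply hN.1
    rw [eq_top_iff]
    intro x _
    have := LinearMap.congr_fun hs x
    change (s x).1 = x at this
    rw [← this]; exact (s x).2
  · intro W h hh
    refine factor_inj (sub_inj X N) h ?_
    have hr : LinearMap.range (sub.ι X N) = N := Submodule.range_subtype N
    rw [hr]
    by_contra hle
    have htop : LinearMap.range h ⊔ N = ⊤ := by
      have : N < LinearMap.range h ⊔ N := by
        refine lt_of_le_of_ne le_sup_right fun he => hle ?_
        rw [he]; exact le_sup_left
      exact hN.2 _ this
    have hsurj : Function.Surjective (LinearMap.coprod h (sub.ι X N)) := by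
      rw [← LinearMap.range_eq_top, LinearMap.range_coprod, hr, htop]
    obtain ⟨s, hs⟩ := Module.projective_lifting_property (LinearMap.coprod h (sub.ι X N))
      LinearMap.id hsurj
    let s1 : X.M →ₗ[R] W.M := LinearMap.fst R _ _ ∘ₗ s
    let s2 : X.M →ₗ[R] (sub X N).M := LinearMap.snd R _ _ ∘ₗ s
    have hid : h ∘ₗ s1 + sub.ι X N ∘ₗ s2 = LinearMap.id := by rw [← hs]; rfl
    have h1 : ¬ Function.Bijective (h ∘ₗ s1) := fun hb => hh (splitEpi_of_bij_comp h s1 hb)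
    have h2 : ¬ Function.Bijective (sub.ι X N ∘ₗ s2) := fun hb => by
      apply hN.1
      rw [eq_top_iff]
      intro x _
      obtain ⟨y, rfl⟩ := hb.2 x
      exact (s2 y).2
    have h3 := nonbij_add' hX h1 h2
    rw [hid] at h3
    exact h3 Function.bijective_id

theorem inj_source (K : Type u) {R : Type u} [CommRing K] [IsArtinianRing K] [Ring R] [Algebra K R]
    [Module.Finite K R] {X : ModA R} (hX : X.IsIndec) (hp : Module.Injective R X.M) :
    ∃ (Y : ModA R) (f : X.M →ₗ[R] Y.M), Function.Surjective f ∧ ¬ SplitMonoMap f ∧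
      ∀ (W : ModA R) (h : X.M →ₗ[R] W.M), ¬SplitMonoMap h → ∃ h' : Y.M →ₗ[R] W.M, h'.comp f = h := by
  let σ := antiOp K R
  obtain ⟨Y, g, h1, h2, h3⟩ := proj_sink (D_indec σ hX) (D_proj_of_inj σ hp)
  refine ⟨D σ.symm Y, Dm σ.symm g ∘ₗ (eta σ X).toLinearMap, ?_, ?_, ?_⟩
  · exact (Dm_surjective σ.symm h1).comp (eta σ X).surjective
  · rintro ⟨r, hr⟩
    apply h2
    rw [← D_splitMono σ.symm]
    refine ⟨(eta σ X).toLinearMap ∘ₗ r, ?_⟩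
    ext x
    obtain ⟨y, rfl⟩ := (eta σ X).surjective x
    have := LinearMap.congr_fun hr y
    exact congrArg (eta σ X) this
  · intro W h hh
    obtain ⟨h', hh'⟩ := D_left_almost σ.symm g h3 W (h ∘ₗ (eta σ X).symm.toLinearMap) (by
      rintro ⟨r, hr⟩
      apply hh
      refine ⟨(eta σ X).symm.toLinearMap ∘ₗ r, ?_⟩
      ext x
      have := LinearMap.congr_fun hr (eta σ X x)
      simp only [LinearMap.comp_apply, LinearEquiv.coe_coe, LinearEquiv.symm_apply_apply,
        LinearMap.id_apply] at this
      simp only [LinearMap.comp_apply, LinearEquiv.coe_coe, LinearMap.id_apply]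
      rw [this, LinearEquiv.symm_apply_apply])
    refine ⟨h', ?_⟩
    ext x
    have := LinearMap.congr_fun hh' (eta σ X x)
    simpa using this

section
variable {R : Type u} [Ring R]

theorem irred_iso {X X' Y Y' : ModA R} (e : X.M ≃ₗ[R] X'.M) (d : Y.M ≃ₗ[R] Y'.M)
    {f : X.M →ₗ[R] Y.M} (hf : IsIrred f) : IsIrred (X := X') (Y := Y')
      (d.toLinearMap ∘ₗ f ∘ₗ e.symm.toLinearMap) := by
  refine ⟨?_, ?_, ?_⟩
  · rw [splitMono_iso_comp]
    rintro ⟨r, hr⟩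
    apply hf.1
    refine ⟨e.symm.toLinearMap ∘ₗ r, ?_⟩
    ext x
    have := LinearMap.congr_fun hr (e x)
    simp only [LinearMap.comp_apply, LinearEquiv.coe_coe, LinearEquiv.symm_apply_apply,
        LinearMap.id_apply] at this
    simp only [LinearMap.comp_apply, LinearEquiv.coe_coe, LinearMap.id_apply]
    rw [this, LinearEquiv.symm_apply_apply]
  · rintro ⟨r, hr⟩
    apply hf.2.1
    refine ⟨e.symm.toLinearMap ∘ₗ r ∘ₗ d.toLinearMap, ?_⟩
    ext x
    have := LinearMap.congr_fun hr (d x)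
    apply d.injective
    exact this
  · intro Z g h hgh
    have := hf.2.2 Z (g ∘ₗ e.toLinearMap) (d.symm.toLinearMap ∘ₗ h) (by
      ext x
      have := LinearMap.congr_fun hgh (e x)
      simp only [LinearMap.comp_apply, LinearEquiv.coe_coe, LinearEquiv.symm_apply_apply] at this
      simp only [LinearMap.comp_apply, LinearEquiv.coe_coe]
      rw [this, LinearEquiv.symm_apply_apply])
    rcases this with ⟨r, hr⟩ | ⟨r, hr⟩
    · left
      refine ⟨e.toLinearMap ∘ₗ r, ?_⟩
      ext x
      have := LinearMap.congr_fun hr (e.symm x)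
      simp only [LinearMap.comp_apply, LinearEquiv.coe_coe, LinearEquiv.apply_symm_apply,
        LinearMap.id_apply] at this
      simp only [LinearMap.comp_apply, LinearEquiv.coe_coe, LinearMap.id_apply]
      rw [this, LinearEquiv.apply_symm_apply]
    · right
      refine ⟨r ∘ₗ d.symm.toLinearMap, ?_⟩
      ext x
      have := LinearMap.congr_fun hr (d.symm x)
      exact d.symm.injective this

theorem arrow_iff {x y : ARVertex R} :
    ARArrow x y ↔ ∃ f : (rep x).M →ₗ[R] (rep y).M, IsIrred f := by
  constructor
  · rintro ⟨X, Y, f, hf, rfl, rfl⟩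
    obtain ⟨e⟩ := rep_mk X
    obtain ⟨d⟩ := rep_mk Y
    exact ⟨_, irred_iso e.symm d.symm hf⟩
  · rintro ⟨f, hf⟩
    exact ⟨⟨rep x, rep_indec x⟩, ⟨rep y, rep_indec y⟩, f, hf, mk_rep x, mk_rep y⟩

theorem BiP.expand {X : ModA R} {n : ℕ} {Z : Fin n → ARVertex R} (B : BiP X n Z) {W : ModA R}
    (f : X.M →ₗ[R] W.M) : f = ∑ k, (f ∘ₗ B.i k) ∘ₗ B.p k := by
  conv_lhs => rw [← LinearMap.comp_id f, ← B.tot]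
  ext x; simp

theorem BiP.expand' {X : ModA R} {n : ℕ} {Z : Fin n → ARVertex R} (B : BiP X n Z) {W : ModA R}
    (f : W.M →ₗ[R] X.M) : f = ∑ k, B.i k ∘ₗ (B.p k ∘ₗ f) := by
  conv_lhs => rw [← LinearMap.id_comp f, ← B.tot]
  ext x; simp

/-- An endomorphism of an indecomposable that factors isomorphically through a decomposed module
factors isomorphically through a summand. -/
theorem BiP.exists_bij {X W : ModA R} (hW : W.IsIndec) {n : ℕ} {Z : Fin n → ARVertex R} (B : BiP X n Z)
    (f : W.M →ₗ[R] X.M) (g : X.M →ₗ[R] W.M) (h : Function.Bijective (g ∘ₗ f)) :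
    ∃ k, Function.Bijective (B.p k ∘ₗ f) ∧ Function.Bijective (g ∘ₗ B.i k) := by
  by_contra hcon
  push Not at hcon
  have : ∀ k, ¬ Function.Bijective ((g ∘ₗ B.i k) ∘ₗ (B.p k ∘ₗ f)) := by
    intro k hk
    have h1 := splitMono_of_bij_comp _ _ hk
    have h2 := splitMono_bij hW (rep_indec _) h1
    have h3 := splitEpi_of_bij_comp _ _ hk
    exact hcon k h2 (splitEpi_bij (rep_indec _) hW h3)
  have h4 := nonbij_sum' hW Finset.univ _ (fun k _ => this k)
  apply h4
  convert h using 2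
  conv_rhs => rw [B.expand g]
  ext x; simp

theorem arrow_sink {b : ARVertex R} {m : ModA R} (g : m.M →ₗ[R] (rep b).M) (hns : ¬ SplitEpiMap g)
    (hg : ∀ (W : ModA R) (h : W.M →ₗ[R] (rep b).M), ¬SplitEpiMap h →
      ∃ h' : W.M →ₗ[R] m.M, g.comp h' = h)
    {n : ℕ} {Z : Fin n → ARVertex R} (B : BiP m n Z)
    (hmin : ∀ k (c : (rep (Z k)).M →ₗ[R] m.M), g ∘ₗ c = 0 → ¬ Function.Bijective (B.p k ∘ₗ c))
    (x : ARVertex R) : ARArrow x b ↔ ∃ k, Z k = x := by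
  rw [arrow_iff]
  constructor
  · rintro ⟨φ, hφ⟩
    obtain ⟨ψ, hψ⟩ := hg _ φ hφ.2.1
    obtain ⟨r, hr⟩ := (hφ.2.2 _ ψ g hψ).resolve_right hns
    obtain ⟨k, hk, -⟩ := B.exists_bij (rep_indec x) ψ r (by
      have : r ∘ₗ ψ = LinearMap.id := hr
      rw [this]; exact Function.bijective_id)
    exact ⟨k, (eq_of_bij _ hk).symm⟩
  · rintro ⟨k, rfl⟩
    have hne : ¬ SplitEpiMap (X := rep (Z k)) (Y := rep b) (g ∘ₗ B.i k) := by
      rintro ⟨s, hs⟩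
      exact hns ⟨B.i k ∘ₗ s, hs⟩
    refine ⟨g ∘ₗ B.i k, ?_, hne, ?_⟩
    · intro h
      exact hne (splitEpi_of_bij (splitMono_bij (rep_indec _) (rep_indec _) h))
    · intro W e h heh
      by_contra hcon
      push Not at hcon
      obtain ⟨h', hh'⟩ := hg W h hcon.2
      have hz : g ∘ₗ (B.i k - h' ∘ₗ e) = 0 := by
        ext y
        have h1 := LinearMap.congr_fun heh y
        have h2 := LinearMap.congr_fun hh' (e y)
        simp only [LinearMap.comp_apply] at h1 h2
        simp [h1, h2]
      have h3 := hmin k _ hz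
      have h4 : ¬ Function.Bijective ((B.p k ∘ₗ h') ∘ₗ e) := fun hb =>
        hcon.1 (splitMono_of_bij_comp _ _ hb)
      have h5 := nonbij_add' (rep_indec _) h3 h4
      apply h5
      have : B.p k ∘ₗ (B.i k - h' ∘ₗ e) + (B.p k ∘ₗ h') ∘ₗ e = LinearMap.id := by
        rw [← B.pi k]; ext y; simp
      rw [this]; exact Function.bijective_id

theorem arrow_source {a : ARVertex R} {m : ModA R} (f : (rep a).M →ₗ[R] m.M) (hns : ¬ SplitMonoMap f)
    (hf : ∀ (W : ModA R) (h : (rep a).M →ₗ[R] W.M), ¬SplitMonoMap h →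
      ∃ h' : m.M →ₗ[R] W.M, h'.comp f = h)
    {n : ℕ} {Z : Fin n → ARVertex R} (B : BiP m n Z)
    (hmin : ∀ k (c : m.M →ₗ[R] (rep (Z k)).M), c ∘ₗ f = 0 → ¬ Function.Bijective (c ∘ₗ B.i k))
    (x : ARVertex R) : ARArrow a x ↔ ∃ k, Z k = x := by
  rw [arrow_iff]
  constructor
  · rintro ⟨φ, hφ⟩
    obtain ⟨ψ, hψ⟩ := hf _ φ hφ.1
    obtain ⟨r, hr⟩ := (hφ.2.2 _ f ψ hψ).resolve_left hns
    obtain ⟨k, -, hk⟩ := B.exists_bij (rep_indec x) r ψ (by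
      have : ψ ∘ₗ r = LinearMap.id := hr
      rw [this]; exact Function.bijective_id)
    exact ⟨k, eq_of_bij _ hk⟩
  · rintro ⟨k, rfl⟩
    have hne : ¬ SplitMonoMap (X := rep a) (Y := rep (Z k)) (B.p k ∘ₗ f) := by
      rintro ⟨s, hs⟩
      exact hns ⟨s ∘ₗ B.p k, hs⟩
    refine ⟨B.p k ∘ₗ f, hne, ?_, ?_⟩
    · intro h
      exact hne (splitMono_of_bij (splitEpi_bij (rep_indec _) (rep_indec _) h))
    · intro W e h heh
      by_contra hcon
      push Not at hcon
      obtain ⟨h', hh'⟩ := hf W e hcon.1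
      have hz : (B.p k - h ∘ₗ h') ∘ₗ f = 0 := by
        ext y
        have h1 := LinearMap.congr_fun heh y
        have h2 := LinearMap.congr_fun hh' y
        simp only [LinearMap.comp_apply] at h1 h2
        simp [← h1, h2]
      have h3 := hmin k _ hz
      have h4 : ¬ Function.Bijective (h ∘ₗ (h' ∘ₗ B.i k)) := fun hb =>
        hcon.2 (splitEpi_of_bij_comp _ _ hb)
      have h5 := nonbij_add' (rep_indec _) h3 h4
      apply h5
      have : (B.p k - h ∘ₗ h') ∘ₗ B.i k + h ∘ₗ (h' ∘ₗ B.i k) = LinearMap.id := by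
        rw [← B.pi k]; ext y; simp
      rw [this]; exact Function.bijective_id

theorem irred_me {X Y : ModA R} {f : X.M →ₗ[R] Y.M} (hf : IsIrred f) :
    Function.Injective f ∨ Function.Surjective f := by
  rcases hf.2.2 (sub Y (LinearMap.range f)) (LinearMap.rangeRestrict f) (sub.ι Y _) rfl with
    ⟨r, hr⟩ | ⟨s, hs⟩
  · left
    intro x y hxy
    have h1 : LinearMap.rangeRestrict f x = LinearMap.rangeRestrict f y := Subtype.ext hxy
    have h2 := LinearMap.congr_fun hr x
    have h3 := LinearMap.congr_fun hr y
    simp only [LinearMap.comp_apply, LinearMap.id_apply] at h2 h3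
    rw [← h2, ← h3, h1]
  · right
    intro y
    have := LinearMap.congr_fun hs y
    obtain ⟨x, hx⟩ := (s y).2
    exact ⟨x, hx.trans this⟩

theorem tau_unique (s s' : AlmostSplitSeq R) (e : s.r.M ≃ₗ[R] s'.r.M) :
    Nonempty (s.l.M ≃ₗ[R] s'.l.M) := by
  have lift : ∀ (s s' : AlmostSplitSeq R) (e : s.r.M ≃ₗ[R] s'.r.M),
      ∃ (h : s.m.M →ₗ[R] s'.m.M) (u : s.l.M →ₗ[R] s'.l.M),
        (∀ y, s'.g (h y) = e (s.g y)) ∧ ∀ x, h (s.f x) = s'.f (u x) := by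
    intro s s' e
    obtain ⟨h, hh⟩ := s'.right_almost s.m (e.toLinearMap ∘ₗ s.g) (by
      rintro ⟨t, ht⟩
      apply s.not_split
      refine ⟨t ∘ₗ e.toLinearMap, ?_⟩
      ext x
      apply e.injective
      exact LinearMap.congr_fun ht (e x))
    have hh' : ∀ y, s'.g (h y) = e (s.g y) := fun y => LinearMap.congr_fun hh y
    obtain ⟨u, hu⟩ := (seq_sh s').factor_left (h ∘ₗ s.f) (by
      ext x
      change s'.g (h (s.f x)) = 0
      have : s.g (s.f x) = 0 := LinearMap.congr_fun (seq_sh s).zero x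
      rw [hh', this, map_zero])
    exact ⟨h, u, hh', fun x => (LinearMap.congr_fun hu x).symm⟩
  obtain ⟨h, u, h1, h2⟩ := lift s s' e
  obtain ⟨h', u', h1', h2'⟩ := lift s' s e.symm
  rcases fit s.l_indec (u' ∘ₗ u) with hb | ⟨n, hn⟩
  · exact ⟨LinearEquiv.ofBijective u (splitMono_bij s.l_indec s'.l_indec
      (splitMono_of_bij_comp u u' hb))⟩
  · exfalso
    let θ : Module.End R s.m.M := h' ∘ₗ h
    have hθg : ∀ (m : ℕ) y, s.g ((θ ^ m) y) = s.g y := by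
      intro m
      induction m with
      | zero => intro y; rfl
      | succ m ih =>
        intro y
        rw [pow_succ, Module.End.mul_apply, ih]
        change s.g (h' (h y)) = _
        rw [h1', h1, LinearEquiv.symm_apply_apply]
    have hθf : ∀ (m : ℕ) x, (θ ^ m) (s.f x) = s.f (((u' ∘ₗ u : Module.End R s.l.M) ^ m) x) := by
      intro m
      induction m with
      | zero => intro x; rfl
      | succ m ih =>
        intro x
        rw [pow_succ, Module.End.mul_apply, pow_succ, Module.End.mul_apply, ← ih]
        congr 1
        change h' (h (s.f x)) = s.f (u' (u x))
        rw [h2, h2']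
    obtain ⟨k, hk⟩ := (seq_sh s).factor_right (W := s.m) (θ ^ n) (by
      ext x
      change (θ ^ n) (s.f x) = 0
      rw [hθf, hn]; exact map_zero s.f)
    apply s.not_split
    refine ⟨k, ?_⟩
    ext x
    obtain ⟨y, rfl⟩ := s.surj x
    change s.g ((k ∘ₗ s.g) y) = s.g y
    rw [hk, hθg]

end

theorem tau_unique' (K : Type u) {R : Type u} [CommRing K] [IsArtinianRing K] [Ring R] [Algebra K R]
    [Module.Finite K R] (s s' : AlmostSplitSeq R) (e : s.l.M ≃ₗ[R] s'.l.M) :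
    Nonempty (s.r.M ≃ₗ[R] s'.r.M) := by
  let σ := antiOp K R
  obtain ⟨d⟩ := tau_unique (dualSeq σ s) (dualSeq σ s') (Diso σ e)
  exact D_iso σ d

end
end CF

namespace CF
section
set_option linter.unusedSectionVars false

variable {K R : Type u} [CommRing K] [IsArtinianRing K] [Ring R] [Algebra K R] [Module.Finite K R]

section
variable {R : Type u} [Ring R]

/-- vanishing of the first extension group -/
def NoExt (X Y : ModA R) : Prop :=
  ∀ (E : ModA R) (f : Y.M →ₗ[R] E.M) (g : E.M →ₗ[R] X.M), Sh f g → SplitEpiMap g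

theorem NoExt.lift {X L M N : ModA R} (h : NoExt X L) {f : L.M →ₗ[R] M.M} {g : M.M →ₗ[R] N.M}
    (hs : Sh f g) (t : X.M →ₗ[R] N.M) : ∃ t' : X.M →ₗ[R] M.M, g ∘ₗ t' = t := by
  obtain ⟨E, i, j, q, hE, hgj, -, -, -⟩ := pullback hs t
  obtain ⟨s, hs⟩ := h E i q hE
  refine ⟨j ∘ₗ s, ?_⟩
  rw [← LinearMap.comp_assoc, hgj, LinearMap.comp_assoc, hs, LinearMap.comp_id]

theorem NoExt.extend {X L M Y : ModA R} (h : NoExt X L) {f : Y.M →ₗ[R] M.M} {g : M.M →ₗ[R] X.M}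
    (hs : Sh f g) (t : Y.M →ₗ[R] L.M) : ∃ t' : M.M →ₗ[R] L.M, t' ∘ₗ f = t := by
  obtain ⟨E, i, j, q, hE, hit, -, -⟩ := pushout hs t
  obtain ⟨s, hs⟩ := hE.split_iff.2 (h E i q hE)
  refine ⟨s ∘ₗ j, ?_⟩
  rw [LinearMap.comp_assoc, ← hit, ← LinearMap.comp_assoc, hs, LinearMap.id_comp]

theorem noExt_of_extend {X Y : ModA R} (h : ∀ (E : ModA R) (f : Y.M →ₗ[R] E.M) (g : E.M →ₗ[R] X.M),
    Sh f g → ∃ t : E.M →ₗ[R] Y.M, t ∘ₗ f = LinearMap.id) : NoExt X Y := fun E f g hs =>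
  hs.split_iff.1 (h E f g hs)

theorem proj_lift {P : ModA R} (hP : Module.Projective R P.M) {M N : ModA R} {g : M.M →ₗ[R] N.M}
    (hg : Function.Surjective g) (t : P.M →ₗ[R] N.M) : ∃ t' : P.M →ₗ[R] M.M, g ∘ₗ t' = t :=
  Module.projective_lifting_property g t hg

theorem inj_ext {I : ModA R} (hI : Module.Injective R I.M) {M N : ModA R} {f : M.M →ₗ[R] N.M}
    (hf : Function.Injective f) (t : M.M →ₗ[R] I.M) : ∃ t' : N.M →ₗ[R] I.M, t' ∘ₗ f = t := by
  obtain ⟨t', h⟩ := hI.out f hf t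
  exact ⟨t', LinearMap.ext h⟩

/-- AR formula, first half. -/
theorem ar_one (s : AlmostSplitSeq R) {Y : ModA R} (h : ∀ h : Y.M →ₗ[R] s.l.M, h = 0) :
    NoExt s.r Y := by
  intro M f g hs
  by_contra hg
  obtain ⟨t, ht⟩ := s.right_almost M g hg
  have h1 : s.g ∘ₗ (t ∘ₗ f) = 0 := by
    rw [← LinearMap.comp_assoc]; erw [ht]; exact hs.zero
  obtain ⟨v, hv⟩ := (seq_sh s).factor_left (t ∘ₗ f) h1
  rw [h v, LinearMap.comp_zero] at hv
  obtain ⟨t', ht'⟩ := hs.factor_right t hv.symm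
  apply s.not_split
  refine ⟨t', ?_⟩
  ext x
  obtain ⟨y, rfl⟩ := hs.surj x
  have h2 := LinearMap.congr_fun ht' y
  have h3 := LinearMap.congr_fun ht y
  simp only [LinearMap.comp_apply] at h2 h3 ⊢
  rw [h2, h3]; rfl
end

theorem pd_one (K : Type u) {R : Type u} [CommRing K] [IsArtinianRing K] [Ring R] [Algebra K R]
    [Module.Finite K R] (s : AlmostSplitSeq R)
    (hI : ∀ I : ModA R, Module.Injective R I.M → ∀ h : I.M →ₗ[R] s.l.M, h = 0)
    {Ω F : ModA R} {ι : Ω.M →ₗ[R] F.M} {p : F.M →ₗ[R] s.r.M} (hs : Sh ι p)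
    (hF : Module.Projective R F.M) : Module.Projective R Ω.M := by
  obtain ⟨M, q, hM, hq⟩ := exists_free_cover K Ω
  set Y := sub M (LinearMap.ker q) with hY
  set κ := sub.ι M (LinearMap.ker q) with hκ
  have hk : Sh κ q := sub_ker q hq
  obtain ⟨I, j, hIi, hj⟩ := exists_inj_emb K Y
  have hjp := quo_range j hj
  set π := quo.π I (LinearMap.range j)
  obtain ⟨w, hw⟩ := inj_ext hIi hk.inj j
  obtain ⟨w', hw'⟩ := hk.factor_right (π ∘ₗ w) (by
    rw [LinearMap.comp_assoc, hw]; exact hjp.zero)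
  have hne : NoExt s.r (quo I (LinearMap.range j)) := by
    apply ar_one
    intro h
    have := hI I hIi (h ∘ₗ π)
    refine LinearMap.ext fun x => ?_
    obtain ⟨y, rfl⟩ := hjp.surj x
    exact LinearMap.congr_fun this y
  obtain ⟨v, hv⟩ := hne.extend hs w'
  obtain ⟨v', hv'⟩ := proj_lift hF hjp.surj v
  obtain ⟨r, hr⟩ := hjp.factor_left (w - v' ∘ₗ ι ∘ₗ q) (by
    rw [LinearMap.comp_sub, ← LinearMap.comp_assoc, hv', ← LinearMap.comp_assoc, hv, hw', sub_self])
  have hsp : SplitMonoMap κ := by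
    refine ⟨r, ?_⟩
    refine LinearMap.ext fun x => ?_
    apply hj
    have h1 := LinearMap.congr_fun hr (κ x)
    have h2 := LinearMap.congr_fun hw x
    have h3 := LinearMap.congr_fun hk.zero x
    simp only [LinearMap.comp_apply, LinearMap.sub_apply, LinearMap.zero_apply] at h1 h2 h3 ⊢
    rw [h1, h3, h2]; simp
  obtain ⟨t, ht⟩ := hk.split_iff.1 hsp
  exact Module.Projective.of_split t q ht

theorem ar_two (K : Type u) {R : Type u} [CommRing K] [IsArtinianRing K] [Ring R] [Algebra K R]
    [Module.Finite K R] (s : AlmostSplitSeq R)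
    (hI : ∀ I : ModA R, Module.Injective R I.M → ∀ h : I.M →ₗ[R] s.l.M, h = 0)
    {Y : ModA R} (h : Y.M →ₗ[R] s.l.M) (hh : h ≠ 0) : ¬ NoExt s.r Y := by
  intro hne
  obtain ⟨F, p, hF, hp⟩ := exists_free_cover K s.r
  have hs := sub_ker p hp
  set ι := sub.ι F (LinearMap.ker p)
  have hΩ := pd_one K s hI hs hF
  set π := quo.π s.l (LinearMap.range h)
  have hker : LinearMap.ker π = LinearMap.range h := Submodule.ker_mkQ _
  have hπ : ¬ SplitMonoMap π := by
    rintro ⟨r, hr⟩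
    apply hh
    ext y
    have h1 : π (h y) = 0 := by
      have : h y ∈ LinearMap.ker π := by rw [hker]; exact ⟨y, rfl⟩
      exact this
    have h2 := LinearMap.congr_fun hr (h y)
    rw [LinearMap.comp_apply, h1, map_zero] at h2
    exact h2.symm
  obtain ⟨c, hc⟩ := s.left_almost _ π hπ
  let M := sub s.m (LinearMap.ker c)
  let gM : M.M →ₗ[R] s.r.M := s.g ∘ₗ sub.ι s.m (LinearMap.ker c)
  have hgM : Function.Surjective gM := by
    intro x
    obtain ⟨y, rfl⟩ := s.surj x
    obtain ⟨l, hl⟩ := quo_surj s.l (LinearMap.range h) (c y)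
    have h1 : c (y - s.f l) = 0 := by
      have := LinearMap.congr_fun hc l
      simp only [LinearMap.comp_apply] at this
      rw [map_sub, this]
      exact sub_eq_zero.2 hl.symm
    refine ⟨⟨y - s.f l, h1⟩, ?_⟩
    change s.g (y - s.f l) = _
    have h2 := LinearMap.congr_fun (seq_sh s).zero l
    simp only [LinearMap.comp_apply, LinearMap.zero_apply] at h2
    rw [map_sub, h2, sub_zero]
  obtain ⟨w, hw⟩ := proj_lift hF hgM p
  let w1 : F.M →ₗ[R] s.m.M := sub.ι s.m (LinearMap.ker c) ∘ₗ w
  have hcw : ∀ x, c (w1 x) = 0 := fun x => (w x).2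
  have hgw : s.g ∘ₗ w1 = p := hw
  obtain ⟨v, hv⟩ := (seq_sh s).factor_left (w1 ∘ₗ ι) (by
    rw [← LinearMap.comp_assoc, hgw]; exact hs.zero)
  have hvr : ∀ x, v x ∈ LinearMap.range h := by
    intro x
    rw [← hker, LinearMap.mem_ker]
    have h1 := LinearMap.congr_fun hc (v x)
    have h2 := LinearMap.congr_fun hv x
    simp only [LinearMap.comp_apply] at h1 h2
    rw [← h1, h2]; exact hcw _
  obtain ⟨t, ht⟩ := proj_lift (N := sub s.l (LinearMap.range h)) hΩ
    (g := LinearMap.rangeRestrict h) h.surjective_rangeRestrict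
    (LinearMap.codRestrict (LinearMap.range h) v hvr)
  have ht' : ∀ x, h (t x) = v x := fun x => congrArg Subtype.val (LinearMap.congr_fun ht x)
  obtain ⟨ρ, hρ⟩ := hne.extend hs t
  obtain ⟨z, hz⟩ := hs.factor_right (w1 - s.f ∘ₗ h ∘ₗ ρ) (by
    ext x
    have h1 := LinearMap.congr_fun hρ x
    have h2 := LinearMap.congr_fun hv x
    simp only [LinearMap.comp_apply] at h1 h2
    simp [h1, ht', h2])
  apply s.not_split
  refine ⟨z, ?_⟩
  ext x
  obtain ⟨y, rfl⟩ := hp x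
  have h1 := LinearMap.congr_fun hz y
  have h2 := LinearMap.congr_fun hgw y
  have h3 := LinearMap.congr_fun (seq_sh s).zero (h (ρ y))
  simp only [LinearMap.comp_apply, LinearMap.sub_apply, LinearMap.zero_apply] at h1 h2 h3 ⊢
  rw [h1, map_sub, h2, h3, sub_zero]; rfl

/-- precomposition -/
def preK (K : Type u) {R : Type u} [CommRing K] [Ring R] [Algebra K R] {X Y : ModA R}
    (f : X.M →ₗ[R] Y.M) (W : ModA R) : (Y.M →ₗ[R] W.M) →ₗ[K] (X.M →ₗ[R] W.M) where
  toFun g := g ∘ₗ f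
  map_add' _ _ := rfl
  map_smul' _ _ := rfl

/-- postcomposition -/
def postK (K : Type u) {R : Type u} [CommRing K] [Ring R] [Algebra K R] {X Y : ModA R}
    (f : X.M →ₗ[R] Y.M) (W : ModA R) : (W.M →ₗ[R] X.M) →ₗ[K] (W.M →ₗ[R] Y.M) where
  toFun g := f ∘ₗ g
  map_add' _ _ := by ext; simp
  map_smul' k g := by
    ext x
    simp only [LinearMap.comp_apply, LinearMap.smul_apply, RingHom.id_apply]
    rw [kmod_def, kmod_def, map_smul f]

theorem ln_seq {V W U : Type u} [AddCommGroup V] [Module K V]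
    [AddCommGroup W] [Module K W] [AddCommGroup U] [Module K U] [IsNoetherian K V] [IsArtinian K V]
    [IsNoetherian K U] [IsArtinian K U] (α : V →ₗ[K] W) (β : W →ₗ[K] U)
    (hα : Function.Injective α) (hex : LinearMap.range α = LinearMap.ker β) :
    (Function.Surjective β → ln K V + ln K U - ln K W = 0) ∧
    (¬ Function.Surjective β → 0 < ln K V + ln K U - ln K W) := by
  have h1 : ln K W = ln K V + ln K (LinearMap.range β) := by
    refine ln_exact α β.rangeRestrict hα β.surjective_rangeRestrict ?_
    rw [LinearMap.exact_iff, LinearMap.ker_rangeRestrict, hex]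
  have h2 : ln K U = ln K (LinearMap.range β) + ln K (U ⧸ LinearMap.range β) := by
    refine ln_exact (LinearMap.range β).subtype (LinearMap.range β).mkQ
      (Submodule.subtype_injective _) (Submodule.mkQ_surjective _) ?_
    rw [LinearMap.exact_iff]; simp
  constructor
  · intro hs
    have : ln K (U ⧸ LinearMap.range β) = 0 := by
      apply ln_zero
      intro v
      obtain ⟨x, rfl⟩ := Submodule.mkQ_surjective _ v
      obtain ⟨y, rfl⟩ := hs x
      rw [Submodule.mkQ_apply, Submodule.Quotient.mk_eq_zero]
      exact ⟨y, rfl⟩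
    omega
  · intro hs
    have : 0 < ln K (U ⧸ LinearMap.range β) := by
      rw [Function.Surjective] at hs
      push Not at hs
      obtain ⟨x, hx⟩ := hs
      apply ln_pos (Submodule.Quotient.mk x)
      rw [Ne, Submodule.Quotient.mk_eq_zero]
      rintro ⟨y, hy⟩
      exact hx y hy
    omega

theorem sum_comp' {R : Type u} [Ring R] {X Y Z : ModA R} {n : ℕ} (c : Fin n → Y.M →ₗ[R] Z.M)
    (f : X.M →ₗ[R] Y.M) : (∑ k, c k) ∘ₗ f = ∑ k, c k ∘ₗ f := by
  ext x; simp

theorem comp_sum' {R : Type u} [Ring R] {X Y Z : ModA R} {n : ℕ} (c : Fin n → X.M →ₗ[R] Y.M)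
    (f : Y.M →ₗ[R] Z.M) : f ∘ₗ (∑ k, c k) = ∑ k, f ∘ₗ c k := by
  ext x; simp

theorem ln_from_bip {X : ModA R} {n : ℕ} {Z : Fin n → ARVertex R} (B : BiP X n Z) (W : ModA R) :
    ln K (X.M →ₗ[R] W.M) = ∑ k, ln K ((rep (Z k)).M →ₗ[R] W.M) := by
  rw [← ln_pi]
  refine ln_equiv (LinearEquiv.ofBijective (LinearMap.pi fun k => preK K (B.i k) W) ⟨?_, ?_⟩)
  · intro f g hfg
    rw [B.expand f, B.expand g]
    refine Finset.sum_congr rfl fun k _ => ?_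
    have : f ∘ₗ B.i k = g ∘ₗ B.i k := congrFun hfg k
    rw [this]
  · intro c
    refine ⟨∑ k, c k ∘ₗ B.p k, ?_⟩
    funext k
    change (∑ l, c l ∘ₗ B.p l) ∘ₗ B.i k = c k
    rw [sum_comp', Finset.sum_eq_single k]
    · rw [LinearMap.comp_assoc, B.pi, LinearMap.comp_id]
    · intro l _ hl
      rw [LinearMap.comp_assoc, B.orth l k hl, LinearMap.comp_zero]
    · simp

theorem ln_to_bip {X : ModA R} {n : ℕ} {Z : Fin n → ARVertex R} (B : BiP X n Z) (W : ModA R) :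
    ln K (W.M →ₗ[R] X.M) = ∑ k, ln K (W.M →ₗ[R] (rep (Z k)).M) := by
  rw [← ln_pi]
  refine ln_equiv (LinearEquiv.ofBijective (LinearMap.pi fun k => postK K (B.p k) W) ⟨?_, ?_⟩)
  · intro f g hfg
    rw [B.expand' f, B.expand' g]
    refine Finset.sum_congr rfl fun k _ => ?_
    have : B.p k ∘ₗ f = B.p k ∘ₗ g := congrFun hfg k
    rw [this]
  · intro c
    refine ⟨∑ k, B.i k ∘ₗ c k, ?_⟩
    funext k
    change B.p k ∘ₗ (∑ l, B.i l ∘ₗ c l) = c k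
    rw [comp_sum', Finset.sum_eq_single k]
    · rw [← LinearMap.comp_assoc, B.pi, LinearMap.id_comp]
    · intro l _ hl
      rw [← LinearMap.comp_assoc, B.orth k l (Ne.symm hl), LinearMap.zero_comp]
    · simp

theorem ln_dom_iso {X X' : ModA R} (e : X.M ≃ₗ[R] X'.M) (W : ModA R) :
    ln K (X.M →ₗ[R] W.M) = ln K (X'.M →ₗ[R] W.M) := by
  refine ln_equiv (LinearEquiv.ofBijective (preK K e.symm.toLinearMap W) ⟨?_, ?_⟩)
  · intro f g h
    ext x
    have := LinearMap.congr_fun h (e x)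
    simpa [preK] using this
  · intro f
    refine ⟨f ∘ₗ e.toLinearMap, ?_⟩
    ext x; simp [preK]

theorem ln_cod_iso {X X' : ModA R} (e : X.M ≃ₗ[R] X'.M) (W : ModA R) :
    ln K (W.M →ₗ[R] X.M) = ln K (W.M →ₗ[R] X'.M) := by
  refine ln_equiv (LinearEquiv.ofBijective (postK K e.toLinearMap W) ⟨?_, ?_⟩)
  · intro f g h
    ext x
    have := LinearMap.congr_fun h x
    simpa [postK] using this
  · intro f
    refine ⟨e.symm.toLinearMap ∘ₗ f, ?_⟩
    ext x; simp [postK]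

/-- middle of an almost split sequence: lengths from a test object -/
theorem ln_hom_left {X Y Z : ModA R} {f : X.M →ₗ[R] Y.M} {g : Y.M →ₗ[R] Z.M} (hf : Function.Injective f)
    (hex : LinearMap.range f = LinearMap.ker g) (W : ModA R) :
    ((∀ t : W.M →ₗ[R] Z.M, ∃ t' : W.M →ₗ[R] Y.M, g ∘ₗ t' = t) →
      ln K (W.M →ₗ[R] X.M) + ln K (W.M →ₗ[R] Z.M) - ln K (W.M →ₗ[R] Y.M) = 0) ∧
    ((¬ ∀ t : W.M →ₗ[R] Z.M, ∃ t' : W.M →ₗ[R] Y.M, g ∘ₗ t' = t) →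
      0 < ln K (W.M →ₗ[R] X.M) + ln K (W.M →ₗ[R] Z.M) - ln K (W.M →ₗ[R] Y.M)) := by
  refine ln_seq (postK K f W) (postK K g W) ?_ ?_
  · intro a b hab
    ext x
    exact hf (LinearMap.congr_fun hab x)
  · apply le_antisymm
    · rintro _ ⟨a, rfl⟩
      rw [LinearMap.mem_ker]
      ext x
      have : f (a x) ∈ LinearMap.ker g := by rw [← hex]; exact ⟨_, rfl⟩
      exact this
    · intro a ha
      rw [LinearMap.mem_ker] at ha
      obtain ⟨t, ht⟩ := factor_inj hf a (by
        rw [hex]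
        rintro _ ⟨x, rfl⟩
        exact LinearMap.congr_fun ha x)
      exact ⟨t, ht⟩

theorem ln_hom_right {X Y Z : ModA R} {f : X.M →ₗ[R] Y.M} {g : Y.M →ₗ[R] Z.M}
    (hg : Function.Surjective g) (hex : LinearMap.range f = LinearMap.ker g) (W : ModA R) :
    ((∀ t : X.M →ₗ[R] W.M, ∃ t' : Y.M →ₗ[R] W.M, t' ∘ₗ f = t) →
      ln K (Z.M →ₗ[R] W.M) + ln K (X.M →ₗ[R] W.M) - ln K (Y.M →ₗ[R] W.M) = 0) ∧
    ((¬ ∀ t : X.M →ₗ[R] W.M, ∃ t' : Y.M →ₗ[R] W.M, t' ∘ₗ f = t) →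
      0 < ln K (Z.M →ₗ[R] W.M) + ln K (X.M →ₗ[R] W.M) - ln K (Y.M →ₗ[R] W.M)) := by
  refine ln_seq (preK K g W) (preK K f W) ?_ ?_
  · intro a b hab
    ext x
    obtain ⟨y, rfl⟩ := hg x
    exact LinearMap.congr_fun hab y
  · apply le_antisymm
    · rintro _ ⟨a, rfl⟩
      rw [LinearMap.mem_ker]
      ext x
      have : f x ∈ LinearMap.ker g := by rw [← hex]; exact ⟨_, rfl⟩
      change a (g (f x)) = 0
      rw [LinearMap.mem_ker.1 this, map_zero]
    · intro a ha
      rw [LinearMap.mem_ker] at ha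
      obtain ⟨t, ht⟩ := factor_surj hg a (by
        rw [← hex]
        rintro _ ⟨x, rfl⟩
        exact LinearMap.congr_fun ha x)
      exact ⟨t, ht⟩
end
end CF

namespace CF
section
set_option linter.unusedSectionVars false

variable {K R : Type u} [CommRing K] [IsArtinianRing K] [Ring R] [Algebra K R] [Module.Finite K R]

section
variable {R : Type u} [Ring R]

theorem bip_of {n : ℕ} (Z : Fin n → ARVertex R) : ∃ X : ModA R, Nonempty (BiP X n Z) := by
  classical
  refine ⟨⟨∀ k, (rep (Z k)).M, isFiniteLength_iff_isNoetherian_isArtinian.2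
    ⟨inferInstance, inferInstance⟩⟩, ⟨⟨fun k => LinearMap.single R (fun k => (rep (Z k)).M) k,
    fun k => LinearMap.proj k, ?_, ?_, ?_⟩⟩⟩
  · intro k; ext x; simp
  · intro k l hkl; ext x; simp [hkl]
  · refine LinearMap.ext fun x => ?_
    rw [LinearMap.sum_apply]
    funext l
    rw [Finset.sum_apply]
    simp only [LinearMap.comp_apply, LinearMap.coe_proj, Function.eval, LinearMap.id_apply,
      LinearMap.single_apply]
    rw [Finset.sum_eq_single l]
    · simp
    · intro k _ hk; simp [Ne.symm hk]
    · simp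

theorem proj_retract {X Y : ModA R} (h : Module.Projective R Y.M) (i : X.M →ₗ[R] Y.M)
    (p : Y.M →ₗ[R] X.M) (hpi : p ∘ₗ i = LinearMap.id) : Module.Projective R X.M :=
  Module.Projective.of_split i p hpi

theorem inj_retract {X Y : ModA R} (h : Module.Injective R Y.M) (i : X.M →ₗ[R] Y.M)
    (p : Y.M →ₗ[R] X.M) (hpi : p ∘ₗ i = LinearMap.id) : Module.Injective R X.M := by
  refine ⟨fun M N _ _ _ _ j hj g => ?_⟩
  obtain ⟨t, ht⟩ := h.out j hj (i ∘ₗ g)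
  refine ⟨p ∘ₗ t, fun x => ?_⟩
  have := LinearMap.congr_fun hpi (g x)
  simp only [LinearMap.comp_apply, LinearMap.id_apply] at this ht ⊢
  rw [ht, this]

theorem proj_iff {x : ARVertex R} : IsProjVertex x ↔ Module.Projective R (rep x).M := by
  constructor
  · rintro ⟨X, rfl, h⟩
    obtain ⟨e⟩ := rep_mk X
    exact Module.Projective.of_equiv e.symm
  · intro h; exact ⟨⟨rep x, rep_indec x⟩, mk_rep x, h⟩

theorem inj_iff {x : ARVertex R} : IsInjVertex x ↔ Module.Injective R (rep x).M := by
  constructor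
  · rintro ⟨X, rfl, h⟩
    obtain ⟨e⟩ := rep_mk X
    exact injective_equiv e.symm h
  · intro h; exact ⟨⟨rep x, rep_indec x⟩, mk_rep x, h⟩

/-- almost split sequence, unbundled -/
structure ASS {X Y Z : ModA R} (f : X.M →ₗ[R] Y.M) (g : Y.M →ₗ[R] Z.M) : Prop where
  sh : Sh f g
  ns : ¬ SplitEpiMap g
  hl : X.IsIndec
  hr : Z.IsIndec
  ra : ∀ (W : ModA R) (h : W.M →ₗ[R] Z.M), ¬SplitEpiMap h → ∃ h' : W.M →ₗ[R] Y.M, g.comp h' = h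
  la : ∀ (W : ModA R) (h : X.M →ₗ[R] W.M), ¬SplitMonoMap h → ∃ h' : Y.M →ₗ[R] W.M, h'.comp f = h

/-- bundled -/
def ASS.seq {X Y Z : ModA R} {f : X.M →ₗ[R] Y.M} {g : Y.M →ₗ[R] Z.M} (h : ASS f g) :
    AlmostSplitSeq R := ⟨X, Y, Z, f, g, h.sh.inj, h.sh.surj, h.sh.ex, h.ns, h.hl, h.hr, h.ra, h.la⟩

theorem ASS.nm {X Y Z : ModA R} {f : X.M →ₗ[R] Y.M} {g : Y.M →ₗ[R] Z.M} (h : ASS f g) :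
    ¬ SplitMonoMap f := seq_nm h.seq

theorem ass_iso (s : AlmostSplitSeq R) {X Z : ModA R} (e : s.l.M ≃ₗ[R] X.M) (d : s.r.M ≃ₗ[R] Z.M) :
    ∃ (f : X.M →ₗ[R] s.m.M) (g : s.m.M →ₗ[R] Z.M), ASS f g := by
  refine ⟨s.f ∘ₗ e.symm.toLinearMap, d.toLinearMap ∘ₗ s.g, ⟨?_, ?_, ?_⟩, ?_, ?_, ?_, ?_, ?_⟩
  · exact s.inj.comp e.symm.injective
  · exact d.surjective.comp s.surj
  · rw [LinearMap.range_comp, LinearEquiv.range, Submodule.map_top, LinearMap.ker_comp,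
      LinearEquiv.ker, Submodule.comap_bot, s.exact]
  · rintro ⟨t, ht⟩
    apply s.not_split
    refine ⟨t ∘ₗ d.toLinearMap, ?_⟩
    ext x
    have := LinearMap.congr_fun ht (d x)
    simpa using this
  · exact indec_iso e s.l_indec
  · exact indec_iso d s.r_indec
  · intro W h hh
    obtain ⟨h', hh'⟩ := s.right_almost W (d.symm.toLinearMap ∘ₗ h) (by
      rintro ⟨t, ht⟩
      apply hh
      refine ⟨t ∘ₗ d.symm.toLinearMap, ?_⟩
      ext x
      have := LinearMap.congr_fun ht (d.symm x)
      simpa using this)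
    refine ⟨h', ?_⟩
    ext x
    have := LinearMap.congr_fun hh' x
    simp only [LinearMap.comp_apply, LinearEquiv.coe_coe] at this ⊢
    rw [this]; simp
  · intro W h hh
    obtain ⟨h', hh'⟩ := s.left_almost W (h ∘ₗ e.toLinearMap) (by
      rintro ⟨t, ht⟩
      apply hh
      refine ⟨e.toLinearMap ∘ₗ t, ?_⟩
      ext x
      have := LinearMap.congr_fun ht (e.symm x)
      simp only [LinearMap.comp_apply, LinearEquiv.coe_coe, LinearEquiv.apply_symm_apply,
        LinearMap.id_apply] at this ⊢
      rw [this]; simp)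
    refine ⟨h', ?_⟩
    ext x
    have := LinearMap.congr_fun hh' (e.symm x)
    simp only [LinearMap.comp_apply, LinearEquiv.coe_coe] at this ⊢
    rw [this]; simp

theorem tau_ass {a b : ARVertex R} (h : TauRel a b) :
    ∃ (m : ModA R) (f : (rep a).M →ₗ[R] m.M) (g : m.M →ₗ[R] (rep b).M), ASS f g := by
  obtain ⟨X, Y, rfl, rfl, s, ⟨e⟩, ⟨d⟩⟩ := h
  obtain ⟨e'⟩ := rep_mk X
  obtain ⟨d'⟩ := rep_mk Y
  obtain ⟨f, g, h⟩ := ass_iso s (e ≪≫ₗ e'.symm) (d ≪≫ₗ d'.symm)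
  exact ⟨s.m, f, g, h⟩

theorem tau_of_seq (s : AlmostSplitSeq R) {a b : ARVertex R} (e : s.l.M ≃ₗ[R] (rep a).M)
    (d : s.r.M ≃ₗ[R] (rep b).M) : TauRel a b :=
  ⟨⟨rep a, rep_indec a⟩, ⟨rep b, rep_indec b⟩, mk_rep a, mk_rep b, s, ⟨e⟩, ⟨d⟩⟩

end

theorem tau_l' {a a' b : ARVertex R} (h : TauRel a b) (h' : TauRel a' b) : a = a' := by
  obtain ⟨m, f, g, h1⟩ := tau_ass h
  obtain ⟨m', f', g', h2⟩ := tau_ass h'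
  obtain ⟨e⟩ := tau_unique h1.seq h2.seq (LinearEquiv.refl R _)
  exact eq_of_iso e

theorem tau_r' (K : Type u) {R : Type u} [CommRing K] [IsArtinianRing K] [Ring R] [Algebra K R]
    [Module.Finite K R] {a b b' : ARVertex R} (h : TauRel a b) (h' : TauRel a b') : b = b' := by
  obtain ⟨m, f, g, h1⟩ := tau_ass h
  obtain ⟨m', f', g', h2⟩ := tau_ass h'
  obtain ⟨e⟩ := tau_unique' K h1.seq h2.seq (LinearEquiv.refl R _)
  exact eq_of_iso e

theorem proj_or' (K : Type u) {R : Type u} [CommRing K] [IsArtinianRing K] [Ring R] [Algebra K R]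
    [Module.Finite K R] (b : ARVertex R) (h : ¬ IsProjVertex b) : ∃ a, TauRel a b := by
  obtain ⟨s, hs⟩ := ar_exists K (rep_indec b) (fun hp => h (proj_iff.2 hp))
  obtain ⟨a, ⟨e⟩⟩ := exists_rep s.l_indec
  refine ⟨a, tau_of_seq s e.symm (by rw [hs])⟩

theorem inj_or' (K : Type u) {R : Type u} [CommRing K] [IsArtinianRing K] [Ring R] [Algebra K R]
    [Module.Finite K R] (a : ARVertex R) (h : ¬ IsInjVertex a) : ∃ b, TauRel a b := by
  obtain ⟨s, ⟨hs⟩⟩ := ar_exists_left K (rep_indec a) (fun hp => h (inj_iff.2 hp))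
  obtain ⟨b, ⟨e⟩⟩ := exists_rep s.r_indec
  exact ⟨b, tau_of_seq s hs e.symm⟩

/-- number of vertices -/
noncomputable def nvv (K R : Type u) [CommRing K] [IsArtinianRing K] [Ring R] [Algebra K R]
    [Module.Finite K R] : ℕ := (exists_biP (fr K R 1)).choose

/-- indecomposable projectives -/
noncomputable def PV (K R : Type u) [CommRing K] [IsArtinianRing K] [Ring R] [Algebra K R]
    [Module.Finite K R] : Fin (nvv K R) → ARVertex R := (exists_biP (fr K R 1)).choose_spec.choose

theorem PV_bip (K R : Type u) [CommRing K] [IsArtinianRing K] [Ring R] [Algebra K R]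
    [Module.Finite K R] : Nonempty (BiP (fr K R 1) (nvv K R) (PV K R)) :=
  (exists_biP (fr K R 1)).choose_spec.choose_spec

theorem proj_PV (K : Type u) {R : Type u} [CommRing K] [IsArtinianRing K] [Ring R] [Algebra K R]
    [Module.Finite K R] (x : ARVertex R) (hx : Module.Projective R (rep x).M) : ∃ i, PV K R i = x := by
  classical
  obtain ⟨B⟩ := PV_bip K R
  obtain ⟨n, g, hg⟩ := Module.Finite.exists_fin' R (rep x).M
  obtain ⟨s, hs⟩ := Module.projective_lifting_property g LinearMap.id hg
  let c : Fin n → (rep x).M →ₗ[R] (fr K R 1).M := fun k =>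
    LinearMap.pi fun _ : Fin 1 => LinearMap.proj k ∘ₗ s
  let d : Fin n → (fr K R 1).M →ₗ[R] (rep x).M := fun k =>
    g ∘ₗ LinearMap.single R (fun _ : Fin n => R) k ∘ₗ (LinearMap.proj 0 : (Fin 1 → R) →ₗ[R] R)
  have hsum : ∑ k, d k ∘ₗ c k = LinearMap.id := by
    rw [← hs]
    refine LinearMap.ext fun y => ?_
    rw [LinearMap.sum_apply, LinearMap.comp_apply]
    have : s y = ∑ k, Pi.single k (s y k) := by
      funext l; rw [Finset.sum_apply]; simp
    conv_rhs => rw [this, map_sum]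
    rfl
  obtain ⟨k, -, hk⟩ := nonbij_sum (rep_indec x) Finset.univ (fun k => d k ∘ₗ c k) (by
    rw [hsum]; exact Function.bijective_id)
  obtain ⟨i, hi, -⟩ := B.exists_bij (rep_indec x) (c k) (d k) hk
  exact ⟨i, (eq_of_bij _ hi).symm⟩

theorem proj_vec {F : ModA R} (hF : Module.Projective R F.M) : ∃ g : Fin (nvv K R) → ℤ,
    ∀ Y : ModA R, ln K (F.M →ₗ[R] Y.M) = ∑ i, g i * ln K ((rep (PV K R i)).M →ₗ[R] Y.M) := by
  classical
  obtain ⟨n, Z, ⟨B⟩⟩ := exists_biP F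
  choose c hc using fun k => proj_PV K (Z k) (proj_retract hF (B.i k) (B.p k) (B.pi k))
  refine ⟨fun i => ∑ k, if c k = i then 1 else 0, fun Y => ?_⟩
  rw [ln_from_bip B]
  simp_rw [Finset.sum_mul]
  rw [Finset.sum_comm]
  refine Finset.sum_congr rfl fun k _ => ?_
  rw [Finset.sum_eq_single (c k)]
  · rw [hc]; simp
  · intro i _ hi; simp [Ne.symm hi]
  · simp

theorem gvec (s : AlmostSplitSeq R)
    (hI : ∀ I : ModA R, Module.Injective R I.M → ∀ h : I.M →ₗ[R] s.l.M, h = 0) :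
    ∃ g : Fin (nvv K R) → ℤ, ∀ Y : ModA R, (∀ h : Y.M →ₗ[R] s.l.M, h = 0) →
      ln K (s.r.M →ₗ[R] Y.M) = ∑ i, g i * ln K ((rep (PV K R i)).M →ₗ[R] Y.M) := by
  obtain ⟨F, p, hF, hp⟩ := exists_free_cover K s.r
  have hs := sub_ker p hp
  have hΩ := pd_one K s hI hs hF
  obtain ⟨g1, h1⟩ := proj_vec (K := K) hF
  obtain ⟨g2, h2⟩ := proj_vec (K := K) hΩ
  refine ⟨fun i => g1 i - g2 i, fun Y hY => ?_⟩
  have h3 := (ln_hom_right (K := K) hs.surj hs.ex Y).1 (fun t => (ar_one s hY).extend hs t)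
  simp_rw [sub_mul]
  rw [Finset.sum_sub_distrib, ← h1, ← h2]
  omega

theorem all_inj {X : ModA R} (h : ∀ i : ARVertex R, IsInjVertex i → ∀ f : (rep i).M →ₗ[R] X.M, f = 0)
    (I : ModA R) (hI : Module.Injective R I.M) (f : I.M →ₗ[R] X.M) : f = 0 := by
  obtain ⟨n, Z, ⟨B⟩⟩ := exists_biP I
  rw [B.expand f]
  refine Finset.sum_eq_zero fun k _ => ?_
  rw [h (Z k) (inj_iff.2 (inj_retract hI (B.i k) (B.p k) (B.pi k))) (f ∘ₗ B.i k), LinearMap.zero_comp]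

theorem all_proj {X : ModA R} (h : ∀ i : ARVertex R, IsProjVertex i → ∀ f : X.M →ₗ[R] (rep i).M, f = 0)
    (I : ModA R) (hI : Module.Projective R I.M) (f : X.M →ₗ[R] I.M) : f = 0 := by
  obtain ⟨n, Z, ⟨B⟩⟩ := exists_biP I
  rw [B.expand' f]
  refine Finset.sum_eq_zero fun k _ => ?_
  rw [h (Z k) (proj_iff.2 (proj_retract hI (B.i k) (B.p k) (B.pi k))) (B.p k ∘ₗ f), LinearMap.comp_zero]

theorem gvec' (s : AlmostSplitSeq R)
    (hP : ∀ P : ModA R, Module.Projective R P.M → ∀ h : s.r.M →ₗ[R] P.M, h = 0) :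
    ∃ g : Fin (nvv K Rᵐᵒᵖ) → ℤ, ∀ Y : ModA R, (∀ h : s.r.M →ₗ[R] Y.M, h = 0) →
      ln K (Y.M →ₗ[R] s.l.M) =
        ∑ i, g i * ln K ((rep (PV K Rᵐᵒᵖ i)).M →ₗ[Rᵐᵒᵖ] (D (antiOp K R) Y).M) := by
  obtain ⟨g, hg⟩ := gvec (K := K) (dualSeq (antiOp K R) s) (by
    intro I hI h
    let e := eta (antiOp K R).symm I
    obtain ⟨f, hf⟩ := Dm_surj (antiOp K R) (X := s.r) (Y := D (antiOp K R).symm I)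
      (h ∘ₗ e.symm.toLinearMap)
    have h0 := hP _ (D_proj_of_inj (antiOp K R).symm hI) f
    rw [h0, Dm_zero] at hf
    refine LinearMap.ext fun x => ?_
    have := LinearMap.congr_fun hf (e x)
    have h3 : h (e.symm (e x)) = 0 := this.symm
    rw [LinearEquiv.symm_apply_apply] at h3
    exact h3)
  refine ⟨g, fun Y hY => ?_⟩
  rw [← hg (D (antiOp K R) Y) (by
    intro h
    obtain ⟨f, hf⟩ := Dm_surj (antiOp K R) (X := s.r) (Y := Y) h
    rw [← hf, hY f, Dm_zero]; rfl)]
  exact ln_equiv (DmEquiv (antiOp K R) Y s.l)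

theorem inj_vec {F : ModA R} (hF : Module.Injective R F.M) : ∃ g : Fin (nvv K Rᵐᵒᵖ) → ℤ,
    ∀ Y : ModA R, ln K (Y.M →ₗ[R] F.M) =
      ∑ i, g i * ln K ((rep (PV K Rᵐᵒᵖ i)).M →ₗ[Rᵐᵒᵖ] (D (antiOp K R) Y).M) := by
  obtain ⟨g, hg⟩ := proj_vec (K := K) (D_proj_of_inj (antiOp K R) hF)
  refine ⟨g, fun Y => ?_⟩
  rw [← hg]
  exact ln_equiv (DmEquiv (antiOp K R) Y F)
end
end CF

namespace CF
section
set_option linter.unusedSectionVars false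

variable {K R : Type u} [CommRing K] [IsArtinianRing K] [Ring R] [Algebra K R] [Module.Finite K R]

section
variable {R : Type u} [Ring R]

/-- the radical of a hom group between indecomposables -/
def NB (a b : ARVertex R) : AddSubgroup ((rep a).M →ₗ[R] (rep b).M) where
  carrier := {f | ¬ Function.Bijective f}
  zero_mem' := by
    intro h
    have := (rep_indec a).1
    obtain ⟨x, hx⟩ := exists_ne (0 : (rep a).M)
    exact hx (h.1 rfl)
  add_mem' := by
    intro f g hf hg hfg
    let e := LinearEquiv.ofBijective _ hfg
    have key : ∀ h : (rep a).M →ₗ[R] (rep b).M, Function.Bijective (e.symm.toLinearMap ∘ₗ h) →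
        Function.Bijective h := by
      intro h hb
      have : (h : (rep a).M → (rep b).M) = e ∘ (e.symm.toLinearMap ∘ₗ h) := by
        funext x; simp
      rw [this]; exact e.bijective.comp hb
    have hs : e.symm.toLinearMap ∘ₗ f + e.symm.toLinearMap ∘ₗ g = LinearMap.id := by
      ext x
      have : e.symm (e x) = x := e.symm_apply_apply x
      rw [← LinearMap.comp_add]
      exact this
    rcases nonbij_add (rep_indec a) (by rw [hs]; exact Function.bijective_id) with h | h
    · exact hf (key f h)
    · exact hg (key g h)
  neg_mem' := by
    intro f hf h
    apply hf
    have : (f : (rep a).M → (rep b).M) = (fun x => -x) ∘ (-f : (rep a).M →ₗ[R] (rep b).M) := by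
      funext x; simp
    rw [this]; exact (Equiv.neg _).bijective.comp h

theorem mem_NB {a b : ARVertex R} {f : (rep a).M →ₗ[R] (rep b).M} :
    f ∈ NB a b ↔ ¬ Function.Bijective f := Iff.rfl

theorem NB_epi {a b : ARVertex R} {f : (rep a).M →ₗ[R] (rep b).M} (h : f ∈ NB a b) :
    ¬ SplitEpiMap f := fun hs => h (splitEpi_bij (rep_indec a) (rep_indec b) hs)

theorem NB_mono {a b : ARVertex R} {f : (rep a).M →ₗ[R] (rep b).M} (h : f ∈ NB a b) :
    ¬ SplitMonoMap f := fun hs => h (splitMono_bij (rep_indec a) (rep_indec b) hs)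

theorem NB_l {a b c : ARVertex R} (f : (rep a).M →ₗ[R] (rep b).M) (g : (rep b).M →ₗ[R] (rep c).M)
    (h : f ∈ NB a b) : g ∘ₗ f ∈ NB a c := by
  intro hb
  apply NB_mono h
  refine ⟨(LinearEquiv.ofBijective _ hb).symm.toLinearMap ∘ₗ g, ?_⟩
  ext x; exact (LinearEquiv.ofBijective _ hb).symm_apply_apply x

theorem NB_r {a b c : ARVertex R} (f : (rep a).M →ₗ[R] (rep b).M) (g : (rep b).M →ₗ[R] (rep c).M)
    (h : g ∈ NB b c) : g ∘ₗ f ∈ NB a c := by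
  intro hb
  apply NB_epi h
  refine ⟨f ∘ₗ (LinearEquiv.ofBijective _ hb).symm.toLinearMap, ?_⟩
  ext x; exact (LinearEquiv.ofBijective _ hb).apply_symm_apply x

theorem mono_of_comp_bij {X Y : ModA R} {b : ARVertex R} (f : X.M →ₗ[R] Y.M) (p : Y.M →ₗ[R] (rep b).M)
    (h : Function.Bijective (p ∘ₗ f)) : SplitMonoMap f :=
  ⟨(LinearEquiv.ofBijective _ h).symm.toLinearMap ∘ₗ p, by
    ext x; exact (LinearEquiv.ofBijective _ h).symm_apply_apply x⟩

theorem epi_of_comp_bij {X Y : ModA R} {b : ARVertex R} (g : X.M →ₗ[R] Y.M) (i : (rep b).M →ₗ[R] X.M)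
    (h : Function.Bijective (g ∘ₗ i)) : SplitEpiMap g :=
  ⟨i ∘ₗ (LinearEquiv.ofBijective _ h).symm.toLinearMap, by
    ext x; exact (LinearEquiv.ofBijective _ h).apply_symm_apply x⟩

theorem BiP.p_sum {X : ModA R} {n : ℕ} {Z : Fin n → ARVertex R} (B : BiP X n Z) {W : ModA R}
    (c : ∀ k, W.M →ₗ[R] (rep (Z k)).M) (k : Fin n) : B.p k ∘ₗ (∑ l, B.i l ∘ₗ c l) = c k := by
  rw [comp_sum', Finset.sum_eq_single k]
  · rw [← LinearMap.comp_assoc, B.pi, LinearMap.id_comp]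
  · intro l _ hl
    rw [← LinearMap.comp_assoc, B.orth k l (Ne.symm hl), LinearMap.zero_comp]
  · simp

theorem BiP.i_sum {X : ModA R} {n : ℕ} {Z : Fin n → ARVertex R} (B : BiP X n Z) {W : ModA R}
    (c : ∀ k, (rep (Z k)).M →ₗ[R] W.M) (k : Fin n) : (∑ l, c l ∘ₗ B.p l) ∘ₗ B.i k = c k := by
  rw [sum_comp', Finset.sum_eq_single k]
  · rw [LinearMap.comp_assoc, B.pi, LinearMap.comp_id]
  · intro l _ hl
    rw [LinearMap.comp_assoc, B.orth l k hl, LinearMap.comp_zero]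
  · simp

end

theorem c_proj_seq (b : ARVertex R) (hb : IsProjVertex b) :
    ∃ (n : ℕ) (Z : Fin n → ARVertex R) (p : ∀ k, (rep (Z k)).M →ₗ[R] (rep b).M),
    (∀ x, ARArrow x b ↔ ∃ k, Z k = x) ∧ (∀ k, p k ∈ NB _ _) ∧
    (∀ (w : ARVertex R) (f : (rep w).M →ₗ[R] (rep b).M), f ∈ NB w b →
      ∃ c : ∀ k, (rep w).M →ₗ[R] (rep (Z k)).M, f = ∑ k, p k ∘ₗ c k) ∧
    (∀ w : ARVertex R, w ≠ b → ln K ((rep w).M →ₗ[R] (rep b).M) -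
      ∑ k, ln K ((rep w).M →ₗ[R] (rep (Z k)).M) = 0) ∧
    0 < ln K ((rep b).M →ₗ[R] (rep b).M) - ∑ k, ln K ((rep b).M →ₗ[R] (rep (Z k)).M) := by
  obtain ⟨Y, g, hg, hns, hra⟩ := proj_sink (rep_indec b) (proj_iff.1 hb)
  obtain ⟨n, Z, ⟨B⟩⟩ := exists_biP Y
  have hex : LinearMap.range (sub.ι Y ⊥) = LinearMap.ker g := by
    rw [LinearMap.ker_eq_bot.2 hg]
    change LinearMap.range (Submodule.subtype ⊥) = ⊥
    simp
  have h0 : ∀ W : ModA R, ln K (W.M →ₗ[R] (sub Y ⊥).M) = 0 := fun W =>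
    ln_zero (fun f => by
      refine LinearMap.ext fun x => ?_
      exact Subtype.ext ((Submodule.mem_bot R).1 (f x).2))
  refine ⟨n, Z, fun k => g ∘ₗ B.i k, ?_, ?_, ?_, ?_, ?_⟩
  · refine fun x => arrow_sink g hns hra B (fun k c hc => ?_) x
    have : c = 0 := by
      ext y; exact hg (by rw [LinearMap.zero_apply, map_zero]; exact LinearMap.congr_fun hc y)
    rw [this, LinearMap.comp_zero]
    exact not_bij_zero (rep_indec _)
  · intro k hk
    exact hns (epi_of_comp_bij g (B.i k) hk)
  · intro w f hf
    obtain ⟨h', hh'⟩ := hra _ f (NB_epi hf)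
    refine ⟨fun k => B.p k ∘ₗ h', ?_⟩
    rw [← hh']
    conv_lhs => rw [B.expand' h', comp_sum']
    rfl
  · intro w hw
    have := (ln_hom_left (K := K) (sub_inj Y ⊥) hex (rep w)).1 (fun t => by
      obtain ⟨h', hh'⟩ := hra _ t (fun hs => hw (eq_of_bij t (splitEpi_bij (rep_indec _) (rep_indec _) hs)))
      exact ⟨h', hh'⟩)
    rw [h0, ln_to_bip B] at this
    omega
  · have := (ln_hom_left (K := K) (sub_inj Y ⊥) hex (rep b)).2 (fun h => by
      obtain ⟨t', ht'⟩ := h LinearMap.id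
      exact hns ⟨t', ht'⟩)
    rw [h0, ln_to_bip B] at this
    omega

theorem c_inj_seq (a : ARVertex R) (ha : IsInjVertex a) :
    ∃ (n : ℕ) (Z : Fin n → ARVertex R) (i : ∀ k, (rep a).M →ₗ[R] (rep (Z k)).M),
    (∀ x, ARArrow a x ↔ ∃ k, Z k = x) ∧ (∀ k, i k ∈ NB _ _) ∧
    (∀ (w : ARVertex R) (f : (rep a).M →ₗ[R] (rep w).M), f ∈ NB a w →
      ∃ c : ∀ k, (rep (Z k)).M →ₗ[R] (rep w).M, f = ∑ k, c k ∘ₗ i k) ∧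
    (∀ w : ARVertex R, w ≠ a → ln K ((rep a).M →ₗ[R] (rep w).M) -
      ∑ k, ln K ((rep (Z k)).M →ₗ[R] (rep w).M) = 0) ∧
    0 < ln K ((rep a).M →ₗ[R] (rep a).M) - ∑ k, ln K ((rep (Z k)).M →ₗ[R] (rep a).M) := by
  obtain ⟨Y, f, hf, hns, hla⟩ := inj_source K (rep_indec a) (inj_iff.1 ha)
  obtain ⟨n, Z, ⟨B⟩⟩ := exists_biP Y
  have hex : LinearMap.range f = LinearMap.ker (quo.π Y ⊤) := by
    rw [LinearMap.range_eq_top.2 hf]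
    change ⊤ = LinearMap.ker (Submodule.mkQ ⊤)
    simp
  have h0 : ∀ W : ModA R, ln K ((quo Y ⊤).M →ₗ[R] W.M) = 0 := fun W =>
    ln_zero (fun f => by
      refine LinearMap.ext fun x => ?_
      have : x = 0 := by
        obtain ⟨y, rfl⟩ := quo_surj Y ⊤ x
        exact (Submodule.Quotient.mk_eq_zero _).2 trivial
      rw [this, map_zero, map_zero])
  refine ⟨n, Z, fun k => B.p k ∘ₗ f, ?_, ?_, ?_, ?_, ?_⟩
  · refine fun x => arrow_source f hns hla B (fun k c hc => ?_) x
    have : c = 0 := by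
      ext y
      obtain ⟨y, rfl⟩ := hf y
      exact LinearMap.congr_fun hc y
    rw [this, LinearMap.zero_comp]
    exact not_bij_zero (rep_indec _)
  · intro k hk
    exact hns (mono_of_comp_bij f (B.p k) hk)
  · intro w f' hf
    obtain ⟨h', hh'⟩ := hla _ f' (NB_mono hf)
    refine ⟨fun k => h' ∘ₗ B.i k, ?_⟩
    rw [← hh']
    conv_lhs => rw [B.expand h', sum_comp']
    rfl
  · intro w hw
    have := (ln_hom_right (K := K) (quo_surj Y ⊤) hex (rep w)).1 (fun t => by
      obtain ⟨h', hh'⟩ := hla _ t (fun hs => hw (eq_of_bij t (splitMono_bij (rep_indec _) (rep_indec _) hs)).symm)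
      exact ⟨h', hh'⟩)
    rw [h0, ln_from_bip B] at this
    omega
  · have := (ln_hom_right (K := K) (quo_surj Y ⊤) hex (rep a)).2 (fun h => by
      obtain ⟨t', ht'⟩ := h LinearMap.id
      exact hns ⟨t', ht'⟩)
    rw [h0, ln_from_bip B] at this
    omega

theorem c_tau_seq (a b : ARVertex R) (h : TauRel a b) :
    ∃ (n : ℕ) (Z : Fin n → ARVertex R) (i : ∀ k, (rep a).M →ₗ[R] (rep (Z k)).M)
    (p : ∀ k, (rep (Z k)).M →ₗ[R] (rep b).M),
    (∀ x, ARArrow x b ↔ ∃ k, Z k = x) ∧ (∀ x, ARArrow a x ↔ ∃ k, Z k = x) ∧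
    (∀ k, p k ∈ NB _ _) ∧ (∀ k, i k ∈ NB _ _) ∧
    (∀ (w : ARVertex R) (f : (rep w).M →ₗ[R] (rep b).M), f ∈ NB w b →
      ∃ c : ∀ k, (rep w).M →ₗ[R] (rep (Z k)).M, f = ∑ k, p k ∘ₗ c k) ∧
    (∀ (w : ARVertex R) (f : (rep a).M →ₗ[R] (rep w).M), f ∈ NB a w →
      ∃ c : ∀ k, (rep (Z k)).M →ₗ[R] (rep w).M, f = ∑ k, c k ∘ₗ i k) ∧
    (∀ (w : ARVertex R) (c : ∀ k, (rep w).M →ₗ[R] (rep (Z k)).M), ∑ k, p k ∘ₗ c k = 0 →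
      ∃ d : (rep w).M →ₗ[R] (rep a).M, ∀ k, c k = i k ∘ₗ d) ∧
    (∀ (w : ARVertex R) (c : ∀ k, (rep (Z k)).M →ₗ[R] (rep w).M), ∑ k, c k ∘ₗ i k = 0 →
      ∃ d : (rep b).M →ₗ[R] (rep w).M, ∀ k, c k = d ∘ₗ p k) ∧
    (∀ w : ARVertex R, w ≠ b → ln K ((rep w).M →ₗ[R] (rep a).M) + ln K ((rep w).M →ₗ[R] (rep b).M) -
      ∑ k, ln K ((rep w).M →ₗ[R] (rep (Z k)).M) = 0) ∧
    0 < ln K ((rep b).M →ₗ[R] (rep a).M) + ln K ((rep b).M →ₗ[R] (rep b).M) -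
      ∑ k, ln K ((rep b).M →ₗ[R] (rep (Z k)).M) ∧
    (∀ w : ARVertex R, w ≠ a → ln K ((rep a).M →ₗ[R] (rep w).M) + ln K ((rep b).M →ₗ[R] (rep w).M) -
      ∑ k, ln K ((rep (Z k)).M →ₗ[R] (rep w).M) = 0) ∧
    0 < ln K ((rep a).M →ₗ[R] (rep a).M) + ln K ((rep b).M →ₗ[R] (rep a).M) -
      ∑ k, ln K ((rep (Z k)).M →ₗ[R] (rep a).M) ∧ 0 < n := by
  obtain ⟨Y, f, g, hA⟩ := tau_ass h
  obtain ⟨n, Z, ⟨B⟩⟩ := exists_biP Y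
  have hla := hA.la
  have hra := hA.ra
  have hsh := hA.sh
  refine ⟨n, Z, fun k => B.p k ∘ₗ f, fun k => g ∘ₗ B.i k, ?_, ?_, ?_, ?_, ?_, ?_, ?_, ?_, ?_, ?_, ?_, ?_, ?_⟩
  · refine fun x => arrow_sink g hA.ns hra B (fun k c hc hb => ?_) x
    obtain ⟨d, hd⟩ := hsh.factor_left c hc
    rw [← hd] at hb
    have h1 : SplitEpiMap (B.p k ∘ₗ f) := epi_of_comp_bij _ d hb
    exact hA.nm (mono_of_comp_bij f (B.p k) (splitEpi_bij (rep_indec _) (rep_indec _) h1))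
  · refine fun x => arrow_source f hA.nm hla B (fun k c hc hb => ?_) x
    obtain ⟨d, hd⟩ := hsh.factor_right c hc
    rw [← hd] at hb
    have h1 : SplitMonoMap (g ∘ₗ B.i k) := mono_of_comp_bij _ d hb
    exact hA.ns (epi_of_comp_bij g (B.i k) (splitMono_bij (rep_indec _) (rep_indec _) h1))
  · intro k hk
    exact hA.ns (epi_of_comp_bij g (B.i k) hk)
  · intro k hk
    exact hA.nm (mono_of_comp_bij f (B.p k) hk)
  · intro w f' hf
    obtain ⟨h', hh'⟩ := hra _ f' (NB_epi hf)
    refine ⟨fun k => B.p k ∘ₗ h', ?_⟩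
    rw [← hh']
    conv_lhs => rw [B.expand' h', comp_sum']
    rfl
  · intro w f' hf
    obtain ⟨h', hh'⟩ := hla _ f' (NB_mono hf)
    refine ⟨fun k => h' ∘ₗ B.i k, ?_⟩
    rw [← hh']
    conv_lhs => rw [B.expand h', sum_comp']
    rfl
  · intro w c hc
    obtain ⟨d, hd⟩ := hsh.factor_left (∑ l, B.i l ∘ₗ c l) (by rw [comp_sum']; exact hc)
    refine ⟨d, fun k => ?_⟩
    rw [LinearMap.comp_assoc, hd, B.p_sum]
  · intro w c hc
    obtain ⟨d, hd⟩ := hsh.factor_right (∑ l, c l ∘ₗ B.p l) (by rw [sum_comp']; exact hc)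
    refine ⟨d, fun k => ?_⟩
    rw [← LinearMap.comp_assoc, hd, B.i_sum]
  · intro w hw
    have := (ln_hom_left (K := K) hsh.inj hsh.ex (rep w)).1 (fun t => by
      obtain ⟨h', hh'⟩ := hra _ t (fun hs => hw (eq_of_bij t (splitEpi_bij (rep_indec _) (rep_indec _) hs)))
      exact ⟨h', hh'⟩)
    rw [ln_to_bip B] at this
    exact this
  · have := (ln_hom_left (K := K) hsh.inj hsh.ex (rep b)).2 (fun h => by
      obtain ⟨t', ht'⟩ := h LinearMap.id
      exact hA.ns ⟨t', ht'⟩)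
    rw [ln_to_bip B] at this
    exact this
  · intro w hw
    have := (ln_hom_right (K := K) hsh.surj hsh.ex (rep w)).1 (fun t => by
      obtain ⟨h', hh'⟩ := hla _ t (fun hs => hw (eq_of_bij t (splitMono_bij (rep_indec _) (rep_indec _) hs)).symm)
      exact ⟨h', hh'⟩)
    rw [ln_from_bip B] at this
    omega
  · have := (ln_hom_right (K := K) hsh.surj hsh.ex (rep a)).2 (fun h => by
      obtain ⟨t', ht'⟩ := h LinearMap.id
      exact hA.nm ⟨t', ht'⟩)
    rw [ln_from_bip B] at this
    omega
  · rcases Nat.eq_zero_or_pos n with hn | hn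
    · exfalso
      subst hn
      have h1 := B.tot
      rw [Fin.sum_univ_zero] at h1
      have := (rep_indec b).1
      obtain ⟨x, hx⟩ := exists_ne (0 : (rep b).M)
      obtain ⟨y, rfl⟩ := hsh.surj x
      apply hx
      have : y = 0 := (LinearMap.congr_fun h1 y).symm
      rw [this, map_zero]
    · exact hn

theorem c_ex_proj (K : Type u) {R : Type u} [CommRing K] [IsArtinianRing K] [Ring R] [Algebra K R]
    [Module.Finite K R] (X : ModA R) (hX : Nontrivial X.M) :
    ∃ p : ARVertex R, IsProjVertex p ∧ ∃ f : (rep p).M →ₗ[R] X.M, f ≠ 0 := by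
  by_contra hcon
  push Not at hcon
  obtain ⟨P, g, hP, hg⟩ := exists_free_cover K X
  obtain ⟨n, Z, ⟨B⟩⟩ := exists_biP P
  have : g = 0 := by
    rw [B.expand g]
    refine Finset.sum_eq_zero fun k _ => ?_
    rw [hcon (Z k) (proj_iff.2 (proj_retract hP (B.i k) (B.p k) (B.pi k))) (g ∘ₗ B.i k),
      LinearMap.zero_comp]
  obtain ⟨x, hx⟩ := exists_ne (0 : X.M)
  obtain ⟨y, rfl⟩ := hg x
  rw [this] at hx
  exact hx rfl

theorem c_ex_inj (K : Type u) {R : Type u} [CommRing K] [IsArtinianRing K] [Ring R] [Algebra K R]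
    [Module.Finite K R] (X : ModA R) (hX : Nontrivial X.M) :
    ∃ p : ARVertex R, IsInjVertex p ∧ ∃ f : X.M →ₗ[R] (rep p).M, f ≠ 0 := by
  by_contra hcon
  push Not at hcon
  obtain ⟨P, g, hP, hg⟩ := exists_inj_emb K X
  obtain ⟨n, Z, ⟨B⟩⟩ := exists_biP P
  have : g = 0 := by
    rw [B.expand' g]
    refine Finset.sum_eq_zero fun k _ => ?_
    rw [hcon (Z k) (inj_iff.2 (inj_retract hP (B.i k) (B.p k) (B.pi k))) (B.p k ∘ₗ g),
      LinearMap.comp_zero]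
  obtain ⟨x, hx⟩ := exists_ne (0 : X.M)
  apply hx
  apply hg
  rw [this]; rfl
end
end CF

namespace CF
section
set_option linter.unusedSectionVars false

theorem jac_mem {R : Type u} [Ring R] {X : ModA R} {a b : ARVertex R} (q : X.M →ₗ[R] (rep a).M)
    (i : (rep b).M →ₗ[R] X.M) (r : (rep a).M →ₗ[R] (rep b).M) (hr : r ∈ NB a b) :
    (i ∘ₗ r ∘ₗ q : Module.End R X.M) ∈ Ideal.jacobson (⊥ : Ideal (Module.End R X.M)) := by
  rw [Ideal.mem_jacobson_iff]
  intro y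
  have hn : IsNilpotent ((q ∘ₗ y ∘ₗ i) ∘ₗ r : Module.End R (rep a).M) :=
    (fit (rep_indec a) _).resolve_left (NB_l (a := a) (b := b) (c := a) r (q ∘ₗ y ∘ₗ i) hr)
  obtain ⟨v, hv⟩ := hn.isUnit_one_add.exists_left_inv
  refine ⟨1 - (y ∘ₗ i ∘ₗ r) ∘ₗ v ∘ₗ q, ?_⟩
  rw [Ideal.mem_bot]
  refine LinearMap.ext fun x => ?_
  have h1 := LinearMap.congr_fun hv (q x)
  simp only [Module.End.mul_apply, LinearMap.add_apply, Module.End.one_apply, LinearMap.comp_apply,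
    map_add, LinearMap.sub_apply, LinearMap.zero_apply] at h1 ⊢
  have h2 := congrArg (fun t => y (i (r t))) h1
  simp only [map_add] at h2
  have h3 : ∀ p q t s : X.M, t + s = p → p - s + (q - t) - q = 0 := by
    intro p q t s h; rw [← h]; abel
  exact h3 _ _ _ _ h2

theorem c_hs (K : Type u) {R : Type u} [CommRing K] [IsArtinianRing K] [Ring R] [Algebra K R]
    [Module.Finite K R] (U : Set (ARVertex R)) (hU : U.Finite) :
    ∃ (N : ℕ) (J : ℕ → ∀ a b : ARVertex R, AddSubgroup ((rep a).M →ₗ[R] (rep b).M)),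
    (∀ a b f, f ∈ J 0 a b) ∧
    (∀ n a b c f (g : (rep b).M →ₗ[R] (rep c).M), a ∈ U → b ∈ U → c ∈ U → f ∈ J n a b →
      g ∈ NB b c → g ∘ₗ f ∈ J (n + 1) a c) ∧
    (∀ n a b c (f : (rep a).M →ₗ[R] (rep b).M) g, a ∈ U → b ∈ U → c ∈ U → f ∈ NB a b →
      g ∈ J n b c → g ∘ₗ f ∈ J (n + 1) a c) ∧
    (∀ a b f, a ∈ U → b ∈ U → f ∈ J N a b → f = 0) := by
  obtain ⟨n, w, hw⟩ : ∃ (n : ℕ) (w : Fin n → ARVertex R), Set.range w = U := by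
    have := hU.to_subtype
    obtain ⟨n, ⟨e⟩⟩ := Finite.exists_equiv_fin U
    exact ⟨n, fun k => (e.symm k).1, by
      ext x; constructor
      · rintro ⟨k, rfl⟩; exact (e.symm k).2
      · intro hx; exact ⟨e ⟨x, hx⟩, by simp⟩⟩
  obtain ⟨X, ⟨B⟩⟩ := bip_of w
  have : IsArtinianRing (Module.End R X.M) :=
    @isArtinian_of_tower K (Module.End R X.M) (Module.End R X.M) _ _ _ _ _ _ _
      (homArt (K := K) X X)
  obtain ⟨N, hN⟩ := IsArtinianRing.isNilpotent_jacobson_bot (R := Module.End R X.M)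
  obtain ⟨pw, pw0, pw1, pw2, pwN⟩ : ∃ pw : ℕ → Ideal (Module.End R X.M), (∀ x, x ∈ pw 0) ∧
      (∀ m x y, x ∈ Ideal.jacobson (⊥ : Ideal (Module.End R X.M)) → y ∈ pw m → x * y ∈ pw (m + 1)) ∧
      (∀ m x y, y ∈ Ideal.jacobson (⊥ : Ideal (Module.End R X.M)) → x ∈ pw m → x * y ∈ pw (m + 1)) ∧
      pw N = ⊥ := by
    refine ⟨fun m => (Ideal.jacobson (⊥ : Ideal (Module.End R X.M))) ^ m, ?_, ?_, ?_, hN⟩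
    · intro x
      beta_reduce; rw [Submodule.pow_zero, Ideal.one_eq_top]; exact Submodule.mem_top
    · intro m x y hx hy
      have := Ideal.IsTwoSided.pow_succ (I := Ideal.jacobson (⊥ : Ideal (Module.End R X.M))) (n := m)
      change _ ∈ (Ideal.jacobson (⊥ : Ideal (Module.End R X.M))) ^ (m + 1)
      rw [this]
      exact Ideal.mul_mem_mul hx hy
    · intro m x y hx hy
      have := Submodule.pow_succ (Ideal.jacobson (⊥ : Ideal (Module.End R X.M))) (n := m)
      change _ ∈ (Ideal.jacobson (⊥ : Ideal (Module.End R X.M))) ^ (m + 1)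
      rw [this]
      exact Ideal.mul_mem_mul hy hx
  refine ⟨N, fun m a b => 
    { carrier := {f | ∀ k l (α : (rep (w k)).M →ₗ[R] (rep a).M) (β : (rep b).M →ₗ[R] (rep (w l)).M),
        (B.i l ∘ₗ β ∘ₗ f ∘ₗ α ∘ₗ B.p k : Module.End R X.M) ∈ pw m}
      zero_mem' := by
        intro k l α β
        simp only [LinearMap.zero_comp, LinearMap.comp_zero]
        exact zero_mem _
      add_mem' := by
        intro f g hf hg k l α β
        have := add_mem (hf k l α β) (hg k l α β)
        simpa only [LinearMap.add_comp, LinearMap.comp_add] using this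
      neg_mem' := by
        intro f hf k l α β
        have := neg_mem (hf k l α β)
        simpa only [LinearMap.neg_comp, LinearMap.comp_neg] using this }, ?_, ?_, ?_, ?_⟩
  · intro a b f k l α β
    exact pw0 _
  · intro m a b c f g _ hb _ hf hg k l α β
    rw [← hw] at hb
    obtain ⟨t, rfl⟩ := hb
    have e : (B.i l ∘ₗ β ∘ₗ (g ∘ₗ f) ∘ₗ α ∘ₗ B.p k : Module.End R X.M) =
        (B.i l ∘ₗ (β ∘ₗ g) ∘ₗ B.p t : Module.End R X.M) *
        (B.i t ∘ₗ LinearMap.id ∘ₗ f ∘ₗ α ∘ₗ B.p k : Module.End R X.M) := by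
      refine LinearMap.ext fun x => ?_
      have := LinearMap.congr_fun (B.pi t) (f (α (B.p k x)))
      simp only [LinearMap.comp_apply, LinearMap.id_apply, Module.End.mul_apply] at this ⊢
      rw [this]
    change _ ∈ pw (m + 1)
    rw [e]
    exact pw1 _ _ _ (jac_mem _ _ _ (NB_l _ _ hg)) (hf k t α LinearMap.id)
  · intro m a b c f g _ hb _ hf hg k l α β
    rw [← hw] at hb
    obtain ⟨t, rfl⟩ := hb
    have e : (B.i l ∘ₗ β ∘ₗ (g ∘ₗ f) ∘ₗ α ∘ₗ B.p k : Module.End R X.M) =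
        (B.i l ∘ₗ β ∘ₗ g ∘ₗ LinearMap.id ∘ₗ B.p t : Module.End R X.M) *
        (B.i t ∘ₗ (f ∘ₗ α) ∘ₗ B.p k : Module.End R X.M) := by
      refine LinearMap.ext fun x => ?_
      have := LinearMap.congr_fun (B.pi t) (f (α (B.p k x)))
      simp only [LinearMap.comp_apply, LinearMap.id_apply, Module.End.mul_apply] at this ⊢
      rw [this]
    change _ ∈ pw (m + 1)
    rw [e]
    exact pw2 _ _ _ (jac_mem _ _ _ (NB_r _ _ hf)) (hg t l LinearMap.id β)
  · intro a b f ha hb hf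
    rw [← hw] at ha hb
    obtain ⟨k, rfl⟩ := ha
    obtain ⟨l, rfl⟩ := hb
    have h0 := hf k l LinearMap.id LinearMap.id
    change _ ∈ pw N at h0
    rw [pwN] at h0
    have h1 := (Ideal.mem_bot (R := Module.End R X.M)).1 h0
    refine LinearMap.ext fun x => ?_
    have h2 := congrArg (B.p l) (LinearMap.congr_fun h1 (B.i k x))
    have h3 := LinearMap.congr_fun (B.pi k) x
    have h4 := LinearMap.congr_fun (B.pi l) (f x)
    simp only [LinearMap.comp_apply, LinearMap.id_apply, LinearMap.zero_apply, map_zero] at h2 h3 h4 ⊢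
    rw [h3, h4] at h2
    exact h2

/-- The category of indecomposables of an artin algebra. -/
noncomputable def arc (K R : Type u) [CommRing K] [IsArtinianRing K] [Ring R] [Algebra K R]
    [Module.Finite K R] : ARCat.{u+1, u} (ARVertex R) where
  Hom a b := (rep a).M →ₗ[R] (rep b).M
  ag a b := inferInstance
  comp := AddMonoidHom.mk' (fun f => AddMonoidHom.mk' (fun g => g ∘ₗ f)
    (fun g g' => LinearMap.add_comp _ _ _)) (fun f f' => by
      ext g x; simp)
  one a := LinearMap.id
  one_comp f := rfl
  comp_one f := rfl
  assoc f g h := rfl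
  Rad a b := NB a b
  rad_l f g h := NB_l f g h
  rad_r f g h := NB_r f g h
  rad_ne h f := fun hb => h (eq_of_bij f hb)
  one_rad a := fun h => h Function.bijective_id
  Arrow := ARArrow
  Tau := TauRel
  Proj := IsProjVertex
  Inj := IsInjVertex
  len a b := ln K ((rep a).M →ₗ[R] (rep b).M)
  len_zero a b h := ln_zero h
  arrow_ne {a b} h := by
    obtain ⟨f, hf⟩ := arrow_iff.1 h
    refine ⟨f, ?_⟩
    rintro rfl
    have := (rep_indec a).1
    have := (rep_indec b).1
    rcases irred_me hf with hi | hs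
    · obtain ⟨x, hx⟩ := exists_ne (0 : (rep a).M)
      exact hx (hi rfl)
    · obtain ⟨y, hy⟩ := exists_ne (0 : (rep b).M)
      obtain ⟨x, rfl⟩ := hs y
      exact hy rfl
  tau_l h h' := tau_l' h h'
  tau_r h h' := tau_r' K h h'
  proj_or := proj_or' K
  inj_or := inj_or' K
  proj_seq b hb := c_proj_seq (K := K) b hb
  inj_seq a ha := c_inj_seq (K := K) a ha
  tau_seq a b h := c_tau_seq (K := K) a b h
  arrow_me {a b} h := by
    obtain ⟨f, hf⟩ := arrow_iff.1 h
    rcases irred_me hf with hi | hs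
    · left
      rintro i hi' ⟨t, ht⟩
      obtain ⟨t', ht'⟩ := inj_ext (inj_iff.1 hi') hi t
      refine ⟨t', ?_⟩
      rintro rfl
      exact ht (by rw [← ht', LinearMap.zero_comp])
    · right
      rintro p hp ⟨t, ht⟩
      obtain ⟨t', ht'⟩ := proj_lift (proj_iff.1 hp) hs t
      refine ⟨t', ?_⟩
      rintro rfl
      exact ht (by rw [← ht', LinearMap.comp_zero])
  ex_proj b := c_ex_proj K (rep b) (rep_indec b).1
  ex_inj b := c_ex_inj K (rep b) (rep_indec b).1
  nv := nvv K R
  dv i y := ln K ((rep (PV K R i)).M →ₗ[R] (rep y).M)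
  gv_proj b hb := by
    obtain ⟨g, hg⟩ := proj_vec (K := K) (proj_iff.1 hb)
    exact ⟨g, fun y => hg _⟩
  gv a b h hI := by
    obtain ⟨m, f, g, hs⟩ := tau_ass h
    obtain ⟨v, hv⟩ := gvec (K := K) hs.seq (all_inj hI)
    exact ⟨v, fun y hy => hv _ hy⟩
  nv' := nvv K Rᵐᵒᵖ
  dv' i y := ln K ((rep (PV K Rᵐᵒᵖ i)).M →ₗ[Rᵐᵒᵖ] (D (antiOp K R) (rep y)).M)
  gv_inj b hb := by
    obtain ⟨g, hg⟩ := inj_vec (K := K) (inj_iff.1 hb)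
    exact ⟨g, fun y => hg _⟩
  gv' a b h hP := by
    obtain ⟨m, f, g, hs⟩ := tau_ass h
    obtain ⟨v, hv⟩ := gvec' (K := K) hs.seq (all_proj hP)
    exact ⟨v, fun y hy => hv _ hy⟩
  hs U hU := c_hs K U hU

end
end CF

namespace CF
section
set_option linter.unusedSectionVars false

theorem path_fun' {V : Type*} {r : V → V → Prop} {a b : V} (h : Relation.ReflTransGen r a b) :
    ∃ (n : ℕ) (X : ℕ → V), X 0 = a ∧ X n = b ∧ ∀ k < n, r (X k) (X (k + 1)) := by
  rcases Relation.reflTransGen_iff_eq_or_transGen.1 h with rfl | h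
  · exact ⟨0, fun _ => b, rfl, rfl, by intro k hk; omega⟩
  · obtain ⟨n, X, _, h⟩ := ARCat.path_fun h
    exact ⟨n, X, h⟩

variable (K : Type u) {R : Type u} [CommRing K] [IsArtinianRing K] [Ring R] [Algebra K R]
    [Module.Finite K R]

theorem radN_radPow (n : ℕ) (a b : ARVertex R) (f : (rep a).M →ₗ[R] (rep b).M)
    (hf : f ∈ (arc K R).radN n a b) : f ∈ radPow R n (rep a) (rep b) := by
  induction n generalizing a b with
  | zero => exact AddSubgroup.mem_top _
  | succ n ih =>
    have hle : (arc K R).radN (n + 1) a b ≤ radPow R (n + 1) (rep a) (rep b) := by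
      refine (AddSubgroup.closure_le _).2 ?_
      rintro f ⟨z, g, h, hg, hh, rfl⟩
      refine AddSubgroup.subset_closure ⟨rep z, g, h, ?_, ih z b h hh, rfl⟩
      exact (inRad_iff (rep_indec a) (rep_indec z) g).2 hg
    exact hle hf

theorem radPow_radN (n : ℕ) (X Y : ModA R) (f : X.M →ₗ[R] Y.M) (hf : f ∈ radPow R n X Y)
    (a b : ARVertex R) (α : (rep a).M →ₗ[R] X.M) (β : Y.M →ₗ[R] (rep b).M) :
    (β ∘ₗ f ∘ₗ α : (rep a).M →ₗ[R] (rep b).M) ∈ (arc K R).radN n a b := by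
  induction n generalizing X a with
  | zero => exact AddSubgroup.mem_top _
  | succ n ih =>
    have hf' : f ∈ AddSubgroup.closure
      {f | ∃ (Z : ModA R) (g : X.M →ₗ[R] Z.M) (h : Z.M →ₗ[R] Y.M),
        InRad g ∧ h ∈ radPow R n Z Y ∧ f = h.comp g} := hf
    clear hf
    induction hf' using AddSubgroup.closure_induction with
    | zero =>
      rw [LinearMap.zero_comp, LinearMap.comp_zero]; exact zero_mem _
    | add x y _ _ hx hy =>
      rw [LinearMap.add_comp, LinearMap.comp_add]; exact add_mem hx hy
    | neg x _ hx =>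
      rw [LinearMap.neg_comp, LinearMap.comp_neg]; exact neg_mem hx
    | mem x hx =>
      obtain ⟨Z, g, h, hg, hh, rfl⟩ := hx
      obtain ⟨m, W, ⟨B⟩⟩ := exists_biP Z
      have e : (β ∘ₗ (h ∘ₗ g) ∘ₗ α) =
          ∑ k, (β ∘ₗ h ∘ₗ B.i k) ∘ₗ (B.p k ∘ₗ g ∘ₗ α) := by
        conv_lhs => rw [B.expand h]
        refine LinearMap.ext fun x => ?_
        simp
      rw [e]
      refine sum_mem fun k _ => AddSubgroup.subset_closure ⟨W k, B.p k ∘ₗ g ∘ₗ α,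
        β ∘ₗ h ∘ₗ B.i k, ?_, ih Z h hh (W k) (B.i k), rfl⟩
      intro hb
      refine hg (rep a) (rep_indec a) α
        ((LinearEquiv.ofBijective _ hb).symm.toLinearMap ∘ₗ B.p k) ?_
      have : (((LinearEquiv.ofBijective _ hb).symm.toLinearMap ∘ₗ B.p k) ∘ₗ g ∘ₗ α) =
          LinearMap.id := by
        refine LinearMap.ext fun x => ?_
        exact (LinearEquiv.ofBijective _ hb).symm_apply_apply x
      rw [this]
      exact Function.bijective_id

/-- nonzero radical map -/
def SS (a b : ARVertex R) : Prop := ∃ f : (rep a).M →ₗ[R] (rep b).M, f ≠ 0 ∧ f ∈ NB a b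

theorem le_SS {a b : ARVertex R} (h : (arc K R).Le a b) : Relation.ReflTransGen SS a b := by
  induction h with
  | refl => exact .refl
  | @tail b c _ h ih =>
    by_cases hbc : b = c
    · exact hbc ▸ ih
    · obtain ⟨f, hf⟩ := h
      exact ih.tail ⟨f, hf, fun hb => hbc (eq_of_bij f hb)⟩

theorem cf_radN {M : IndecModA R} (hM : IsCycleFiniteModule M.1) (w v : ARVertex R) (hwv : w ≠ v)
    (h1 : (arc K R).Le (ARVertex.mk M) w) (h2 : (arc K R).Le v (ARVertex.mk M))
    (f : (arc K R).Hom w v) (hf : f ≠ 0) : ∃ n, f ∉ (arc K R).radN n w v := by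
  by_contra hcon
  push Not at hcon
  have hinf : InRadInf (X := rep w) (Y := rep v) f := fun n => radN_radPow K n w v f (hcon n)
  obtain ⟨m, X1, a0, a1, a2⟩ := path_fun' (le_SS K h2)
  obtain ⟨n, X2, b0, b1, b2⟩ := path_fun' (le_SS K h1)
  let c : ℕ → ARVertex R := fun k => if k ≤ m then X1 k else X2 (k - m)
  have c0 : c 0 = v := by simp [c, a0]
  have cm : c m = ARVertex.mk M := by simp [c, a1]
  have cn : c (m + n) = w := by
    by_cases hn : n = 0
    · subst hn
      rw [b0] at b1
      rw [← b1, ← cm]; simp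
    · simp [c, hn, b1]
  have cs : ∀ k < m + n, SS (c k) (c (k + 1)) := by
    intro k hk
    by_cases h : k < m
    · have := a2 k h
      simp only [c]
      rw [if_pos (by omega), if_pos (by omega)]; exact this
    · have hb := b2 (k - m) (by omega)
      simp only [c]
      rw [if_neg (show ¬ k + 1 ≤ m by omega)]
      rw [show k + 1 - m = k - m + 1 by omega]
      split_ifs with h'
      · have : k = m := by omega
        subst this
        rw [Nat.sub_self] at hb ⊢
        rw [a1, ← b0]; exact hb
      · exact hb
  let d : ℕ → ARVertex R := fun k => Nat.casesOn k w c
  have hd : ∀ k, k < m + n + 1 → ∃ g : (rep (d k)).M →ₗ[R] (rep (d (k + 1))).M,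
      g ≠ 0 ∧ ¬ Function.Bijective g ∧ (k = 0 → InRadInf (X := rep (d k)) (Y := rep (d (k + 1))) g) := by
    intro k hk
    cases k with
    | zero =>
      change ∃ g : (rep w).M →ₗ[R] (rep (c 0)).M, g ≠ 0 ∧ ¬ Function.Bijective g ∧
        (0 = 0 → InRadInf (X := rep w) (Y := rep (c 0)) g)
      rw [c0]
      exact ⟨f, hf, fun hb => hwv (eq_of_bij f hb), fun _ => hinf⟩
    | succ k =>
      obtain ⟨g, hg, hb⟩ := cs k (by omega)
      exact ⟨g, hg, hb, fun h => by omega⟩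
  choose g hg0 hgb hgi using hd
  let cy : ModCycle R :=
    { len := m + n + 1
      len_pos := by omega
      obj := fun i => rep (d i)
      obj_indec := fun i => rep_indec _
      closed := by
        change rep (c (m + n)) = rep w
        rw [cn]
      hom := fun i => g i i.2
      hom_ne_zero := fun i => hg0 i i.2
      hom_not_iso := fun i => hgb i i.2 }
  have hp : cy.Passes M.1 := by
    refine ⟨⟨m + 1, by change m + 1 < m + n + 1 + 1; omega⟩, ?_⟩
    change (rep (c m)).Iso M.1
    rw [cm]
    exact rep_mk M
  exact hM.2 cy hp ⟨0, by change 0 < m + n + 1; omega⟩ (hgi 0 (by omega) rfl)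

/-- Convexity of a cycle-finite cyclic component. -/
theorem cf_conv {Γ : Set (ARVertex R)} (hΓ : IsCycleFiniteCyclicComponent Γ) :
    ∀ a ∈ Γ, ∀ b ∈ Γ, ∀ z, (arc K R).Le a z → (arc K R).Le z b → z ∈ Γ := by
  obtain ⟨⟨h1, h2, h3, h4⟩, x, hx, M, rfl, hM⟩ := hΓ
  refine ARCat.S3 (arc K R) Γ (fun a ha => h1 ha) (fun a ha b hb h => h3 a ha b hb h)
    (fun a ha b hb => h4 a ha b hb) _ hx ?_
  intro w v hwv h1 h2 f hf
  exact cf_radN K hM w v hwv h1 h2 f hf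

theorem gs_set {U : Set (ARVertex R)}
    (h : ∀ x ∈ U, ∀ y ∈ U, ∃ N, ∀ f ∈ (arc K R).radN N x y, f = 0) : GeneralizedStandardSet U := by
  intro X Y hX hY f hf
  obtain ⟨N, hN⟩ := h _ hX _ hY
  obtain ⟨e⟩ := rep_mk X
  obtain ⟨d⟩ := rep_mk Y
  have := hN _ (radPow_radN K N _ _ f (hf N) _ _ e.toLinearMap d.symm.toLinearMap)
  refine LinearMap.ext fun x => d.symm.injective ?_
  have h2 := LinearMap.congr_fun this (e.symm x)
  simp only [LinearMap.comp_apply, LinearEquiv.coe_coe, LinearEquiv.apply_symm_apply] at h2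
  rw [h2, LinearMap.zero_apply, map_zero]; rfl

end
end CF

namespace CF
section
set_option linter.unusedSectionVars false
variable {R : Type u} [Ring R]

theorem noExt_right {X Y Y' : ModA R} (h : NoExt X Y) (i : Y'.M →ₗ[R] Y.M) (p : Y.M →ₗ[R] Y'.M)
    (hpi : p ∘ₗ i = LinearMap.id) : NoExt X Y' := by
  refine noExt_of_extend fun E f g hs => ?_
  obtain ⟨t, ht⟩ := h.extend hs i
  exact ⟨p ∘ₗ t, by rw [LinearMap.comp_assoc, ht, hpi]⟩

theorem noExt_fam {X Y : ModA R} {n : ℕ} {Z : Fin n → ModA R} (i : ∀ k, (Z k).M →ₗ[R] X.M)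
    (p : ∀ k, X.M →ₗ[R] (Z k).M) (tot : ∑ k, i k ∘ₗ p k = LinearMap.id)
    (h : ∀ k, NoExt (Z k) Y) : NoExt X Y := by
  intro E f g hs
  choose t ht using fun k => (h k).lift hs (i k)
  refine ⟨∑ k, t k ∘ₗ p k, ?_⟩
  change g ∘ₗ _ = _
  rw [comp_sum', ← tot]
  refine Finset.sum_congr rfl fun k _ => ?_
  rw [← LinearMap.comp_assoc, ht]

theorem noExt_left {X X' Y : ModA R} (h : NoExt X Y) (i : X'.M →ₗ[R] X.M) (p : X.M →ₗ[R] X'.M)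
    (hpi : p ∘ₗ i = LinearMap.id) : NoExt X' Y := by
  intro E f g hs
  obtain ⟨t, ht⟩ := h.lift hs p
  refine ⟨t ∘ₗ i, ?_⟩
  change g ∘ₗ _ = _
  rw [← LinearMap.comp_assoc, ht, hpi]

theorem noExt_proj {X Y : ModA R} (h : Module.Projective R X.M) : NoExt X Y := by
  intro E f g hs
  obtain ⟨t, ht⟩ := proj_lift h hs.surj LinearMap.id
  exact ⟨t, ht⟩

theorem noExt_ext {A E C Y : ModA R} {i : A.M →ₗ[R] E.M} {q : E.M →ₗ[R] C.M} (hs : Sh i q)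
    (hA : NoExt A Y) (hC : NoExt C Y) : NoExt E Y := by
  refine noExt_of_extend fun M f g hM => ?_
  obtain ⟨t, ht⟩ := hA.lift hM i
  have hgf := hM.zero
  have hqg : ∃ q' : (quo M (LinearMap.range t)).M →ₗ[R] C.M,
      q' ∘ₗ quo.π M (LinearMap.range t) = q ∘ₗ g := by
    refine factor_surj (quo_surj M _) _ ?_
    change LinearMap.ker (LinearMap.range t).mkQ ≤ _
    rw [Submodule.ker_mkQ]
    rintro _ ⟨a, rfl⟩
    have h1 : g (t a) = i a := LinearMap.congr_fun ht a
    have h2 : q (i a) = 0 := LinearMap.congr_fun hs.zero a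
    rw [LinearMap.mem_ker, LinearMap.comp_apply, h1, h2]
  obtain ⟨q', hq'⟩ := hqg
  have hsh : Sh (quo.π M (LinearMap.range t) ∘ₗ f) q' := by
    refine ⟨?_, ?_, ?_⟩
    · rw [← LinearMap.ker_eq_bot, LinearMap.ker_eq_bot']
      intro y hy
      have : f y ∈ LinearMap.range t := (Submodule.Quotient.mk_eq_zero _).1 hy
      obtain ⟨a, ha⟩ := this
      have h1 : g (t a) = i a := LinearMap.congr_fun ht a
      have h2 : g (f y) = 0 := LinearMap.congr_fun hgf y
      rw [ha, h2] at h1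
      have ha0 : a = 0 := hs.inj (by rw [← h1, map_zero])
      rw [ha0, map_zero] at ha
      exact hM.inj (by rw [← ha, map_zero])
    · intro c
      obtain ⟨e, rfl⟩ := hs.surj c
      obtain ⟨m, rfl⟩ := hM.surj e
      exact ⟨quo.π M _ m, LinearMap.congr_fun hq' m⟩
    · apply le_antisymm
      · rintro _ ⟨y, rfl⟩
        have h1 : q' (quo.π M _ (f y)) = q (g (f y)) := LinearMap.congr_fun hq' (f y)
        have h2 : g (f y) = 0 := LinearMap.congr_fun hgf y
        rw [LinearMap.mem_ker, LinearMap.comp_apply, h1, h2, map_zero]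
      · intro m' hm'
        obtain ⟨m, rfl⟩ := quo_surj M _ m'
        have h1 : q' (quo.π M _ m) = q (g m) := LinearMap.congr_fun hq' m
        have h2 : q (g m) = 0 := by rw [← h1]; exact hm'
        have h3 : g m ∈ LinearMap.range i := by rw [hs.ex]; exact h2
        obtain ⟨a, ha⟩ := h3
        have h4 : g (t a) = i a := LinearMap.congr_fun ht a
        have h5 : m - t a ∈ LinearMap.range f := by
          rw [hM.ex, LinearMap.mem_ker, map_sub, h4, ha, sub_self]
        obtain ⟨y, hy⟩ := h5
        refine ⟨y, ?_⟩
        rw [LinearMap.comp_apply, hy, map_sub]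
        have : quo.π M (LinearMap.range t) (t a) = 0 :=
          (Submodule.Quotient.mk_eq_zero _).2 ⟨a, rfl⟩
        rw [this, sub_zero]
  obtain ⟨r, hr⟩ := hC.extend hsh (LinearMap.id : Y.M →ₗ[R] Y.M)
  exact ⟨r ∘ₗ quo.π M _, by rw [LinearMap.comp_assoc, hr]⟩

theorem noExt_ker {X L G Y : ModA R} {ι : L.M →ₗ[R] G.M} {φ : G.M →ₗ[R] Y.M} (hs : Sh ι φ)
    (hG : NoExt X G) (hl : ∀ t : X.M →ₗ[R] Y.M, ∃ t' : X.M →ₗ[R] G.M, φ ∘ₗ t' = t) :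
    NoExt X L := by
  refine noExt_of_extend fun M f g hM => ?_
  obtain ⟨ρ, hρ⟩ := hG.extend hM ι
  obtain ⟨t, ht⟩ := hM.factor_right (φ ∘ₗ ρ) (by rw [LinearMap.comp_assoc, hρ, hs.zero])
  obtain ⟨t', ht'⟩ := hl t
  obtain ⟨ρ', hρ'⟩ := hs.factor_left (ρ - t' ∘ₗ g) (by
    rw [LinearMap.comp_sub, ← LinearMap.comp_assoc, ht', ht, sub_self])
  refine ⟨ρ', ?_⟩
  refine LinearMap.ext fun y => hs.inj ?_
  have h1 : ι (ρ' (f y)) = ρ (f y) - t' (g (f y)) := LinearMap.congr_fun hρ' (f y)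
  have h2 : g (f y) = 0 := LinearMap.congr_fun hM.zero y
  have h3 : ρ (f y) = ι y := LinearMap.congr_fun hρ y
  rw [LinearMap.comp_apply, h1, h2, h3, map_zero, sub_zero]
  rfl

/-- power of a module -/
abbrev pw (X : ModA R) (k : ℕ) : ModA R :=
  ⟨Fin k → X.M, isFiniteLength_iff_isNoetherian_isArtinian.2 ⟨inferInstance, inferInstance⟩⟩

/-- coordinate -/
def pw.p (X : ModA R) (k : ℕ) (a : Fin k) : (pw X k).M →ₗ[R] X.M := LinearMap.proj a

/-- coordinate inclusion -/
def pw.i (X : ModA R) (k : ℕ) (a : Fin k) : X.M →ₗ[R] (pw X k).M :=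
  LinearMap.single R (fun _ => X.M) a

theorem pw.tot (X : ModA R) (k : ℕ) : ∑ a, pw.i X k a ∘ₗ pw.p X k a = LinearMap.id := by
  refine LinearMap.ext fun x => ?_
  rw [LinearMap.sum_apply]
  exact LinearMap.sum_single_apply (fun _ => X.M) x

theorem pw.sh {X Y Z : ModA R} {f : X.M →ₗ[R] Y.M} {g : Y.M →ₗ[R] Z.M} (h : Sh f g) (k : ℕ) :
    Sh (X := pw X k) (Y := pw Y k) (Z := pw Z k) (f.compLeft (Fin k)) (g.compLeft (Fin k)) := by
  refine ⟨?_, ?_, ?_⟩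
  · intro x y hxy
    funext a
    exact h.inj (congrFun hxy a)
  · intro z
    choose y hy using fun a => h.surj (z a)
    exact ⟨y, funext hy⟩
  · apply le_antisymm
    · rintro _ ⟨x, rfl⟩
      exact funext fun a => LinearMap.congr_fun h.zero (x a)
    · intro y hy
      have : ∀ a, ∃ x, f x = y a := fun a => by
        have : y a ∈ LinearMap.range f := by
          rw [h.ex]; exact congrFun hy a
        exact this
      choose x hx using this
      exact ⟨x, funext hx⟩

theorem pw_ext {X Y : ModA R} {k : ℕ} {f g : X.M →ₗ[R] (pw Y k).M}
    (h : ∀ a, pw.p Y k a ∘ₗ f = pw.p Y k a ∘ₗ g) : f = g :=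
  LinearMap.ext fun x => funext fun a => LinearMap.congr_fun (h a) x

/-- Bongartz' universal extension -/
theorem bongartz (K : Type u) {R : Type u} [CommRing K] [IsArtinianRing K] [Ring R] [Algebra K R]
    [Module.Finite K R] (U B : ModA R) (hU : ∀ k, NoExt U (pw U k)) :
    ∃ (k : ℕ) (E : ModA R) (i : B.M →ₗ[R] E.M) (q : E.M →ₗ[R] (pw U k).M), Sh i q ∧ NoExt U E := by
  obtain ⟨F, p, hF, hp⟩ := exists_free_cover K U
  have hs := sub_ker p hp
  set Ω := sub F (LinearMap.ker p) with hΩ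
  set ι := sub.ι F (LinearMap.ker p) with hι
  have hfin : IsNoetherian K (Ω.M →ₗ[R] B.M) := homNoeth Ω B
  have hfin' : Module.Finite K (Ω.M →ₗ[R] B.M) := Module.IsNoetherian.finite K _
  obtain ⟨k, g, hg⟩ := Module.Finite.exists_fin (R := K) (M := Ω.M →ₗ[R] B.M)
  obtain ⟨E, i, j, q, hE, hit, hqj, -⟩ := pushout (pw.sh hs k)
    (W := B) (∑ a, g a ∘ₗ pw.p Ω k a)
  refine ⟨k, E, i, q, hE, ?_⟩
  -- every `Ω → E` extends to `F`
  have key : ∀ t : Ω.M →ₗ[R] E.M, ∃ t' : F.M →ₗ[R] E.M, t' ∘ₗ ι = t := by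
    intro t
    obtain ⟨s, hs1⟩ := (hU k).extend hs (q ∘ₗ t)
    obtain ⟨s', hs2⟩ := proj_lift hF hE.surj s
    obtain ⟨d, hd⟩ := hE.factor_left (t - s' ∘ₗ ι) (by
      rw [LinearMap.comp_sub, ← LinearMap.comp_assoc, hs2, hs1, sub_self])
    have hdm : d ∈ Submodule.span K (Set.range g) := by rw [hg]; trivial
    obtain ⟨c, hc⟩ := (Submodule.mem_span_range_iff_exists_fun K).1 hdm
    have hga : ∀ a, i ∘ₗ g a = (j ∘ₗ pw.i F k a) ∘ₗ ι := by
      intro a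
      refine LinearMap.ext fun x => ?_
      have h1 := LinearMap.congr_fun hit (pw.i Ω k a x)
      have h2 : (∑ b, g b ∘ₗ pw.p Ω k b) (pw.i Ω k a x) = g a x := by
        rw [LinearMap.sum_apply, Finset.sum_eq_single a]
        · change g a (pw.p Ω k a (pw.i Ω k a x)) = _
          congr 1
          exact Pi.single_eq_same (M := fun _ => Ω.M) a x
        · intro b _ hb
          change g b (pw.p Ω k b (pw.i Ω k a x)) = _
          have : pw.p Ω k b (pw.i Ω k a x) = 0 := Pi.single_eq_of_ne (M := fun _ => Ω.M) hb x
          rw [this, map_zero]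
        · simp
      rw [LinearMap.comp_apply, h2] at h1
      rw [LinearMap.comp_apply, h1]
      change j _ = j _
      congr 1
      funext b
      change ι ((Pi.single a x : Fin k → Ω.M) b) = (Pi.single a (ι x) : Fin k → F.M) b
      by_cases hb : b = a
      · subst hb; rw [Pi.single_eq_same, Pi.single_eq_same]
      · rw [Pi.single_eq_of_ne hb, Pi.single_eq_of_ne hb, map_zero]
    refine ⟨s' + ∑ a, c a • (j ∘ₗ pw.i F k a), ?_⟩
    refine LinearMap.ext fun x => ?_
    have h3 : i (d x) = t x - s' (ι x) := LinearMap.congr_fun hd x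
    have h4 : i (d x) = ∑ a, c a • i (g a x) := by
      rw [← hc, LinearMap.sum_apply, map_sum]
      refine Finset.sum_congr rfl fun a _ => ?_
      change i (algebraMap K R (c a) • g a x) = algebraMap K R (c a) • i (g a x)
      rw [map_smul i]
    have h5 : ∀ a, i (g a x) = j (pw.i F k a (ι x)) := fun a => LinearMap.congr_fun (hga a) x
    rw [LinearMap.comp_apply, LinearMap.add_apply, LinearMap.sum_apply]
    have h6 : (∑ a, (c a • (j ∘ₗ pw.i F k a)) (ι x)) = t x - s' (ι x) := by
      rw [← h3, h4]
      refine Finset.sum_congr rfl fun a _ => ?_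
      rw [h5]; rfl
    rw [h6]; abel
  refine noExt_of_extend fun M f g' hM => ?_
  obtain ⟨l, hl⟩ := proj_lift hF hM.surj p
  obtain ⟨t, ht⟩ := hM.factor_left (l ∘ₗ ι) (by rw [← LinearMap.comp_assoc, hl, hs.zero])
  obtain ⟨t', ht'⟩ := key t
  -- section of g'
  obtain ⟨s, hs'⟩ := hs.factor_right (l - f ∘ₗ t') (by
    rw [LinearMap.sub_comp, LinearMap.comp_assoc, ht', ht, sub_self])
  refine hM.split_iff.2 ⟨s, ?_⟩
  refine LinearMap.ext fun x => ?_
  obtain ⟨y, rfl⟩ := hp x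
  have h1 : s (p y) = l y - f (t' y) := LinearMap.congr_fun hs' y
  have h2 : g' (l y) = p y := LinearMap.congr_fun hl y
  have h3 : g' (f (t' y)) = 0 := LinearMap.congr_fun hM.zero _
  change g' (s (p y)) = p y
  rw [h1, map_sub, h2, h3, sub_zero]

end
end CF

namespace CF
section
set_option linter.unusedSectionVars false

variable {K R : Type u} [CommRing K] [IsArtinianRing K] [Ring R] [Algebra K R]
    [Module.Finite K R] {Γ : Set (ARVertex R)}

theorem H_iff {a b : ARVertex R} : (arc K R).H a b ↔ ∃ f : (rep a).M →ₗ[R] (rep b).M, f ≠ 0 :=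
  Iff.rfl

theorem H_of {a b : ARVertex R} (f : (rep a).M →ₗ[R] (rep b).M) (hf : f ≠ 0) : (arc K R).H a b :=
  ⟨f, hf⟩

/-- Torsion modules. -/
def InT (K : Type u) {R : Type u} [CommRing K] [IsArtinianRing K] [Ring R] [Algebra K R]
    [Module.Finite K R] (Γ : Set (ARVertex R)) (Y : ModA R) : Prop :=
  ∀ z, ¬ (arc K R).T Γ z → ∀ f : Y.M →ₗ[R] (rep z).M, f = 0

theorem zero_of_T {x z : ARVertex R} (hx : (arc K R).T Γ x) (hz : ¬ (arc K R).T Γ z)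
    (f : (rep x).M →ₗ[R] (rep z).M) : f = 0 := by
  by_contra hf
  exact ARCat.T_not hx hz (H_of f hf)

theorem inT_rep {y : ARVertex R} : InT K Γ (rep y) ↔ (arc K R).T Γ y := by
  constructor
  · intro h
    by_contra hy
    have h0 := h y hy LinearMap.id
    have := (rep_indec y).1
    obtain ⟨x, hx⟩ := exists_ne (0 : (rep y).M)
    exact hx (LinearMap.congr_fun h0 x)
  · intro h z hz f
    exact zero_of_T h hz f

theorem inT_bip {X : ModA R} {n : ℕ} {Z : Fin n → ARVertex R} (B : BiP X n Z)
    (h : ∀ k, (arc K R).T Γ (Z k)) : InT K Γ X := by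
  intro z hz f
  rw [B.expand f]
  refine Finset.sum_eq_zero fun k _ => ?_
  rw [zero_of_T (h k) hz (f ∘ₗ B.i k), LinearMap.zero_comp]

theorem inT_quot {X Y : ModA R} (h : InT K Γ X) (g : X.M →ₗ[R] Y.M) (hg : Function.Surjective g) :
    InT K Γ Y := by
  intro z hz f
  have := h z hz (f ∘ₗ g)
  refine LinearMap.ext fun y => ?_
  obtain ⟨x, rfl⟩ := hg y
  exact LinearMap.congr_fun this x

theorem inT_pw {X : ModA R} (h : InT K Γ X) (k : ℕ) : InT K Γ (pw X k) := by
  intro z hz f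
  have : f = ∑ a, (f ∘ₗ pw.i X k a) ∘ₗ pw.p X k a := by
    calc f = f ∘ₗ LinearMap.id := rfl
      _ = f ∘ₗ ∑ a, pw.i X k a ∘ₗ pw.p X k a := by rw [pw.tot]
      _ = _ := by rw [comp_sum']; rfl
  rw [this]
  refine Finset.sum_eq_zero fun a _ => ?_
  rw [h z hz (f ∘ₗ pw.i X k a), LinearMap.zero_comp]

theorem ar_one' {a b : ARVertex R} (h : TauRel a b) {Y : ModA R}
    (hY : ∀ f : Y.M →ₗ[R] (rep a).M, f = 0) : NoExt (rep b) Y := by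
  obtain ⟨m, f, g, hs⟩ := tau_ass h
  exact ar_one hs.seq hY

theorem noExt_sl {s : ARVertex R} (hs : s ∈ (arc K R).Sl Γ) {Y : ModA R} (hY : InT K Γ Y) :
    NoExt (rep s) Y := by
  obtain ⟨-, hp | ⟨a, ha, hab⟩⟩ := hs
  · exact noExt_proj (proj_iff.1 hp)
  · exact ar_one' hab (hY a ha)

/-- (f) -/
theorem noExt_notT {x : ARVertex R} (hx : ¬ (arc K R).T Γ x) {Y : ModA R} (hY : InT K Γ Y) :
    NoExt (rep x) Y := by
  by_cases hp : IsProjVertex x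
  · exact noExt_proj (proj_iff.1 hp)
  · obtain ⟨a, ha⟩ := proj_or' K x hp
    refine ar_one' ha (hY a fun haT => hx ?_)
    obtain ⟨n, Z, i, p, h1, h2, h3, h4, h5, h6, h7, h8, h9, h10, h11, h12, hn⟩ :=
      (arc K R).tau_seq a x ha
    have e1 : (arc K R).Arrow a (Z ⟨0, hn⟩) := (h2 (Z ⟨0, hn⟩)).2 ⟨_, rfl⟩
    have e2 : (arc K R).Arrow (Z ⟨0, hn⟩) x := (h1 (Z ⟨0, hn⟩)).2 ⟨_, rfl⟩
    exact ARCat.T_arrow (ARCat.T_arrow haT e1) e2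

theorem fr_proj (n : ℕ) : Module.Projective R (fr K R n).M :=
  inferInstanceAs (Module.Projective R (Fin n → R))

/-- The Bongartz completion. -/
theorem tilt (h : ARCat.Cfg (arc K R) Γ) : ∃ (E : ModA R) (i : (fr K R 1).M →ₗ[R] E.M) (n : ℕ)
    (Z : Fin n → ARVertex R), Nonempty (BiP E n Z) ∧ (∀ k, Z k ∈ (arc K R).Sl Γ) ∧
    Function.Injective i ∧ ∀ Y : ModA R, (∀ s ∈ (arc K R).Sl Γ, NoExt (rep s) Y) →
      ∀ t : (fr K R 1).M →ₗ[R] Y.M, ∃ t' : E.M →ₗ[R] Y.M, t' ∘ₗ i = t := by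
  obtain ⟨m, s, hsr⟩ : ∃ (m : ℕ) (s : Fin m → ARVertex R), Set.range s = (arc K R).Sl Γ := by
    have := h.Sl_finite
    obtain ⟨m, s, hs⟩ := this.fin_param
    exact ⟨m, s, hs.2⟩
  have hsm : ∀ k, s k ∈ (arc K R).Sl Γ := fun k => hsr ▸ Set.mem_range_self k
  obtain ⟨U, ⟨BU⟩⟩ := bip_of s
  have hUT : InT K Γ U := inT_bip BU fun k => (hsm k).1
  have hUY : ∀ Y : ModA R, (∀ s ∈ (arc K R).Sl Γ, NoExt (rep s) Y) → NoExt U Y := fun Y hY =>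
    noExt_fam BU.i BU.p BU.tot fun k => hY (s k) (hsm k)
  have hUY' : ∀ Y : ModA R, InT K Γ Y → NoExt U Y := fun Y hY =>
    hUY Y fun s hs => noExt_sl hs hY
  obtain ⟨k, E, i, q, hs, hUE⟩ := bongartz K U (fr K R 1) (fun k => hUY' _ (inT_pw hUT k))
  have hVY : ∀ Y : ModA R, (∀ s ∈ (arc K R).Sl Γ, NoExt (rep s) Y) → NoExt (pw U k) Y :=
    fun Y hY => noExt_fam (Z := fun _ => U) (pw.i U k) (pw.p U k) (pw.tot U k) fun a => hUY Y hY
  obtain ⟨n, Z, ⟨B⟩⟩ := exists_biP E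
  have hZT : ∀ j, (arc K R).T Γ (Z j) := by
    intro j
    by_contra hj
    have hH : ∃ b ∈ (arc K R).Sl Γ ∪ Γ, (arc K R).H (Z j) b := by
      by_cases hq : q ∘ₗ B.i j = 0
      · obtain ⟨t, ht⟩ := hs.factor_left (B.i j) hq
        have hp : Module.Projective R (rep (Z j)).M :=
          proj_retract (fr_proj (K := K) 1) t (B.p j ∘ₗ i) (by
            rw [LinearMap.comp_assoc, ht, B.pi])
        obtain ⟨a, ha, hh⟩ := h.proj (Z j) (proj_iff.2 hp)
        exact ⟨a, Or.inr ha, hh⟩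
      · by_contra hcon
        push Not at hcon
        apply hq
        refine pw_ext fun a => ?_
        rw [LinearMap.comp_zero]
        rw [BU.expand' (pw.p U k a ∘ₗ (q ∘ₗ B.i j))]
        refine Finset.sum_eq_zero fun l _ => ?_
        have : BU.p l ∘ₗ (pw.p U k a ∘ₗ (q ∘ₗ B.i j)) = 0 := by
          by_contra hne
          exact hcon (s l) (Or.inl (hsm l)) (H_of _ hne)
        rw [this, LinearMap.comp_zero]
    obtain ⟨b, hb, hh⟩ := hH
    obtain ⟨x, y, hx, hy, hxy, hzx⟩ := h.L10 hj hb hh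
    obtain ⟨f, hf⟩ := hzx
    obtain ⟨M, f', g', ha⟩ := tau_ass hxy
    obtain ⟨l, rfl⟩ : y ∈ Set.range s := hsr ▸ hy
    refine ar_two K ha.seq (fun I hI => all_inj (fun i hi f => ?_) I hI) f hf ?_
    · exact zero_of_T (h.T_inj hi) hx f
    · exact noExt_right (noExt_left hUE (BU.i l) (BU.p l) (BU.pi l)) (B.i j) (B.p j) (B.pi j)
  have hET : InT K Γ E := inT_bip B hZT
  refine ⟨E, i, n, Z, ⟨B⟩, ?_, hs.inj, fun Y hY t => (hVY Y hY).extend hs t⟩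
  intro j
  refine ⟨hZT j, ?_⟩
  by_contra hcon
  push Not at hcon
  obtain ⟨a, ha⟩ := proj_or' K (Z j) hcon.1
  have haT : (arc K R).T Γ a := by
    by_contra haT
    exact hcon.2 a haT ha
  obtain ⟨M, f', g', hAR⟩ := tau_ass ha
  have h1 : NoExt E (rep a) := noExt_ext hs (noExt_proj (fr_proj 1))
    (hVY _ fun s hs => noExt_sl hs (inT_rep.2 haT))
  exact hAR.ns (noExt_left h1 (B.i j) (B.p j) (B.pi j) M f' g' hAR.sh)

/-- maps from non-torsion modules to torsion modules factor through the slice -/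
theorem factor_sl (h : ARCat.Cfg (arc K R) Γ) {x : ARVertex R} (hx : ¬ (arc K R).T Γ x)
    {Y : ModA R} (hY : InT K Γ Y) (f : (rep x).M →ₗ[R] Y.M) :
    ∃ (n : ℕ) (Z : Fin n → ARVertex R) (g : ∀ k, (rep x).M →ₗ[R] (rep (Z k)).M)
      (t : ∀ k, (rep (Z k)).M →ₗ[R] Y.M), (∀ k, Z k ∈ (arc K R).Sl Γ) ∧ f = ∑ k, t k ∘ₗ g k := by
  classical
  obtain ⟨m, s, hsr⟩ : ∃ (m : ℕ) (s : Fin m → ARVertex R), Set.range s = (arc K R).Sl Γ := by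
    obtain ⟨m, s, hs⟩ := h.Sl_finite.fin_param
    exact ⟨m, s, hs.2⟩
  have hsm : ∀ k, s k ∈ (arc K R).Sl Γ := fun k => hsr ▸ Set.mem_range_self k
  have hgen : ∀ l, ∃ (k : ℕ) (g : Fin k → ((rep (s l)).M →ₗ[R] Y.M)),
      Submodule.span K (Set.range g) = ⊤ := fun l => by
    have hfin' : Module.Finite K ((rep (s l)).M →ₗ[R] Y.M) := Module.IsNoetherian.finite K _
    exact Module.Finite.exists_fin
  choose k g hg using hgen
  -- index type
  let ι := Σ l, Fin (k l)
  let e : ι ≃ Fin (Fintype.card ι) := Fintype.equivFin ι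
  let Z : Fin (Fintype.card ι) → ARVertex R := fun a => s (e.symm a).1
  let γ : ∀ a, (rep (Z a)).M →ₗ[R] Y.M := fun a => g (e.symm a).1 (e.symm a).2
  obtain ⟨G, ⟨B⟩⟩ := bip_of Z
  let φ : G.M →ₗ[R] Y.M := ∑ a, γ a ∘ₗ B.p a
  have hφi : ∀ a, φ ∘ₗ B.i a = γ a := by
    intro a
    change (∑ b, γ b ∘ₗ B.p b) ∘ₗ B.i a = _
    rw [sum_comp', Finset.sum_eq_single a]
    · rw [LinearMap.comp_assoc, B.pi, LinearMap.comp_id]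
    · intro b _ hb
      rw [LinearMap.comp_assoc, B.orth b a hb, LinearMap.comp_zero]
    · simp
  have hGT : InT K Γ G := inT_bip B fun a => (hsm _).1
  have happ : ∀ l (t : (rep (s l)).M →ₗ[R] Y.M), ∃ t' : (rep (s l)).M →ₗ[R] G.M, φ ∘ₗ t' = t := by
    intro l t
    have htm : t ∈ Submodule.span K (Set.range (g l)) := by rw [hg]; trivial
    induction htm using Submodule.span_induction with
    | mem t ht =>
      obtain ⟨b, rfl⟩ := ht
      have hh := hφi (e ⟨l, b⟩)
      have hz : ∃ w : (rep (s l)).M →ₗ[R] G.M, φ ∘ₗ w = g l b := by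
        have : ∀ c : ι, e.symm (e ⟨l, b⟩) = c → ∃ w : (rep (s c.1)).M →ₗ[R] G.M,
            φ ∘ₗ w = g c.1 c.2 := by
          rintro c rfl
          exact ⟨B.i (e ⟨l, b⟩), hh⟩
        exact this ⟨l, b⟩ (e.symm_apply_apply _)
      exact hz
    | zero => exact ⟨0, LinearMap.comp_zero _⟩
    | add a b _ _ ha hb =>
      obtain ⟨a', rfl⟩ := ha
      obtain ⟨b', rfl⟩ := hb
      exact ⟨a' + b', LinearMap.comp_add _ _ _⟩
    | smul c a _ ha =>
      obtain ⟨a', rfl⟩ := ha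
      refine ⟨c • a', LinearMap.ext fun x => ?_⟩
      change φ (algebraMap K R c • a' x) = algebraMap K R c • φ (a' x)
      rw [map_smul φ]
  obtain ⟨E, i, n, W, ⟨BE⟩, hW, hi, hE⟩ := tilt h
  have happ' : ∀ w ∈ (arc K R).Sl Γ, ∀ t : (rep w).M →ₗ[R] Y.M,
      ∃ t' : (rep w).M →ₗ[R] G.M, φ ∘ₗ t' = t := by
    intro w hw
    obtain ⟨l, rfl⟩ : w ∈ Set.range s := hsr ▸ hw
    exact happ l
  have happE : ∀ t : E.M →ₗ[R] Y.M, ∃ t' : E.M →ₗ[R] G.M, φ ∘ₗ t' = t := by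
    intro t
    choose t' ht' using fun k => happ' (W k) (hW k) (t ∘ₗ BE.i k)
    refine ⟨∑ k, t' k ∘ₗ BE.p k, ?_⟩
    rw [comp_sum', BE.expand t]
    refine Finset.sum_congr rfl fun k _ => ?_
    rw [← LinearMap.comp_assoc, ht']
  let pt : ∀ (N : ModA R) (y : N.M), (fr K R 1).M →ₗ[R] N.M := fun N y =>
    (LinearMap.toSpanSingleton R N.M y) ∘ₗ (LinearMap.proj (0 : Fin 1) : (Fin 1 → R) →ₗ[R] R)
  have hpt : ∀ (N : ModA R) (y : N.M), pt N y (fun _ : Fin 1 => (1 : R)) = y := by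
    intro N y
    change (1 : R) • y = y
    rw [one_smul]
  have hφs : Function.Surjective φ := by
    intro y
    obtain ⟨t, ht⟩ := hE Y (fun s hs => noExt_sl hs hY) (pt Y y)
    obtain ⟨t', ht'⟩ := happE t
    refine ⟨t' (i (fun _ : Fin 1 => (1 : R))), ?_⟩
    have h1 : φ (t' (i (fun _ : Fin 1 => (1 : R)))) = t (i (fun _ : Fin 1 => (1 : R))) :=
      LinearMap.congr_fun ht' _
    have h2 : t (i (fun _ : Fin 1 => (1 : R))) = pt Y y (fun _ : Fin 1 => (1 : R)) :=
      LinearMap.congr_fun ht _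
    rw [h1, h2, hpt]
  have hsh := sub_ker φ hφs
  have hLT : InT K Γ (sub G (LinearMap.ker φ)) := by
    intro z hz f
    refine LinearMap.ext fun y => ?_
    obtain ⟨t, ht⟩ := hE (sub G (LinearMap.ker φ))
      (fun s hs => noExt_ker hsh (noExt_sl hs hGT) (happ' s hs)) (pt _ y)
    have h2 : t (i (fun _ : Fin 1 => (1 : R))) = pt _ y (fun _ : Fin 1 => (1 : R)) :=
      LinearMap.congr_fun ht _
    rw [hpt] at h2
    have h3 := inT_bip (K := K) (Γ := Γ) BE (fun k => (hW k).1) z hz (f ∘ₗ t)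
    rw [← h2]
    exact LinearMap.congr_fun h3 _
  obtain ⟨f', hf'⟩ := (noExt_notT hx hLT).lift hsh f
  refine ⟨_, Z, fun a => B.p a ∘ₗ f', γ, fun a => hsm _, ?_⟩
  rw [← hf']
  change (∑ a, γ a ∘ₗ B.p a) ∘ₗ f' = _
  rw [sum_comp']
  rfl

end
end CF

namespace CF
section
set_option linter.unusedSectionVars false

theorem cf_of {R : Type u} [Ring R] {S M : Type u} [AddCommGroup S] [Module R S] [AddCommGroup M]
    [Module R M] (N : Submodule R M) (g : N →ₗ[R] S) (hg : Function.Surjective g) :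
    IsCompFactorMod R S M := by
  refine ⟨(LinearMap.ker g).map N.subtype, N, Submodule.map_subtype_le _ _, ⟨?_⟩⟩
  have : ((LinearMap.ker g).map N.subtype).comap N.subtype = LinearMap.ker g :=
    Submodule.comap_map_eq_of_injective N.subtype_injective _
  rw [this]
  exact g.quotKerEquivOfSurjective hg

theorem cf_elim {R : Type u} [Ring R] {S M : Type u} [AddCommGroup S] [Module R S] [AddCommGroup M]
    [Module R M] (h : IsCompFactorMod R S M) :
    ∃ (N : Submodule R M) (g : N →ₗ[R] S), Function.Surjective g := by
  obtain ⟨N', N, -, ⟨e⟩⟩ := h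
  exact ⟨N, e.toLinearMap ∘ₗ Submodule.mkQ _, e.surjective.comp (Submodule.mkQ_surjective _)⟩

theorem cf_equiv {R : Type u} [Ring R] {S M M' : Type u} [AddCommGroup S] [Module R S]
    [AddCommGroup M] [Module R M] [AddCommGroup M'] [Module R M'] (e : M ≃ₗ[R] M')
    (h : IsCompFactorMod R S M) : IsCompFactorMod R S M' := by
  obtain ⟨N, g, hg⟩ := cf_elim h
  refine cf_of (N.map e.toLinearMap) (g ∘ₗ (e.submoduleMap N).symm.toLinearMap)
    (hg.comp (LinearEquiv.surjective _))

theorem cf_sub {R : Type u} [Ring R] {S M M' : Type u} [AddCommGroup S] [Module R S]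
    [AddCommGroup M] [Module R M] [AddCommGroup M'] [Module R M'] (i : M →ₗ[R] M')
    (hi : Function.Injective i)
    (h : IsCompFactorMod R S M) : IsCompFactorMod R S M' := by
  obtain ⟨N, g, hg⟩ := cf_elim h
  refine cf_of (N.map i) (g ∘ₗ (Submodule.equivMapOfInjective i hi N).symm.toLinearMap)
    (hg.comp (LinearEquiv.surjective _))

theorem l2a {R : Type u} [Ring R] {S M P : Type u} [AddCommGroup S] [Module R S] [AddCommGroup M]
    [Module R M] [AddCommGroup P] [Module R P] [Module.Projective R P] (h : IsCompFactorMod R S M)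
    (u : P →ₗ[R] S) (hu : u ≠ 0) : ∃ f : P →ₗ[R] M, f ≠ 0 := by
  obtain ⟨N, g, hg⟩ := cf_elim h
  obtain ⟨t, ht⟩ := Module.projective_lifting_property g u hg
  refine ⟨N.subtype ∘ₗ t, fun h0 => hu ?_⟩
  have : t = 0 := LinearMap.ext fun x => N.subtype_injective (by
    have := LinearMap.congr_fun h0 x
    simpa using this)
  rw [← ht, this, LinearMap.comp_zero]

theorem l2b {R : Type u} [Ring R] {S M I : Type u} [AddCommGroup S] [Module R S] [AddCommGroup M]
    [Module R M] [AddCommGroup I] [Module R I] (hI : Module.Injective R I)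
    (h : IsCompFactorMod R S M)
    (v : S →ₗ[R] I) (hv : v ≠ 0) : ∃ f : M →ₗ[R] I, f ≠ 0 := by
  obtain ⟨N, g, hg⟩ := cf_elim h
  obtain ⟨t, ht⟩ := hI.out N.subtype N.subtype_injective (v ∘ₗ g)
  refine ⟨t, fun h0 => hv ?_⟩
  refine LinearMap.ext fun s => ?_
  obtain ⟨n, rfl⟩ := hg s
  have := ht n
  rw [h0] at this
  exact this.symm

theorem l1 {R : Type u} [Ring R] {P : ModA R} (hP : P.IsIndec) (hpr : Module.Projective R P.M)
    {X S : Type u} [AddCommGroup X] [Module R X] [AddCommGroup S] [Module R S] [IsSimpleModule R S]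
    (f : P.M →ₗ[R] X) (hf : f ≠ 0) (π : P.M →ₗ[R] S) (hπ : π ≠ 0) : IsCompFactorMod R S X := by
  have hπs : Function.Surjective π := LinearMap.surjective_of_ne_zero hπ
  have hker : LinearMap.ker f ≤ LinearMap.ker π := by
    by_contra hcon
    have h1 : π ∘ₗ (LinearMap.ker f).subtype ≠ 0 := by
      intro h0
      apply hcon
      intro x hx
      exact LinearMap.congr_fun h0 ⟨x, hx⟩
    have h2 : Function.Surjective (π ∘ₗ (LinearMap.ker f).subtype) :=
      LinearMap.surjective_of_ne_zero h1
    obtain ⟨t, ht⟩ := Module.projective_lifting_property _ π h2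
    let θ : Module.End R P.M := (LinearMap.ker f).subtype ∘ₗ t
    have hθ : ∀ x, π (θ x) = π x := fun x => LinearMap.congr_fun ht x
    rcases fit hP θ with hb | ⟨n, hn⟩
    · apply hf
      refine LinearMap.ext fun x => ?_
      obtain ⟨y, rfl⟩ := hb.2 x
      exact (t y).2
    · have : ∀ m x, π ((θ ^ m) x) = π x := by
        intro m
        induction m with
        | zero => intro x; rfl
        | succ m ih =>
          intro x
          rw [pow_succ']
          change π (θ ((θ ^ m) x)) = _
          rw [hθ, ih]
      apply hπ
      refine LinearMap.ext fun x => ?_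
      rw [← this n x, hn]
      simp
  obtain ⟨g, hg⟩ := factor_surj (LinearMap.surjective_rangeRestrict f) π (by
    rwa [LinearMap.ker_rangeRestrict])
  refine cf_of (LinearMap.range f) g fun s => ?_
  obtain ⟨x, rfl⟩ := hπs s
  exact ⟨f.rangeRestrict x, LinearMap.congr_fun hg x⟩

theorem simple_fl {R : Type u} [Ring R] (S : Type u) [AddCommGroup S] [Module R S]
    [IsSimpleModule R S] : IsFiniteLength R S :=
  isFiniteLength_iff_isNoetherian_isArtinian.2 ⟨inferInstance, inferInstance⟩

theorem ex_simple_sub {R : Type u} [Ring R] (X : ModA R) (h : Nontrivial X.M) :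
    ∃ N : Submodule R X.M, IsSimpleModule R N := by
  obtain ⟨N, hN⟩ := IsAtomic.exists_atom (Submodule R X.M)
  exact ⟨N, isSimpleModule_iff_isAtom.2 hN⟩

theorem ex_simple_quo {R : Type u} [Ring R] (X : ModA R) (h : Nontrivial X.M) :
    ∃ N : Submodule R X.M, IsSimpleModule R (X.M ⧸ N) := by
  obtain ⟨N, hN⟩ := IsCoatomic.exists_coatom (Submodule R X.M)
  exact ⟨N, isSimpleModule_iff_isCoatom.2 hN⟩

variable {K R : Type u} [CommRing K] [IsArtinianRing K] [Ring R] [Algebra K R]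
    [Module.Finite K R] {Γ : Set (ARVertex R)}

theorem simple_top (K : Type u) {R : Type u} [CommRing K] [IsArtinianRing K] [Ring R] [Algebra K R]
    [Module.Finite K R] (S : Type u) [AddCommGroup S] [Module R S] [IsSimpleModule R S] :
    ∃ p : ARVertex R, IsProjVertex p ∧ ∃ π : (rep p).M →ₗ[R] S, π ≠ 0 :=
  c_ex_proj K ⟨S, simple_fl S⟩ (IsSimpleModule.nontrivial R S)

theorem simple_cf (h : ARCat.Cfg (arc K R) Γ) (S : Type u) [AddCommGroup S] [Module R S]
    [IsSimpleModule R S] : ∃ a ∈ Γ, IsCompFactorMod R S (rep a).M := by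
  obtain ⟨p, hp, π, hπ⟩ := simple_top K (R := R) S
  obtain ⟨a, ha, f, hf⟩ := h.proj p hp
  exact ⟨a, ha, l1 (rep_indec p) (proj_iff.1 hp) f hf π hπ⟩

theorem cc_comp (h : ARCat.Cfg (arc K R) Γ) : IsARComponent ((arc K R).CC Γ) := by
  refine ⟨Set.subset_univ _, ?_, ?_, ?_⟩
  · obtain ⟨a, ha⟩ := h.ne
    exact ⟨a, ARCat.CC_of_mem ha⟩
  · intro x hx y _ hxy
    exact ARCat.CC_conn hx (Relation.ReflTransGen.single hxy)
  · intro x hx y hy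
    exact Relation.ReflTransGen.mono (fun a b hab => ⟨trivial, trivial, hab⟩) _ _
      (h.CC_conn_iff hx hy)

theorem comp_conn {D : Set (ARVertex R)} (hD : IsARComponent D) {x y : ARVertex R} (hx : x ∈ D)
    (hy : y ∈ D) : (arc K R).Conn x y :=
  Relation.ReflTransGen.mono (fun _ _ hab => hab.2.2) _ _ (hD.2.2.2 x hx y hy)

theorem comp_closed {D : Set (ARVertex R)} (hD : IsARComponent D) {x y : ARVertex R} (hx : x ∈ D)
    (hxy : (arc K R).Conn x y) : y ∈ D := by
  induction hxy with
  | refl => exact hx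
  | tail _ h ih => exact hD.2.2.1 _ ih _ trivial h

theorem comp_eq {D D' : Set (ARVertex R)} (hD : IsARComponent D) (hD' : IsARComponent D')
    {x : ARVertex R} (hx : x ∈ D) (hx' : x ∈ D') : D = D' := by
  apply Set.Subset.antisymm
  · intro y hy
    have : Relation.ReflTransGen (fun a b => a ∈ Set.univ ∧ b ∈ Set.univ ∧ ARStep a b) x y :=
      hD.2.2.2 x hx y hy
    clear hy
    induction this with
    | refl => exact hx'
    | tail _ h ih => exact hD'.2.2.1 _ ih _ trivial h.2.2
  · intro y hy
    have : Relation.ReflTransGen (fun a b => a ∈ Set.univ ∧ b ∈ Set.univ ∧ ARStep a b) x y :=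
      hD'.2.2.2 x hx' y hy
    clear hy
    induction this with
    | refl => exact hx
    | tail _ h ih => exact hD.2.2.1 _ ih _ trivial h.2.2

theorem cyc_of {C : Set (ARVertex R)} {x : ARVertex R} (h : OnCycleIn C x) :
    Relation.TransGen (arc K R).Arrow x x :=
  Relation.TransGen.mono (fun _ _ hab => hab.2.2) _ _ h

theorem cc_core (h : ARCat.Cfg (arc K R) Γ) : IsCoreOf ((arc K R).CC Γ) Γ := by
  refine ⟨fun x hx => ARCat.CC_of_mem hx, h.fin, ?_, fun x hx hc => h.cyclic_mem hx (cyc_of hc)⟩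
  intro n c hc harr h0 hn k hk
  have hle : ∀ i j, i ≤ j → j ≤ n → (arc K R).Le (c i) (c j) := by
    intro i j hij
    induction j, hij using Nat.le_induction with
    | base => intro _; exact .refl
    | succ j hij ih =>
      intro hj
      exact (ih (by omega)).tail ((arc K R).arrow_ne (harr j (by omega)))
  exact h.conv _ h0 _ hn _ (hle 0 k (by omega) hk) (hle k n hk le_rfl)

theorem cc_acyc (h : ARCat.Cfg (arc K R) Γ) : IsAlmostAcyclicComp ((arc K R).CC Γ) :=
  h.fin.subset fun _ hx => h.cyclic_mem hx.1 (cyc_of hx.2)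

theorem homVanish_of {U V : Set (ARVertex R)} (h : ∀ x ∈ U, ∀ y ∈ V, ¬ (arc K R).H x y) :
    HomVanish U V := by
  intro X Y hX hY f
  obtain ⟨e⟩ := rep_mk X
  obtain ⟨d⟩ := rep_mk Y
  have h0 : d.symm.toLinearMap ∘ₗ f ∘ₗ e.toLinearMap = 0 := by
    by_contra hne
    exact h _ hX _ hY (H_of _ hne)
  refine LinearMap.ext fun x => ?_
  have := LinearMap.congr_fun h0 (e.symm x)
  simpa using this

theorem not_H_of {U V : Set (ARVertex R)} (h : HomVanish U V) {x y : ARVertex R} (hx : x ∈ U)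
    (hy : y ∈ V) : ¬ (arc K R).H x y := by
  rintro ⟨f, hf⟩
  exact hf (h ⟨rep x, rep_indec x⟩ ⟨rep y, rep_indec y⟩ (by rwa [mk_rep]) (by rwa [mk_rep]) f)

theorem sincere_cc (h : ARCat.Cfg (arc K R) Γ) : SincereSet ((arc K R).CC Γ) := by
  intro S _ _ hS
  obtain ⟨a, ha, hc⟩ := simple_cf h S
  exact ⟨a, ARCat.CC_of_mem ha, ⟨rep a, rep_indec a⟩, mk_rep a, hc⟩

theorem cc_sep (h : ARCat.Cfg (arc K R) Γ) : IsSeparatingFamily {(arc K R).CC Γ} := by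
  set C := (arc K R).CC Γ with hC
  have hCc := cc_comp h
  have hnot : ∀ D, IsARComponent D → D ≠ C → ∀ x ∈ D, x ∉ C := fun D hD hne x hx hxC =>
    hne (comp_eq hD hCc hx hxC)
  have hTc : ∀ D, IsARComponent D → D ≠ C → ∀ x ∈ D, ∀ y ∈ D,
      ((arc K R).T Γ x ↔ (arc K R).T Γ y) := fun D hD hne x hx y hy =>
    h.T_conn (hnot D hD hne x hx) (comp_conn hD hx hy)
  refine ⟨{D | IsARComponent D ∧ D ≠ C ∧ ∀ x ∈ D, ¬ (arc K R).T Γ x},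
    {D | IsARComponent D ∧ D ≠ C ∧ ∀ x ∈ D, (arc K R).T Γ x}, fun D hD => hD.1, ?_,
    fun D hD => hD.1, ?_, ?_, ?_, ?_, ?_, ?_, ?_, ?_, ?_⟩
  · rintro D rfl
    exact hCc
  · intro D hD
    by_cases hDC : D = C
    · exact Or.inr (Or.inl hDC)
    · obtain ⟨x, hx⟩ := hD.2.1
      by_cases hT : (arc K R).T Γ x
      · exact Or.inr (Or.inr ⟨hD, hDC, fun y hy => (hTc D hD hDC x hx y hy).1 hT⟩)
      · exact Or.inl ⟨hD, hDC, fun y hy hyT => hT ((hTc D hD hDC x hx y hy).2 hyT)⟩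
  · rintro D ⟨hD, hDC, hT⟩
    refine ⟨hDC, ?_⟩
    rintro ⟨-, -, hT'⟩
    obtain ⟨x, hx⟩ := hD.2.1
    exact hT x hx (hT' x hx)
  · rintro D rfl ⟨-, h', -⟩
    exact h' rfl
  · rw [Set.sUnion_singleton]; exact sincere_cc h
  · rw [Set.sUnion_singleton]
    exact gs_set K fun x hx y hy => h.gen_standard hx hy
  · refine homVanish_of (K := K) ?_
    rintro x ⟨D, ⟨-, -, hT⟩, hx⟩ y ⟨D', ⟨-, -, hT'⟩, hy⟩
    exact ARCat.T_not (hT x hx) (hT' y hy)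
  · refine homVanish_of (K := K) ?_
    rw [Set.sUnion_singleton]
    rintro x ⟨D, ⟨hD, hDC, hT⟩, hx⟩ y hy
    exact h.van_left hy (hnot D hD hDC x hx) (hT x hx)
  · refine homVanish_of (K := K) ?_
    rw [Set.sUnion_singleton]
    rintro x hx y ⟨D, ⟨hD, hDC, hT⟩, hy⟩
    exact h.van_right hx (hnot D hD hDC y hy) (hT y hy)
  · rintro X Y ⟨D, ⟨-, -, hT⟩, hX⟩ ⟨D', ⟨-, -, hT'⟩, hY⟩ f
    rw [Set.sUnion_singleton]
    obtain ⟨e⟩ := rep_mk X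
    obtain ⟨d⟩ := rep_mk Y
    have hYT : InT K Γ Y.1 := inT_quot (inT_rep.2 (hT' _ hY)) d.toLinearMap d.surjective
    obtain ⟨n, Z, g, t, hZ, hft⟩ := factor_sl h (hT _ hX) hYT (f ∘ₗ e.toLinearMap)
    refine ⟨n, fun k => ⟨rep (Z k), rep_indec (Z k)⟩, fun k => g k ∘ₗ e.symm.toLinearMap, t,
      fun k => ?_, ?_⟩
    · rw [mk_rep]; exact h.L4 (Or.inl (hZ k))
    · refine LinearMap.ext fun x => ?_
      have := LinearMap.congr_fun hft (e.symm x)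
      rw [LinearMap.sum_apply] at this ⊢
      simpa using this

theorem cc_unique (h : ARCat.Cfg (arc K R) Γ) {C' : Set (ARVertex R)} (hC' : IsARComponent C')
    (hs : IsSeparatingFamily {C'}) : C' = (arc K R).CC Γ := by
  by_contra hne
  obtain ⟨ps, qs, -, -, -, hall, -, -, hsin, -, hqp, hqc, hcp, -⟩ := hs
  rw [Set.sUnion_singleton] at hsin hqc hcp
  set C := (arc K R).CC Γ with hC
  have hCc := cc_comp h
  have hin : ∀ x ∈ C', x ∉ C := fun x hx hxC => hne (comp_eq hC' hCc hx hxC)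
  obtain ⟨x, hx⟩ := hC'.2.1
  have hCcase := hall C hCc
  have sinc : ∀ (S : Type u) [AddCommGroup S] [Module R S], IsSimpleModule R S →
      ∃ y ∈ C', IsCompFactorMod R S (rep y).M := by
    intro S _ _ hS
    obtain ⟨y, hy, Y, rfl, hc⟩ := hsin S hS
    obtain ⟨e⟩ := rep_mk Y
    exact ⟨_, hy, cf_equiv e.symm hc⟩
  by_cases hxT : (arc K R).T Γ x
  · -- C' in the torsion class
    have h1 : ∃ z ∈ C, (arc K R).H z x := by
      obtain ⟨p, hp, f, hf⟩ := c_ex_proj K (rep x) (rep_indec x).1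
      by_cases hpT : (arc K R).T Γ p
      · obtain ⟨a, ha, hpa⟩ := h.proj p hp
        exact ⟨p, ARCat.CC_of_mem (h.mem_of_T hpT ha (.single hpa)), H_of f hf⟩
      · obtain ⟨n, Z, g, t, hZ, hft⟩ := factor_sl h hpT (inT_rep.2 hxT) f
        by_contra hcon
        push Not at hcon
        apply hf
        rw [hft]
        refine Finset.sum_eq_zero fun k _ => ?_
        have : t k = 0 := by
          by_contra hne
          exact hcon (Z k) (h.L4 (Or.inl (hZ k))) (H_of _ hne)
        rw [this, LinearMap.zero_comp]
    obtain ⟨z, hz, hzx⟩ := h1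
    have hCps : C ∈ ps := by
      rcases hCcase with h | h | h
      · exact h
      · exact absurd h.symm hne
      · exact absurd hzx (not_H_of hqc (Set.mem_sUnion_of_mem hz h) hx)
    obtain ⟨i, hi, hI⟩ := h.exists_inj
    obtain ⟨N, hN⟩ := ex_simple_sub (rep i) (rep_indec i).1
    obtain ⟨y, hy, hc⟩ := sinc N hN
    have hnt : Nontrivial N := IsSimpleModule.nontrivial R N
    obtain ⟨f, hf⟩ := l2b (inj_iff.1 hI) hc N.subtype (by
      intro h0
      obtain ⟨n, hn⟩ := exists_ne (0 : N)
      exact hn (N.subtype_injective (LinearMap.congr_fun h0 n)))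
    exact not_H_of hcp hy (Set.mem_sUnion_of_mem hi hCps) (H_of (K := K) f hf)
  · have h1 : ∃ z ∈ C, (arc K R).H x z := by
      obtain ⟨i, hi, f, hf⟩ := c_ex_inj K (rep x) (rep_indec x).1
      obtain ⟨n, Z, g, t, hZ, hft⟩ := factor_sl h hxT (inT_rep.2 (h.T_inj hi)) f
      by_contra hcon
      push Not at hcon
      apply hf
      rw [hft]
      refine Finset.sum_eq_zero fun k _ => ?_
      have : g k = 0 := by
        by_contra hne
        exact hcon (Z k) (h.L4 (Or.inl (hZ k))) (H_of _ hne)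
      rw [this, LinearMap.comp_zero]
    obtain ⟨z, hz, hxz⟩ := h1
    have hCqs : C ∈ qs := by
      rcases hCcase with h | h | h
      · exact absurd hxz (not_H_of hcp hx (Set.mem_sUnion_of_mem hz h))
      · exact absurd h.symm hne
      · exact h
    obtain ⟨p, hp, hP⟩ := h.exists_proj
    obtain ⟨N, hN⟩ := ex_simple_quo (rep p) (rep_indec p).1
    obtain ⟨y, hy, hc⟩ := sinc _ hN
    have hpr : Module.Projective R (rep p).M := proj_iff.1 hP
    have hnt : Nontrivial ((rep p).M ⧸ N) := IsSimpleModule.nontrivial R _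
    obtain ⟨f, hf⟩ := l2a hc N.mkQ (by
      intro h0
      obtain ⟨n, hn⟩ := exists_ne (0 : (rep p).M ⧸ N)
      obtain ⟨m, rfl⟩ := N.mkQ_surjective n
      exact hn (LinearMap.congr_fun h0 m))
    exact not_H_of hqc (Set.mem_sUnion_of_mem hp hCqs) hy (H_of (K := K) f hf)

end
end CF

namespace CF
section
set_option linter.unusedSectionVars false

variable {K R : Type u} [CommRing K] [IsArtinianRing K] [Ring R] [Algebra K R]
    [Module.Finite K R] {Γ : Set (ARVertex R)}

/-- Nonzero quotients of indecomposable projective modules are indecomposable. -/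
theorem quo_indec {P X : ModA R} (hP : P.IsIndec) (hpr : Module.Projective R P.M)
    (π : P.M →ₗ[R] X.M) (hπ : Function.Surjective π) (hX : Nontrivial X.M) : X.IsIndec := by
  refine ⟨hX, fun θ hθ => ?_⟩
  obtain ⟨t, ht⟩ := proj_lift hpr hπ (θ ∘ₗ π)
  have ht' : ∀ x, π (t x) = θ (π x) := fun x => LinearMap.congr_fun ht x
  have hθ' : ∀ x, θ (θ x) = θ x := fun x => LinearMap.congr_fun hθ x
  rcases fit hP t with hb | ⟨n, hn⟩
  · right
    refine LinearMap.ext fun x => ?_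
    obtain ⟨y, rfl⟩ := hπ x
    obtain ⟨z, rfl⟩ := hb.2 y
    rw [ht', hθ']
    rfl
  · left
    have h1 : ∀ m x, π ((t ^ m : Module.End R P.M) (t x)) = θ (π x) := by
      intro m
      induction m with
      | zero => intro x; exact ht' x
      | succ m ih =>
        intro x
        rw [pow_succ]
        change π ((t ^ m : Module.End R P.M) (t (t x))) = _
        rw [ih, ht', hθ']
    refine LinearMap.ext fun x => ?_
    obtain ⟨y, rfl⟩ := hπ x
    rw [← h1 n y, show (t : Module.End R P.M) ^ n = 0 from hn]
    simp

theorem cfg_reject (h : ARCat.Cfg (arc K R) Γ) (p : ARVertex R) (hp : IsProjVertex p)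
    (x : (rep p).M) (hx : ∀ a ∈ Γ, ∀ f : (rep p).M →ₗ[R] (rep a).M, f x = 0) : x = 0 := by
  by_contra hx0
  have hpr : Module.Projective R (rep p).M := proj_iff.1 hp
  let L : Submodule R (rep p).M :=
    { carrier := {x | ∀ a ∈ Γ, ∀ f : (rep p).M →ₗ[R] (rep a).M, f x = 0}
      add_mem' := fun {u v} hu hv a ha f => by rw [map_add, hu a ha f, hv a ha f, add_zero]
      zero_mem' := fun a _ f => map_zero f
      smul_mem' := fun r u hu a ha f => by rw [map_smul f, hu a ha f, smul_zero] }
  have hL : ∀ a ∈ Γ, ∀ f : (rep p).M →ₗ[R] (rep a).M, L ≤ LinearMap.ker f :=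
    fun a ha f y hy => hy a ha f
  obtain ⟨a0, ha0, f0, hf0⟩ := h.proj p hp
  have hX : Nontrivial ((rep p).M ⧸ L) := by
    rw [Submodule.Quotient.nontrivial_iff]
    intro htop
    apply hf0
    refine LinearMap.ext fun y => ?_
    exact hL a0 ha0 f0 (htop ▸ Submodule.mem_top : y ∈ L)
  have hXi : (quo (rep p) L).IsIndec := quo_indec (rep_indec p) hpr (quo.π _ L) (quo_surj _ L) hX
  obtain ⟨b, ⟨e⟩⟩ := exists_rep hXi
  let f : (rep p).M →ₗ[R] (rep b).M := e.symm.toLinearMap ∘ₗ quo.π _ L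
  have hfs : Function.Surjective f := e.symm.surjective.comp (quo_surj _ L)
  have hfk : LinearMap.ker f = L := by
    change LinearMap.ker (e.symm.toLinearMap ∘ₗ L.mkQ) = L
    rw [LinearEquiv.ker_comp, Submodule.ker_mkQ]
  have hbn : ¬ IsProjVertex b := by
    intro hb
    obtain ⟨s, hs⟩ := proj_lift (proj_iff.1 hb) hfs LinearMap.id
    have hbij := splitEpi_bij (rep_indec p) (rep_indec b) (f := f) ⟨s, hs⟩
    have : x ∈ LinearMap.ker f := by rw [hfk]; exact hx
    exact hx0 (hbij.1 (by rw [map_zero]; exact this))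
  have hfac : ∀ (z : ARVertex R) (c : (rep p).M →ₗ[R] (rep z).M), L ≤ LinearMap.ker c →
      ∃ c' : (rep b).M →ₗ[R] (rep z).M, c' ∘ₗ f = c := by
    intro z c hc
    exact factor_surj hfs c (by rw [hfk]; exact hc)
  obtain ⟨c0, hc0⟩ := hfac a0 f0 (hL a0 ha0 f0)
  have hba : (arc K R).H b a0 := H_of c0 (by
    rintro rfl
    exact hf0 (by rw [← hc0, LinearMap.zero_comp]; rfl))
  obtain ⟨a, hab⟩ := proj_or' K b hbn
  have hna : ∀ n ∈ Γ, ¬ (arc K R).H n a := by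
    intro n hn hna
    obtain ⟨m, Z, i, q, hZb, haZ, hqr, -, hlift, -⟩ := (arc K R).tau_seq a b hab
    have hZ : ∀ k, Z k ∈ Γ := by
      intro k
      refine h.conv n hn a0 ha0 (Z k) ?_ ?_
      · exact (Relation.ReflTransGen.single hna).tail ((arc K R).arrow_ne ((haZ _).2 ⟨k, rfl⟩))
      · exact (Relation.ReflTransGen.single
          ((arc K R).arrow_ne ((hZb _).2 ⟨k, rfl⟩))).tail hba
    have hfr : f ∈ (arc K R).Rad p b := (arc K R).rad_ne (by rintro rfl; exact hbn hp) f
    obtain ⟨c, hc⟩ := hlift p f hfr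
    have hc' : ∀ k, ∃ c' : (rep b).M →ₗ[R] (rep (Z k)).M, c' ∘ₗ f = c k := fun k =>
      hfac (Z k) (c k) (hL _ (hZ k) _)
    choose c' hc' using hc'
    have hone : (LinearMap.id : (rep b).M →ₗ[R] (rep b).M) =
        ∑ k, (arc K R).comp (a := b) (c' k) (q k) := by
      refine LinearMap.ext fun y => ?_
      obtain ⟨w, rfl⟩ := hfs y
      have h1 := LinearMap.congr_fun (show f = ∑ k, ((q k : (rep (Z k)).M →ₗ[R] (rep b).M) ∘ₗ
        (c k : (rep p).M →ₗ[R] (rep (Z k)).M)) from hc) w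
      have h2 : (∑ k, (arc K R).comp (a := b) (c' k) (q k)) =
        ∑ k, ((q k : (rep (Z k)).M →ₗ[R] (rep b).M) ∘ₗ c' k) := rfl
      rw [h2]
      rw [LinearMap.sum_apply] at h1 ⊢
      rw [LinearMap.id_apply]
      refine h1.trans (Finset.sum_congr rfl fun k _ => ?_)
      rw [← hc' k]
      rfl
    apply (arc K R).one_rad b
    change (LinearMap.id : (rep b).M →ₗ[R] (rep b).M) ∈ (arc K R).Rad b b
    rw [hone]
    exact AddSubgroup.sum_mem _ fun k _ => (arc K R).rad_r _ _ (hqr k)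
  -- a simple quotient of L
  have hLn : Nontrivial (sub (rep p) L).M := ⟨⟨x, hx⟩, 0, fun h0 => hx0 (congrArg Subtype.val h0)⟩
  obtain ⟨M, hM⟩ := ex_simple_quo (sub (rep p) L) hLn
  obtain ⟨n, hn, hcf⟩ := simple_cf h ((sub (rep p) L).M ⧸ M)
  obtain ⟨N, g, hg⟩ := cf_elim hcf
  let W : Submodule R (rep n).M := (LinearMap.ker g).map N.subtype
  let Y := quo (rep n) W
  have hY : NoExt (rep b) Y := by
    refine ar_one' hab fun t => ?_
    by_contra ht
    refine hna n hn (H_of (t ∘ₗ quo.π _ W) fun h0 => ht ?_)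
    refine LinearMap.ext fun y => ?_
    obtain ⟨w, rfl⟩ := quo_surj _ W y
    exact LinearMap.congr_fun h0 w
  obtain ⟨v, hv⟩ := factor_surj hg (W.mkQ ∘ₗ N.subtype) (by
    intro y hy
    change W.mkQ (N.subtype y) = 0
    rw [Submodule.mkQ_apply, Submodule.Quotient.mk_eq_zero]
    exact ⟨y, hy, rfl⟩)
  have hSh : Sh (sub.ι (rep p) L) f := ⟨sub_inj _ _, hfs, by
    rw [hfk]; exact Submodule.range_subtype L⟩
  obtain ⟨t, ht⟩ := hY.extend hSh (v ∘ₗ M.mkQ)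
  obtain ⟨t', ht'⟩ := proj_lift hpr (quo_surj (rep n) W) t
  have hz : ∀ y : (sub (rep p) L).M, v (M.mkQ y) = 0 := by
    intro y
    have h1 := LinearMap.congr_fun ht y
    have h2 : t (y : L).1 = quo.π _ W (t' (y : L).1) := (LinearMap.congr_fun ht' _).symm
    have h3 : t' (y : L).1 = 0 := (y : L).2 n hn t'
    rw [h3, map_zero] at h2
    exact h1.symm.trans h2
  have hnt : Nontrivial ((sub (rep p) L).M ⧸ M) := IsSimpleModule.nontrivial R _
  obtain ⟨s, hs⟩ := exists_ne (0 : (sub (rep p) L).M ⧸ M)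
  obtain ⟨y, rfl⟩ := M.mkQ_surjective s
  obtain ⟨w, hw⟩ := hg (M.mkQ y)
  apply hs
  rw [← hw]
  have h4 : W.mkQ (N.subtype w) = 0 := by
    have := LinearMap.congr_fun hv w
    rw [LinearMap.comp_apply, hw, hz y] at this
    exact this.symm
  rw [Submodule.mkQ_apply, Submodule.Quotient.mk_eq_zero] at h4
  obtain ⟨w', hw', he⟩ := h4
  have : w' = w := N.subtype_injective he
  rw [← this]
  exact hw'

theorem cfg_faithful (h : ARCat.Cfg (arc K R) Γ) (r : R)
    (hr : ∀ a ∈ Γ, ∀ m : (rep a).M, r • m = 0) : r = 0 := by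
  obtain ⟨n, Z, ⟨B⟩⟩ := exists_biP (fr K R 1)
  let o : (fr K R 1).M := (fun _ => (1 : R) : Fin 1 → R)
  have h1 : r • o = 0 := by
    have h2 := LinearMap.congr_fun B.tot (r • o)
    rw [LinearMap.id_apply, LinearMap.sum_apply] at h2
    rw [← h2]
    refine Finset.sum_eq_zero fun k _ => ?_
    have hp : IsProjVertex (Z k) := proj_iff.2 (proj_retract (fr_proj 1) (B.i k) (B.p k) (B.pi k))
    have : B.p k (r • o) = 0 := by
      refine cfg_reject h (Z k) hp _ fun a ha f => ?_
      rw [map_smul (B.p k), map_smul f, hr a ha]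
    rw [LinearMap.comp_apply, this, map_zero]
  have h2 := congrFun (show (r • (fun _ => (1 : R)) : Fin 1 → R) = 0 from h1) 0
  simpa using h2

end
end CF

namespace CF
section
set_option linter.unusedSectionVars false

variable {R R' : Type u} [Ring R] [Ring R'] (φ : R →+* R') (hφ : Function.Surjective φ)

/-- restriction of scalars -/
def resRaw (N : Type u) [AddCommGroup N] [Module R' N] : RawMod R :=
  @RawMod.mk R _ N _ (Module.compHom N φ)

theorem res_fl (φ : R →+* R') (hφ : Function.Surjective φ) (N : ModA R') : IsFiniteLength R (resRaw φ N.M).M := by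
  let F : Submodule R (resRaw φ N.M).M → Submodule R' N.M := fun p =>
    { carrier := {x | (x : (resRaw φ N.M).M) ∈ p}
      add_mem' := fun {a b} ha hb => p.add_mem ha hb
      zero_mem' := p.zero_mem
      smul_mem' := fun b x hx => by
        obtain ⟨r, rfl⟩ := hφ b
        exact p.smul_mem r hx }
  have hF : StrictMono F := by
    intro p q hpq
    refine lt_of_le_of_ne (fun x hx => hpq.le hx) fun heq => hpq.ne ?_
    refine SetLike.ext fun x => ?_
    exact SetLike.ext_iff.1 heq x
  rw [isFiniteLength_iff_isNoetherian_isArtinian]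
  constructor
  · rw [isNoetherian_iff']
    exact hF.wellFoundedGT
  · exact hF.wellFoundedLT

/-- restriction of scalars -/
def res (N : ModA R') : ModA R := ⟨(resRaw φ N.M).M, res_fl φ hφ N⟩

/-- The identity as a map. -/
def toRes (N : ModA R') : N.M ≃+ (res φ hφ N).M := AddEquiv.refl N.M

theorem toRes_smul (N : ModA R') (r : R) (m : N.M) :
    toRes φ hφ N (φ r • m) = r • toRes φ hφ N m := rfl

theorem toRes_symm_smul (N : ModA R') (r : R) (m : (res φ hφ N).M) :
    (toRes φ hφ N).symm (r • m) = φ r • (toRes φ hφ N).symm m := rfl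

/-- restrict a map -/
def dn {N L : ModA R'} (f : N.M →ₗ[R'] L.M) : (res φ hφ N).M →ₗ[R] (res φ hφ L).M where
  toFun x := toRes φ hφ L (f ((toRes φ hφ N).symm x))
  map_add' x y := by simp
  map_smul' r x := by
    rw [toRes_symm_smul, map_smul f, toRes_smul]; rfl

/-- lift a map -/
def up {N L : ModA R'} (f : (res φ hφ N).M →ₗ[R] (res φ hφ L).M) : N.M →ₗ[R'] L.M where
  toFun x := (toRes φ hφ L).symm (f (toRes φ hφ N x))
  map_add' x y := by simp
  map_smul' b x := by
    obtain ⟨r, rfl⟩ := hφ b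
    rw [toRes_smul, map_smul f, toRes_symm_smul]; rfl

theorem up_dn {N L : ModA R'} (f : N.M →ₗ[R'] L.M) : up φ hφ (dn φ hφ f) = f := rfl

theorem dn_up {N L : ModA R'} (f : (res φ hφ N).M →ₗ[R] (res φ hφ L).M) :
    dn φ hφ (up φ hφ f) = f := rfl

theorem dn_inj {N L : ModA R'} {f g : N.M →ₗ[R'] L.M} (h : dn φ hφ f = dn φ hφ g) : f = g := by
  rw [← up_dn φ hφ f, h, up_dn]

theorem dn_comp {N L M : ModA R'} (f : N.M →ₗ[R'] L.M) (g : L.M →ₗ[R'] M.M) :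
    dn φ hφ (g ∘ₗ f) = dn φ hφ g ∘ₗ dn φ hφ f := rfl

theorem up_comp {N L M : ModA R'} (f : (res φ hφ N).M →ₗ[R] (res φ hφ L).M)
    (g : (res φ hφ L).M →ₗ[R] (res φ hφ M).M) :
    up φ hφ (g ∘ₗ f) = up φ hφ g ∘ₗ up φ hφ f := rfl

theorem res_indec {N : ModA R'} (h : N.IsIndec) : (res φ hφ N).IsIndec := by
  have hnt := h.1
  refine ⟨(toRes φ hφ N).symm.toEquiv.nontrivial, fun f hf => ?_⟩
  rcases h.2 (up φ hφ f) (congrArg (up φ hφ) hf) with h0 | h1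
  · left
    exact congrArg (dn φ hφ) h0
  · right
    exact congrArg (dn φ hφ) h1

theorem indec_of_res {N : ModA R'} (h : (res φ hφ N).IsIndec) : N.IsIndec := by
  have hnt := h.1
  refine ⟨(toRes φ hφ N).toEquiv.nontrivial, fun f hf => ?_⟩
  rcases h.2 (dn φ hφ f) (congrArg (dn φ hφ) hf) with h0 | h1
  · left
    exact congrArg (up φ hφ) h0
  · right
    exact congrArg (up φ hφ) h1

/-- isomorphisms lift -/
theorem up_iso {N L : ModA R'} (e : (res φ hφ N).M ≃ₗ[R] (res φ hφ L).M) :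
    Nonempty (N.M ≃ₗ[R'] L.M) :=
  ⟨LinearEquiv.ofBijective (up φ hφ e.toLinearMap) e.bijective⟩

theorem dn_iso {N L : ModA R'} (e : N.M ≃ₗ[R'] L.M) :
    Nonempty ((res φ hφ N).M ≃ₗ[R] (res φ hφ L).M) :=
  ⟨LinearEquiv.ofBijective (dn φ hφ e.toLinearMap) e.bijective⟩

/-- Irreducible maps lift. -/
theorem up_irred {N L : ModA R'} {f : (res φ hφ N).M →ₗ[R] (res φ hφ L).M} (hf : IsIrred f) :
    IsIrred (up φ hφ f) := by
  refine ⟨?_, ?_, ?_⟩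
  · rintro ⟨r, hr⟩
    exact hf.1 ⟨dn φ hφ r, congrArg (dn φ hφ) hr⟩
  · rintro ⟨r, hr⟩
    exact hf.2.1 ⟨dn φ hφ r, congrArg (dn φ hφ) hr⟩
  · intro Z g h hgh
    rcases hf.2.2 (res φ hφ Z) (dn φ hφ g) (dn φ hφ h) (congrArg (dn φ hφ) hgh) with
      ⟨r, hr⟩ | ⟨r, hr⟩
    · exact Or.inl ⟨up φ hφ r, congrArg (up φ hφ) hr⟩
    · exact Or.inr ⟨up φ hφ r, congrArg (up φ hφ) hr⟩

theorem res_up (X : ModA R) (hX : ∀ r, φ r = 0 → ∀ m : X.M, r • m = 0) :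
    ∃ N : ModA R', Nonempty ((res φ hφ N).M ≃ₗ[R] X.M) := by
  let g : R' →+* AddMonoid.End X.M := RingHom.liftOfRightInverse φ _ (Function.rightInverse_surjInv hφ)
    ⟨Module.toAddMonoidEnd R X.M, fun r hr => by
      rw [RingHom.mem_ker] at hr ⊢
      refine AddMonoidHom.ext fun m => ?_
      exact hX r hr m⟩
  have hg : ∀ r (m : X.M), g (φ r) m = r • m := by
    intro r m
    have := RingHom.liftOfRightInverse_comp_apply φ _ (Function.rightInverse_surjInv hφ)
      ⟨Module.toAddMonoidEnd R X.M, fun r hr => by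
        rw [RingHom.mem_ker] at hr ⊢
        refine AddMonoidHom.ext fun m => ?_
        exact hX r hr m⟩ r
    exact DFunLike.congr_fun this m
  let _ : Module R' X.M := Module.compHom X.M g
  have hs : ∀ r (m : X.M), φ r • m = r • m := fun r m => hg r m
  let F : Submodule R' X.M → Submodule R X.M := fun p =>
    { carrier := p
      add_mem' := fun {a b} ha hb => p.add_mem ha hb
      zero_mem' := p.zero_mem
      smul_mem' := fun b x hx => by
        rw [← hs]
        exact p.smul_mem _ hx }
  have hF : StrictMono F := by
    intro p q hpq
    refine lt_of_le_of_ne (fun x hx => hpq.le hx) fun heq => hpq.ne ?_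
    refine SetLike.ext fun x => ?_
    exact SetLike.ext_iff.1 heq x
  have hfl : IsFiniteLength R' X.M := by
    rw [isFiniteLength_iff_isNoetherian_isArtinian]
    constructor
    · rw [isNoetherian_iff']
      exact hF.wellFoundedGT
    · exact hF.wellFoundedLT
  exact ⟨⟨X.M, hfl⟩, ⟨{ toRes φ hφ ⟨X.M, hfl⟩ with
    toFun := (toRes φ hφ ⟨X.M, hfl⟩).symm
    invFun := toRes φ hφ ⟨X.M, hfl⟩
    left_inv := fun _ => rfl
    right_inv := fun _ => rfl
    map_add' := fun _ _ => rfl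
    map_smul' := fun r m => hs r m }⟩⟩

/-- the map on vertices -/
noncomputable def rs (y : ARVertex R') : ARVertex R := ARVertex.mk ⟨res φ hφ (rep y), res_indec φ hφ (rep_indec y)⟩

theorem rs_iso (y : ARVertex R') : Nonempty ((rep (rs φ hφ y)).M ≃ₗ[R] (res φ hφ (rep y)).M) :=
  rep_mk _

theorem rs_inj {y z : ARVertex R'} (h : rs φ hφ y = rs φ hφ z) : y = z := by
  obtain ⟨e⟩ := rs_iso φ hφ y
  obtain ⟨d⟩ := rs_iso φ hφ z
  rw [h] at e
  obtain ⟨t⟩ := up_iso φ hφ (e.symm ≪≫ₗ d)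
  exact eq_of_iso t

theorem rs_surj {x : ARVertex R} (hx : ∀ r, φ r = 0 → ∀ m : (rep x).M, r • m = 0) :
    ∃ y, rs φ hφ y = x := by
  obtain ⟨N, ⟨e⟩⟩ := res_up φ hφ (rep x) hx
  have hN : N.IsIndec := indec_of_res φ hφ (indec_iso e.symm (rep_indec x))
  obtain ⟨y, ⟨d⟩⟩ := exists_rep hN
  obtain ⟨d'⟩ := dn_iso φ hφ d
  obtain ⟨t⟩ := rs_iso φ hφ y
  exact ⟨y, eq_of_iso (t ≪≫ₗ d' ≪≫ₗ e)⟩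

theorem rs_hom {y z : ARVertex R'} : (∃ f : (rep (rs φ hφ y)).M →ₗ[R] (rep (rs φ hφ z)).M, f ≠ 0) ↔
    ∃ f : (rep y).M →ₗ[R'] (rep z).M, f ≠ 0 := by
  obtain ⟨e⟩ := rs_iso φ hφ y
  obtain ⟨d⟩ := rs_iso φ hφ z
  constructor
  · rintro ⟨f, hf⟩
    refine ⟨up φ hφ (d.toLinearMap ∘ₗ f ∘ₗ e.symm.toLinearMap), fun h0 => hf ?_⟩
    have h1 : d.toLinearMap ∘ₗ f ∘ₗ e.symm.toLinearMap = 0 := congrArg (dn φ hφ) h0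
    refine LinearMap.ext fun x => ?_
    have := LinearMap.congr_fun h1 (e x)
    simpa using this
  · rintro ⟨f, hf⟩
    refine ⟨d.symm.toLinearMap ∘ₗ dn φ hφ f ∘ₗ e.toLinearMap, fun h0 => hf ?_⟩
    apply dn_inj φ hφ
    refine LinearMap.ext fun x => ?_
    have := LinearMap.congr_fun h0 (e.symm x)
    simp at this
    exact this

theorem rs_arrow {y z : ARVertex R'} (h : ARArrow (rs φ hφ y) (rs φ hφ z)) : ARArrow y z := by
  obtain ⟨f, hf⟩ := arrow_iff.1 h
  obtain ⟨e⟩ := rs_iso φ hφ y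
  obtain ⟨d⟩ := rs_iso φ hφ z
  exact arrow_iff.2 ⟨_, up_irred φ hφ (irred_iso e d hf)⟩

theorem cf_up {S : Type u} [AddCommGroup S] [Module R' S] {N : ModA R'}
    (h : IsCompFactorMod R (resRaw φ S).M (res φ hφ N).M) : IsCompFactorMod R' S N.M := by
  obtain ⟨L, g, hg⟩ := cf_elim h
  let L' : Submodule R' N.M :=
    { carrier := {x | toRes φ hφ N x ∈ L}
      add_mem' := fun {a b} ha hb => L.add_mem ha hb
      zero_mem' := L.zero_mem
      smul_mem' := fun b x hx => by
        obtain ⟨r, rfl⟩ := hφ b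
        exact L.smul_mem r hx }
  let g' : L' →ₗ[R'] S :=
    { toFun := fun x => g ⟨toRes φ hφ N x.1, x.2⟩
      map_add' := fun x y => map_add g ⟨toRes φ hφ N x.1, x.2⟩ ⟨toRes φ hφ N y.1, y.2⟩
      map_smul' := fun b x => by
        obtain ⟨r, rfl⟩ := hφ b
        exact map_smul g r ⟨toRes φ hφ N x.1, x.2⟩ }
  refine cf_of L' g' fun s => ?_
  obtain ⟨x, hx⟩ := hg s
  exact ⟨⟨(toRes φ hφ N).symm x.1, x.2⟩, hx⟩

theorem simple_res (φ : R →+* R') (hφ : Function.Surjective φ) (S : Type u) [AddCommGroup S] [Module R' S] [IsSimpleModule R' S] :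
    IsSimpleModule R (resRaw φ S).M := by
  have hnt : Nontrivial S := IsSimpleModule.nontrivial R' S
  have : Nontrivial (resRaw φ S).M := hnt
  refine { eq_bot_or_eq_top := fun L => ?_ }
  let L' : Submodule R' S :=
    { carrier := {x | (x : (resRaw φ S).M) ∈ L}
      add_mem' := fun {a b} ha hb => L.add_mem ha hb
      zero_mem' := L.zero_mem
      smul_mem' := fun b x hx => by
        obtain ⟨r, rfl⟩ := hφ b
        exact L.smul_mem r hx }
  rcases eq_bot_or_eq_top L' with h | h
  · left
    rw [eq_bot_iff]
    intro x hx
    have : (x : S) ∈ L' := hx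
    rw [h] at this
    exact this
  · right
    rw [eq_top_iff]
    intro x _
    have : (x : S) ∈ L' := by rw [h]; trivial
    exact this

end
end CF

namespace CF
section
set_option linter.unusedSectionVars false

variable {K R R' : Type u} [CommRing K] [IsArtinianRing K] [Ring R] [Algebra K R]
    [Module.Finite K R] [Ring R'] [Algebra K R'] [Module.Finite K R'] {Γ : Set (ARVertex R)}

theorem path_lift (φ : R →+* R') (hφ : Function.Surjective φ)
    (hker : ∀ x ∈ Γ, ∀ r, φ r = 0 → ∀ m : (rep x).M, r • m = 0)
    {a b : ARVertex R} (hab : Relation.TransGen ARArrow a b) (hb : b ∈ Γ)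
    (hmid : ∀ z, Relation.TransGen ARArrow a z → Relation.TransGen ARArrow z b → z ∈ Γ)
    {y : ARVertex R'} (hy : rs φ hφ y = a) :
    ∃ z, rs φ hφ z = b ∧ Relation.TransGen ARArrow y z := by
  induction hab with
  | single h =>
    obtain ⟨z, rfl⟩ := rs_surj φ hφ (hker _ hb)
    refine ⟨z, rfl, Relation.TransGen.single ?_⟩
    subst hy
    exact rs_arrow φ hφ h
  | tail h1 h2 ih =>
    obtain ⟨w, rfl, hw⟩ := ih (hmid _ h1 (Relation.TransGen.single h2))
      fun z h3 h4 => hmid z h3 (h4.tail h2)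
    obtain ⟨z, rfl⟩ := rs_surj φ hφ (hker _ hb)
    exact ⟨z, rfl, hw.tail (rs_arrow φ hφ h2)⟩

theorem transfer (φ : R →+* R') (hφ : Function.Surjective φ)
    (hΓ : IsCycleFiniteCyclicComponent Γ) (hfin : Γ.Finite)
    (hker : ∀ x ∈ Γ, ∀ r, φ r = 0 → ∀ m : (rep x).M, r • m = 0)
    (hsinc : ∀ (S : Type u) [AddCommGroup S] [Module R' S] [IsSimpleModule R' S],
      ∃ y, rs φ hφ y ∈ Γ ∧ IsCompFactorMod R' S (rep y).M) :
    ARCat.Cfg (arc K R') {y | rs φ hφ y ∈ Γ} := by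
  have hconv := cf_conv K hΓ
  have hLe : ∀ y z, (arc K R').Le y z → (arc K R).Le (rs φ hφ y) (rs φ hφ z) := by
    intro y z h
    induction h with
    | refl => exact Relation.ReflTransGen.refl
    | tail _ h2 ih => exact ih.tail ((rs_hom φ hφ).2 h2)
  have hArr : ∀ {a b : ARVertex R}, Relation.TransGen ARArrow a b → (arc K R).Le a b := by
    intro a b h
    refine Relation.TransGen.to_reflTransGen (Relation.TransGen.mono (fun x y hxy => ?_) _ _ h)
    exact (arc K R).arrow_ne hxy
  refine ⟨?_, ?_, ?_, ?_, ?_, ?_, ?_⟩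
  · exact hfin.preimage (fun a _ b _ h => rs_inj φ hφ h)
  · obtain ⟨x, hx⟩ := hΓ.1.2.1
    obtain ⟨y, rfl⟩ := rs_surj φ hφ (hker x hx)
    exact ⟨y, hx⟩
  · intro a ha b hb z h1 h2
    exact hconv _ ha _ hb _ (hLe _ _ h1) (hLe _ _ h2)
  · intro i hi
    obtain ⟨N, hN⟩ := ex_simple_sub (rep i) (rep_indec i).1
    obtain ⟨y, hy, hc⟩ := hsinc N
    have hnt : Nontrivial N := IsSimpleModule.nontrivial R' N
    obtain ⟨f, hf⟩ := l2b (inj_iff.1 hi) hc N.subtype (fun h0 => by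
      obtain ⟨x, hx⟩ := exists_ne (0 : N)
      exact hx (Subtype.ext (LinearMap.congr_fun h0 x)))
    exact ⟨y, hy, f, hf⟩
  · intro p hp
    obtain ⟨N, hN⟩ := ex_simple_quo (rep p) (rep_indec p).1
    obtain ⟨y, hy, hc⟩ := hsinc ((rep p).M ⧸ N)
    have hnt : Nontrivial ((rep p).M ⧸ N) := IsSimpleModule.nontrivial R' _
    have hpr : Module.Projective R' (rep p).M := proj_iff.1 hp
    obtain ⟨f, hf⟩ := l2a hc N.mkQ (fun h0 => by
      obtain ⟨x, hx⟩ := exists_ne (0 : (rep p).M ⧸ N)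
      obtain ⟨x, rfl⟩ := N.mkQ_surjective x
      exact hx (LinearMap.congr_fun h0 x))
    exact ⟨y, hy, f, hf⟩
  · intro a ha
    have hc : Relation.TransGen ARArrow (rs φ hφ a) (rs φ hφ a) := hΓ.1.1 ha
    obtain ⟨z, hz, hp⟩ := path_lift φ hφ hker hc ha
      (fun z h1 h2 => hconv _ ha _ ha _ (hArr h1) (hArr h2)) rfl
    rwa [rs_inj φ hφ hz] at hp
  · intro a ha b hb
    have h3 := hΓ.1.2.2.1
    have h4 := hΓ.1.2.2.2 _ ha _ hb
    have key : ∀ x, Relation.ReflTransGen (fun a b : ARVertex R => a ∈ {x | OnARCycle x} ∧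
        b ∈ {x | OnARCycle x} ∧ ARStep a b) (rs φ hφ a) x →
        ∃ z, rs φ hφ z = x ∧ x ∈ Γ ∧ (arc K R').Conn a z := by
      intro x hx
      induction hx with
      | refl => exact ⟨a, rfl, ha, Relation.ReflTransGen.refl⟩
      | tail _ hs ih =>
        obtain ⟨w, rfl, hw, hc⟩ := ih
        have hx := h3 _ hw _ hs.2.1 hs.2.2
        obtain ⟨z, rfl⟩ := rs_surj φ hφ (hker _ hx)
        refine ⟨z, rfl, hx, hc.tail ?_⟩
        rcases hs.2.2 with h | h
        · exact Or.inl (rs_arrow φ hφ h)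
        · exact Or.inr (rs_arrow φ hφ h)
    obtain ⟨z, hz, -, hc⟩ := key _ h4
    rwa [rs_inj φ hφ hz] at hc

end
end CF

namespace CF
section
set_option linter.unusedSectionVars false

theorem faithful_sincere (K : Type u) {R : Type u} [CommRing K] [IsArtinianRing K] [Ring R]
    [Algebra K R] [Module.Finite K R] {Γ : Set (ARVertex R)}
    (h : ∀ r : R, (∀ a ∈ Γ, ∀ m : (rep a).M, r • m = 0) → r = 0)
    (S : Type u) [AddCommGroup S] [Module R S] [IsSimpleModule R S] :
    ∃ a ∈ Γ, IsCompFactorMod R S (rep a).M := by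
  obtain ⟨p, hp, π, hπ⟩ := simple_top K (R := R) S
  have hpr : Module.Projective R (rep p).M := proj_iff.1 hp
  obtain ⟨n, g, hg⟩ := Module.Finite.exists_fin' R (rep p).M
  obtain ⟨s, hs⟩ := Module.projective_lifting_property g LinearMap.id hg
  have hnt := (rep_indec p).1
  obtain ⟨x, hx⟩ := exists_ne (0 : (rep p).M)
  have hsx : s x ≠ 0 := by
    intro h0
    apply hx
    have := LinearMap.congr_fun hs x
    simp only [LinearMap.comp_apply, LinearMap.id_apply] at this
    rw [← this, h0, map_zero]
  obtain ⟨k, hk⟩ := Function.ne_iff.1 hsx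
  have : ∃ a ∈ Γ, ∃ m : (rep a).M, s x k • m ≠ 0 := by
    by_contra hcon
    push Not at hcon
    exact hk (h _ hcon)
  obtain ⟨a, ha, m, hm⟩ := this
  refine ⟨a, ha, l1 (rep_indec p) hpr
    (LinearMap.toSpanSingleton R (rep a).M m ∘ₗ LinearMap.proj k ∘ₗ s) (fun h0 => hm ?_) π hπ⟩
  exact LinearMap.congr_fun h0 x

theorem two_tops {R : Type u} [Ring R] {X Y : ModA R} (hX : X.IsIndec) (hY : Y.IsIndec)
    (pX : Module.Projective R X.M) (pY : Module.Projective R Y.M)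
    {S : Type u} [AddCommGroup S] [Module R S] [IsSimpleModule R S]
    (a : X.M →ₗ[R] S) (ha : a ≠ 0) (b : Y.M →ₗ[R] S) (hb : b ≠ 0) :
    Nonempty (X.M ≃ₗ[R] Y.M) := by
  have has : Function.Surjective a := LinearMap.surjective_of_ne_zero ha
  have hbs : Function.Surjective b := LinearMap.surjective_of_ne_zero hb
  obtain ⟨c, hc⟩ := Module.projective_lifting_property b a hbs
  obtain ⟨d, hd⟩ := Module.projective_lifting_property a b has
  let θ : Module.End R X.M := d ∘ₗ c
  have hθ : ∀ x, a (θ x) = a x := fun x => by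
    have h1 := LinearMap.congr_fun hd (c x)
    have h2 := LinearMap.congr_fun hc x
    exact h1.trans h2
  rcases fit hX θ with hbij | ⟨n, hn⟩
  · exact ⟨LinearEquiv.ofBijective c (bij_of_split hX hY c d hbij).1⟩
  · exfalso
    have : ∀ m x, a ((θ ^ m) x) = a x := by
      intro m
      induction m with
      | zero => intro x; rfl
      | succ m ih =>
        intro x
        rw [pow_succ']
        change a (θ ((θ ^ m) x)) = _
        rw [hθ, ih]
    apply ha
    refine LinearMap.ext fun x => ?_
    rw [← this n x, hn]
    simp

variable {A : Type u} [Ring A]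

theorem op_lin {M : Type u} [AddCommGroup M] [Module Aᵐᵒᵖ M] (f : A →ₗ[Aᵐᵒᵖ] M) (a : A) :
    f a = MulOpposite.op a • f 1 := by
  rw [← map_smul f]
  congr 1
  change a = 1 * a
  rw [one_mul]

theorem op_mul_lin (f : A →ₗ[Aᵐᵒᵖ] A) (a : A) : f a = f 1 * a := op_lin f a

theorem prim_of {X : ModA Aᵐᵒᵖ} (hX : X.IsIndec) (i : X.M →ₗ[Aᵐᵒᵖ] A) (r : A →ₗ[Aᵐᵒᵖ] X.M)
    (hri : r ∘ₗ i = LinearMap.id) : IsPrimitiveIdempotent A (i (r 1)) ∧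
      Nonempty (X.M ≃ₗ[Aᵐᵒᵖ] (Submodule.span Aᵐᵒᵖ {i (r 1)} : Submodule Aᵐᵒᵖ A)) := by
  have hri' : ∀ x, r (i x) = x := fun x => LinearMap.congr_fun hri x
  have hE : ∀ a, i (r a) = i (r 1) * a := fun a => op_mul_lin (i ∘ₗ r) a
  have hid : i (r 1) * i (r 1) = i (r 1) := by rw [← hE, hri']
  have hinj : Function.Injective i := fun x y hxy => by rw [← hri' x, hxy, hri']
  refine ⟨⟨hid, ?_, ?_⟩, ?_⟩
  · intro h0
    have hnt := hX.1
    obtain ⟨x, hx⟩ := exists_ne (0 : X.M)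
    apply hx
    apply hinj
    rw [← hri' x, hE, h0, zero_mul, map_zero]
  · intro f g hf hg hfg hgf he
    have hef : i (r 1) * f = f := by rw [he, add_mul, hf, hgf, add_zero]
    have hfe : f * i (r 1) = f := by rw [he, mul_add, hf, hfg, add_zero]
    let Lf : A →ₗ[Aᵐᵒᵖ] A :=
      { toFun := fun a => f * a
        map_add' := fun a b => mul_add f a b
        map_smul' := fun b a => by
          change f * (a * b.unop) = f * a * b.unop
          rw [mul_assoc] }
    have hth : ∀ x, i (r (Lf x)) = Lf x := by
      intro x
      rw [hE]
      change i (r 1) * (f * x) = f * x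
      rw [← mul_assoc, hef]
    have hLL : ∀ x, Lf (Lf x) = Lf x := by
      intro x
      change f * (f * x) = f * x
      rw [← mul_assoc, hf]
    rcases hX.2 (r ∘ₗ Lf ∘ₗ i) (LinearMap.ext fun x => by
      change r (Lf (i (r (Lf (i x))))) = r (Lf (i x))
      rw [hth, hLL]) with h0 | h1
    · left
      have := LinearMap.congr_fun h0 (r 1)
      have h2 : r (Lf (i (r 1))) = 0 := this
      have h3 : Lf (i (r 1)) = f := hfe
      rw [h3] at h2
      rw [← hef, ← hE, h2, map_zero]
    · right
      have := LinearMap.congr_fun h1 (r 1)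
      have h2 : r (Lf (i (r 1))) = r 1 := this
      have h3 : Lf (i (r 1)) = f := hfe
      rw [h3] at h2
      have h4 : f = i (r 1) := by rw [← h2, hE, hef]
      rw [← h4] at he
      simpa using he
  · have hr : LinearMap.range i = Submodule.span Aᵐᵒᵖ {i (r 1)} := ?_
    · exact ⟨(LinearEquiv.ofInjective i hinj).trans (LinearEquiv.ofEq (LinearMap.range i) (Submodule.span Aᵐᵒᵖ {i (r 1)}) hr)⟩
    apply le_antisymm
    · rintro _ ⟨x, rfl⟩
      have hx : i x = i (r 1) * i x := by rw [← hE, hri']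
      rw [hx]
      exact Submodule.smul_mem _ (MulOpposite.op (i x)) (Submodule.mem_span_singleton_self (i (r 1)))
    · rw [Submodule.span_singleton_le_iff_mem]
      exact ⟨_, rfl⟩

theorem basic_contra (hb : IsBasicAlgebra A) {X Y : ModA Aᵐᵒᵖ} (hX : X.IsIndec) (hY : Y.IsIndec)
    (i : X.M →ₗ[Aᵐᵒᵖ] A) (r : A →ₗ[Aᵐᵒᵖ] X.M) (hri : r ∘ₗ i = LinearMap.id)
    (j : Y.M →ₗ[Aᵐᵒᵖ] A) (s : A →ₗ[Aᵐᵒᵖ] Y.M) (hsj : s ∘ₗ j = LinearMap.id)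
    (h1 : r ∘ₗ j = 0) (h2 : s ∘ₗ i = 0) (e : X.M ≃ₗ[Aᵐᵒᵖ] Y.M) : False := by
  obtain ⟨hp, ⟨ex⟩⟩ := prim_of hX i r hri
  obtain ⟨hq, ⟨ey⟩⟩ := prim_of hY j s hsj
  refine hb ⟨_, _, hp, hq, ?_, ?_, ⟨ex.symm ≪≫ₗ e ≪≫ₗ ey⟩⟩
  · have := op_mul_lin (i ∘ₗ r) (j (s 1))
    simp only [LinearMap.comp_apply] at this
    rw [← this]
    have h3 : r (j (s 1)) = 0 := LinearMap.congr_fun h1 (s 1)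
    rw [h3, map_zero]
  · have := op_mul_lin (j ∘ₗ s) (i (r 1))
    simp only [LinearMap.comp_apply] at this
    rw [← this]
    have h3 : s (i (r 1)) = 0 := LinearMap.congr_fun h2 (r 1)
    rw [h3, map_zero]

/-- evaluation at an element of a right module -/
def evm {M : Type u} [AddCommGroup M] [Module Aᵐᵒᵖ M] (m : M) : A →ₗ[Aᵐᵒᵖ] M where
  toFun a := MulOpposite.op a • m
  map_add' a b := by rw [MulOpposite.op_add, add_smul]
  map_smul' b a := by
    change MulOpposite.op (a * b.unop) • m = b • MulOpposite.op a • m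
    rw [MulOpposite.op_mul, mul_smul, MulOpposite.op_unop]

theorem A_proj : Module.Projective Aᵐᵒᵖ A := by
  let e : Aᵐᵒᵖ ≃ₗ[Aᵐᵒᵖ] A :=
    { toFun := MulOpposite.unop
      invFun := MulOpposite.op
      left_inv := fun _ => rfl
      right_inv := fun _ => rfl
      map_add' := fun _ _ => rfl
      map_smul' := fun _ _ => rfl }
  exact Module.Projective.of_equiv e

theorem A_fin : Module.Finite Aᵐᵒᵖ A := by
  let e : Aᵐᵒᵖ ≃ₗ[Aᵐᵒᵖ] A :=
    { toFun := MulOpposite.unop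
      invFun := MulOpposite.op
      left_inv := fun _ => rfl
      right_inv := fun _ => rfl
      map_add' := fun _ _ => rfl
      map_smul' := fun _ _ => rfl }
  exact Module.Finite.equiv e

theorem A_fl (K : Type u) [CommRing K] [IsArtinianRing K] [Algebra K A] [Module.Finite K A] :
    IsFiniteLength Aᵐᵒᵖ A := by
  have := A_fin (A := A)
  exact modA_of_K K A

end
end CF

namespace CF
section
set_option linter.unusedSectionVars false

variable {A : Type u} [Ring A]

/-- projection to the quotient, on opposite rings -/
def qo (I : TwoSidedIdeal A) : Aᵐᵒᵖ →+* (I.ringCon.Quotient)ᵐᵒᵖ := RingHom.op (RingCon.mk' I.ringCon)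

theorem qo_surj (I : TwoSidedIdeal A) : Function.Surjective (qo I) := by
  intro b
  obtain ⟨a, ha⟩ := RingCon.mk'_surjective I.ringCon b.unop
  exact ⟨MulOpposite.op a, MulOpposite.unop_injective ha⟩

theorem qo_zero (I : TwoSidedIdeal A) (a : Aᵐᵒᵖ) : qo I a = 0 ↔ a.unop ∈ I := by
  rw [TwoSidedIdeal.mem_iff, ← RingCon.eq]
  constructor
  · intro h
    exact congrArg MulOpposite.unop h
  · intro h
    exact MulOpposite.unop_injective h

theorem quo_finite (K : Type u) [CommRing K] [Algebra K A] [Module.Finite K A]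
    (I : TwoSidedIdeal A) : Module.Finite K I.ringCon.Quotient :=
  Module.Finite.of_surjective (RingCon.mkₐ K I.ringCon).toLinearMap (RingCon.mkₐ_surjective (α := K) I.ringCon)

theorem mem_ann {Γ : Set (ARVertex Aᵐᵒᵖ)} {a : A} : a ∈ annTwoSidedIdeal A Γ ↔
    ∀ x ∈ Γ, ∀ m : (rep x).M, MulOpposite.op a • m = 0 := by
  unfold annTwoSidedIdeal
  rw [TwoSidedIdeal.mem_mk']
  constructor
  · intro h x hx m
    exact h x hx ⟨rep x, rep_indec x⟩ (mk_rep x) m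
  · rintro h x hx X rfl m
    obtain ⟨e⟩ := rep_mk X
    apply e.symm.injective
    rw [map_smul e.symm, h _ hx, map_zero]

theorem vr_iff (I : TwoSidedIdeal A) {y : ARVertex (I.ringCon.Quotient)ᵐᵒᵖ} {x : ARVertex Aᵐᵒᵖ} :
    VertexRestrictsTo (RingCon.mk' I.ringCon) y x ↔ rs (qo I) (qo_surj I) y = x := by
  constructor
  · rintro ⟨N, X, rfl, rfl, e, he⟩
    obtain ⟨d⟩ := rep_mk N
    obtain ⟨d'⟩ := dn_iso (qo I) (qo_surj I) d
    obtain ⟨c⟩ := rep_mk X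
    obtain ⟨t⟩ := rs_iso (qo I) (qo_surj I) (ARVertex.mk N)
    let e' : X.1.M ≃ₗ[Aᵐᵒᵖ] (res (qo I) (qo_surj I) N.1).M :=
      { e.trans (toRes (qo I) (qo_surj I) N.1) with
        map_smul' := fun a m => he a.unop m }
    exact eq_of_iso (t ≪≫ₗ d' ≪≫ₗ e'.symm ≪≫ₗ c.symm)
  · rintro rfl
    refine ⟨⟨rep y, rep_indec y⟩, ⟨res (qo I) (qo_surj I) (rep y), res_indec _ _ (rep_indec y)⟩,
      mk_rep y, rfl, (toRes (qo I) (qo_surj I) (rep y)).symm, fun a m => ?_⟩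
    rfl

variable {K : Type u} [CommRing K] [IsArtinianRing K] [Algebra K A] [Module.Finite K A]
  {Γ : Set (ARVertex Aᵐᵒᵖ)}

/-- The configuration over a quotient. -/
theorem cfg_quo (hΓ : IsCycleFiniteCyclicComponent Γ) (hfin : Γ.Finite) (I : TwoSidedIdeal A)
    (hI : I ≤ annTwoSidedIdeal A Γ)
    [Module.Finite K I.ringCon.Quotient]
    (hsinc : ∀ (S : Type u) [AddCommGroup S] [Module (I.ringCon.Quotient)ᵐᵒᵖ S]
      [IsSimpleModule (I.ringCon.Quotient)ᵐᵒᵖ S],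
      ∃ y, rs (qo I) (qo_surj I) y ∈ Γ ∧ IsCompFactorMod (I.ringCon.Quotient)ᵐᵒᵖ S (rep y).M) :
    ARCat.Cfg (arc K (I.ringCon.Quotient)ᵐᵒᵖ) {y | rs (qo I) (qo_surj I) y ∈ Γ} := by
  refine transfer (K := K) (qo I) (qo_surj I) hΓ hfin (fun x hx r hr m => ?_) hsinc
  exact mem_ann.1 (hI ((qo_zero I r).1 hr)) x hx m

/-- The faithful algebra. -/
theorem cfg_ann (hΓ : IsCycleFiniteCyclicComponent Γ) (hfin : Γ.Finite)
    [Module.Finite K (annTwoSidedIdeal A Γ).ringCon.Quotient] :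
    ARCat.Cfg (arc K ((annTwoSidedIdeal A Γ).ringCon.Quotient)ᵐᵒᵖ)
      {y | rs (qo (annTwoSidedIdeal A Γ)) (qo_surj _) y ∈ Γ} := by
  refine cfg_quo hΓ hfin _ le_rfl fun S _ _ _ => ?_
  refine faithful_sincere K (Γ := {y | rs (qo (annTwoSidedIdeal A Γ)) (qo_surj _) y ∈ Γ}) ?_ S
  intro r hr
  obtain ⟨a, rfl⟩ := qo_surj _ r
  rw [qo_zero, mem_ann]
  intro x hx m
  obtain ⟨y, rfl⟩ := rs_surj (qo (annTwoSidedIdeal A Γ)) (qo_surj _) (x := x) (fun r hr m =>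
    mem_ann.1 ((qo_zero _ r).1 hr) x hx m)
  obtain ⟨e⟩ := rs_iso (qo (annTwoSidedIdeal A Γ)) (qo_surj _) y
  apply e.injective
  rw [map_smul e, map_zero]
  exact hr y hx ((toRes (qo (annTwoSidedIdeal A Γ)) (qo_surj _) (rep y)).symm (e m))

theorem hom_zero (hb : IsBasicAlgebra A) (D : GammaDecomp A Γ) (x : ARVertex Aᵐᵒᵖ) (hx : x ∈ Γ)
    (K : Type u) [CommRing K] [IsArtinianRing K] [Algebra K A] [Module.Finite K A]
    (g : D.Q →ₗ[Aᵐᵒᵖ] (rep x).M) : g = 0 := by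
  by_contra hg
  have hA := A_proj (A := A)
  have hfl := A_fl (A := A) K
  let P' : ModA Aᵐᵒᵖ := ⟨D.P, (sub ⟨A, hfl⟩ D.P).finLen⟩
  let Q' : ModA Aᵐᵒᵖ := ⟨D.Q, (sub ⟨A, hfl⟩ D.Q).finLen⟩
  let pP : A →ₗ[Aᵐᵒᵖ] D.P := Submodule.projectionOnto D.P D.Q D.compl
  let pQ : A →ₗ[Aᵐᵒᵖ] D.Q := Submodule.projectionOnto D.Q D.P D.compl.symm
  have hPP : ∀ a : D.P, pP a = a := fun a => Submodule.projectionOnto_apply_left D.compl a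
  have hQQ : ∀ a : D.Q, pQ a = a := fun a => Submodule.projectionOnto_apply_left D.compl.symm a
  have hPQ : ∀ a : D.Q, pP a = 0 := fun a => Submodule.projectionOnto_apply_right D.compl a
  have hQP : ∀ a : D.P, pQ a = 0 := fun a => Submodule.projectionOnto_apply_right D.compl.symm a
  have hPpr : Module.Projective Aᵐᵒᵖ P'.M :=
    Module.Projective.of_split D.P.subtype pP (LinearMap.ext hPP)
  have hQpr : Module.Projective Aᵐᵒᵖ Q'.M :=
    Module.Projective.of_split D.Q.subtype pQ (LinearMap.ext hQQ)
  obtain ⟨n, Z, ⟨B⟩⟩ := exists_biP Q'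
  obtain ⟨n', W, ⟨B'⟩⟩ := exists_biP P'
  obtain ⟨k, hk⟩ : ∃ k, g ∘ₗ B.i k ≠ 0 := by
    by_contra hcon
    push Not at hcon
    apply hg
    have := B.expand (W := rep x) g
    rw [this]
    exact Finset.sum_eq_zero fun k _ => by rw [hcon k, LinearMap.zero_comp]
  have hkpr : Module.Projective Aᵐᵒᵖ (rep (Z k)).M := proj_retract hQpr (B.i k) (B.p k) (B.pi k)
  obtain ⟨N, hN⟩ := ex_simple_quo (rep (Z k)) (rep_indec _).1
  have hnt : Nontrivial ((rep (Z k)).M ⧸ N) := IsSimpleModule.nontrivial Aᵐᵒᵖ _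
  have hNk : N.mkQ ≠ 0 := fun h0 => by
    obtain ⟨x, hx⟩ := exists_ne (0 : (rep (Z k)).M ⧸ N)
    obtain ⟨x, rfl⟩ := N.mkQ_surjective x
    exact hx (LinearMap.congr_fun h0 x)
  have hcf := l1 (rep_indec _) hkpr _ hk N.mkQ hNk
  have hcf2 := (D.top_factors ((rep (Z k)).M ⧸ N) hN).2
    ⟨x, hx, ⟨rep x, rep_indec x⟩, mk_rep x, hcf⟩
  obtain ⟨f, hf⟩ := l2a hcf2 N.mkQ hNk
  obtain ⟨z, hz⟩ : ∃ z, f z ≠ 0 := by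
    by_contra hcon
    push Not at hcon
    exact hf (LinearMap.ext hcon)
  obtain ⟨w, hw⟩ := (modRadical Aᵐᵒᵖ D.P).mkQ_surjective (f z)
  have hw' : w ∉ modRadical Aᵐᵒᵖ D.P := fun h => hz (by
    rw [← hw]; exact (Submodule.Quotient.mk_eq_zero _).2 h)
  obtain ⟨M, hM, hwM⟩ : ∃ M : Submodule Aᵐᵒᵖ D.P, IsCoatom M ∧ w ∉ M := by
    by_contra hcon
    push Not at hcon
    exact hw' ((Submodule.mem_sInf).2 hcon)
  have hMs : IsSimpleModule Aᵐᵒᵖ (D.P ⧸ M) := isSimpleModule_iff_isCoatom.2 hM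
  have hle : modRadical Aᵐᵒᵖ D.P ≤ M := sInf_le hM
  let a : (rep (Z k)).M →ₗ[Aᵐᵒᵖ] (D.P ⧸ M) := Submodule.factor hle ∘ₗ f
  have ha : a ≠ 0 := fun h0 => by
    have h1 : Submodule.factor hle (f z) = 0 := LinearMap.congr_fun h0 z
    rw [← hw] at h1
    exact hwM ((Submodule.Quotient.mk_eq_zero _).1 h1)
  let P2 : ModA Aᵐᵒᵖ := quo P' M
  have hMQ : (M.mkQ : P'.M →ₗ[Aᵐᵒᵖ] P2.M) ≠ 0 := fun h0 =>
    hwM ((Submodule.Quotient.mk_eq_zero _).1 (LinearMap.congr_fun h0 w))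
  obtain ⟨j, hj⟩ : ∃ j, (M.mkQ : P'.M →ₗ[Aᵐᵒᵖ] P2.M) ∘ₗ B'.i j ≠ 0 := by
    by_contra hcon
    push Not at hcon
    apply hMQ
    rw [B'.expand (W := P2) M.mkQ]
    exact Finset.sum_eq_zero fun k _ => by rw [hcon k, LinearMap.zero_comp]
  have hjpr : Module.Projective Aᵐᵒᵖ (rep (W j)).M := proj_retract hPpr (B'.i j) (B'.p j) (B'.pi j)
  obtain ⟨e⟩ := two_tops (rep_indec (Z k)) (rep_indec (W j)) hkpr hjpr a ha (S := D.P ⧸ M)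
    (M.mkQ ∘ₗ B'.i j) hj
  refine basic_contra hb (rep_indec (Z k)) (rep_indec (W j))
    (D.Q.subtype ∘ₗ B.i k) (B.p k ∘ₗ pQ) ?_ (D.P.subtype ∘ₗ B'.i j) (B'.p j ∘ₗ pP) ?_ ?_ ?_ e
  · refine LinearMap.ext fun x => ?_
    change B.p k (pQ (B.i k x)) = x
    rw [hQQ]
    exact LinearMap.congr_fun (B.pi k) x
  · refine LinearMap.ext fun x => ?_
    change B'.p j (pP (B'.i j x)) = x
    rw [hPP]
    exact LinearMap.congr_fun (B'.pi j) x
  · refine LinearMap.ext fun x => ?_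
    change B.p k (pQ (B'.i j x)) = 0
    rw [hQP]
    exact map_zero _
  · refine LinearMap.ext fun x => ?_
    change B'.p j (pP (B.i k x)) = 0
    rw [hPQ]
    exact map_zero _

theorem trace_le (K : Type u) [CommRing K] [IsArtinianRing K] [Algebra K A] [Module.Finite K A]
    (hb : IsBasicAlgebra A) (D : GammaDecomp A Γ) :
    traceIdeal A D.Q ≤ annTwoSidedIdeal A Γ := by
  refine TwoSidedIdeal.span_le.2 ?_
  intro a ha
  obtain ⟨f, q, rfl⟩ := Set.mem_iUnion.1 ha
  refine mem_ann.2 fun x hx m => ?_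
  exact LinearMap.congr_fun (hom_zero hb D x hx K (evm m ∘ₗ f)) q

theorem cfg_trace (hΓ : IsCycleFiniteCyclicComponent Γ) (hfin : Γ.Finite)
    (hb : IsBasicAlgebra A) (D : GammaDecomp A Γ)
    [Module.Finite K (traceIdeal A D.Q).ringCon.Quotient] :
    ARCat.Cfg (arc K ((traceIdeal A D.Q).ringCon.Quotient)ᵐᵒᵖ)
      {y | rs (qo (traceIdeal A D.Q)) (qo_surj _) y ∈ Γ} := by
  have hle := trace_le K hb D
  refine cfg_quo hΓ hfin _ hle fun S _ _ _ => ?_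
  have hS : IsSimpleModule Aᵐᵒᵖ (resRaw (qo (traceIdeal A D.Q)) S).M :=
    simple_res _ (qo_surj _) S
  have hnt : Nontrivial (resRaw (qo (traceIdeal A D.Q)) S).M := IsSimpleModule.nontrivial Aᵐᵒᵖ _
  obtain ⟨s, hs⟩ := exists_ne (0 : (resRaw (qo (traceIdeal A D.Q)) S).M)
  have hQ : ∀ q ∈ D.Q, evm s q = 0 := by
    intro q hq
    have h1 : q ∈ traceIdeal A D.Q := TwoSidedIdeal.subset_span
      (Set.mem_iUnion.2 ⟨D.Q.subtype, ⟨q, hq⟩, rfl⟩)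
    have h2 : qo (traceIdeal A D.Q) (MulOpposite.op q) = 0 := (qo_zero _ _).2 h1
    change (qo (traceIdeal A D.Q) (MulOpposite.op q)) • (show S from s) = 0
    rw [h2, zero_smul]
  let h : D.P →ₗ[Aᵐᵒᵖ] (resRaw (qo (traceIdeal A D.Q)) S).M := evm s ∘ₗ D.P.subtype
  have hh : h ≠ 0 := by
    intro h0
    apply hs
    have h1 : evm s (1 : A) = s := one_smul Aᵐᵒᵖ s
    have h2 : (1 : A) ∈ D.P ⊔ D.Q := by rw [D.compl.sup_eq_top]; trivial
    obtain ⟨p, hp, q, hq, hpq⟩ := Submodule.mem_sup.1 h2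
    rw [← h1, ← hpq, map_add, hQ q hq, add_zero]
    exact LinearMap.congr_fun h0 ⟨p, hp⟩
  have hhs : Function.Surjective h := LinearMap.surjective_of_ne_zero hh
  have hco : IsCoatom (LinearMap.ker h) := by
    rw [← isSimpleModule_iff_isCoatom]
    exact IsSimpleModule.congr (h.quotKerEquivOfSurjective hhs)
  have hrad : modRadical Aᵐᵒᵖ D.P ≤ LinearMap.ker h := sInf_le hco
  let t := (modRadical Aᵐᵒᵖ D.P).liftQ h hrad
  have hcf : IsCompFactorMod Aᵐᵒᵖ (resRaw (qo (traceIdeal A D.Q)) S).M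
      (D.P ⧸ modRadical Aᵐᵒᵖ D.P) := by
    refine cf_of ⊤ (t ∘ₗ Submodule.subtype ⊤) fun s => ?_
    obtain ⟨p, hp⟩ := hhs s
    exact ⟨⟨(modRadical Aᵐᵒᵖ D.P).mkQ p, trivial⟩, hp⟩
  obtain ⟨x, hx, X, rfl, hX⟩ := (D.top_factors _ hS).1 hcf
  obtain ⟨y, hy⟩ := rs_surj (qo (traceIdeal A D.Q)) (qo_surj _) (x := ARVertex.mk X)
    (fun r hr m => mem_ann.1 (hle ((qo_zero _ r).1 hr)) _ hx m)
  refine ⟨y, by rw [hy]; exact hx, ?_⟩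
  obtain ⟨e⟩ := rep_mk X
  obtain ⟨d⟩ := rs_iso (qo (traceIdeal A D.Q)) (qo_surj _) y
  rw [hy] at d
  exact cf_up _ (qo_surj _) (cf_equiv (e.symm ≪≫ₗ d) hX)

theorem ann_le (K : Type u) [CommRing K] [IsArtinianRing K] [Algebra K A] [Module.Finite K A]
    (hΓ : IsCycleFiniteCyclicComponent Γ) (hfin : Γ.Finite)
    (hb : IsBasicAlgebra A) (D : GammaDecomp A Γ) :
    annTwoSidedIdeal A Γ ≤ traceIdeal A D.Q := by
  have := quo_finite K (traceIdeal A D.Q)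
  intro a ha
  refine (qo_zero (traceIdeal A D.Q) (MulOpposite.op a)).1 ?_
  refine cfg_faithful (cfg_trace (K := K) hΓ hfin hb D) _ fun y hy m => ?_
  obtain ⟨e⟩ := rs_iso (qo (traceIdeal A D.Q)) (qo_surj _) y
  have h1 := mem_ann.1 ha _ hy (e.symm (toRes (qo (traceIdeal A D.Q)) (qo_surj _) (rep y) m))
  rw [← map_smul e.symm, ← toRes_smul] at h1
  have h2 := e.symm.injective (h1.trans (map_zero e.symm).symm)
  exact (toRes (qo (traceIdeal A D.Q)) (qo_surj _) (rep y)).injective (h2.trans (map_zero _).symm)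

end
end CF

/-- **Theorem 2.** Let `A` be a basic indecomposable artin algebra and `Γ` a cycle-finite
finite component of the cyclic quiver `_cΓ_A`. Then:
(i) the support algebra `supp(Γ)` is a generalized double tilted algebra;
(ii) `Γ` is the core `c(C)` of a unique almost acyclic connecting (= separating almost
acyclic) component `C` of the Auslander-Reiten quiver of the faithful algebra `B(Γ)`,
where `Γ` is identified with a set of vertices of `Γ_{B(Γ)}` via restriction of scalars
along the projection `A → B(Γ)`;
(iii) `supp(Γ) = B(Γ)` (the trace ideal coincides with the annihilator, for any admissible
decomposition of `A`). -/
theorem cycle_finite_finite_cyclic_component_structure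
    (K A : Type u) [CommRing K] [IsArtinianRing K] [Ring A] [Algebra K A]
    [Module.Finite K A] (hbasic : IsBasicAlgebra A) (hconn : IsConnectedAlgebra A)
    (Γ : Set (ARVertex Aᵐᵒᵖ)) (hΓ : IsCycleFiniteCyclicComponent Γ) (hfin : Γ.Finite) :
    -- (i)
    (∀ D : GammaDecomp A Γ,
      IsGeneralizedDoubleTiltedAlgebra ((traceIdeal A D.Q).ringCon.Quotient)) ∧
    -- (ii)
    (∃ C : Set (ARVertex (faithfulAlg A Γ)ᵐᵒᵖ),
      (IsARComponent C ∧ IsAlmostAcyclicComp C ∧ IsSeparatingFamily {C}) ∧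
      IsCoreOf C {y | ∃ x ∈ Γ, VertexRestrictsTo (faithfulProj A Γ) y x} ∧
      ∀ C' : Set (ARVertex (faithfulAlg A Γ)ᵐᵒᵖ),
        (IsARComponent C' ∧ IsAlmostAcyclicComp C' ∧ IsSeparatingFamily {C'}) → C' = C) ∧
    -- (iii)
    ∀ D : GammaDecomp A Γ, traceIdeal A D.Q = annTwoSidedIdeal A Γ := by
  refine ⟨fun D => ?_, ?_, fun D => ?_⟩
  · have := CF.quo_finite K (traceIdeal A D.Q)
    have h := CF.cfg_trace (K := K) hΓ hfin hbasic D
    exact ⟨_, CF.cc_comp h, CF.cc_acyc h, CF.cc_sep h⟩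
  · have := CF.quo_finite K (annTwoSidedIdeal A Γ)
    have h := CF.cfg_ann (K := K) hΓ hfin
    have heq : {y | ∃ x ∈ Γ, VertexRestrictsTo (faithfulProj A Γ) y x} =
        {y | CF.rs (CF.qo (annTwoSidedIdeal A Γ)) (CF.qo_surj _) y ∈ Γ} := by
      refine Set.ext fun y => ⟨?_, fun hy => ⟨_, hy, (CF.vr_iff _).2 rfl⟩⟩
      rintro ⟨x, hx, hv⟩
      have := (CF.vr_iff _).1 hv
      change CF.rs _ _ y ∈ Γ
      rw [this]
      exact hx
    rw [heq]
    exact ⟨_, ⟨CF.cc_comp h, CF.cc_acyc h, CF.cc_sep h⟩, CF.cc_core h,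
      fun C' hC' => CF.cc_unique h hC'.1 hC'.2.2⟩
  · exact le_antisymm (CF.trace_le K hbasic D) (CF.ann_le K hΓ hfin hbasic D)
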